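/- All positive integer solutions (n, m, k, ℓ) of the Diophantine equation F^(k)_n · F^(k)_m = P_ℓ with k ≥ 2 and n ≥ m ≥ 3 are (n, m, k, ℓ) = (7, 7, 2, 7), (6, 6, 3, 7), and (15, 3, 5, 12). -/

import Mathlib

/-- The Pell sequence: `P 0 = 0`, `P 1 = 1`, `P (ℓ+2) = 2 P (ℓ+1) + P ℓ`. -/
def pell : ℕ → ℤ
  | 0 => 0
  | 1 => 1
  | n + 2 => 2 * pell (n + 1) + pell n

/-- `kfib k j` is the `k`-generalized Fibonacci number `F⁽ᵏ⁾_n` with shifted index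
`j = n + k - 2` (so `j = 0` corresponds to `n = 2 - k`).  Thus `kfib k j = 0` for
`0 ≤ j ≤ k - 2` (these are `F⁽ᵏ⁾_{2-k} = ⋯ = F⁽ᵏ⁾_0 = 0`), `kfib k (k - 1) = 1`
(this is `F⁽ᵏ⁾_1 = 1`), and every later term is the sum of the preceding `k` terms
(junk value `0` if `k < 2`). -/
def kfib (k : ℕ) : ℕ → ℤ
  | j =>
    if k < 2 then 0
    else if j < k - 1 then 0
    else if j = k - 1 then 1
    else ∑ i ∈ Finset.range k, kfib k (j - 1 - i)
decreasing_by omega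

section

open Finset

theorem kfib_of_lt {k j : ℕ} (h : j + 1 < k) : kfib k j = 0 := by
  rw [kfib]; split_ifs <;> first | rfl | omega

theorem kfib_pred {k : ℕ} (hk : 2 ≤ k) : kfib k (k - 1) = 1 := by
  rw [kfib]; split_ifs <;> first | rfl | omega

theorem kfib_add {k : ℕ} (hk : 2 ≤ k) (j : ℕ) :
    kfib k (j + k) = ∑ i ∈ range k, kfib k (j + i) := by
  rw [kfib, if_neg (by omega), if_neg (by omega), if_neg (by omega), ← sum_range_reflect]
  refine sum_congr rfl fun i hi => ?_
  have := mem_range.1 hi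
  congr 1; omega

theorem kfib_self {k : ℕ} (hk : 2 ≤ k) : kfib k k = 1 := by
  have h := kfib_add hk 0
  obtain ⟨k, rfl⟩ : ∃ t, k = t + 1 := ⟨k - 1, by omega⟩
  rw [zero_add, sum_range_succ, sum_eq_zero, zero_add] at h
  · rw [h]; simpa using kfib_pred hk
  · intro i hi
    exact kfib_of_lt (by simpa using hi)

theorem kfib_add_succ {k : ℕ} (hk : 2 ≤ k) (j : ℕ) :
    kfib k (j + k + 1) = 2 * kfib k (j + k) - kfib k j := by
  have h1 := kfib_add hk (j + 1)
  have h2 := kfib_add hk j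
  have h3 := sum_range_succ (fun i => kfib k (j + i)) k
  have h4 := sum_range_succ' (fun i => kfib k (j + i)) k
  simp only [add_zero] at h4
  have h5 : ∑ i ∈ range k, kfib k (j + 1 + i) = ∑ i ∈ range k, kfib k (j + (i + 1)) :=
    sum_congr rfl fun i _ => by congr 1; omega
  rw [show j + k + 1 = j + 1 + k by omega, h1, h5]
  linarith

/-- `α` is the dominant root of `x ^ k - x ^ (k - 1) - ⋯ - 1`. -/
structure IsDom (k : ℕ) (α : ℝ) : Prop where
  two_le : 2 ≤ k
  gt : 1.618 < α
  lt : α < 2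
  eq : α ^ k * (2 - α) = 1

theorem exists_isDom {k : ℕ} (hk : 2 ≤ k) : ∃ α, IsDom k α := by
  have hc : ContinuousOn (fun x : ℝ => x ^ k * (2 - x)) (Set.Icc 1.618 2) := by fun_prop
  have h := intermediate_value_Ioo' (by norm_num) hc
  have h1 : (1 : ℝ) ∈ Set.Ioo ((2 : ℝ) ^ k * (2 - 2)) (1.618 ^ k * (2 - 1.618)) := by
    refine ⟨by norm_num, ?_⟩
    have : (1.618 : ℝ) ^ 2 ≤ 1.618 ^ k := pow_le_pow_right₀ (by norm_num) hk
    nlinarith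
  obtain ⟨α, hα, h2⟩ := h h1
  exact ⟨α, hk, hα.1, hα.2, h2⟩

namespace IsDom

variable {k : ℕ} {α : ℝ}

theorem pos (h : IsDom k α) : 0 < α := by linarith [h.gt]

theorem one_lt (h : IsDom k α) : 1 < α := by linarith [h.gt]

theorem pow_pos (h : IsDom k α) (n : ℕ) : 0 < α ^ n := _root_.pow_pos h.pos n

/-- `2 - α = α ^ (-k)`. -/
theorem two_sub (h : IsDom k α) : 2 - α = (α ^ k)⁻¹ :=
  eq_inv_of_mul_eq_one_right h.eq

theorem sum_inv {x : ℝ} (hx : 1 < x) (k : ℕ) :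
    ∑ i ∈ range k, (x ^ (i + 1))⁻¹ = (1 - (x ^ k)⁻¹) / (x - 1) := by
  have h1 : x - 1 ≠ 0 := by linarith
  have h0 : x ≠ 0 := by linarith
  induction k with
  | zero => simp
  | succ n ih => rw [sum_range_succ, ih]; field_simp; ring

theorem sum_inv_eq (h : IsDom k α) : ∑ i ∈ range k, (α ^ (i + 1))⁻¹ = 1 := by
  rw [sum_inv h.one_lt, ← h.two_sub, div_eq_one_iff_eq (by linarith [h.one_lt])]; ring

theorem sum_inv_lt {x y : ℝ} (hx : 1 < x) (hxy : x < y) {k : ℕ} (hk : 0 < k) :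
    ∑ i ∈ range k, (y ^ (i + 1))⁻¹ < ∑ i ∈ range k, (x ^ (i + 1))⁻¹ := by
  refine sum_lt_sum_of_nonempty (by simpa using hk.ne') fun i _ => ?_
  have := pow_lt_pow_left₀ hxy (by linarith) (Nat.succ_ne_zero i)
  exact inv_strictAnti₀ (by positivity) this

theorem lt_of (h : IsDom k α) {x : ℝ} (hx : 1 < x) (hx' : 1 < x ^ k * (2 - x)) : x < α := by
  by_contra! hc
  have h0 := h.sum_inv_eq
  have h1 : 1 < ∑ i ∈ range k, (x ^ (i + 1))⁻¹ := by
    rw [sum_inv hx, lt_div_iff₀ (by linarith)]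
    have : (x ^ k)⁻¹ < 2 - x := by
      rw [inv_lt_iff_one_lt_mul₀ (by positivity)]; linarith
    linarith
  rcases hc.eq_or_lt with rfl | hc
  · linarith
  · have := sum_inv_lt h.one_lt hc (k := k) (by linarith [h.two_le]); linarith

theorem of_lt (h : IsDom k α) {x : ℝ} (hx : 1 < x) (hx' : x ^ k * (2 - x) < 1) : α < x := by
  by_contra! hc
  have h0 := h.sum_inv_eq
  have h1 : ∑ i ∈ range k, (x ^ (i + 1))⁻¹ < 1 := by
    rw [sum_inv hx, div_lt_iff₀ (by linarith)]
    have : 2 - x < (x ^ k)⁻¹ := by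
      rw [← one_div, lt_div_iff₀ (by positivity)]; linarith
    linarith
  rcases hc.eq_or_lt with rfl | hc
  · linarith
  · have := sum_inv_lt hx hc (k := k) (by linarith [h.two_le]); linarith

/-- The factor `β` in `f = (α - 1) / β`. -/
theorem succ_mul_le (h : IsDom k α) : (k + 1) * ((2 - α) * α) ≤ 2 := by
  rcases h.two_le.eq_or_lt with rfl | hk
  · have := h.eq
    have h2 : (α - 1) * (α ^ 2 - α - 1) = 0 := by nlinarith
    have h3 : α ^ 2 - α - 1 = 0 := by
      rcases mul_eq_zero.1 h2 with h | h'
      · linarith [h, IsDom.gt ‹_›]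
      · exact h'
    push_cast
    nlinarith [h.gt]
  · have h18 : 1.8 < α := by
      refine h.lt_of (by norm_num) ?_
      have : (1.8 : ℝ) ^ 3 ≤ 1.8 ^ k := pow_le_pow_right₀ (by norm_num) hk
      norm_num at this ⊢
      linarith
    have h4 : ((k : ℝ) + 1) ≤ α ^ k := by
      have : ∀ n : ℕ, ((n + 3 : ℕ) : ℝ) + 1 ≤ α ^ (n + 3) := by
        intro n
        induction n with
        | zero => norm_num; nlinarith [pow_le_pow_left₀ (by norm_num) h18.le 3]
        | succ n ih =>
          push_cast at ih ⊢
          rw [show n + 1 + 3 = (n + 3) + 1 by ring, pow_succ]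
          nlinarith [(Nat.cast_nonneg n : (0 : ℝ) ≤ n)]
      obtain ⟨n, rfl⟩ : ∃ n, k = n + 3 := ⟨k - 3, by omega⟩
      exact this n
    have h5 : ((k : ℝ) + 1) * (2 - α) ≤ 1 := by
      exact (mul_le_mul_of_nonneg_right h4 (by linarith [h.lt])).trans h.eq.le
    nlinarith [h.lt, h.gt]

end IsDom

/-- The coefficient `f` of `α ^ (n - 1)` in the Binet-type formula for `F⁽ᵏ⁾_n`. -/
noncomputable def binetCoeff (k : ℕ) (α : ℝ) : ℝ := (α - 1) / ((k + 1) * α - 2 * k)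

namespace IsDom

variable {k : ℕ} {α : ℝ}

theorem den_eq (k : ℕ) (α : ℝ) : (k + 1) * α - 2 * k = α - k * (2 - α) := by ring

theorem den_lt (h : IsDom k α) : (k + 1) * α - 2 * k < 2 := by
  have : (0:ℝ) ≤ k * (2 - α) := mul_nonneg (Nat.cast_nonneg _) (by linarith [h.lt])
  linarith [h.lt, den_eq k α]

theorem den_pos (h : IsDom k α) : 0.76 < (k + 1) * α - 2 * k := by
  have := h.succ_mul_le
  have h1 : ((k : ℝ) + 1) * (2 - α) ≤ 2 / α := by
    rw [le_div_iff₀ h.pos]; linarith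
  have h2 : 2 / α < 1.24 := by rw [div_lt_iff₀ h.pos]; linarith [h.gt]
  linarith

theorem half_lt (h : IsDom k α) : 1 / 2 < binetCoeff k α := by
  unfold binetCoeff
  have := h.den_pos
  rw [div_lt_div_iff₀ (by norm_num) (by linarith)]
  have h1 : (2 : ℝ) ≤ k := by exact_mod_cast h.two_le
  nlinarith [h.lt]

theorem binetCoeff_le (h : IsDom k α) : binetCoeff k α ≤ α / 2 := by
  unfold binetCoeff
  have := h.den_pos
  rw [div_le_div_iff₀ (by linarith) (by norm_num)]
  nlinarith [h.succ_mul_le]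

theorem binetCoeff_lt (h : IsDom k α) : binetCoeff k α < 1 := by
  linarith [h.binetCoeff_le, h.lt]

/-- The error sequence in Binet's formula is an average of its `k` predecessors. -/
theorem error_rec (h : IsDom k α) (j : ℕ) :
    kfib k (j + k) - binetCoeff k α / α ^ (k - 1) * α ^ (j + k) =
      ∑ t ∈ range k, (α ^ (t + 1))⁻¹ *
        (kfib k (j + t) - binetCoeff k α / α ^ (k - 1) * α ^ (j + t)) := by
  have ha := h.pos.ne'
  have hk := h.two_le
  have hG : ∀ j, (kfib k (j + k) : ℝ) - ∑ t ∈ range k, (α ^ (t + 1))⁻¹ * kfib k (j + t) =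
      α ^ j * (1 - (α ^ k)⁻¹) := by
    intro j
    induction j with
    | zero =>
      obtain ⟨m, rfl⟩ : ∃ t, k = t + 1 := ⟨k - 1, by omega⟩
      rw [sum_range_succ, sum_eq_zero]
      · have := kfib_pred hk
        simp only [Nat.add_sub_cancel] at this
        simp [kfib_self hk, this]
      · intro i hi
        rw [zero_add, kfib_of_lt (by simpa using hi)]; simp
    | succ j ih =>
      have e1 : (kfib k (j + 1 + k) : ℝ) = 2 * kfib k (j + k) - kfib k j := by
        rw [show j + 1 + k = j + k + 1 by ring, kfib_add_succ hk]; push_cast; ring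
      have e2 : ∑ t ∈ range k, (α ^ (t + 1))⁻¹ * (kfib k (j + 1 + t) : ℝ) =
          α * (∑ t ∈ range k, (α ^ (t + 1))⁻¹ * (kfib k (j + t) : ℝ)) - kfib k j +
          (α ^ k)⁻¹ * kfib k (j + k) := by
        have s1 := sum_range_succ (fun t => (α ^ t)⁻¹ * (kfib k (j + t) : ℝ)) k
        have s2 := sum_range_succ' (fun t => (α ^ t)⁻¹ * (kfib k (j + t) : ℝ)) k
        have s3 : ∑ t ∈ range k, (α ^ (t + 1))⁻¹ * (kfib k (j + 1 + t) : ℝ) =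
            ∑ t ∈ range k, (α ^ (t + 1))⁻¹ * (kfib k (j + (t + 1)) : ℝ) :=
          sum_congr rfl fun t _ => by rw [show j + 1 + t = j + (t + 1) by ring]
        have s4 : α * ∑ t ∈ range k, (α ^ (t + 1))⁻¹ * (kfib k (j + t) : ℝ) =
            ∑ t ∈ range k, (α ^ t)⁻¹ * (kfib k (j + t) : ℝ) := by
          rw [mul_sum]; refine sum_congr rfl fun t _ => ?_
          rw [pow_succ]; field_simp
        simp only [pow_zero, inv_one, one_mul, add_zero] at s2
        rw [s3, s4]; linarith
      rw [e1, e2, pow_succ, mul_comm (α ^ j) α, mul_assoc, ← ih, ← h.two_sub]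
      ring
  have hA : ∑ t ∈ range k, (α ^ (t + 1))⁻¹ * α ^ (j + t) = α ^ j * (k / α) := by
    rw [sum_congr rfl (g := fun _ => α ^ j * α⁻¹)]
    · simp; ring
    · intro t _; field_simp; ring
  have hd := h.den_pos
  simp only [mul_sub, sum_sub_distrib]
  have e3 : ∀ c : ℝ, ∑ t ∈ range k, (α ^ (t + 1))⁻¹ * (c * α ^ (j + t)) =
      c * (α ^ j * (k / α)) := by
    intro c; rw [← hA, mul_sum]; exact sum_congr rfl fun t _ => by ring
  rw [e3]
  have e4 : binetCoeff k α / α ^ (k - 1) * (α ^ (j + k) - α ^ j * (k / α)) =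
      α ^ j * (1 - (α ^ k)⁻¹) := by
    have hp : α ^ k = α ^ (k - 1) * α := by rw [← pow_succ]; congr 1; omega
    rw [← h.two_sub]
    have e5 : α ^ (j + k) - α ^ j * (k / α) = α ^ j * α ^ (k - 1) * ((k + 1) * α - 2 * k) := by
      have : (k : ℝ) / α = k * (α ^ (k - 1) * (2 - α)) := by
        rw [div_eq_iff ha]; linear_combination (-(k : ℝ)) * h.eq + (k : ℝ) * (2 - α) * hp
      rw [this, pow_add, hp]; ring
    have hd' : (k + 1) * α - 2 * k ≠ 0 := by linarith
    rw [e5, binetCoeff, div_div, div_mul_eq_mul_div, div_eq_iff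
      (mul_ne_zero hd' (h.pow_pos _).ne')]
    linarith
  linarith [hG j]

theorem abs_error_le (h : IsDom k α) (j : ℕ) :
    |kfib k j - binetCoeff k α / α ^ (k - 1) * α ^ j| ≤ 1 / 2 := by
  induction j using Nat.strong_induction_on with
  | _ j ih =>
    have h1 := h.half_lt
    have h2 := h.binetCoeff_le
    have hk := h.two_le
    rcases lt_trichotomy (j + 1) k with hj | hj | hj
    · rw [kfib_of_lt hj]
      have e : binetCoeff k α / α ^ (k - 1) * α ^ j ≤ 1 / 2 := by
        rw [div_mul_eq_mul_div, div_le_iff₀ (h.pow_pos _)]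
        have : α ^ j * α ≤ α ^ (k - 1) := by
          rw [← pow_succ]; exact pow_le_pow_right₀ h.one_lt.le (by omega)
        nlinarith [h.pow_pos j]
      have e' : 0 ≤ binetCoeff k α / α ^ (k - 1) * α ^ j := by
        have := h.pow_pos j
        have := h.pow_pos (k - 1)
        positivity
      rw [Int.cast_zero, zero_sub, abs_neg, abs_of_nonneg e']; exact e
    · obtain rfl : j = k - 1 := by omega
      rw [kfib_pred hk, div_mul_cancel₀ _ (h.pow_pos _).ne', abs_le]
      have := h.lt
      push_cast; constructor <;> linarith
    · obtain ⟨i, rfl⟩ : ∃ i, j = i + k := ⟨j - k, by omega⟩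
      rw [h.error_rec]
      refine (abs_sum_le_sum_abs _ _).trans ?_
      calc _ ≤ ∑ t ∈ range k, (α ^ (t + 1))⁻¹ * (1 / 2) := by
            refine sum_le_sum fun t ht => ?_
            rw [abs_mul, abs_of_pos (inv_pos.2 (h.pow_pos _))]
            exact mul_le_mul_of_nonneg_left (ih _ (by simpa using ht))
              (inv_pos.2 (h.pow_pos _)).le
        _ = 1 / 2 := by rw [← sum_mul, h.sum_inv_eq, one_mul]

/-- Binet-type approximation of `F⁽ᵏ⁾_n`. -/
theorem abs_kfib_sub_le (h : IsDom k α) {n : ℕ} (hn : 1 ≤ n) :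
    |kfib k (n + k - 2) - binetCoeff k α * α ^ (n - 1)| ≤ 1 / 2 := by
  have := h.abs_error_le (n + k - 2)
  rw [show n + k - 2 = (n - 1) + (k - 1) by have := h.two_le; omega] at this ⊢
  rw [pow_add, mul_comm (α ^ (n - 1)), ← mul_assoc, div_mul_cancel₀ _ (h.pow_pos _).ne'] at this
  exact this

end IsDom

namespace IsDom

variable {k : ℕ} {α : ℝ}

theorem pow_eq_sum (h : IsDom k α) : α ^ k = ∑ i ∈ range k, α ^ i := by
  have h1 := mul_geom_sum α k
  have : (α - 1) * (α ^ k - ∑ i ∈ range k, α ^ i) = 0 := by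
    linear_combination -h.eq - h1
  rcases mul_eq_zero.1 this with h2 | h2 <;> linarith [h.one_lt]

/-- All roots other than the dominant one lie in the closed unit disc. -/
theorem norm_root_le_one (h : IsDom k α) {z : ℂ} (hz : z ^ k = ∑ i ∈ range k, z ^ i)
    (hne : z ≠ α) : ‖z‖ ≤ 1 := by
  by_contra! hc
  have h0 : z ≠ 0 := fun h => by simp [h] at hc; linarith
  have hk := h.two_le
  have e1 : z ^ k * (2 - z) = 1 := by
    have := mul_geom_sum z k
    rw [← hz] at this
    linear_combination -this
  have e2 : ‖z‖ ^ k * ‖2 - z‖ = 1 := by rw [← norm_pow, ← norm_mul, e1, norm_one]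
  have e3 : 2 - ‖z‖ ≤ ‖2 - z‖ := by simpa using norm_sub_norm_le 2 z
  have hle : ‖z‖ ≤ α := by
    by_contra! hlt
    have h1 := sum_inv_lt h.one_lt hlt (k := k) (by omega)
    rw [h.sum_inv_eq] at h1
    have h2 : ∑ i ∈ range k, (z ^ (i + 1))⁻¹ = 1 := by
      have h3 : ∑ i ∈ range k, (z ^ (i + 1))⁻¹ = (z ^ k)⁻¹ * ∑ i ∈ range k, z ^ i := by
        rw [← sum_range_reflect (fun i => z ^ i), mul_sum]
        refine sum_congr rfl fun i hi => ?_
        have hi := mem_range.1 hi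
        rw [inv_eq_iff_eq_inv, mul_inv, inv_inv, ← div_eq_mul_inv, eq_div_iff (by positivity),
          ← pow_add]
        congr 1; omega
      rw [h3, ← hz, inv_mul_cancel₀ (by positivity)]
    have h4 := norm_sum_le (range k) fun i => (z ^ (i + 1))⁻¹
    rw [h2, norm_one] at h4
    simp only [norm_inv, norm_pow] at h4
    linarith
  have hge : α ≤ ‖z‖ := by
    by_contra! hlt
    have h1 := sum_inv_lt hc hlt (k := k) (by omega)
    rw [h.sum_inv_eq, sum_inv hc, lt_div_iff₀ (by linarith)] at h1
    have h2 : 0 < ‖z‖ ^ k := by positivity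
    have h3 : ‖z‖ ^ k * (‖z‖ ^ k)⁻¹ = 1 := mul_inv_cancel₀ h2.ne'
    have h4 := mul_lt_mul_of_pos_left h1 h2
    have h5 := mul_le_mul_of_nonneg_left e3 h2.le
    linarith [mul_sub (‖z‖ ^ k) 1 (‖z‖ ^ k)⁻¹, mul_sub (‖z‖ ^ k) ‖z‖ 1, mul_sub (‖z‖ ^ k) 2 ‖z‖]
  have hza : ‖z‖ = α := le_antisymm hle hge
  have e4 : ‖2 - z‖ = 2 - α := by
    have := h.eq
    rw [hza] at e2
    exact mul_left_cancel₀ (h.pow_pos k).ne' (e2.trans this.symm)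
  have e5 : z.re * z.re + z.im * z.im = α ^ 2 := by
    rw [← hza, ← Complex.normSq_eq_norm_sq, Complex.normSq_apply]
  have e6 : (2 - z.re) * (2 - z.re) + z.im * z.im = (2 - α) ^ 2 := by
    rw [← e4, ← Complex.normSq_eq_norm_sq, Complex.normSq_apply]; simp
  have e7 : z.re = α := by linarith
  have e8 : z.im = 0 := by
    rw [e7] at e5
    have : z.im * z.im = 0 := by linarith
    simpa using this
  exact hne (Complex.ext (by simpa using e7) (by simpa using e8))

end IsDom

/-- `F⁽ᵏ⁾_n` in its usual indexing. -/
def genFib (k n : ℕ) : ℤ := kfib k (n + k - 2)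

theorem kfib_nonneg (k j : ℕ) : 0 ≤ kfib k j := by
  induction j using Nat.strong_induction_on with
  | _ j ih =>
    rw [kfib]; split_ifs
    · rfl
    · rfl
    · norm_num
    · exact sum_nonneg fun i _ => ih _ (by omega)

theorem genFib_one {k : ℕ} (hk : 2 ≤ k) : genFib k 1 = 1 := by
  rw [genFib, show 1 + k - 2 = k - 1 by omega, kfib_pred hk]

theorem genFib_two {k : ℕ} (hk : 2 ≤ k) : genFib k 2 = 1 := by
  rw [genFib, show 2 + k - 2 = k by omega, kfib_self hk]

theorem genFib_succ {k n : ℕ} (hk : 2 ≤ k) :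
    genFib k (n + 3) = 2 * genFib k (n + 2) - kfib k n := by
  have := kfib_add_succ hk n
  rw [genFib, genFib, show n + 3 + k - 2 = n + k + 1 by omega,
    show n + 2 + k - 2 = n + k by omega, this]

theorem genFib_le {k : ℕ} (hk : 2 ≤ k) (n : ℕ) : genFib k (n + 2) ≤ 2 ^ n := by
  induction n with
  | zero => rw [genFib_two hk]; norm_num
  | succ n ih =>
    rw [genFib_succ hk, pow_succ]; linarith [kfib_nonneg k n]

theorem kfib_mul_le {k : ℕ} (hk : 2 ≤ k) (j : ℕ) : kfib k j * 2 ^ k ≤ 2 * 2 ^ j := by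
  rcases lt_trichotomy (j + 1) k with hj | hj | hj
  · rw [kfib_of_lt hj]; simp
  · subst hj
    have := kfib_pred hk
    rw [Nat.add_sub_cancel] at this
    rw [this, pow_succ]; linarith
  · obtain ⟨i, rfl⟩ : ∃ i, j = i + k := ⟨j - k, by omega⟩
    have := genFib_le hk i
    rw [genFib, show i + 2 + k - 2 = i + k by omega] at this
    rw [pow_add]
    nlinarith [pow_pos (show (0 : ℤ) < 2 by norm_num) i, pow_pos (show (0 : ℤ) < 2 by norm_num) k,
      mul_pos (pow_pos (show (0 : ℤ) < 2 by norm_num) i) (pow_pos (show (0 : ℤ) < 2 by norm_num) k)]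

theorem le_genFib {k : ℕ} (hk : 2 ≤ k) (n : ℕ) :
    2 ^ n * (2 ^ k - n) ≤ 2 ^ k * genFib k (n + 2) := by
  induction n with
  | zero => rw [genFib_two hk]; simp
  | succ n ih =>
    rw [genFib_succ hk, pow_succ]
    have := kfib_mul_le hk n
    push_cast
    nlinarith

theorem genFib_mono {k : ℕ} (hk : 2 ≤ k) (n : ℕ) : genFib k (n + 2) ≤ genFib k (n + 3) := by
  unfold genFib
  rw [show n + 3 + k - 2 = (n + 1) + k by omega, show n + 2 + k - 2 = n + 1 + (k - 1) by omega,
    kfib_add hk]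
  exact single_le_sum (f := fun i => kfib k (n + 1 + i)) (fun i _ => kfib_nonneg _ _)
    (by simp; omega)

theorem genFib_pos {k : ℕ} (hk : 2 ≤ k) (n : ℕ) : 1 ≤ genFib k (n + 1) := by
  rcases n with - | n
  · rw [genFib_one hk]
  induction n with
  | zero => rw [genFib_two hk]
  | succ n ih => exact ih.trans (genFib_mono hk n)

theorem genFib_mono_le {k m n : ℕ} (hk : 2 ≤ k) (hm : 2 ≤ m) (hmn : m ≤ n) :
    genFib k m ≤ genFib k n := by
  induction n, hmn using Nat.le_induction with
  | base => rfl
  | succ n hn ih =>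
    obtain ⟨t, rfl⟩ : ∃ t, n = t + 2 := ⟨n - 2, by omega⟩
    exact ih.trans (genFib_mono hk t)

theorem two_le_genFib {k n : ℕ} (hk : 2 ≤ k) (hn : 3 ≤ n) : 2 ≤ genFib k n := by
  have h : genFib k 3 = 2 := by
    have := genFib_succ (n := 0) hk
    rw [genFib_two hk, kfib_of_lt (by omega)] at this
    simpa using this
  exact h ▸ genFib_mono_le hk (by norm_num) hn

theorem IsDom.abs_genFib_sub_le {k : ℕ} {α : ℝ} (h : IsDom k α) {n : ℕ} (hn : 1 ≤ n) :
    |genFib k n - binetCoeff k α * α ^ (n - 1)| ≤ 1 / 2 := h.abs_kfib_sub_le hn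

end

/-- `γ = 1 + √2`. -/
noncomputable def silver : ℝ := 1 + √2

theorem sqrt_two_sq : √2 ^ 2 = (2 : ℝ) := Real.sq_sqrt (by norm_num)

theorem sqrt_two_gt : 1.4142 < √2 := Real.lt_sqrt_of_sq_lt (by norm_num)

theorem sqrt_two_lt : √2 < 1.4143 := by
  rw [Real.sqrt_lt' (by norm_num)]; norm_num

theorem silver_gt : 2.4142 < silver := by unfold silver; linarith [sqrt_two_gt]

theorem silver_lt : silver < 2.4143 := by unfold silver; linarith [sqrt_two_lt]

theorem silver_pos : 0 < silver := by linarith [silver_gt]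

theorem silver_sq : silver ^ 2 = 2 * silver + 1 := by
  unfold silver; linear_combination sqrt_two_sq

theorem pell_binet (n : ℕ) : 2 * √2 * (pell n : ℝ) = silver ^ n - (1 - √2) ^ n := by
  have key : ∀ n : ℕ, 2 * √2 * (pell n : ℝ) = silver ^ n - (1 - √2) ^ n ∧
      2 * √2 * (pell (n + 1) : ℝ) = silver ^ (n + 1) - (1 - √2) ^ (n + 1) := by
    intro n
    induction n with
    | zero => constructor <;> simp [pell, silver]; ring
    | succ n ih =>
      refine ⟨ih.2, ?_⟩
      have e1 : (pell (n + 1 + 1) : ℝ) = 2 * pell (n + 1) + pell n := by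
        simp [pell]
      have e2 : silver ^ (n + 1 + 1) = 2 * silver ^ (n + 1) + silver ^ n := by
        rw [pow_add, pow_add, pow_one]; linear_combination silver ^ n * silver_sq
      have e3 : (1 - √2) ^ (n + 1 + 1) = 2 * (1 - √2) ^ (n + 1) + (1 - √2) ^ n := by
        linear_combination (1 - √2) ^ n * sqrt_two_sq
      rw [e1, e2, e3]; linear_combination 2 * ih.2 + ih.1
  exact (key n).1

/-- `2√2 P_ℓ` is within `γ ^ (-ℓ)` of `γ ^ ℓ`. -/
theorem abs_pell_sub_le (n : ℕ) : |2 * √2 * (pell n : ℝ) - silver ^ n| ≤ (silver ^ n)⁻¹ := by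
  rw [pell_binet, sub_sub_cancel_left, abs_neg, abs_pow]
  have : |1 - √2| = silver⁻¹ := by
    rw [abs_of_neg (by linarith [sqrt_two_gt]), ← mul_eq_one_iff_eq_inv₀ silver_pos.ne']
    unfold silver; linear_combination sqrt_two_sq
  rw [this, inv_pow]

theorem pell_pos (n : ℕ) : 1 ≤ pell (n + 1) := by
  induction n using Nat.strong_induction_on with
  | _ n ih =>
    rcases n with - | - | n
    · simp [pell]
    · simp [pell]
    · have h1 := ih (n + 1) (by omega)
      have h2 := ih n (by omega)
      rw [pell]; linarith

section

open Finset IntermediateField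

/-- Evaluation of integer polynomials in two variables at a pair of complex numbers. -/
noncomputable def biEval (z w : ℂ) : MvPolynomial (Fin 2) ℤ →ₐ[ℤ] ℂ := MvPolynomial.aeval ![z, w]

/-- The `k`-step recurrence polynomial. -/
noncomputable def stepPoly (k : ℕ) : Polynomial ℤ := .X ^ k - ∑ i ∈ range k, .X ^ i

theorem stepPoly_monic (k : ℕ) : (stepPoly k).Monic := by
  refine Polynomial.monic_X_pow_sub ?_
  refine (Polynomial.degree_sum_le _ _).trans_lt ?_
  refine (Finset.sup_lt_iff (WithBot.bot_lt_coe k)).2 fun i hi => ?_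
  rw [Polynomial.degree_X_pow]
  exact WithBot.coe_lt_coe.2 (mem_range.1 hi)

theorem stepPoly_natDegree (k : ℕ) : (stepPoly k).natDegree = k := by
  refine Polynomial.natDegree_eq_of_degree_eq_some ?_
  rw [stepPoly, Polynomial.degree_sub_eq_left_of_degree_lt, Polynomial.degree_X_pow]
  rw [Polynomial.degree_X_pow]
  refine (Polynomial.degree_sum_le _ _).trans_lt ?_
  refine (Finset.sup_lt_iff (WithBot.bot_lt_coe k)).2 fun i hi => ?_
  rw [Polynomial.degree_X_pow]
  exact WithBot.coe_lt_coe.2 (mem_range.1 hi)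

theorem sq_eq_two_iff (w : ℂ) : w ^ 2 = 2 ↔ w = (√2 : ℝ) ∨ w = -(√2 : ℝ) := by
  rw [← sq_eq_sq_iff_eq_or_eq_neg]
  have : ((√2 : ℝ) : ℂ) ^ 2 = 2 := by exact_mod_cast sqrt_two_sq
  rw [this]

theorem prod_le_of_injOn {ι κ : Type*} [DecidableEq κ] {s : Finset ι} {t : Finset κ} (φ : ι → κ)
    (hφ : Set.InjOn φ s) (hst : ∀ i ∈ s, φ i ∈ t) {f : ι → ℝ} {g : κ → ℝ}
    (hf : ∀ i ∈ s, 0 ≤ f i) (hfg : ∀ i ∈ s, f i ≤ g (φ i)) (hg : ∀ j ∈ t, 1 ≤ g j) :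
    ∏ i ∈ s, f i ≤ ∏ j ∈ t, g j := by
  calc ∏ i ∈ s, f i ≤ ∏ i ∈ s, g (φ i) := prod_le_prod hf hfg
    _ = ∏ j ∈ s.image φ, g j := (prod_image hφ).symm
    _ ≤ ∏ j ∈ t, g j := prod_le_prod_of_subset_of_one_le (image_subset_iff.2 hst)
        (fun j hj => zero_le_one.trans (hg j (image_subset_iff.2 hst hj)))
        (fun j hj _ => hg j hj)

theorem IsDom.one_le_norm_mul_of_field {k : ℕ} {α : ℝ} (h : IsDom k α) {K : Type*} [Field K]
    [Algebra ℚ K] [FiniteDimensional ℚ K] {A R : K} (hA : A ^ k = ∑ i ∈ range k, A ^ i)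
    (hR : R ^ 2 = 2) (hgen : ∀ σ τ : K →ₐ[ℚ] ℂ, σ A = τ A → σ R = τ R → σ = τ)
    (ι : K →ₐ[ℚ] ℂ) (hιA : ι A = α) (hιR : ι R = (√2 : ℝ)) (p : MvPolynomial (Fin 2) ℤ)
    (hp : biEval α (√2 : ℝ) p ≠ 0) {B B' : ℝ} (hB1 : 1 ≤ B) (hB1' : 1 ≤ B')
    (hB : ∀ z w : ℂ, ‖z‖ ≤ 1 → z ^ k = ∑ i ∈ range k, z ^ i → w ^ 2 = 2 → ‖biEval z w p‖ ≤ B)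
    (hB' : ‖biEval α (-(√2 : ℝ)) p‖ ≤ B') :
    1 ≤ ‖biEval α (√2 : ℝ) p‖ * (B' * B ^ (2 * k)) := by
  classical
  have : CharZero K := algebraRat.charZero K
  set a : ℂ := (α : ℂ) with ha
  set r : ℂ := ((√2 : ℝ) : ℂ) with hr
  let x : K := MvPolynomial.aeval ![A, R] p
  have hσ : ∀ σ : K →ₐ[ℚ] ℂ, σ x = biEval (σ A) (σ R) p := by
    intro σ
    have := MvPolynomial.map_aeval ![A, R] (σ : K →+* ℂ) p
    rw [biEval, MvPolynomial.aeval_def]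
    refine this.trans ?_
    rw [MvPolynomial.coe_eval₂Hom]
    congr 1
    · exact RingHom.ext_int _ _
    · funext i; fin_cases i <;> rfl
  have hx0 : x ≠ 0 := by
    intro h0
    have := hσ ι
    rw [h0, map_zero] at this
    rw [hιA, hιR] at this
    exact hp this.symm
  have iA : IsIntegral ℤ A := by
    refine ⟨stepPoly k, stepPoly_monic k, ?_⟩
    simp [stepPoly, Polynomial.eval₂_finsetSum, hA]
  have iR : IsIntegral ℤ R := by
    refine ⟨.X ^ 2 - .C 2, Polynomial.monic_X_pow_sub_C 2 (by norm_num), ?_⟩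
    simp [hR]
  have ix : IsIntegral ℤ x := by
    refine MvPolynomial.induction_on (motive := fun p => IsIntegral ℤ
      (MvPolynomial.aeval ![A, R] p : K)) p ?_ ?_ ?_
    · intro n; rw [MvPolynomial.aeval_C]; exact isIntegral_algebraMap
    · intro p q hp hq; rw [map_add]; exact hp.add hq
    · intro p i hp; rw [map_mul, MvPolynomial.aeval_X]
      refine hp.mul ?_
      fin_cases i
      · exact iA
      · exact iR
  have hnorm : 1 ≤ ∏ σ : K →ₐ[ℚ] ℂ, ‖σ x‖ := by
    rw [← norm_prod, ← Algebra.norm_eq_prod_embeddings ℚ ℂ x]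
    obtain ⟨n, hn⟩ := IsIntegrallyClosed.isIntegral_iff.1 (Algebra.isIntegral_norm ℚ ix)
    have hn0 : n ≠ 0 := by
      rintro rfl
      rw [map_zero, eq_comm, Algebra.norm_eq_zero_iff] at hn
      exact hx0 hn
    rw [← hn]
    simp only [algebraMap_int_eq, eq_intCast, map_intCast]
    rw [Complex.norm_intCast]
    exact_mod_cast Int.one_le_abs hn0
  rw [← mul_prod_erase _ _ (mem_univ ι), hσ ι, hιA, hιR] at hnorm
  refine hnorm.trans (mul_le_mul_of_nonneg_left ?_ (norm_nonneg _))
  -- the pairs of conjugates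
  have hσA : ∀ σ : K →ₐ[ℚ] ℂ, (σ A) ^ k = ∑ i ∈ range k, (σ A) ^ i := by
    intro σ
    rw [← map_pow, hA, map_sum]; simp
  have hσR : ∀ σ : K →ₐ[ℚ] ℂ, (σ R) ^ 2 = 2 := by
    intro σ
    rw [← map_pow, hR, map_ofNat]
  let φ : (K →ₐ[ℚ] ℂ) → ℂ × ℂ := fun σ => (σ A, σ R)
  have hφ : Function.Injective φ := by
    intro σ τ hστ
    obtain ⟨h1, h2⟩ := Prod.ext_iff.1 hστ
    exact hgen σ τ h1 h2
  let Z : Finset ℂ := ((stepPoly k).map (Int.castRingHom ℂ)).roots.toFinset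
  have hZ : ∀ z : ℂ, z ^ k = ∑ i ∈ range k, z ^ i → z ∈ Z := by
    intro z hz
    have h0 : (stepPoly k).map (Int.castRingHom ℂ) ≠ 0 := ((stepPoly_monic k).map _).ne_zero
    rw [Multiset.mem_toFinset, Polynomial.mem_roots h0, Polynomial.IsRoot.def,
      Polynomial.eval_map]
    simp [stepPoly, Polynomial.eval₂_finsetSum, hz]
  have hZc : Z.card ≤ k := by
    refine (Multiset.toFinset_card_le _).trans ((Polynomial.card_roots' _).trans ?_)
    rw [(stepPoly_monic k).natDegree_map, stepPoly_natDegree]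
  have hW : ∀ w : ℂ, w ^ 2 = 2 → w ∈ ({r, -r} : Finset ℂ) := fun w hw => by
    simpa using (sq_eq_two_iff w).1 hw
  let T := insert (a, -r) ((Z.erase a) ×ˢ ({r, -r} : Finset ℂ))
  have hne : (a, -r) ∉ (Z.erase a) ×ˢ ({r, -r} : Finset ℂ) := by simp
  calc ∏ σ ∈ univ.erase ι, ‖σ x‖ ≤ ∏ q ∈ T, if q.1 = a then B' else B := by
        refine prod_le_of_injOn φ hφ.injOn ?_ (fun _ _ => norm_nonneg _) ?_ ?_
        · intro σ hs
          by_cases hσa : σ A = a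
          · rcases (sq_eq_two_iff _).1 (hσR σ) with hσr | hσr
            · exact absurd (hφ (Prod.ext (hσa.trans hιA.symm) (hσr.trans hιR.symm)))
                (mem_erase.1 hs).1
            · exact mem_insert.2 (Or.inl (Prod.ext hσa hσr))
          · refine mem_insert.2 (Or.inr (mem_product.2 ⟨mem_erase.2 ⟨hσa, hZ _ (hσA σ)⟩,
              hW _ (hσR σ)⟩))
        · intro σ hs
          rw [hσ]
          by_cases hσa : σ A = a
          · rcases (sq_eq_two_iff _).1 (hσR σ) with hσr | hσr
            · exact absurd (hφ (Prod.ext (hσa.trans hιA.symm) (hσr.trans hιR.symm)))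
                (mem_erase.1 hs).1
            · simp only [φ, hσa, if_true]; rw [hσr]; exact hB'
          · simp only [φ, hσa, if_false]
            exact hB _ _ (h.norm_root_le_one (hσA σ) hσa) (hσA σ) (hσR σ)
        · intro q _; split_ifs <;> assumption
    _ = B' * B ^ ((Z.erase a) ×ˢ ({r, -r} : Finset ℂ)).card := by
        rw [prod_insert hne, if_pos rfl, ← prod_const]
        congr 1
        refine prod_congr rfl fun q hq => if_neg ?_
        exact (mem_erase.1 (mem_product.1 hq).1).1
    _ ≤ B' * B ^ (2 * k) := by
        refine mul_le_mul_of_nonneg_left (pow_le_pow_right₀ hB1 ?_) (by linarith)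
        rw [card_product, mul_comm]
        exact Nat.mul_le_mul card_le_two ((card_erase_le).trans hZc)

/-- Liouville-type inequality in `ℤ[α, √2]`. -/
theorem IsDom.one_le_norm_mul {k : ℕ} {α : ℝ} (h : IsDom k α) (p : MvPolynomial (Fin 2) ℤ)
    (hp : biEval α (√2 : ℝ) p ≠ 0) {B B' : ℝ} (hB1 : 1 ≤ B) (hB1' : 1 ≤ B')
    (hB : ∀ z w : ℂ, ‖z‖ ≤ 1 → z ^ k = ∑ i ∈ range k, z ^ i → w ^ 2 = 2 → ‖biEval z w p‖ ≤ B)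
    (hB' : ‖biEval α (-(√2 : ℝ)) p‖ ≤ B') :
    1 ≤ ‖biEval α (√2 : ℝ) p‖ * (B' * B ^ (2 * k)) := by
  set a : ℂ := (α : ℂ) with ha
  set r : ℂ := ((√2 : ℝ) : ℂ) with hr
  have hroot : a ^ k = ∑ i ∈ range k, a ^ i := by
    rw [ha]; exact_mod_cast h.pow_eq_sum
  have hr2 : r ^ 2 = 2 := by rw [hr]; exact_mod_cast sqrt_two_sq
  have ia : IsIntegral ℤ a := by
    refine ⟨stepPoly k, stepPoly_monic k, ?_⟩
    simp [stepPoly, Polynomial.eval₂_finsetSum, hroot]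
  have ir : IsIntegral ℤ r := by
    refine ⟨.X ^ 2 - .C 2, Polynomial.monic_X_pow_sub_C 2 (by norm_num), ?_⟩
    simp [hr2]
  have ma : a ∈ adjoin ℚ ({a, r} : Set ℂ) := subset_adjoin ℚ _ (by simp)
  have mr : r ∈ adjoin ℚ ({a, r} : Set ℂ) := subset_adjoin ℚ _ (by simp)
  have : FiniteDimensional ℚ (adjoin ℚ ({a, r} : Set ℂ)) :=
    finiteDimensional_adjoin_pair ia.tower_top ir.tower_top
  refine @IsDom.one_le_norm_mul_of_field k α h (adjoin ℚ ({a, r} : Set ℂ)) _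
    (IntermediateField.algebra' _) this ⟨a, ma⟩ ⟨r, mr⟩ (Subtype.ext (by simpa using hroot))
    (Subtype.ext hr2) ?_ (adjoin ℚ ({a, r} : Set ℂ)).val rfl rfl p hp B B'
    hB1 hB1' hB hB'
  intro σ τ h1 h2
  refine algHom_ext_of_eq_adjoin ℚ rfl fun y hy => ?_
  rcases hy with rfl | hy
  · exact h1
  · obtain rfl := Set.mem_singleton_iff.1 hy; exact h2

end

section

open Finset

/-- A function taking each value below `J` at most `K` times on a set with `K * J` elements has
large sum. -/
theorem le_sum_of_card_fiber_le {ι : Type*} [Fintype ι] {K J : ℕ} (hN : Fintype.card ι = K * J)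
    (f : ι → Fin (J + 1)) (hf : ∀ s : Fin (J + 1), (s : ℕ) < J → #{j | f j = s} ≤ K) :
    K * ∑ t ∈ range J, t ≤ ∑ j, (f j : ℕ) := by
  classical
  have h1 : ∀ j, (f j : ℕ) = ∑ t ∈ range J, if t < f j then 1 else 0 := by
    intro j
    have : {t ∈ range J | t < (f j : ℕ)} = range (f j) := by
      ext t; simp only [mem_filter, mem_range]; have := (f j).2; omega
    rw [sum_boole, this, card_range, Nat.cast_id]
  have h2 : ∀ t ∈ range J, K * (J - 1 - t) ≤ #{j | t < (f j : ℕ)} := by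
    intro t ht
    have ht := mem_range.1 ht
    have h3 : #{j | ¬ t < (f j : ℕ)} ≤ (t + 1) * K := by
      have : ({j | ¬ t < (f j : ℕ)} : Finset ι) ⊆
          (range (t + 1)).biUnion fun s => {j | (f j : ℕ) = s} := by
        intro j hj
        simp only [mem_filter, mem_univ, true_and] at hj
        simp only [mem_biUnion, mem_range, mem_filter, mem_univ, true_and]
        exact ⟨_, by omega, rfl⟩
      refine (card_le_card this).trans ((card_biUnion_le_card_mul _ _ K fun s hs => ?_).trans
        (by rw [card_range]))
      have hs := mem_range.1 hs
      convert hf ⟨s, by omega⟩ (by simp; omega) using 3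
      simp [Fin.ext_iff]
    have h4 := card_filter_add_card_filter_not (s := univ) (fun j => t < (f j : ℕ))
    rw [card_univ, hN] at h4
    have h5 : K * (J - 1 - t) + (t + 1) * K = K * J := by
      rw [mul_comm (t + 1), ← mul_add]; congr 1; omega
    omega
  rw [sum_congr rfl fun j _ => h1 j, sum_comm]
  calc K * ∑ t ∈ range J, t = ∑ t ∈ range J, K * (J - 1 - t) := by
        rw [← sum_range_reflect, mul_sum]
    _ ≤ _ := sum_le_sum fun t ht => by simpa using h2 t ht

theorem card_fiber_le_of_det_ne_zero {ι : Type*} [Fintype ι] [DecidableEq ι] {A : Matrix ι ι ℝ}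
    (hA : A.det ≠ 0) {K : ℕ} (W : Submodule ℝ (ι → ℝ)) (hW : Module.finrank ℝ W ≤ K)
    (S : Finset ι) (hS : ∀ j ∈ S, (fun i => A i j) ∈ W) : #S ≤ K := by
  have hli : LinearIndependent ℝ A.col := Matrix.linearIndependent_cols_of_det_ne_zero hA
  let v : S → W := fun j => ⟨fun i => A i j, hS j j.2⟩
  have hv : LinearIndependent ℝ v := by
    refine LinearIndependent.of_comp W.subtype ?_
    exact hli.comp (fun j : S => (j : ι)) Subtype.val_injective
  have := hv.fintype_card_le_finrank
  rw [Fintype.card_coe] at this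
  exact this.trans hW

/-- Interpolation determinants are small. -/
theorem abs_det_mul_pow_le {ι : Type*} [Fintype ι] [DecidableEq ι] {K J : ℕ}
    (hN : Fintype.card ι = K * J) (C : Fin (J + 1) → Matrix ι ι ℝ)
    (W : Fin (J + 1) → Submodule ℝ (ι → ℝ))
    (hW : ∀ s : Fin (J + 1), (s : ℕ) < J → Module.finrank ℝ (W s) ≤ K)
    (hC : ∀ s : Fin (J + 1), (s : ℕ) < J → ∀ j, (fun i => C s i j) ∈ W s)
    {E : ℝ} (hE : 1 ≤ E) (B : ι → ℝ) (hB : ∀ i j, ∑ s : Fin (J + 1), E ^ (s : ℕ) * |C s i j| ≤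
        B j) :
    |(∑ s, C s).det| * E ^ (K * ∑ t ∈ range J, t) ≤ (Fintype.card ι).factorial * ∏ j, B j := by
  have hE0 : 0 < E := by linarith
  have e1 : (∑ s, C s).det = ∑ f : ι → Fin (J + 1), (Matrix.of fun i j => C (f j) i j).det := by
    simp only [Matrix.det_apply', Matrix.of_apply, Matrix.sum_apply]
    rw [sum_comm]
    refine sum_congr rfl fun σ _ => ?_
    rw [prod_univ_sum, mul_sum, Fintype.piFinset_univ]
  have e2 : ∀ f : ι → Fin (J + 1), |(Matrix.of fun i j => C (f j) i j).det| *
      E ^ (K * ∑ t ∈ range J, t) ≤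
      ∑ σ : Equiv.Perm ι, ∏ j, (E ^ (f j : ℕ) * |C (f j) (σ j) j|) := by
    intro f
    by_cases h0 : (Matrix.of fun i j => C (f j) i j).det = 0
    · rw [h0, abs_zero, zero_mul]
      exact sum_nonneg fun σ _ => prod_nonneg fun j _ => by positivity
    have h1 : K * ∑ t ∈ range J, t ≤ ∑ j, (f j : ℕ) := by
      refine le_sum_of_card_fiber_le hN f fun s hs => ?_
      refine card_fiber_le_of_det_ne_zero h0 (W s) (hW s hs) _ fun j hj => ?_
      have : f j = s := by simpa using hj
      simpa [this] using hC s hs j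
    calc _ ≤ (∑ σ : Equiv.Perm ι, ∏ j, |C (f j) (σ j) j|) * E ^ (∑ j, (f j : ℕ)) := by
          gcongr
          · rw [Matrix.det_apply']
            refine (abs_sum_le_sum_abs _ _).trans (sum_le_sum fun σ _ => ?_)
            rw [abs_mul, abs_prod]
            rcases Int.units_eq_one_or (Equiv.Perm.sign σ) with h | h <;> simp [h]
      _ = _ := by
          rw [sum_mul]
          refine sum_congr rfl fun σ _ => ?_
          rw [prod_mul_distrib, prod_pow_eq_pow_sum, mul_comm]
  calc |(∑ s, C s).det| * E ^ (K * ∑ t ∈ range J, t)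
      ≤ (∑ f : ι → Fin (J + 1), |(Matrix.of fun i j => C (f j) i j).det|) *
          E ^ (K * ∑ t ∈ range J, t) := by
        rw [e1]; gcongr; exact abs_sum_le_sum_abs _ _
    _ ≤ ∑ f : ι → Fin (J + 1), ∑ σ : Equiv.Perm ι, ∏ j, (E ^ (f j : ℕ) * |C (f j) (σ j) j|) := by
        rw [sum_mul]; exact sum_le_sum fun f _ => e2 f
    _ = ∑ σ : Equiv.Perm ι, ∏ j, ∑ s : Fin (J + 1), E ^ (s : ℕ) * |C s (σ j) j| := by
        rw [sum_comm]
        refine sum_congr rfl fun σ _ => ?_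
        rw [prod_univ_sum, Fintype.piFinset_univ]
    _ ≤ ∑ σ : Equiv.Perm ι, ∏ j, B j :=
        sum_le_sum fun σ _ => prod_le_prod
          (fun j _ => sum_nonneg fun s _ => by positivity) fun j _ => hB _ _
    _ = _ := by rw [sum_const, card_univ, Fintype.card_perm, nsmul_eq_mul]

end

open Polynomial in
/-- Sylvester matrices of relatively prime polynomials over a unique factorization domain are
nonsingular. -/
theorem resultant_ne_zero_of_isRelPrime {R : Type*} [CommRing R] [IsDomain R]
    [UniqueFactorizationMonoid R] {f g : R[X]} (hf : f ≠ 0) (h : IsRelPrime f g) :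
    f.resultant g ≠ 0 := by
  intro h0
  rw [resultant, ← toMatrix_sylvesterMap' f g le_rfl le_rfl] at h0
  set b₁ := ((degreeLT.basis R f.natDegree).prod (degreeLT.basis R g.natDegree)).reindex
    finSumFinEquiv with hb₁
  set b₂ := degreeLT.basis R (f.natDegree + g.natDegree) with hb₂
  obtain ⟨v, hv, hv0⟩ := Matrix.exists_mulVec_eq_zero_iff.mpr h0
  obtain ⟨x, hx⟩ : ∃ x, (b₁.repr x : _ → R) = v :=
    ⟨b₁.equivFun.symm v, by
      have := b₁.equivFun.apply_symm_apply v
      rwa [Module.Basis.equivFun_apply] at this⟩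
  rw [← hx, LinearMap.toMatrix_mulVec_repr] at hv0
  have hS : sylvesterMap f g le_rfl le_rfl x = 0 := by
    apply b₂.repr.injective
    ext i
    rw [hv0]
    simp
  have hS' : f * x.2 + g * x.1 = 0 := by
    have := congrArg Subtype.val hS
    simpa using this
  have hdvd : f ∣ g * (x.1 : R[X]) := ⟨-x.2, by linear_combination hS'⟩
  have hdvd' : f ∣ (x.1 : R[X]) := h.dvd_of_dvd_mul_left hdvd
  have hx1 : (x.1 : R[X]) = 0 := by
    by_contra hne
    have := degree_le_of_dvd hdvd' hne
    have h2 := mem_degreeLT.mp x.1.2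
    rw [degree_eq_natDegree hf] at this
    exact absurd (this.trans_lt h2) (lt_irrefl _)
  have hx2 : (x.2 : R[X]) = 0 := by
    rw [hx1, mul_zero, add_zero] at hS'
    exact (mul_eq_zero.mp hS').resolve_left hf
  apply hv
  have : x = 0 := Prod.ext (Subtype.ext hx1) (Subtype.ext hx2)
  rw [← hx, this]
  simp

open Polynomial in
theorem natDegree_det_le_mul {R ι : Type*} [CommRing R] [Fintype ι] [DecidableEq ι] (D : ℕ)
    (M : Matrix ι ι R[X]) (h : ∀ i j, (M i j).natDegree ≤ D) :
    M.det.natDegree ≤ Fintype.card ι * D := by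
  rw [Matrix.det_apply]
  refine natDegree_sum_le_of_forall_le _ _ fun σ _ => ?_
  refine (natDegree_smul_le _ _).trans ((natDegree_prod_le _ _).trans ?_)
  refine (Finset.sum_le_sum fun i _ => h (σ i) i).trans ?_
  simp

open Polynomial in
/-- A weak form of Bézout's theorem. -/
theorem card_le_of_isRelPrime {Q Q' : ℝ[X][X]} {D : ℕ} (hQ : Q ≠ 0)
    (h : IsRelPrime Q Q') (hD : Q.natDegree ≤ D) (hD' : Q'.natDegree ≤ D)
    (hc : ∀ i, (Q.coeff i).natDegree ≤ D) (hc' : ∀ i, (Q'.coeff i).natDegree ≤ D)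
    (S : Finset (ℝ × ℝ)) (hS : Set.InjOn Prod.fst (S : Set (ℝ × ℝ)))
    (h0 : ∀ p ∈ S, Q.evalEval p.1 p.2 = 0) (h0' : ∀ p ∈ S, Q'.evalEval p.1 p.2 = 0) :
    S.card ≤ 2 * D ^ 2 := by
  have key : ∀ r : ℝ[X], r ≠ 0 → (∀ p ∈ S, r.eval p.1 = 0) → S.card ≤ r.natDegree := by
    intro r hr hz
    rw [← Finset.card_image_of_injOn hS]
    refine card_le_degree_of_subset_roots (p := r) fun x hx => ?_
    obtain ⟨p, hp, rfl⟩ := Finset.mem_image.mp hx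
    exact (mem_roots hr).mpr (hz p hp)
  by_cases hm : Q.natDegree = 0
  · obtain ⟨r, rfl⟩ : ∃ r, Q = C r := ⟨_, eq_C_of_natDegree_eq_zero hm⟩
    have := key r (by rintro rfl; simp at hQ) (fun p hp => by
      have := h0 p hp
      rwa [evalEval_C] at this)
    have h2 := hc 0
    simp only [coeff_C_zero] at h2
    nlinarith
  · obtain ⟨p, q, -, -, hpq⟩ := exists_mul_add_mul_eq_C_resultant Q Q' le_rfl le_rfl (Or.inl hm)
    have h1 := key (Q.resultant Q') (resultant_ne_zero_of_isRelPrime hQ h) (fun s hs => by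
      have := congrArg (evalEval s.1 s.2) hpq
      rw [evalEval_add, evalEval_mul, evalEval_mul, h0 s hs, h0' s hs, evalEval_C] at this
      linarith)
    refine h1.trans ((natDegree_det_le_mul D _ fun i j => ?_).trans ?_)
    · rw [sylvester, Matrix.of_apply]
      refine Fin.addCases (fun j₁ => ?_) (fun j₁ => ?_) j
      · rw [Fin.addCases_left]
        split_ifs
        · exact hc' _
        · simp
      · rw [Fin.addCases_right]
        split_ifs
        · exact hc _
        · simp
    · rw [Fintype.card_fin]
      nlinarith

open Polynomial in
theorem coeff_prod_sum_of_natDegree_le {R ι : Type*} [CommRing R] (s : Finset ι) (f : ι → R[X])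
    (d : ι → ℕ) (h : ∀ i ∈ s, (f i).natDegree ≤ d i) :
    (∏ i ∈ s, f i).coeff (∑ i ∈ s, d i) = ∏ i ∈ s, (f i).coeff (d i) := by
  classical
  induction s using Finset.induction_on with
  | empty => simp
  | insert a s ha ih =>
    rw [Finset.prod_insert ha, Finset.sum_insert ha, Finset.prod_insert ha,
      coeff_mul_add_eq_of_natDegree_le (h a (Finset.mem_insert_self _ _)),
      ih fun i hi => h i (Finset.mem_insert_of_mem hi)]
    exact (natDegree_prod_le _ _).trans
      (Finset.sum_le_sum fun i hi => h i (Finset.mem_insert_of_mem hi))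

open Polynomial in
theorem coeff_det_of_natDegree_le {R ι : Type*} [CommRing R] [Fintype ι] [DecidableEq ι]
    (M : Matrix ι ι R[X]) (d : ι → ℕ) (h : ∀ i j, (M i j).natDegree ≤ d j) :
    M.det.coeff (∑ j, d j) = (Matrix.of fun i j => (M i j).coeff (d j)).det := by
  rw [Matrix.det_apply, Matrix.det_apply, finsetSum_coeff]
  refine Finset.sum_congr rfl fun σ _ => ?_
  rw [coeff_smul, coeff_prod_sum_of_natDegree_le _ _ _ fun i _ => h (σ i) i]
  rfl

/-- Nonvanishing of a Vandermonde-type determinant with column factors. -/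
theorem det_mul_pow_ne_zero {ι : Type*} [Fintype ι] [DecidableEq ι] {L : ℕ} (e : ι ≃ Fin L)
    (a x : ι → ℝ) (ha : ∀ j, a j ≠ 0) (hx : Function.Injective x) :
    (Matrix.of fun i j : ι => a j * x j ^ (e i : ℕ)).det ≠ 0 := by
  have h1 : (Matrix.of fun i j : ι => a j * x j ^ (e i : ℕ)) =
      Matrix.of fun i j : ι => a j * (Matrix.of fun i j : ι => x j ^ (e i : ℕ)) i j := rfl
  rw [h1, Matrix.det_mul_row]
  refine mul_ne_zero (Finset.prod_ne_zero_iff.mpr fun j _ => ha j) ?_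
  have h2 : (Matrix.of fun i j : ι => x j ^ (e i : ℕ)) =
      ((Matrix.vandermonde (fun q : Fin L => x (e.symm q))).transpose).submatrix e e := by
    ext i j
    simp [Matrix.vandermonde]
  rw [h2, Matrix.det_submatrix_equiv_self, Matrix.det_transpose, Matrix.det_vandermonde_ne_zero_iff]
  exact hx.comp e.symm.injective

open Polynomial in
theorem det_taylor_ne_zero {ι : Type*} [Fintype ι] [DecidableEq ι] {L : ℕ} (e : ι ≃ Fin L)
    (P : ι → ℝ[X]) (hP : ∀ j, P j ≠ 0) (x : ι → ℝ) (hx : Function.Injective x) (s : ℝ) :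
    (Matrix.of fun i j : ι =>
      C (x j ^ (e i : ℕ)) * taylor ((e i : ℕ) * s) (P j)).det ≠ 0 := by
  intro h0
  have h1 := coeff_det_of_natDegree_le (Matrix.of fun i j : ι =>
      C (x j ^ (e i : ℕ)) * taylor ((e i : ℕ) * s) (P j)) (fun j => (P j).natDegree) fun i j => by
    rw [Matrix.of_apply]
    exact (natDegree_C_mul_le _ _).trans (natDegree_taylor _ _).le
  rw [h0, coeff_zero] at h1
  refine det_mul_pow_ne_zero e (fun j => (P j).leadingCoeff) x
    (fun j => leadingCoeff_ne_zero.mpr (hP j)) hx ?_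
  rw [h1]
  congr 1
  ext i j
  rw [Matrix.of_apply, Matrix.of_apply, Matrix.of_apply, coeff_C_mul, coeff_taylor_natDegree,
    mul_comm]

open Polynomial in
theorem det_map_taylor_ne_zero {ι : Type*} [Fintype ι] [DecidableEq ι] {L : ℕ} (e : ι ≃ Fin L)
    (P : ι → ℝ[X][X]) (hP : ∀ j, P j ≠ 0) (x : ι → ℝ) (hx : Function.Injective x) (s : ℝ) :
    (Matrix.of fun i j : ι =>
      C (C (x j ^ (e i : ℕ))) * (P j).map (taylorAlgHom ((e i : ℕ) * s)).toRingHom).det ≠ 0 := by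
  intro h0
  have h1 := coeff_det_of_natDegree_le (Matrix.of fun i j : ι =>
      C (C (x j ^ (e i : ℕ))) * (P j).map (taylorAlgHom ((e i : ℕ) * s)).toRingHom)
      (fun j => (P j).natDegree) fun i j => by
    rw [Matrix.of_apply]
    exact (natDegree_C_mul_le _ _).trans (natDegree_map_le)
  rw [h0, coeff_zero] at h1
  refine det_taylor_ne_zero e (fun j => (P j).leadingCoeff)
    (fun j => leadingCoeff_ne_zero.mpr (hP j)) x hx s ?_
  rw [h1]
  refine congrArg Matrix.det (Matrix.ext fun i j => ?_)
  rw [Matrix.of_apply, Matrix.of_apply, Matrix.of_apply, coeff_C_mul, coeff_map]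
  rfl

open Polynomial in
theorem natDegree_coeff_mul_le {R : Type*} [CommRing R] {p q : R[X][X]} {a b : ℕ}
    (hp : ∀ i, (p.coeff i).natDegree ≤ a) (hq : ∀ i, (q.coeff i).natDegree ≤ b) (i : ℕ) :
    ((p * q).coeff i).natDegree ≤ a + b := by
  rw [coeff_mul]
  exact natDegree_sum_le_of_forall_le _ _ fun x _ =>
    natDegree_mul_le.trans (add_le_add (hp _) (hq _))

open Polynomial in
theorem natDegree_coeff_det_le {R ι : Type*} [CommRing R] [Fintype ι] [DecidableEq ι] (D : ℕ)
    (M : Matrix ι ι R[X][X]) (h : ∀ i j n, ((M i j).coeff n).natDegree ≤ D) (n : ℕ) :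
    (M.det.coeff n).natDegree ≤ Fintype.card ι * D := by
  have hprod : ∀ (s : Finset ι) (f : ι → R[X][X]), (∀ i n, ((f i).coeff n).natDegree ≤ D) →
      ∀ n, ((∏ i ∈ s, f i).coeff n).natDegree ≤ s.card * D := by
    classical
    intro s f hf
    induction s using Finset.induction_on with
    | empty =>
      intro n
      rw [Finset.prod_empty, coeff_one]
      split_ifs <;> simp
    | insert a s ha ih =>
      intro n
      rw [Finset.prod_insert ha, Finset.card_insert_of_notMem ha]
      exact (natDegree_coeff_mul_le (hf a) ih n).trans (by nlinarith)
  rw [Matrix.det_apply, finsetSum_coeff]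
  refine natDegree_sum_le_of_forall_le _ _ fun σ _ => ?_
  rw [coeff_smul]
  exact (natDegree_smul_le _ _).trans (hprod _ (fun i => M (σ i) i) (fun i => h _ _) n)

open Polynomial in
theorem evalEval_map_taylor (v u t : ℝ) (P : ℝ[X][X]) :
    (P.map (taylorAlgHom t).toRingHom).evalEval v u = P.evalEval (v + t) u := by
  rw [evalEval, evalEval]
  induction P using Polynomial.induction_on' with
  | add p q hp hq =>
    simp only [Polynomial.map_add, eval_add, hp, hq]
  | monomial n a =>
    simp only [map_monomial, eval_monomial, eval_mul, eval_pow, eval_C]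
    congr 1
    exact taylor_eval t a v

open Polynomial in
/-- Elimination of the exponential variable from a polynomial in `u, v, y`. -/
theorem exists_bivariate_of_vanishing {L K : ℕ} (P : Fin L → ℝ[X][X]) (hP : P ≠ 0)
    (hd : ∀ q, (P q).natDegree ≤ K) (hc : ∀ q n, ((P q).coeff n).natDegree ≤ K)
    {c : ℝ} (hc0 : 0 < c) (hc1 : c ≠ 1) (s : ℝ) :
    ∃ Q : ℝ[X][X], Q ≠ 0 ∧ Q.natDegree ≤ L * K ∧ (∀ n, (Q.coeff n).natDegree ≤ L * K) ∧
      ∀ v u y : ℝ, y ≠ 0 →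
        (∀ i < L, ∑ q, (P q).evalEval (v + i * s) u * (y * c ^ i) ^ (q : ℕ) = 0) →
        Q.evalEval v u = 0 := by
  classical
  set ι := {q : Fin L // P q ≠ 0}
  set L' := Fintype.card ι with hL'
  have hL'L : L' ≤ L := (Fintype.card_subtype_le _).trans (Fintype.card_fin L).le
  set e : ι ≃ Fin L' := Fintype.equivFin ι
  set x : ι → ℝ := fun j => c ^ ((j : Fin L) : ℕ) with hx
  have hxi : Function.Injective x := fun i j h =>
    Subtype.ext (Fin.ext (pow_right_injective₀ hc0 hc1 h))
  set M : Matrix ι ι ℝ[X][X] := Matrix.of fun i j : ι =>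
      C (C (x j ^ (e i : ℕ))) * (P j).map (taylorAlgHom ((e i : ℕ) * s)).toRingHom with hM
  refine ⟨M.det, det_map_taylor_ne_zero e (fun j => P j) (fun j => j.2) x hxi s, ?_, ?_, ?_⟩
  · refine (natDegree_det_le_mul K M fun i j => ?_).trans (Nat.mul_le_mul_right _ hL'L)
    exact (natDegree_C_mul_le _ _).trans (natDegree_map_le.trans (hd _))
  · intro n
    refine (natDegree_coeff_det_le K M (fun i j m => ?_) n).trans (Nat.mul_le_mul_right _ hL'L)
    rw [hM, Matrix.of_apply, coeff_C_mul, coeff_map]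
    refine (natDegree_C_mul_le _ _).trans ?_
    exact (natDegree_taylor ((P j).coeff m) _).le.trans (hc _ _)
  · intro v u y hy h
    obtain ⟨q₀, hq₀⟩ := Function.ne_iff.mp hP
    have hdet : (evalEvalRingHom v u) M.det = ((evalEvalRingHom v u).mapMatrix M).det :=
      RingHom.map_det _ _
    rw [coe_evalEvalRingHom] at hdet
    rw [hdet]
    refine Matrix.exists_mulVec_eq_zero_iff.mp ⟨fun j => y ^ ((j : Fin L) : ℕ), ?_, ?_⟩
    · exact Function.ne_iff.mpr ⟨⟨q₀, hq₀⟩, pow_ne_zero _ hy⟩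
    · ext i
      rw [Matrix.mulVec, dotProduct, Pi.zero_apply, ← h (e i) ((e i).2.trans_le hL'L)]
      rw [← Finset.sum_subset (Finset.subset_univ (Finset.univ.filter fun q => P q ≠ 0)),
        ← Finset.sum_subtype_of_mem (p := fun q => P q ≠ 0)
          (f := fun q => evalEval (v + (e i : ℕ) * s) u (P q) * (y * c ^ (e i : ℕ)) ^ (q : ℕ))]
      · have : (Finset.univ.filter fun q => P q ≠ 0).subtype (fun q => P q ≠ 0) =
          (Finset.univ : Finset ι) := by
          ext j; simpa using j.2
        rw [this]
        refine Finset.sum_congr rfl fun j _ => ?_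
        rw [RingHom.mapMatrix_apply, Matrix.map_apply, hM, Matrix.of_apply, coe_evalEvalRingHom,
          evalEval_mul, evalEval_map_taylor, evalEval_C, eval_C, hx]
        ring
      · intro q hq
        simpa using hq
      · intro q _ hq
        have : P q = 0 := by simpa using hq
        rw [this, evalEval_zero, zero_mul]

open Polynomial in
/-- Elimination of the exponential variable from a polynomial in `v, y`. -/
theorem exists_univariate_of_vanishing {L K : ℕ} (P : Fin L → ℝ[X]) (hP : P ≠ 0)
    (hc : ∀ q, (P q).natDegree ≤ K) {c : ℝ} (hc0 : 0 < c) (hc1 : c ≠ 1) (s : ℝ) :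
    ∃ Q : ℝ[X], Q ≠ 0 ∧ Q.natDegree ≤ L * K ∧
      ∀ v y : ℝ, y ≠ 0 →
        (∀ i < L, ∑ q, (P q).eval (v + i * s) * (y * c ^ i) ^ (q : ℕ) = 0) → Q.eval v = 0 := by
  obtain ⟨q₀, hq₀⟩ := Function.ne_iff.mp hP
  obtain ⟨Q, hQ, -, hQc, h⟩ := exists_bivariate_of_vanishing (K := K) (fun q => C (P q))
    (fun h0 => hq₀ (by simpa using congrFun h0 q₀)) (fun q => by simp) (fun q n => by
      rw [coeff_C]
      split_ifs
      · exact hc q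
      · simp) hc0 hc1 s
  obtain ⟨n, hn⟩ : ∃ n, Q.coeff n ≠ 0 := by
    by_contra! h0
    exact hQ (ext h0)
  refine ⟨Q.coeff n, hn, hQc n, fun v y hy hv => ?_⟩
  have h1 : ∀ u, (Q.map (evalRingHom v)).eval u = 0 := fun u => by
    have := h v u y hy (fun i hi => by simpa only [evalEval_C] using hv i hi)
    rw [← this, ← eval₂_eq_eval_map, eval₂_evalRingHom]
  have h2 : Q.map (evalRingHom v) = 0 := Polynomial.funext fun u => by rw [h1, eval_zero]
  have := congrArg (fun p => coeff p n) h2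
  simpa using this

open Polynomial in
theorem eq_C_of_eval_add_eq {p : ℝ[X]} {t : ℝ} (ht : t ≠ 0) (h : taylor t p = p) :
    p = C (p.coeff 0) := by
  have hz : ∀ n : ℕ, p.eval (n * t) = p.coeff 0 := by
    intro n
    induction n with
    | zero => simp [coeff_zero_eq_eval_zero]
    | succ n ih =>
      rw [← ih]
      nth_rewrite 2 [← h]
      rw [taylor_eval]
      push_cast
      ring_nf
  refine Polynomial.eq_of_infinite_eval_eq _ _ ((Set.infinite_range_of_injective
    (f := fun n : ℕ => (n : ℝ) * t) fun a b hab => ?_).mono ?_)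
  · exact_mod_cast mul_right_cancel₀ ht hab
  · rintro _ ⟨n, rfl⟩
    simp [hz n]

open Polynomial in
/-- Translation by `(h.1, h.2)` on bivariate polynomials; `h.1` acts on the inner variable. -/
noncomputable def shift (h : ℝ × ℝ) : ℝ[X][X] →+* ℝ[X][X] :=
  (taylorAlgHom (C h.2)).toRingHom.comp (mapRingHom (taylorAlgHom h.1).toRingHom)

open Polynomial in
theorem shift_apply (h : ℝ × ℝ) (P : ℝ[X][X]) :
    shift h P = taylor (C h.2) (P.map (taylorAlgHom h.1).toRingHom) := rfl

open Polynomial in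
theorem evalEval_shift (h : ℝ × ℝ) (P : ℝ[X][X]) (v u : ℝ) :
    (shift h P).evalEval v u = P.evalEval (v + h.1) (u + h.2) := by
  rw [← evalEval_map_taylor, shift_apply, evalEval, evalEval, taylor_eval, C_add]

open Polynomial in
theorem eq_of_evalEval_eq {P Q : ℝ[X][X]} (h : ∀ v u, P.evalEval v u = Q.evalEval v u) :
    P = Q :=
  Polynomial.funext fun r => Polynomial.funext fun v => by
    have := h v (r.eval v)
    have key : ∀ p : ℝ[X][X], (p.eval r).eval v = p.evalEval v (r.eval v) := fun p => by
      rw [← eval₂_evalRingHom]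
      have h2 := Polynomial.hom_eval₂ p (RingHom.id _) (evalRingHom v) r
      simpa only [RingHom.comp_id, coe_evalRingHom, eval₂_id] using h2
    rw [key, key, this]

open Polynomial in
theorem shift_shift (g h : ℝ × ℝ) (P : ℝ[X][X]) : shift g (shift h P) = shift (g + h) P :=
  eq_of_evalEval_eq fun v u => by
    rw [evalEval_shift, evalEval_shift, evalEval_shift, Prod.fst_add, Prod.snd_add, add_assoc,
      add_assoc]

open Polynomial in
theorem shift_zero (P : ℝ[X][X]) : shift 0 P = P :=
  eq_of_evalEval_eq fun v u => by
    rw [evalEval_shift, Prod.fst_zero, Prod.snd_zero, add_zero, add_zero]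

open Polynomial in
theorem natDegree_shift (h : ℝ × ℝ) (P : ℝ[X][X]) : (shift h P).natDegree = P.natDegree := by
  rw [shift_apply, natDegree_taylor]
  exact natDegree_map_eq_of_injective (taylor_injective h.1) P

open Polynomial in
theorem natDegree_coeff_taylor_C_le {P : ℝ[X][X]} {D : ℕ} (hD : ∀ i, (P.coeff i).natDegree ≤ D)
    (u : ℝ) (i : ℕ) : ((taylor (C u) P).coeff i).natDegree ≤ D := by
  rw [taylor_coeff, eval_eq_sum, sum]
  refine natDegree_sum_le_of_forall_le _ _ fun n _ => ?_
  rw [hasseDeriv_coeff, ← C_pow, ← C_eq_natCast]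
  exact (natDegree_mul_C_le _ _).trans ((natDegree_C_mul_le _ _).trans (hD _))

open Polynomial in
theorem natDegree_coeff_shift_le {P : ℝ[X][X]} {D : ℕ} (hD : ∀ i, (P.coeff i).natDegree ≤ D)
    (h : ℝ × ℝ) (i : ℕ) : ((shift h P).coeff i).natDegree ≤ D := by
  rw [shift_apply]
  refine natDegree_coeff_taylor_C_le (fun n => ?_) _ _
  rw [coeff_map]
  exact (natDegree_taylor (P.coeff n) _).le.trans (hD n)

open Polynomial in
theorem leadingCoeff_shift (h : ℝ × ℝ) (P : ℝ[X][X]) :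
    (shift h P).leadingCoeff = taylor h.1 P.leadingCoeff := by
  rw [shift_apply, leadingCoeff_taylor]
  exact leadingCoeff_map_of_injective (taylor_injective h.1) P

open Polynomial in
theorem coeff_natDegree_sub_one_taylor {R : Type*} [CommRing R] (f : R[X]) (r : R) {n : ℕ}
    (hn : f.natDegree = n + 1) :
    (taylor r f).coeff n = f.coeff n + (n + 1) * r * f.coeff (n + 1) := by
  have h1 : ((hasseDeriv n f)).natDegree < 2 := by
    have := natDegree_hasseDeriv_le f n
    omega
  rw [taylor_coeff, eval_eq_sum_range' h1, Finset.sum_range_succ, Finset.sum_range_one,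
    hasseDeriv_coeff, hasseDeriv_coeff]
  simp [add_comm 1 n, Nat.choose_succ_self_right]
  ring

open Polynomial in
theorem shift_eq_of_associated {P : ℝ[X][X]} (hP : P ≠ 0) {h : ℝ × ℝ}
    (ha : Associated (shift h P) P) : shift h P = P := by
  obtain ⟨w, hw⟩ := ha
  obtain ⟨r, hr, hrw⟩ := Polynomial.isUnit_iff.mp w.isUnit
  obtain ⟨s, hs, rfl⟩ := Polynomial.isUnit_iff.mp hr
  rw [← hrw] at hw
  have h1 := congrArg (fun p => p.leadingCoeff.leadingCoeff) hw
  simp only [leadingCoeff_mul, leadingCoeff_shift, leadingCoeff_taylor, leadingCoeff_C] at h1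
  have h2 : P.leadingCoeff.leadingCoeff ≠ 0 := by simpa using hP
  have h3 : s = 1 := by
    apply mul_left_cancel₀ h2
    rw [h1, mul_one]
  rw [h3] at hw
  simpa using hw

open Polynomial in
/-- The periods (up to associates) of a nonconstant bivariate polynomial lie on a line. -/
theorem exists_functional_of_irreducible {P : ℝ[X][X]} (hP : Irreducible P) :
    ∃ a : ℝ × ℝ, a ≠ 0 ∧ ∀ h : ℝ × ℝ, Associated (shift h P) P → a.1 * h.1 + a.2 * h.2 = 0 := by
  have hlc : ∀ h : ℝ × ℝ, shift h P = P → h.1 ≠ 0 → P.leadingCoeff = C (P.leadingCoeff.coeff 0) :=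
    fun h hh h1 => eq_C_of_eval_add_eq h1 (by rw [← leadingCoeff_shift, hh])
  rcases hn : P.natDegree with _ | n
  · refine ⟨(1, 0), by simp, fun h ha => ?_⟩
    have hh := shift_eq_of_associated hP.ne_zero ha
    by_contra h1
    have h2 := hlc h hh (by simpa using h1)
    have h3 : P = C (P.coeff 0) := eq_C_of_natDegree_eq_zero hn
    rw [leadingCoeff, hn] at h2
    apply hP.not_isUnit
    rw [h3, h2]
    refine Polynomial.isUnit_C.mpr (Polynomial.isUnit_C.mpr (IsUnit.mk0 _ ?_))
    intro h0
    rw [h0, C_0] at h2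
    rw [h2, C_0] at h3
    exact hP.ne_zero h3
  · have hl0 : P.leadingCoeff.leadingCoeff ≠ 0 := by simpa using hP.ne_zero
    refine ⟨((P.coeff n).coeff 1, (n + 1) * P.leadingCoeff.leadingCoeff), fun h0 => ?_,
      fun h ha => ?_⟩
    · have := congrArg Prod.snd h0
      simp only [Prod.snd_zero, mul_eq_zero] at this
      exact this.elim (by positivity) hl0
    have hh := shift_eq_of_associated hP.ne_zero ha
    have hc : (shift h P).coeff n = taylor h.1 (P.coeff n) +
        (n + 1) * C h.2 * taylor h.1 P.leadingCoeff := by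
      have hd : (P.map (taylorAlgHom h.1).toRingHom).natDegree = n + 1 := by
        rw [← hn]
        exact natDegree_map_eq_of_injective (taylor_injective h.1) P
      rw [shift_apply, coeff_natDegree_sub_one_taylor _ _ hd, coeff_map, coeff_map, leadingCoeff,
        hn]
      rfl
    rw [hh] at hc
    by_cases h1 : h.1 = 0
    · rw [h1, taylor_zero, taylor_zero] at hc
      have h2 : ((n : ℝ[X]) + 1) * C h.2 * P.leadingCoeff = 0 := by linear_combination -hc
      have h3 : h.2 = 0 := by
        rcases mul_eq_zero.mp h2 with h2 | h2
        · rcases mul_eq_zero.mp h2 with h2 | h2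
          · exact absurd h2 (by exact_mod_cast Nat.succ_ne_zero n)
          · simpa using h2
        · exact absurd h2 (by simpa using hP.ne_zero)
      rw [h1, h3]
      ring
    · have h2 := hlc h hh h1
      set l := P.leadingCoeff.coeff 0 with hl
      have hll : P.leadingCoeff.leadingCoeff = l := by rw [h2, leadingCoeff_C]
      rw [h2, taylor_C] at hc
      set s : ℝ := -(n + 1) * h.2 * l / h.1 with hs
      have hs1 : s * h.1 = -(n + 1) * h.2 * l := by rw [hs]; field_simp
      have h4 : taylor h.1 (P.coeff n - C s * X) = P.coeff n - C s * X := by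
        rw [map_sub, taylor_mul, taylor_C, taylor_X]
        have hs2 : C s * C h.1 = -((n : ℝ[X]) + 1) * C h.2 * C l := by
          rw [← C_mul, hs1]
          simp
        linear_combination (-1 : ℝ[X]) * hc - hs2
      have h5 := eq_C_of_eval_add_eq h1 h4
      have h6 := congrArg (fun p => coeff p 1) h5
      simp only [coeff_sub, coeff_C_mul, coeff_X_one, mul_one, coeff_C_succ] at h6
      rw [hll]
      simp only
      rw [sub_eq_zero.mp h6, hs1]
      ring

open Polynomial in
noncomputable def shiftEquiv (h : ℝ × ℝ) : ℝ[X][X] ≃+* ℝ[X][X] :=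
  RingEquiv.ofRingHom (shift h) (shift (-h))
    (RingHom.ext fun P => by simp [shift_shift, shift_zero])
    (RingHom.ext fun P => by simp [shift_shift, shift_zero])

open Polynomial in
theorem irreducible_shift {P : ℝ[X][X]} (hP : Irreducible P) (h : ℝ × ℝ) :
    Irreducible (shift h P) :=
  (MulEquiv.irreducible_iff (shiftEquiv h)).mpr hP

open Polynomial in
/-- A linear combination of translates. -/
noncomputable def combShift (A : Finset (ℝ × ℝ)) (Q : ℝ[X][X]) (t : ℝ × ℝ → ℝ) : ℝ[X][X] :=
  ∑ g ∈ A, C (C (t g)) * shift g Q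

open Polynomial in
theorem exists_irreducible_dvd_shift {Q : ℝ[X][X]} (hQ : Q ≠ 0) {D : ℕ} (hd : Q.natDegree ≤ D)
    (hc : ∀ n, (Q.coeff n).natDegree ≤ D) {A B : Finset (ℝ × ℝ)} (h0 : 0 ∈ A)
    (hB : Set.InjOn Prod.fst (B : Set (ℝ × ℝ))) (hcard : 2 * D ^ 2 < B.card)
    (hv : ∀ g ∈ A, ∀ x ∈ B, Q.evalEval (x.1 + g.1) (x.2 + g.2) = 0) :
    ∃ P, Irreducible P ∧ ∀ g ∈ A, P ∣ shift g Q := by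
  classical
  by_contra! hcon
  set φ := combShift A Q with hφ
  have hφa : ∀ s t, φ (s + t) = φ s + φ t := fun s t => by
    simp only [hφ, combShift, Pi.add_apply, C_add, add_mul, Finset.sum_add_distrib]
  have hφs : ∀ (r : ℝ) t, φ (r • t) = C (C r) * φ t := fun r t => by
    simp only [hφ, combShift, Pi.smul_apply, smul_eq_mul, C_mul, Finset.mul_sum, mul_assoc]
  have hφ0 : φ 0 = 0 := by simp [hφ, combShift]
  set p : ℝ[X][X] → Subspace ℝ (ℝ × ℝ → ℝ) := fun P =>
    { carrier := {t | P ∣ φ t}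
      add_mem' := fun {s t} hs ht => by
        simp only [Set.mem_ofPred_eq, hφa] at *
        exact dvd_add hs ht
      zero_mem' := by simp [hφ0]
      smul_mem' := fun r t ht => by
        simp only [Set.mem_ofPred_eq, hφs] at *
        exact dvd_mul_of_dvd_right ht _ } with hp
  have hcov := Subspace.biUnion_ne_univ_of_top_notMem
    (s := (UniqueFactorizationMonoid.factors Q).toFinset.image p) (by
      intro hmem
      obtain ⟨P, hP, htop⟩ := Finset.mem_image.mp hmem
      have hPi := UniqueFactorizationMonoid.irreducible_of_factor P (Multiset.mem_toFinset.mp hP)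
      obtain ⟨g, hg, hgd⟩ := hcon P hPi
      have h1 : Pi.single g (1 : ℝ) ∈ p P := by rw [htop]; trivial
      have h2 : P ∣ φ (Pi.single g (1 : ℝ)) := h1
      apply hgd
      convert h2
      rw [hφ, combShift, Finset.sum_eq_single_of_mem g hg]
      · simp
      · intro b _ hb
        simp [Pi.single_eq_of_ne hb])
  obtain ⟨t, ht⟩ := (Set.ne_univ_iff_exists_notMem _).mp hcov
  have ht' : ∀ P ∈ UniqueFactorizationMonoid.factors Q, ¬ P ∣ φ t := by
    intro P hP hdvd
    apply ht
    simp only [Set.mem_iUnion]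
    exact ⟨p P, Finset.mem_image_of_mem _ (Multiset.mem_toFinset.mpr hP), hdvd⟩
  have hrel : IsRelPrime Q (φ t) := by
    refine WfDvdMonoid.isRelPrime_of_no_irreducible_factors (fun h => hQ h.1) fun z hz hzQ hzt => ?_
    obtain ⟨P, hP, hass⟩ := UniqueFactorizationMonoid.exists_mem_factors_of_dvd hQ hz hzQ
    exact ht' P hP (hass.symm.dvd.trans hzt)
  have hφd : (φ t).natDegree ≤ D := natDegree_sum_le_of_forall_le _ _ fun g _ =>
      (natDegree_C_mul_le _ _).trans ((natDegree_shift _ _).le.trans hd)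
  have hφc : ∀ i, ((φ t).coeff i).natDegree ≤ D := fun i => by
    rw [hφ, combShift, finsetSum_coeff]
    refine natDegree_sum_le_of_forall_le _ _ fun g _ => ?_
    rw [coeff_C_mul]
    exact (natDegree_C_mul_le _ _).trans (natDegree_coeff_shift_le hc _ _)
  have hφv : ∀ x ∈ B, (φ t).evalEval x.1 x.2 = 0 := fun x hx => by
    rw [hφ, combShift, ← coe_evalEvalRingHom, map_sum]
    refine Finset.sum_eq_zero fun g hg => ?_
    rw [map_mul, coe_evalEvalRingHom, evalEval_shift, hv g hg x hx, mul_zero]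
  have := card_le_of_isRelPrime hQ hrel hd hφd hc hφc B hB
    (fun x hx => by
      have := hv 0 h0 x hx
      rwa [Prod.fst_zero, Prod.snd_zero, add_zero, add_zero] at this) hφv
  omega

open Polynomial in
theorem exists_functional_card_le {Q : ℝ[X][X]} (hQ : Q ≠ 0) {D : ℕ} (hd : Q.natDegree ≤ D)
    (hc : ∀ n, (Q.coeff n).natDegree ≤ D) {A B : Finset (ℝ × ℝ)} (h0 : 0 ∈ A)
    (hB : Set.InjOn Prod.fst (B : Set (ℝ × ℝ))) (hcard : 2 * D ^ 2 < B.card)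
    (hv : ∀ g ∈ A, ∀ x ∈ B, Q.evalEval (x.1 + g.1) (x.2 + g.2) = 0) :
    ∃ a : ℝ × ℝ, a ≠ 0 ∧ (A.image fun g => a.1 * g.1 + a.2 * g.2).card ≤ D := by
  classical
  obtain ⟨P, hP, hdvd⟩ := exists_irreducible_dvd_shift hQ hd hc h0 hB hcard hv
  obtain ⟨a, ha, hper⟩ := exists_functional_of_irreducible hP
  refine ⟨a, ha, ?_⟩
  set T := A.image fun g => a.1 * g.1 + a.2 * g.2 with hT
  have hex : ∀ t : T, ∃ g ∈ A, a.1 * g.1 + a.2 * g.2 = t := fun t => Finset.mem_image.mp t.2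
  choose σ hσA hσ using hex
  have hprod : ∏ t : T, shift (-σ t) P ∣ Q := by
    refine Finset.prod_dvd_of_isRelPrime (fun t _ s _ hts => ?_) fun t _ => ?_
    · rw [Function.onFun, (irreducible_shift hP _).isRelPrime_iff_not_dvd,
        (irreducible_shift hP _).dvd_irreducible_iff_associated (irreducible_shift hP _)]
      intro hass
      have h1 := hass.map (shift (σ s))
      rw [shift_shift, shift_shift, add_neg_cancel, shift_zero] at h1
      have h2 := hper _ h1
      apply hts
      apply Subtype.ext
      rw [← hσ, ← hσ]
      simp only [Prod.fst_add, Prod.snd_add, Prod.fst_neg, Prod.snd_neg] at h2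
      linarith
    · have h1 := map_dvd (shift (-σ t)) (hdvd (σ t) (hσA t))
      rwa [shift_shift, neg_add_cancel, shift_zero] at h1
  rw [← Fintype.card_coe]
  rcases hn : P.natDegree with _ | n
  · obtain ⟨p, rfl⟩ : ∃ p, P = C p := ⟨_, eq_C_of_natDegree_eq_zero hn⟩
    obtain ⟨i, hi⟩ : ∃ n, Q.coeff n ≠ 0 := by
      by_contra! hz
      exact hQ (ext hz)
    have h1 : ∀ t : T, shift (-σ t) (C p) = C (taylor (-σ t).1 p) := fun t => by
      rw [shift_apply, map_C, taylor_C]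
      rfl
    simp only [h1] at hprod
    rw [← map_prod] at hprod
    have h2 := natDegree_le_of_dvd ((C_dvd_iff_dvd_coeff _ _).mp hprod i) hi
    have hp0 : p ≠ 0 := by
      rintro rfl
      exact hP.ne_zero C_0
    rw [natDegree_prod _ _ fun t _ => by simpa [taylor_eq_zero] using hp0] at h2
    simp only [natDegree_taylor, Finset.sum_const, Finset.card_univ, smul_eq_mul] at h2
    have hp1 : 1 ≤ p.natDegree := by
      by_contra hlt
      have h3 := eq_C_of_natDegree_eq_zero (p := p) (by omega)
      apply hP.not_isUnit
      rw [h3]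
      refine Polynomial.isUnit_C.mpr (Polynomial.isUnit_C.mpr (IsUnit.mk0 _ fun h4 => ?_))
      rw [h4, C_0] at h3
      exact hp0 h3
    exact (Nat.le_mul_of_pos_right _ hp1).trans (h2.trans (hc i))
  · have h2 := natDegree_le_of_dvd hprod hQ
    rw [natDegree_prod _ _ fun t _ => (irreducible_shift hP _).ne_zero] at h2
    simp only [natDegree_shift, Finset.sum_const, Finset.card_univ, smul_eq_mul, hn] at h2
    exact (Nat.le_mul_of_pos_right _ n.succ_pos).trans (h2.trans hd)

/-- The image of `{0, …, n-1}²` under `r ↦ d r₁ - c r₂` in `ZMod e` has at least `min n e`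
elements when `c` and `d` are coprime. -/
theorem le_card_image_zmod {c d : ℤ} (hcd : IsCoprime c d) {e n : ℕ} [NeZero e] (hn : n ≤ e) :
    n ≤ ((Finset.range n ×ˢ Finset.range n).image
      fun r => ((d * r.1 - c * r.2 : ℤ) : ZMod e)).card := by
  classical
  set S : ℕ → Finset (ZMod e) := fun n => (Finset.range n ×ˢ Finset.range n).image
      fun r => ((d * r.1 - c * r.2 : ℤ) : ZMod e) with hS
  change n ≤ (S n).card
  induction n with
  | zero => simp
  | succ n ih =>
    have hmono : S n ⊆ S (n + 1) := Finset.image_subset_image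
      (Finset.product_subset_product (Finset.range_mono n.le_succ) (Finset.range_mono n.le_succ))
    have ih' := ih (by omega)
    rcases (Finset.card_le_card hmono).lt_or_eq with h | h
    · omega
    · have heq : S n = S (n + 1) := Finset.eq_of_subset_of_card_le hmono h.ge
      rcases Nat.eq_zero_or_pos n with rfl | hpos
      · have : (S 1).Nonempty := ⟨_, Finset.mem_image_of_mem _
          (show ((0 : ℕ), (0 : ℕ)) ∈ _ by simp)⟩
        exact Finset.card_pos.mpr this
      have h1 : ∀ x ∈ S n, x + (d : ZMod e) ∈ S n := by
        intro x hx
        obtain ⟨r, hr, rfl⟩ := Finset.mem_image.mp hx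
        rw [heq]
        simp only [Finset.mem_product, Finset.mem_range] at hr
        refine Finset.mem_image.mpr ⟨(r.1 + 1, r.2), by simp; omega, ?_⟩
        push_cast
        ring
      have h2 : ∀ x ∈ S n, x - (c : ZMod e) ∈ S n := by
        intro x hx
        obtain ⟨r, hr, rfl⟩ := Finset.mem_image.mp hx
        rw [heq]
        simp only [Finset.mem_product, Finset.mem_range] at hr
        refine Finset.mem_image.mpr ⟨(r.1, r.2 + 1), by simp; omega, ?_⟩
        push_cast
        ring
      have h0 : (0 : ZMod e) ∈ S n :=
        Finset.mem_image.mpr ⟨(0, 0), by simpa using hpos, by simp⟩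
      have h1' : ∀ (k : ℕ), ∀ x ∈ S n, x + k * (d : ZMod e) ∈ S n := by
        intro k x hx
        induction k with
        | zero => simpa using hx
        | succ k ihk =>
          have := h1 _ ihk
          rw [add_assoc] at this
          convert this using 2
          push_cast; ring
      have h2' : ∀ (k : ℕ), ∀ x ∈ S n, x - k * (c : ZMod e) ∈ S n := by
        intro k x hx
        induction k with
        | zero => simpa using hx
        | succ k ihk =>
          have := h2 _ ihk
          rw [sub_sub] at this
          convert this using 2
          push_cast; ring
      obtain ⟨u, v, huv⟩ := hcd
      have huniv : S n = Finset.univ := by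
        refine Finset.eq_univ_iff_forall.mpr fun x => ?_
        have h3 := h2' ((-(u : ZMod e) * x).val) _ (h1' (((v : ZMod e) * x).val) 0 h0)
        rw [ZMod.natCast_zmod_val, ZMod.natCast_zmod_val] at h3
        convert h3 using 1
        have : ((u * c + v * d : ℤ) : ZMod e) = 1 := by rw [huv]; simp
        push_cast at this
        linear_combination -x * this
      rw [← heq, huniv, Finset.card_univ, ZMod.card]
      exact hn

theorem card_le_of_subBox {c d e : ℤ} {A₁ A₂ A₃ D : ℕ}
    (h : ((Finset.range A₁ ×ˢ Finset.range A₂ ×ˢ Finset.range A₃).image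
      fun r => d * (r.1 : ℤ) - c * r.2.1 + e * r.2.2).card ≤ D)
    (S : Finset (ℕ × ℕ × ℕ)) (hS : S ⊆ Finset.range A₁ ×ˢ Finset.range A₂ ×ˢ Finset.range A₃)
    (hi : Set.InjOn (fun r : ℕ × ℕ × ℕ => d * (r.1 : ℤ) - c * r.2.1 + e * r.2.2) S) :
    S.card ≤ D := by
  classical
  rw [← Finset.card_image_of_injOn hi]
  exact (Finset.card_le_card (Finset.image_subset_image hS)).trans h

theorem natAbs_mul_le_of_card_le {c d e : ℤ} (hcd : IsCoprime c d) {A₁ A₂ A₃ D : ℕ}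
    (h12 : D < A₁ * A₂) (h3 : D < A₃ * min A₁ A₂) (hA₃ : 0 < A₃)
    (h : ((Finset.range A₁ ×ˢ Finset.range A₂ ×ˢ Finset.range A₃).image
      fun r => d * (r.1 : ℤ) - c * r.2.1 + e * r.2.2).card ≤ D) :
    d.natAbs * A₁ ≤ D ∧ c.natAbs * A₂ ≤ D ∧ e.natAbs * A₃ ≤ D := by
  classical
  refine ⟨?_, ?_, ?_⟩
  · have h1 := card_le_of_subBox h
      (Finset.range A₁ ×ˢ Finset.range (min d.natAbs A₂) ×ˢ {0}) (by
        intro r hr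
        simp only [Finset.mem_product, Finset.mem_range, Finset.mem_singleton] at hr ⊢
        omega) (by
        intro r hr s hs hrs
        simp only [Finset.coe_product, Set.mem_prod, Finset.mem_coe, Finset.mem_range,
          Finset.mem_singleton] at hr hs
        simp only [hr.2.2, hs.2.2] at hrs
        have hd : d ≠ 0 := by
          rintro rfl
          simp at hr
        have h4 : d ∣ c * ((r.2.1 : ℤ) - s.2.1) := ⟨r.1 - s.1, by linear_combination -hrs⟩
        have h5 := hcd.symm.dvd_of_dvd_mul_left h4
        have h6 : (r.2.1 : ℤ) - s.2.1 = 0 := by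
          refine Int.eq_zero_of_abs_lt_dvd (Int.natAbs_dvd.mpr h5) ?_
          rw [Int.abs_eq_natAbs]
          omega
        have h7 : (r.1 : ℤ) = s.1 := by
          apply mul_left_cancel₀ hd
          linear_combination hrs + c * h6
        ext <;> omega)
    simp only [Finset.card_product, Finset.card_range, Finset.card_singleton, mul_one] at h1
    rcases le_total d.natAbs A₂ with h2 | h2
    · rw [min_eq_left h2] at h1
      linarith [mul_comm A₁ d.natAbs]
    · rw [min_eq_right h2] at h1
      omega
  · have h1 := card_le_of_subBox h
      (Finset.range (min c.natAbs A₁) ×ˢ Finset.range A₂ ×ˢ {0}) (by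
        intro r hr
        simp only [Finset.mem_product, Finset.mem_range, Finset.mem_singleton] at hr ⊢
        omega) (by
        intro r hr s hs hrs
        simp only [Finset.coe_product, Set.mem_prod, Finset.mem_coe, Finset.mem_range,
          Finset.mem_singleton] at hr hs
        simp only [hr.2.2, hs.2.2] at hrs
        have hd : c ≠ 0 := by
          rintro rfl
          simp at hr
        have h4 : c ∣ d * ((r.1 : ℤ) - s.1) := ⟨r.2.1 - s.2.1, by linear_combination hrs⟩
        have h5 := hcd.dvd_of_dvd_mul_left h4
        have h6 : (r.1 : ℤ) - s.1 = 0 := by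
          refine Int.eq_zero_of_abs_lt_dvd (Int.natAbs_dvd.mpr h5) ?_
          rw [Int.abs_eq_natAbs]
          omega
        have h7 : (r.2.1 : ℤ) = s.2.1 := by
          apply mul_left_cancel₀ hd
          linear_combination -hrs + d * h6
        ext <;> omega)
    simp only [Finset.card_product, Finset.card_range, Finset.card_singleton, mul_one] at h1
    rcases le_total c.natAbs A₁ with h2 | h2
    · rwa [min_eq_left h2] at h1
    · rw [min_eq_right h2] at h1
      omega
  · rcases Nat.eq_zero_or_pos e.natAbs with he | he
    · rw [he]; omega
    have : NeZero e.natAbs := ⟨he.ne'⟩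
    set n := min e.natAbs (min A₁ A₂) with hn
    have hcard := le_card_image_zmod hcd (min_le_left e.natAbs (min A₁ A₂))
    rw [← hn] at hcard
    set T := (Finset.range n ×ˢ Finset.range n).image
      fun r => ((d * r.1 - c * r.2 : ℤ) : ZMod e.natAbs) with hT
    have hex : ∀ t : T, ∃ r ∈ Finset.range n ×ˢ Finset.range n,
      ((d * r.1 - c * r.2 : ℤ) : ZMod e.natAbs) = t := fun t => Finset.mem_image.mp t.2
    choose σ hσm hσ using hex
    set F : T × ℕ → ℕ × ℕ × ℕ := fun p => ((σ p.1).1, (σ p.1).2, p.2) with hF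
    have hsub : (Finset.univ ×ˢ Finset.range A₃).image F ⊆
        Finset.range A₁ ×ˢ Finset.range A₂ ×ˢ Finset.range A₃ := by
      intro r hr
      obtain ⟨p, hp, rfl⟩ := Finset.mem_image.mp hr
      have := hσm p.1
      simp only [Finset.mem_product, Finset.mem_range, Finset.mem_univ, true_and] at hp this ⊢
      simp only [hF]
      omega
    have hval : ∀ p q : T × ℕ, d * ((F p).1 : ℤ) - c * (F p).2.1 + e * (F p).2.2 =
        d * ((F q).1 : ℤ) - c * (F q).2.1 + e * (F q).2.2 → p = q := by
      intro p q hpq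
      have he0 : ((e : ℤ) : ZMod e.natAbs) = 0 := by
        rw [ZMod.intCast_zmod_eq_zero_iff_dvd]
        exact Int.natAbs_dvd_self
      have h1 : p.1 = q.1 := by
        apply Subtype.ext
        rw [← hσ, ← hσ]
        have := congrArg (fun z : ℤ => (z : ZMod e.natAbs)) hpq
        simp only [hF] at this
        push_cast [he0] at this ⊢
        linear_combination this
      have h2 : (p.2 : ℤ) = q.2 := by
        simp only [hF, h1] at hpq
        apply mul_left_cancel₀ (Int.natAbs_pos.mp he)
        linarith
      exact Prod.ext h1 (by exact_mod_cast h2)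
    have h1 := card_le_of_subBox h _ hsub (by
      intro r hr s hs hrs
      obtain ⟨p, -, rfl⟩ := Finset.mem_image.mp (Finset.mem_coe.mp hr)
      obtain ⟨q, -, rfl⟩ := Finset.mem_image.mp (Finset.mem_coe.mp hs)
      rw [hval p q hrs])
    rw [Finset.card_image_of_injective _ (fun p q hpq => hval p q (by rw [hpq])),
      Finset.card_product, Finset.card_range, Finset.card_univ, Fintype.card_coe] at h1
    have h2 : n * A₃ ≤ D := (Nat.mul_le_mul_right _ hcard).trans h1
    rcases le_total e.natAbs (min A₁ A₂) with h4 | h4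
    · rwa [hn, min_eq_left h4] at h2
    · rw [hn, min_eq_right h4, mul_comm] at h2
      omega

/-- If a real linear functional takes few values on a box, it is proportional to an integral one
with small coefficients. -/
theorem exists_int_of_card_le {p₁ p₂ : ℝ} (hp : p₁ ≠ 0 ∨ p₂ ≠ 0) {a b : ℤ} {A₁ A₂ A₃ D : ℕ}
    (h12 : D < A₁ * A₂) (h3 : D < A₃ * min A₁ A₂) (hA₃ : 0 < A₃)
    (h : ((Finset.range A₁ ×ˢ Finset.range A₂ ×ˢ Finset.range A₃).image
      fun r => p₁ * ((r.1 : ℝ) + a * r.2.2) + p₂ * (r.2.1 + b * r.2.2)).card ≤ D) :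
    ∃ c d e : ℤ, (c ≠ 0 ∨ d ≠ 0) ∧ e = d * a - c * b ∧
      d.natAbs * A₁ ≤ D ∧ c.natAbs * A₂ ≤ D ∧ e.natAbs * A₃ ≤ D := by
  classical
  obtain ⟨r, hr, s, hs, hne, heq⟩ : ∃ r ∈ Finset.range A₁ ×ˢ Finset.range A₂,
      ∃ s ∈ Finset.range A₁ ×ˢ Finset.range A₂, r ≠ s ∧
      p₁ * (r.1 : ℝ) + p₂ * r.2 = p₁ * s.1 + p₂ * s.2 := by
    refine Finset.exists_ne_map_eq_of_card_lt_of_maps_to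
      (t := (Finset.range A₁ ×ˢ Finset.range A₂ ×ˢ Finset.range A₃).image
      fun r => p₁ * ((r.1 : ℝ) + a * r.2.2) + p₂ * (r.2.1 + b * r.2.2)) ?_ ?_
    · rw [Finset.card_product, Finset.card_range, Finset.card_range]
      omega
    · intro r hr
      simp only [Finset.mem_coe, Finset.mem_product] at hr
      refine Finset.mem_coe.mpr (Finset.mem_image.mpr ⟨(r.1, r.2, 0), ?_, by simp⟩)
      simp only [Finset.mem_product, Finset.mem_range] at hr ⊢
      omega
  set m : ℤ := (r.1 : ℤ) - s.1 with hm
  set n : ℤ := (r.2 : ℤ) - s.2 with hn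
  have hmn : m ≠ 0 ∨ n ≠ 0 := by
    by_contra! hz
    apply hne
    ext <;> omega
  have hpmn : p₁ * m + p₂ * n = 0 := by
    rw [hm, hn]
    push_cast
    linarith
  obtain ⟨g, c, d, hg, hcop, hmc, hnd⟩ := Int.exists_gcd_one'
    (Nat.pos_of_ne_zero fun h0 => by
      rw [Int.gcd_eq_zero_iff] at h0
      omega : 0 < Int.gcd m n)
  have hcd : IsCoprime c d := Int.isCoprime_iff_gcd_eq_one.mpr hcop
  have hpcd : p₁ * c + p₂ * d = 0 := by
    rw [hmc, hnd] at hpmn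
    push_cast at hpmn
    have hg' : (g : ℝ) ≠ 0 := by exact_mod_cast hg.ne'
    apply mul_right_cancel₀ hg'
    linarith
  have hcd0 : c ≠ 0 ∨ d ≠ 0 := by
    by_contra! hz
    rw [hz.1, hz.2] at hcd
    exact not_isCoprime_zero_zero hcd
  obtain ⟨t, ht, h1, h2⟩ : ∃ t : ℝ, t ≠ 0 ∧ p₁ = t * d ∧ p₂ = -t * c := by
    obtain ⟨u, v, huv⟩ := hcd
    have huv' : (u * c + v * d : ℝ) = 1 := by exact_mod_cast huv
    refine ⟨v * p₁ - u * p₂, fun h0 => ?_, by linear_combination (-p₁) * huv' + u * hpcd,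
      by linear_combination (-p₂) * huv' + v * hpcd⟩
    have e1 : p₁ = 0 := by linear_combination (-p₁) * huv' + u * hpcd + d * h0
    have e2 : p₂ = 0 := by linear_combination (-p₂) * huv' + v * hpcd - c * h0
    exact hp.elim (· e1) (· e2)
  refine ⟨c, d, d * a - c * b, hcd0, rfl, natAbs_mul_le_of_card_le hcd h12 h3 hA₃ ?_⟩
  refine le_trans (le_of_eq ?_) h
  rw [← Finset.card_image_of_injective (Finset.image _ _)
    (f := fun z : ℤ => t * (z : ℝ)) (fun x y hxy => by
      have := mul_left_cancel₀ ht hxy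
      exact_mod_cast this), Finset.image_image]
  refine congrArg Finset.card (Finset.image_congr fun r _ => ?_)
  simp only [Function.comp]
  push_cast
  rw [h1, h2]
  ring

/-- `δ` is the value at `(α, √2)` of a quotient of integral polynomials whose conjugates are
bounded by `M`. -/
structure IsFrac (k : ℕ) (α δ M : ℝ) (num den : MvPolynomial (Fin 2) ℤ) : Prop where
  one_le : 1 ≤ M
  den_ne : biEval α (√2 : ℝ) den ≠ 0
  mul_eq : (δ : ℂ) * biEval α (√2 : ℝ) den = biEval α (√2 : ℝ) num
  den_le : ‖biEval α (√2 : ℝ) den‖ ≤ M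
  num_conj : ‖biEval α (-(√2 : ℝ)) num‖ ≤ M
  den_conj : ‖biEval α (-(√2 : ℝ)) den‖ ≤ M
  num_le : ∀ z w : ℂ, ‖z‖ ≤ 1 → z ^ k = ∑ i ∈ Finset.range k, z ^ i → w ^ 2 = 2 →
    ‖biEval z w num‖ ≤ M
  den_le' : ∀ z w : ℂ, ‖z‖ ≤ 1 → z ^ k = ∑ i ∈ Finset.range k, z ^ i → w ^ 2 = 2 →
    ‖biEval z w den‖ ≤ M

theorem norm_le_of_sq_eq_two {w : ℂ} (hw : w ^ 2 = 2) : ‖w - 1‖ ≤ silver := by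
  have h1 : ‖w‖ = √2 := by
    have : ‖w‖ ^ 2 = 2 := by rw [← norm_pow, hw]; simp
    rw [← this, Real.sqrt_sq (norm_nonneg _)]
  calc ‖w - 1‖ ≤ ‖w‖ + ‖(1 : ℂ)‖ := norm_sub_le _ _
    _ = silver := by rw [h1, norm_one, silver, add_comm]

open Nat in
theorem norm_det_le {ι : Type*} [Fintype ι] [DecidableEq ι] {A : Matrix ι ι ℂ} {x : ℝ}
    (h : ∀ i j, ‖A i j‖ ≤ x) : ‖A.det‖ ≤ (Fintype.card ι)! * x ^ Fintype.card ι := by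
  have := Matrix.det_le (A := A) (abv := (NormedField.toAbsoluteValue ℂ)) (x := x) h
  rw [nsmul_eq_mul] at this
  exact this

open Nat in
theorem one_le_abs_det_mul {k : ℕ} {α δ M : ℝ} {num den : MvPolynomial (Fin 2) ℤ}
    (hα : IsDom k α) (hδ : IsFrac k α δ M num den) {ι : Type*} [Fintype ι] [DecidableEq ι]
    {A₀ G₀ D₀ : ℕ} {X : ℝ} (hX : 1 ≤ X) (I A : ι → ι → ℤ) (G D : ι → ι → ℕ)
    (hI : ∀ i j, |(I i j : ℝ)| ≤ X) (hA : ∀ i j, |A i j| ≤ A₀) (hG : ∀ i j, G i j ≤ G₀)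
    (hD : ∀ i j, D i j ≤ D₀)
    (h0 : (Matrix.of fun i j => (I i j : ℝ) * α ^ A i j * (√2 - 1) ^ G i j * δ ^ D i j).det ≠ 0) :
    1 ≤ |(Matrix.of fun i j =>
        (I i j : ℝ) * α ^ A i j * (√2 - 1) ^ G i j * δ ^ D i j).det| *
      (α ^ A₀ * M ^ D₀) ^ Fintype.card ι *
      (((Fintype.card ι)! * (X * (α ^ (2 * A₀) * (silver ^ G₀ * M ^ D₀))) ^ Fintype.card ι) *
      ((Fintype.card ι)! * (X * (silver ^ G₀ * M ^ D₀)) ^ Fintype.card ι) ^ (2 * k)) := by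
  set m : Matrix ι ι ℝ :=
    Matrix.of fun i j => (I i j : ℝ) * α ^ A i j * (√2 - 1) ^ G i j * δ ^ D i j with hm
  set p : Matrix ι ι (MvPolynomial (Fin 2) ℤ) := Matrix.of fun i j =>
    MvPolynomial.C (I i j) * (MvPolynomial.X 0 ^ (A i j + A₀).toNat *
      ((MvPolynomial.X 1 - 1) ^ G i j * (num ^ D i j * den ^ (D₀ - D i j)))) with hp
  have hM := hδ.one_le
  have hα1 := hα.one_lt
  have hs1 : 1 ≤ silver := by have := silver_gt; linarith
  have hev : ∀ z w, ∀ i j, biEval z w (p i j) = (I i j : ℂ) * (z ^ (A i j + A₀).toNat *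
      ((w - 1) ^ G i j * ((biEval z w num) ^ D i j * (biEval z w den) ^ (D₀ - D i j)))) := by
    intro z w i j
    simp only [hp, Matrix.of_apply, map_mul, map_pow, map_sub, map_one]
    simp [biEval]
  have hdet : ∀ z w, biEval z w p.det = (Matrix.of fun i j => biEval z w (p i j)).det := by
    intro z w
    rw [AlgHom.map_det]
    rfl
  have hnum : ∀ i j (a b c : ℝ), 0 ≤ a → 0 ≤ b → a ≤ c → b ≤ c → 1 ≤ c →
      a ^ D i j * b ^ (D₀ - D i j) ≤ c ^ D₀ := by
    intro i j a b c ha hb hac hbc hc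
    calc a ^ D i j * b ^ (D₀ - D i j) ≤ c ^ D i j * c ^ (D₀ - D i j) := by gcongr
      _ = c ^ D₀ := by rw [← pow_add, Nat.add_sub_cancel' (hD i j)]
  have hIn : ∀ i j, ‖(I i j : ℂ)‖ ≤ X := fun i j => by
    rw [Complex.norm_intCast]
    exact hI i j
  -- the value at `(α, √2)`
  set den₀ : ℂ := biEval α (√2 : ℝ) den with hden₀
  have hval : biEval α (√2 : ℝ) p.det =
      ((α : ℂ) ^ A₀ * den₀ ^ D₀) ^ Fintype.card ι * (m.det : ℂ) := by
    have hcast : (m.det : ℂ) = (Complex.ofRealHom.mapMatrix m).det :=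
      RingHom.map_det Complex.ofRealHom m
    rw [hdet, hcast, ← Matrix.det_smul]
    congr 1
    ext i j
    rw [Matrix.of_apply, hev, ← hδ.mul_eq, Matrix.smul_apply, RingHom.mapMatrix_apply,
      Matrix.map_apply, hm, Matrix.of_apply, smul_eq_mul, ← hden₀]
    simp only [Complex.ofRealHom_eq_coe, Complex.ofReal_mul, Complex.ofReal_pow,
      Complex.ofReal_zpow, Complex.ofReal_sub, Complex.ofReal_one, Complex.ofReal_intCast]
    have hα0 : (α : ℂ) ≠ 0 := by exact_mod_cast hα.pos.ne'
    have h1 : (α : ℂ) ^ (A i j + A₀).toNat = (α : ℂ) ^ A i j * (α : ℂ) ^ A₀ := by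
      rw [← zpow_natCast, ← zpow_natCast, ← zpow_add₀ hα0, Int.toNat_of_nonneg]
      have := (abs_le.mp (hA i j)).1
      linarith
    have h2 : den₀ ^ D₀ = den₀ ^ D i j * den₀ ^ (D₀ - D i j) := by
      rw [← pow_add, Nat.add_sub_cancel' (hD i j)]
    rw [h1, h2, mul_pow]
    ring
  have hne : biEval α (√2 : ℝ) p.det ≠ 0 := by
    rw [hval]
    refine mul_ne_zero (pow_ne_zero _ (mul_ne_zero (pow_ne_zero _ ?_)
      (pow_ne_zero _ hδ.den_ne))) ?_
    · exact_mod_cast hα.pos.ne'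
    · exact_mod_cast h0
  have hfac : (1 : ℝ) ≤ (Fintype.card ι)! := by exact_mod_cast Nat.factorial_pos _
  have hsG : 1 ≤ silver ^ G₀ := one_le_pow₀ hs1
  have hMD : 1 ≤ M ^ D₀ := one_le_pow₀ hM
  have hαA : 1 ≤ α ^ (2 * A₀) := one_le_pow₀ hα1.le
  have key := hα.one_le_norm_mul p.det hne
    (B := (Fintype.card ι)! * (X * (silver ^ G₀ * M ^ D₀)) ^ Fintype.card ι)
    (B' := (Fintype.card ι)! * (X * (α ^ (2 * A₀) * (silver ^ G₀ * M ^ D₀))) ^ Fintype.card ι)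
    (one_le_mul_of_one_le_of_one_le hfac (one_le_pow₀
      (one_le_mul_of_one_le_of_one_le hX (one_le_mul_of_one_le_of_one_le hsG hMD))))
    (one_le_mul_of_one_le_of_one_le hfac (one_le_pow₀ (one_le_mul_of_one_le_of_one_le hX
      (one_le_mul_of_one_le_of_one_le hαA (one_le_mul_of_one_le_of_one_le hsG hMD)))))
    (fun z w hz hzk hw => by
      rw [hdet]
      refine norm_det_le fun i j => ?_
      rw [Matrix.of_apply, hev, norm_mul, norm_mul, norm_mul, norm_mul, norm_pow, norm_pow,
        norm_pow, norm_pow]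
      have h1 : ‖z‖ ^ (A i j + A₀).toNat ≤ 1 := pow_le_one₀ (norm_nonneg _) hz
      have h2 : ‖w - 1‖ ^ G i j ≤ silver ^ G₀ :=
        (pow_le_pow_left₀ (norm_nonneg _) (norm_le_of_sq_eq_two hw) _).trans
          (pow_le_pow_right₀ hs1 (hG i j))
      have h3 := hnum i j _ _ M (norm_nonneg _) (norm_nonneg _) (hδ.num_le z w hz hzk hw)
        (hδ.den_le' z w hz hzk hw) hM
      refine mul_le_mul (hIn i j) ?_ (by positivity) (by linarith)
      refine (mul_le_of_le_one_left (by positivity) h1).trans ?_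
      exact mul_le_mul h2 h3 (by positivity) (by positivity))
    (by
      rw [hdet]
      refine norm_det_le fun i j => ?_
      rw [Matrix.of_apply, hev, norm_mul, norm_mul, norm_mul, norm_mul, norm_pow, norm_pow,
        norm_pow, norm_pow]
      have h1 : ‖(α : ℂ)‖ ^ (A i j + A₀).toNat ≤ α ^ (2 * A₀) := by
        rw [Complex.norm_real, Real.norm_of_nonneg hα.pos.le]
        refine pow_le_pow_right₀ hα1.le ?_
        have := (abs_le.mp (hA i j)).2
        omega
      have hw : (-((√2 : ℝ) : ℂ)) ^ 2 = 2 := by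
        rw [neg_sq, ← Complex.ofReal_pow, Real.sq_sqrt (by norm_num)]
        norm_num
      have h2 : ‖-((√2 : ℝ) : ℂ) - 1‖ ^ G i j ≤ silver ^ G₀ :=
        (pow_le_pow_left₀ (norm_nonneg _) (norm_le_of_sq_eq_two hw) _).trans
          (pow_le_pow_right₀ hs1 (hG i j))
      have h3 := hnum i j _ _ M (norm_nonneg _) (norm_nonneg _) hδ.num_conj hδ.den_conj hM
      refine mul_le_mul (hIn i j) ?_ (by positivity) (by linarith)
      refine mul_le_mul h1 ?_ (by positivity) (by positivity)
      exact mul_le_mul h2 h3 (by positivity) (by positivity))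
  refine key.trans (mul_le_mul_of_nonneg_right ?_ (by positivity))
  rw [hval, norm_mul, norm_pow, norm_mul, norm_pow, norm_pow, Complex.norm_real, Complex.norm_real,
    Real.norm_of_nonneg hα.pos.le, Real.norm_eq_abs, mul_comm]
  refine mul_le_mul_of_nonneg_left ?_ (abs_nonneg _)
  have := hα.pos
  have h2 := hδ.den_le
  gcongr

open Nat in
theorem exp_neg_le_abs_det {k : ℕ} {α δ M : ℝ} {num den : MvPolynomial (Fin 2) ℤ}
    (hα : IsDom k α) (hδ : IsFrac k α δ M num den) {ι : Type*} [Fintype ι] [DecidableEq ι]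
    {A₀ G₀ D₀ : ℕ} {X h Y : ℝ} (hX : 1 ≤ X) (hY : Fintype.card ι * X ≤ Real.exp Y)
    (hY0 : 0 ≤ Y) (hh : M ≤ Real.exp h) (I A : ι → ι → ℤ) (G D : ι → ι → ℕ)
    (hI : ∀ i j, |(I i j : ℝ)| ≤ X) (hA : ∀ i j, |A i j| ≤ A₀) (hG : ∀ i j, G i j ≤ G₀)
    (hD : ∀ i j, D i j ≤ D₀)
    (h0 : (Matrix.of fun i j => (I i j : ℝ) * α ^ A i j * (√2 - 1) ^ G i j * δ ^ D i j).det ≠ 0) :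
    Real.exp (-(Fintype.card ι * ((2 * k + 2) * (Y + G₀ + h * D₀) + 3 * A₀))) ≤
      |(Matrix.of fun i j => (I i j : ℝ) * α ^ A i j * (√2 - 1) ^ G i j * δ ^ D i j).det| := by
  have key := one_le_abs_det_mul hα hδ hX I A G D hI hA hG hD h0
  set N := Fintype.card ι with hN
  set d := |(Matrix.of fun i j =>
    (I i j : ℝ) * α ^ A i j * (√2 - 1) ^ G i j * δ ^ D i j).det| with hd
  have hM := hδ.one_le
  have h0' : 0 ≤ h := Real.one_le_exp_iff.mp (hM.trans hh)
  have hα0 := hα.pos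
  have he := Real.exp_one_gt_d9
  have hαe : α ≤ Real.exp 1 := by have := hα.lt; linarith
  have hse : silver ≤ Real.exp 1 := by have := silver_lt; linarith
  have hs0 := silver_pos
  have hαp : ∀ n : ℕ, α ^ n ≤ Real.exp n := fun n => by
    rw [← mul_one (n : ℝ), Real.exp_nat_mul]
    exact pow_le_pow_left₀ hα0.le hαe n
  have hsp : ∀ n : ℕ, silver ^ n ≤ Real.exp n := fun n => by
    rw [← mul_one (n : ℝ), Real.exp_nat_mul]
    exact pow_le_pow_left₀ hs0.le hse n
  have hMp : M ^ D₀ ≤ Real.exp (h * D₀) := by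
    rw [mul_comm, Real.exp_nat_mul]
    exact pow_le_pow_left₀ (by linarith) hh _
  have hfac : ((N ! : ℕ) : ℝ) ≤ (N : ℝ) ^ N := by exact_mod_cast Nat.factorial_le_pow N
  have hfac' : ∀ x y : ℝ, 0 ≤ x → x ≤ Real.exp y → (N ! : ℝ) * (X * x) ^ N ≤
      Real.exp (N * (Y + y)) := fun x y hx hy => by
    calc (N ! : ℝ) * (X * x) ^ N ≤ (N : ℝ) ^ N * (X * x) ^ N := by gcongr
      _ = (N * X * x) ^ N := by rw [← mul_pow, mul_assoc]
      _ ≤ (Real.exp Y * Real.exp y) ^ N := by gcongr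
      _ = Real.exp (N * (Y + y)) := by rw [← Real.exp_add, ← Real.exp_nat_mul]
  have hM0 : 0 < M := by linarith
  have h1 : (α ^ A₀ * M ^ D₀) ^ N ≤ Real.exp (N * (A₀ + h * D₀)) := by
    rw [Real.exp_nat_mul, Real.exp_add]
    exact pow_le_pow_left₀ (by positivity)
      (mul_le_mul (hαp _) hMp (by positivity) (by positivity)) _
  have hsM : silver ^ G₀ * M ^ D₀ ≤ Real.exp (G₀ + h * D₀) := by
    rw [Real.exp_add]
    exact mul_le_mul (hsp _) hMp (by positivity) (by positivity)
  have h2 := hfac' (α ^ (2 * A₀) * (silver ^ G₀ * M ^ D₀)) (2 * A₀ + (G₀ + h * D₀))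
      (by positivity) (by
    rw [Real.exp_add]
    have := hαp (2 * A₀)
    push_cast at this
    exact mul_le_mul this hsM (by positivity) (by positivity))
  have h3 := hfac' _ (G₀ + h * D₀) (by positivity) hsM
  have h3' := pow_le_pow_left₀ (by positivity) h3 (2 * k)
  rw [← Real.exp_nat_mul] at h3'
  have hd0 : 0 ≤ d := abs_nonneg _
  have hfin : d * Real.exp (N * (A₀ + h * D₀)) * (Real.exp (N * (Y + (2 * A₀ + (G₀ + h * D₀)))) *
      Real.exp ((2 * k : ℕ) * (N * (Y + (G₀ + h * D₀))))) ≤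
      d * Real.exp (N * ((2 * k + 2) * (Y + G₀ + h * D₀) + 3 * A₀)) := by
    rw [mul_assoc, ← Real.exp_add, ← Real.exp_add]
    refine mul_le_mul_of_nonneg_left (Real.exp_le_exp.mpr ?_) hd0
    have : 0 ≤ (N : ℝ) * (Y + G₀) := by positivity
    push_cast
    nlinarith
  have : 1 ≤ d * Real.exp (N * ((2 * k + 2) * (Y + G₀ + h * D₀) + 3 * A₀)) := by
    refine key.trans (le_trans ?_ hfin)
    gcongr
  rw [Real.exp_neg, inv_eq_one_div, div_le_iff₀ (Real.exp_pos _)]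
  exact this

open Finset in
theorem exists_det_ne_zero {ι π : Type*} [Fintype ι] [DecidableEq ι] (col : π → ι → ℝ)
    (h : ∀ w : ι → ℝ, (∀ p, ∑ i, w i * col p i = 0) → w = 0) :
    ∃ f : ι → π, (Matrix.of fun i j => col (f j) i).det ≠ 0 := by
  have hspan : Submodule.span ℝ (Set.range col) = ⊤ := by
    by_contra hne
    obtain ⟨g, hg0, hg⟩ := Submodule.exists_le_ker_of_lt_top _ (lt_top_iff_ne_top.mpr hne)
    apply hg0
    have hgs : ∀ v : ι → ℝ, g v = ∑ i, g (Pi.single i 1) * v i := fun v => by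
      rw [LinearMap.pi_apply_eq_sum_univ g v]
      refine sum_congr rfl fun i _ => ?_
      rw [smul_eq_mul, mul_comm]
      congr 2
      ext j
      simp [Pi.single_apply, eq_comm]
    have := h (fun i => g (Pi.single i 1)) fun p => by
      rw [← hgs]
      exact hg (Submodule.subset_span ⟨p, rfl⟩)
    ext i
    simpa using congrFun this i
  obtain ⟨κ, a, -, hs, hli⟩ := exists_linearIndependent' ℝ col
  rw [hspan] at hs
  let b := Module.Basis.mk hli hs.ge
  let e : ι ≃ κ := (Pi.basisFun ℝ ι).indexEquiv b
  refine ⟨a ∘ e, ?_⟩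
  have hli' : LinearIndependent ℝ (fun j => col ((a ∘ e) j)) := hli.comp e e.injective
  have : LinearIndependent ℝ (Matrix.of fun i j => col ((a ∘ e) j) i).col := hli'
  rw [Matrix.linearIndependent_cols_iff_isUnit, Matrix.isUnit_iff_isUnit_det] at this
  exact this.ne_zero

open Finset Nat in
theorem abs_det_mul_pow_le_of_series {ι : Type*} [Fintype ι] [DecidableEq ι] {K J : ℕ}
    (hN : Fintype.card ι = K * J) (m : Matrix ι ι ℝ) (C : ℕ → Matrix ι ι ℝ)
    (W : ℕ → Submodule ℝ (ι → ℝ)) (hW : ∀ s, s < J → Module.finrank ℝ (W s) ≤ K)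
    (hC : ∀ s, s < J → ∀ j, (fun i => C s i j) ∈ W s) {E : ℝ} (hE : 1 ≤ E) (B B' : ι → ℝ)
    (hs : ∀ i j, Summable fun s => E ^ s * |C s i j|)
    (hB : ∀ i j, ∑' s, E ^ s * |C s i j| ≤ B j)
    (hB' : ∀ i j, |m i j - ∑' s, C s i j| * E ^ J ≤ B' j) :
    |m.det| * E ^ (K * ∑ t ∈ range J, t) ≤ (Fintype.card ι)! * ∏ j, (B j + B' j) := by
  let D : Fin (J + 1) → Matrix ι ι ℝ := fun s =>
    if (s : ℕ) < J then C s else m - ∑ t ∈ range J, C t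
  have hlt : ∀ s : Fin J, D s.castSucc = C s := fun s => by simp [D]
  have hlast : D (Fin.last J) = m - ∑ t ∈ range J, C t := by simp [D]
  have hsum : ∑ s, D s = m := by
    rw [Fin.sum_univ_castSucc, hlast]
    simp only [hlt]
    rw [Fin.sum_univ_eq_sum_range, add_sub_cancel]
  have := abs_det_mul_pow_le hN D (fun s => W s) (fun s h => hW s h) (fun s h j => by
    simp only [D, h, if_true]
    exact hC s h j) hE (fun j => B j + B' j) fun i j => by
      rw [Fin.sum_univ_castSucc, hlast]
      simp only [hlt, Fin.val_castSucc, Fin.val_last]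
      rw [Fin.sum_univ_eq_sum_range (fun s => E ^ s * |C s i j|)]
      have hE0 : (0 : ℝ) ≤ E := by linarith
      have hsa : Summable fun s => |C s i j| := by
        refine Summable.of_nonneg_of_le (fun _ => abs_nonneg _) (fun s => ?_) (hs i j)
        exact le_mul_of_one_le_left (abs_nonneg _) (one_le_pow₀ hE)
      have h1 : (m - ∑ t ∈ range J, C t) i j =
          (m i j - ∑' s, C s i j) + ∑' s, C (s + J) i j := by
        rw [← hsa.of_abs.sum_add_tsum_nat_add J, Matrix.sub_apply, Matrix.sum_apply]
        ring
      have h2 : |∑' s, C (s + J) i j| ≤ ∑' s, |C (s + J) i j| := by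
        have := (summable_nat_add_iff J).mpr hsa
        simpa using norm_tsum_le_tsum_norm (f := fun s => C (s + J) i j) (by simpa using this)
      have h3 : E ^ J * ∑' s, |C (s + J) i j| ≤ ∑' s, E ^ (s + J) * |C (s + J) i j| := by
        rw [← tsum_mul_left]
        refine Summable.tsum_le_tsum (fun s => ?_)
          (((summable_nat_add_iff J).mpr hsa).mul_left _) ((summable_nat_add_iff J).mpr (hs i j))
        rw [pow_add]
        refine mul_le_mul_of_nonneg_right ?_ (abs_nonneg _)
        exact le_mul_of_one_le_left (by positivity) (one_le_pow₀ hE)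
      have h4 := (hs i j).sum_add_tsum_nat_add J
      have h5 := hB i j
      have h6 := hB' i j
      rw [h1]
      have h7 : E ^ J * |m i j - ∑' s, C s i j + ∑' s, C (s + J) i j| ≤
          E ^ J * (|m i j - ∑' s, C s i j| + ∑' s, |C (s + J) i j|) := by
        gcongr
        exact (abs_add_le _ _).trans (by gcongr)
      linarith
  rwa [hsum] at this

open Finset in
theorem cauchy_series {a b : ℕ → ℝ} {E : ℝ} (hE : 1 ≤ E)
    (ha : Summable fun s => E ^ s * |a s|) (hb : Summable fun s => E ^ s * |b s|) :
    (Summable fun s => E ^ s * |∑ t ∈ range (s + 1), a t * b (s - t)|) ∧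
    (∑' s, E ^ s * |∑ t ∈ range (s + 1), a t * b (s - t)| ≤
      (∑' s, E ^ s * |a s|) * ∑' s, E ^ s * |b s|) ∧
    ∑' s, ∑ t ∈ range (s + 1), a t * b (s - t) = (∑' s, a s) * ∑' s, b s := by
  have hE0 : (0 : ℝ) ≤ E := by linarith
  have hn : ∀ c : ℕ → ℝ, (fun s => ‖E ^ s * |c s|‖) = fun s => E ^ s * |c s| := fun c => by
    ext s
    rw [Real.norm_of_nonneg (by positivity)]
  have hsa : ∀ c : ℕ → ℝ, (Summable fun s => E ^ s * |c s|) → Summable fun s => ‖c s‖ :=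
    fun c hc => Summable.of_nonneg_of_le (fun _ => norm_nonneg _) (fun s =>
      le_mul_of_one_le_left (abs_nonneg _) (one_le_pow₀ hE)) hc
  have hle : ∀ s, E ^ s * |∑ t ∈ range (s + 1), a t * b (s - t)| ≤
      ∑ t ∈ range (s + 1), (E ^ t * |a t|) * (E ^ (s - t) * |b (s - t)|) := fun s => by
    calc E ^ s * |∑ t ∈ range (s + 1), a t * b (s - t)|
        ≤ E ^ s * ∑ t ∈ range (s + 1), |a t * b (s - t)| := by
          gcongr
          exact abs_sum_le_sum_abs _ _
      _ = _ := by
          rw [mul_sum]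
          refine sum_congr rfl fun t ht => ?_
          have : s = t + (s - t) := by have := mem_range.mp ht; omega
          conv_lhs => rw [this, pow_add, add_tsub_cancel_left]
          rw [abs_mul]
          ring
  have hsum := summable_norm_sum_mul_range_of_summable_norm
    (f := fun s => E ^ s * |a s|) (g := fun s => E ^ s * |b s|)
    (by simpa only [hn] using ha) (by simpa only [hn] using hb)
  have hsum' := hsum.of_norm
  have hS := Summable.of_nonneg_of_le (fun s => by positivity) hle hsum'
  refine ⟨hS, ?_, ?_⟩
  · rw [tsum_mul_tsum_eq_tsum_sum_range_of_summable_norm (by simpa only [hn] using ha)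
      (by simpa only [hn] using hb)]
    exact hS.tsum_le_tsum hle hsum'
  · rw [tsum_mul_tsum_eq_tsum_sum_range_of_summable_norm (hsa a ha) (hsa b hb)]

theorem hasSum_exp_series (x : ℝ) : HasSum (fun n : ℕ => x ^ n / n.factorial) (Real.exp x) := by
  rw [Real.exp_eq_exp_ℝ]
  exact NormedSpace.expSeries_div_hasSum_exp x

open Finset Nat in
theorem exp_series_bound {a : ℕ → ℝ} {B x w ρ : ℝ}
    (ha : Summable fun s => Real.exp 1 ^ s * |a s|) (hB : ∑' s, Real.exp 1 ^ s * |a s| ≤ B)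
    (hx : |x| ≤ w) (hρ : |ρ| ≤ 1) :
    (Summable fun s => Real.exp 1 ^ s * |∑ t ∈ range (s + 1), a t * (x ^ (s - t) / (s - t)!)|) ∧
    (∑' s, Real.exp 1 ^ s * |∑ t ∈ range (s + 1), a t * (x ^ (s - t) / (s - t)!)| ≤
      B * Real.exp (3 * w)) ∧
    |(∑' s, a s) * Real.exp (x + ρ) -
      ∑' s, ∑ t ∈ range (s + 1), a t * (x ^ (s - t) / (s - t)!)| ≤
      B * Real.exp (3 * w) * (2 * |ρ|) := by
  have hE : (1 : ℝ) ≤ Real.exp 1 := Real.one_le_exp zero_le_one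
  have he3 : Real.exp 1 ≤ 3 := by have := Real.exp_one_lt_d9; linarith
  have hbs : HasSum (fun s => Real.exp 1 ^ s * |x ^ s / (s !)|) (Real.exp (Real.exp 1 * |x|)) := by
    have := hasSum_exp_series (Real.exp 1 * |x|)
    convert this using 2 with s
    rw [abs_div, abs_pow, mul_pow, Nat.abs_cast, mul_div_assoc]
  obtain ⟨h1, h2, h3⟩ := cauchy_series (a := a) (b := fun s => x ^ s / (s !)) hE ha hbs.summable
  have hB0 : 0 ≤ B := le_trans (tsum_nonneg fun s => by positivity) hB
  have hw0 : 0 ≤ w := (abs_nonneg x).trans hx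
  have hexp : Real.exp (Real.exp 1 * |x|) ≤ Real.exp (3 * w) :=
    Real.exp_le_exp.mpr (mul_le_mul he3 hx (abs_nonneg _) (by norm_num))
  refine ⟨h1, h2.trans ?_, ?_⟩
  · rw [hbs.tsum_eq]
    exact mul_le_mul hB hexp (Real.exp_pos _).le hB0
  · rw [h3, (hasSum_exp_series x).tsum_eq, ← mul_sub, abs_mul, Real.exp_add]
    have hsa : Summable fun s => |a s| := Summable.of_nonneg_of_le (fun _ => abs_nonneg _)
      (fun s => le_mul_of_one_le_left (abs_nonneg _) (one_le_pow₀ hE)) ha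
    have h4 : |∑' s, a s| ≤ B := by
      refine le_trans ?_ hB
      refine le_trans (by simpa using norm_tsum_le_tsum_norm (f := a) (by simpa using hsa)) ?_
      exact hsa.tsum_le_tsum
        (fun s => le_mul_of_one_le_left (abs_nonneg _) (one_le_pow₀ hE)) ha
    have h5 : |Real.exp x * Real.exp ρ - Real.exp x| ≤ Real.exp (3 * w) * (2 * |ρ|) := by
      rw [show Real.exp x * Real.exp ρ - Real.exp x = Real.exp x * (Real.exp ρ - 1) by ring,
        abs_mul, Real.abs_exp]
      refine mul_le_mul (Real.exp_le_exp.mpr ?_) (Real.abs_exp_sub_one_le hρ) (abs_nonneg _)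
        (Real.exp_pos _).le
      have := le_abs_self x
      linarith
    rw [mul_assoc]
    exact mul_le_mul h4 h5 (abs_nonneg _) hB0

theorem sum_range_id_real (J : ℕ) : ((∑ t ∈ Finset.range J, t : ℕ) : ℝ) = J * (J - 1) / 2 := by
  induction J with
  | zero => simp
  | succ n ih =>
    rw [Finset.sum_range_succ]
    push_cast at ih ⊢
    rw [ih]
    ring

open Finset Nat in
/-- The interpolation determinant vanishes as soon as its analytic upper bound beats the
arithmetic lower bound. -/
theorem det_eq_zero_of_series {k : ℕ} {α δ M : ℝ} {num den : MvPolynomial (Fin 2) ℤ}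
    (hα : IsDom k α) (hδ : IsFrac k α δ M num den) {ι : Type*} [Fintype ι] [DecidableEq ι]
    [Nonempty ι] {K J : ℕ} (hN : Fintype.card ι = K * J)
    {A₀ G₀ D₀ : ℕ} {X h Y B w : ℝ} (hX : 1 ≤ X) (hXB : X ≤ B)
    (hY : 2 * Fintype.card ι * B ≤ Real.exp Y) (hh : M ≤ Real.exp h)
    (I A : ι → ι → ℤ) (G D : ι → ι → ℕ)
    (hI : ∀ i j, |(I i j : ℝ)| ≤ X) (hA : ∀ i j, |A i j| ≤ A₀) (hG : ∀ i j, G i j ≤ G₀)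
    (hD : ∀ i j, D i j ≤ D₀) (a : ι → ι → ℕ → ℝ) (x ρ : ι → ι → ℝ)
    (ha : ∀ i j, Summable fun s => Real.exp 1 ^ s * |a i j s|)
    (hB : ∀ i j, ∑' s, Real.exp 1 ^ s * |a i j s| ≤ B) (hx : ∀ i j, |x i j| ≤ w)
    (hρ : ∀ i j, 2 * |ρ i j| * Real.exp J ≤ 1)
    (hm : ∀ i j, (I i j : ℝ) * α ^ A i j * (√2 - 1) ^ G i j * δ ^ D i j =
      (∑' s, a i j s) * Real.exp (x i j + ρ i j))
    (W : ℕ → Submodule ℝ (ι → ℝ)) (hW : ∀ s, s < J → Module.finrank ℝ (W s) ≤ K)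
    (hC : ∀ s, s < J → ∀ j,
      (fun i => ∑ t ∈ range (s + 1), a i j t * ((x i j) ^ (s - t) / (s - t)!)) ∈ W s)
    (hmain : (2 * k + 3) * Y + 3 * w + (2 * k + 2) * (G₀ + h * D₀) + 3 * A₀ < ((J : ℝ) - 1) / 2) :
    (Matrix.of fun i j => (I i j : ℝ) * α ^ A i j * (√2 - 1) ^ G i j * δ ^ D i j).det = 0 := by
  by_contra h0
  set N := Fintype.card ι with hNdef
  have hN1 : 1 ≤ N := Fintype.card_pos
  have hN1' : (1 : ℝ) ≤ N := by exact_mod_cast hN1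
  have hB1 : 1 ≤ B := hX.trans hXB
  have hY0 : 0 ≤ Y := by
    refine Real.one_le_exp_iff.mp (le_trans ?_ hY)
    nlinarith
  have hlow := exp_neg_le_abs_det hα hδ hX (h := h) (Y := Y)
    (by
      refine le_trans ?_ hY
      rw [← hNdef]
      nlinarith) hY0 hh I A G D hI hA hG hD h0
  have hρ1 : ∀ i j, |ρ i j| ≤ 1 := fun i j => by
    have h1 := hρ i j
    have h2 : (1 : ℝ) ≤ Real.exp J := Real.one_le_exp (by positivity)
    have h3 := abs_nonneg (ρ i j)
    nlinarith
  have hser := fun i j => exp_series_bound (ha i j) (hB i j) (hx i j) (hρ1 i j)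
  have hup := abs_det_mul_pow_le_of_series hN
    (Matrix.of fun i j => (I i j : ℝ) * α ^ A i j * (√2 - 1) ^ G i j * δ ^ D i j)
    (fun s => Matrix.of fun i j =>
      ∑ t ∈ range (s + 1), a i j t * ((x i j) ^ (s - t) / (s - t)!)) W hW hC
    (Real.one_le_exp zero_le_one) (fun _ => B * Real.exp (3 * w)) (fun _ => B * Real.exp (3 * w))
    (fun i j => (hser i j).1) (fun i j => (hser i j).2.1) (fun i j => by
      simp only [Matrix.of_apply]
      rw [hm, ← Real.exp_nat_mul, mul_one]
      have h1 := (hser i j).2.2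
      have h2 := hρ i j
      have h3 : 0 ≤ B * Real.exp (3 * w) := by positivity
      calc _ ≤ B * Real.exp (3 * w) * (2 * |ρ i j|) * Real.exp J := by gcongr
        _ = B * Real.exp (3 * w) * (2 * |ρ i j| * Real.exp J) := by ring
        _ ≤ _ := mul_le_of_le_one_right h3 h2)
  have hfac : ((N ! : ℕ) : ℝ) ≤ (N : ℝ) ^ N := by exact_mod_cast Nat.factorial_le_pow N
  rw [prod_const, Finset.card_univ, ← hNdef, ← Real.exp_nat_mul, mul_one] at hup
  have hup2 : ((N ! : ℕ) : ℝ) * (B * Real.exp (3 * w) + B * Real.exp (3 * w)) ^ N ≤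
      Real.exp (N * (Y + 3 * w)) := by
    calc ((N ! : ℕ) : ℝ) * (B * Real.exp (3 * w) + B * Real.exp (3 * w)) ^ N
        ≤ (N : ℝ) ^ N * (B * Real.exp (3 * w) + B * Real.exp (3 * w)) ^ N := by gcongr
      _ = (2 * N * B * Real.exp (3 * w)) ^ N := by rw [← mul_pow]; ring
      _ ≤ (Real.exp Y * Real.exp (3 * w)) ^ N := by gcongr
      _ = Real.exp (N * (Y + 3 * w)) := by rw [← Real.exp_add, ← Real.exp_nat_mul]
  have hKJ : ((K * ∑ t ∈ range J, t : ℕ) : ℝ) = N * ((J - 1) / 2) := by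
    rw [hN]
    push_cast
    have := sum_range_id_real J
    push_cast at this
    rw [this]
    ring
  rw [hKJ] at hup
  have hfin := (mul_le_mul_of_nonneg_right hlow (Real.exp_pos (N * (((J : ℝ) - 1) / 2))).le).trans
    (hup.trans hup2)
  rw [← Real.exp_add, Real.exp_le_exp, ← hNdef] at hfin
  have : (N : ℝ) * ((2 * k + 3) * Y + 3 * w + (2 * k + 2) * (G₀ + h * D₀) + 3 * A₀ -
      ((J : ℝ) - 1) / 2) < 0 := mul_neg_of_pos_of_neg (by linarith) (by linarith)
  nlinarith

open Polynomial in
theorem eq_zero_of_sum_pow_mul_pow_eq_zero {K L R₁ R₂ : ℕ} {s₁ s₂ : ℤ} {η₁ η₂ : ℝ}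
    (h1 : 0 < η₁) (h1' : η₁ ≠ 1) (h2 : 0 < η₂) (hZ : L * K < (R₁ - L) * R₂)
    (hinj : ∀ r₁ r₁' r₂ r₂' : ℕ, r₁ < R₁ → r₁' < R₁ → r₂ < R₂ → r₂' < R₂ →
      s₁ * r₁ + s₂ * r₂ = s₁ * r₁' + s₂ * r₂' → r₁ = r₁' ∧ r₂ = r₂')
    (w : Fin K × Fin L → ℝ)
    (hw : ∀ r : Fin R₁ × Fin R₂, ∑ i, w i * (((s₁ * (r.1 : ℕ) + s₂ * (r.2 : ℕ) : ℤ) : ℝ) ^ (i.1 : ℕ)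
      * (η₁ ^ (r.1 : ℕ) * η₂ ^ (r.2 : ℕ)) ^ (i.2 : ℕ)) = 0) : w = 0 := by
  by_contra hne
  let P : Fin L → ℝ[X] := fun q => ∑ p : Fin K, C (w (p, q)) * X ^ (p : ℕ)
  have hcoeff : ∀ q (p : Fin K), (P q).coeff p = w (p, q) := fun q p => by
    simp only [P, finsetSum_coeff, coeff_C_mul_X_pow]
    rw [Finset.sum_eq_single p]
    · simp
    · intro b _ hb
      rw [if_neg fun h => hb (Fin.ext h.symm)]
    · simp
  have hP : P ≠ 0 := fun h => hne (by
    ext ⟨p, q⟩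
    rw [← hcoeff, h]
    simp)
  obtain ⟨Q, hQ, hdeg, hvan⟩ := exists_univariate_of_vanishing (K := K) P hP (fun q =>
    natDegree_sum_le_of_forall_le _ _ fun p _ =>
      (natDegree_C_mul_X_pow_le _ _).trans p.2.le) h1 h1' s₁
  apply hQ
  refine eq_zero_of_natDegree_lt_card_of_eval_eq_zero Q
    (f := fun r : Fin (R₁ - L) × Fin R₂ => ((s₁ * (r.1 : ℕ) + s₂ * (r.2 : ℕ) : ℤ) : ℝ)) ?_ ?_ ?_
  · intro r r' h
    have h' : s₁ * ((r.1 : ℕ) : ℤ) + s₂ * ((r.2 : ℕ) : ℤ) = s₁ * (r'.1 : ℕ) + s₂ * (r'.2 : ℕ) := by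
      simp only at h
      exact_mod_cast h
    have hr := r.1.2
    have hr' := r'.1.2
    obtain ⟨ha, hb⟩ := hinj _ _ _ _ (by omega) (by omega) r.2.2 r'.2.2 h'
    exact Prod.ext (Fin.ext ha) (Fin.ext hb)
  · intro r
    refine hvan _ (η₁ ^ (r.1 : ℕ) * η₂ ^ (r.2 : ℕ)) (by positivity) fun i hi => ?_
    have hr := r.1.2
    have := hw (⟨r.1 + i, by omega⟩, r.2)
    rw [← this, Fintype.sum_prod_type_right]
    refine Finset.sum_congr rfl fun q _ => ?_
    simp only [P, eval_finsetSum, Finset.sum_mul]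
    refine Finset.sum_congr rfl fun p _ => ?_
    simp only [eval_mul, eval_C, eval_pow, eval_X]
    push_cast
    rw [pow_add]
    ring
  · rw [Fintype.card_prod, Fintype.card_fin, Fintype.card_fin]
    exact hdeg.trans_lt hZ

open Finset Nat in
/-- A lower bound for a linear form in two logarithms. -/
theorem exp_neg_le_abs_of_two_logs {k : ℕ} {α δ M : ℝ} {num den : MvPolynomial (Fin 2) ℤ}
    (hα : IsDom k α) (hδ : IsFrac k α δ M num den) (hδ0 : 0 < δ) {h : ℝ} (hh : M ≤ Real.exp h)
    {c₁ c₂ s₁ s₂ : ℤ} {d₁ d₂ f₁ f₂ : ℕ} {τ Λ : ℝ} (hτ : τ * s₁ ≠ 0)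
    (h1 : Real.log (α ^ c₁ * (√2 - 1) ^ d₁ * δ ^ f₁) = τ * s₁)
    (h2 : Real.log (α ^ c₂ * (√2 - 1) ^ d₂ * δ ^ f₂) = τ * s₂ + Λ)
    {K L R₁ R₂ : ℕ} (hK : 0 < K) (hL : 0 < L) (hZ : L * K < (R₁ - L) * R₂)
    (hinj : ∀ r₁ r₁' r₂ r₂' : ℕ, r₁ < R₁ → r₁' < R₁ → r₂ < R₂ → r₂' < R₂ →
      s₁ * r₁ + s₂ * r₂ = s₁ * r₁' + s₂ * r₂' → r₁ = r₁' ∧ r₂ = r₂')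
    {X Y w : ℝ} (hX : 1 ≤ X)
    (hx : ∀ r₁ r₂ : ℕ, r₁ < R₁ → r₂ < R₂ → |((s₁ * r₁ + s₂ * r₂ : ℤ) : ℝ)| ≤ X)
    (hw : |τ| * X ≤ w) (hY : 2 * (K * L) * (Real.exp 1 * X) ^ K ≤ Real.exp Y)
    (hLR : 2 * (L * R₂) ≤ Real.exp (K * L))
    (hmain : (2 * k + 3) * Y + 3 * (L * w) + (2 * k + 2) * (L * (d₁ * R₁ + d₂ * R₂) +
      h * (L * (f₁ * R₁ + f₂ * R₂))) + 3 * (L * (c₁.natAbs * R₁ + c₂.natAbs * R₂)) <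
      ((K * L : ℝ) - 1) / 2) :
    Real.exp (-(2 * (K * L))) < |Λ| := by
  by_contra! hΛ
  set η₁ := α ^ c₁ * (√2 - 1) ^ d₁ * δ ^ f₁ with hη1
  set η₂ := α ^ c₂ * (√2 - 1) ^ d₂ * δ ^ f₂ with hη2
  have hα0 := hα.pos
  have hsq : 0 < √2 - 1 := by have := sqrt_two_gt; linarith
  have hη10 : 0 < η₁ := by positivity
  have hη20 : 0 < η₂ := by positivity
  have hη11 : η₁ ≠ 1 := fun h => hτ (by rw [← h1, h, Real.log_one])
  obtain ⟨r, hr⟩ := exists_det_ne_zero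
    (fun (r : Fin R₁ × Fin R₂) (i : Fin K × Fin L) =>
      ((s₁ * (r.1 : ℕ) + s₂ * (r.2 : ℕ) : ℤ) : ℝ) ^ (i.1 : ℕ)
      * (η₁ ^ (r.1 : ℕ) * η₂ ^ (r.2 : ℕ)) ^ (i.2 : ℕ))
    (fun w hw => eq_zero_of_sum_pow_mul_pow_eq_zero hη10 hη11 hη20 hZ hinj w hw)
  apply hr
  have : Nonempty (Fin K × Fin L) := ⟨(⟨0, hK⟩, ⟨0, hL⟩)⟩
  have hcard : Fintype.card (Fin K × Fin L) = K * L := by simp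
  have hE : (1 : ℝ) ≤ Real.exp 1 := Real.one_le_exp zero_le_one
  let x : Fin K × Fin L → ℝ := fun j => ((s₁ * ((r j).1 : ℕ) + s₂ * ((r j).2 : ℕ) : ℤ) : ℝ)
  have hxX : ∀ j, |x j| ≤ X := fun j => hx _ _ (r j).1.2 (r j).2.2
  have hθ : ∀ j, |τ * x j| ≤ w := fun j => by
    rw [abs_mul]
    exact (mul_le_mul_of_nonneg_left (hxX j) (abs_nonneg _)).trans hw
  have hpow : ∀ i j : Fin K × Fin L,
      α ^ ((c₁ * (r j).1 + c₂ * (r j).2) * (i.2 : ℕ) : ℤ) *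
      (√2 - 1) ^ ((d₁ * (r j).1 + d₂ * (r j).2) * (i.2 : ℕ)) *
      δ ^ ((f₁ * (r j).1 + f₂ * (r j).2) * (i.2 : ℕ)) =
      (η₁ ^ ((r j).1 : ℕ) * η₂ ^ ((r j).2 : ℕ)) ^ (i.2 : ℕ) := fun i j => by
    rw [zpow_mul, zpow_add₀ hα0.ne', zpow_mul, zpow_mul, pow_mul, pow_add, pow_mul, pow_mul,
      pow_mul, pow_add, pow_mul, pow_mul, hη1, hη2]
    simp only [zpow_natCast]
    ring
  have hexp : ∀ j, η₁ ^ ((r j).1 : ℕ) * η₂ ^ ((r j).2 : ℕ) =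
      Real.exp (τ * x j + ((r j).2 : ℕ) * Λ) := fun j => by
    have e1 : η₁ = Real.exp (τ * s₁) := by rw [← h1, Real.exp_log hη10]
    have e2 : η₂ = Real.exp (τ * s₂ + Λ) := by rw [← h2, Real.exp_log hη20]
    rw [e1, e2, ← Real.exp_nat_mul, ← Real.exp_nat_mul, ← Real.exp_add]
    congr 1
    simp only [x]
    push_cast
    ring
  have hasum : ∀ i j : Fin K × Fin L,
      HasSum (fun s => Real.exp 1 ^ s * |if s = (i.1 : ℕ) then x j ^ (i.1 : ℕ) else 0|)
        (Real.exp 1 ^ (i.1 : ℕ) * |x j ^ (i.1 : ℕ)|) := fun i j => by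
    convert hasSum_ite_eq (i.1 : ℕ) (Real.exp 1 ^ (i.1 : ℕ) * |x j ^ (i.1 : ℕ)|) using 2 with s
    split_ifs with h
    · rw [h]
    · simp
  have hw0 : 0 ≤ w := le_trans (by positivity) hw
  have key := det_eq_zero_of_series hα hδ (ι := Fin K × Fin L) (K := 1) (J := K * L)
    (by simp) (A₀ := L * (c₁.natAbs * R₁ + c₂.natAbs * R₂)) (G₀ := L * (d₁ * R₁ + d₂ * R₂))
    (D₀ := L * (f₁ * R₁ + f₂ * R₂)) (X := X ^ K) (B := (Real.exp 1 * X) ^ K) (w := L * w)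
    (Y := Y) (h := h) (one_le_pow₀ hX)
    (pow_le_pow_left₀ (by linarith) (le_mul_of_one_le_left (by linarith) hE) _)
    (by
      rw [hcard]
      push_cast
      exact hY) hh
    (fun i j => (s₁ * ((r j).1 : ℕ) + s₂ * ((r j).2 : ℕ)) ^ (i.1 : ℕ))
    (fun i j => (c₁ * (r j).1 + c₂ * (r j).2) * (i.2 : ℕ))
    (fun i j => (d₁ * (r j).1 + d₂ * (r j).2) * (i.2 : ℕ))
    (fun i j => (f₁ * (r j).1 + f₂ * (r j).2) * (i.2 : ℕ))
    (fun i j => by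
      rw [Int.cast_pow, abs_pow]
      exact (pow_le_pow_left₀ (abs_nonneg _) (hxX j) _).trans
        (pow_le_pow_right₀ hX i.1.2.le))
    (fun i j => by
      have a1 := (r j).1.2
      have a2 := (r j).2.2
      have a3 := i.2.2
      rw [abs_mul, Nat.abs_cast, mul_comm]
      push_cast
      refine mul_le_mul (by exact_mod_cast a3.le) ?_ (abs_nonneg _) (by positivity)
      refine (abs_add_le _ _).trans ?_
      rw [abs_mul, abs_mul, Nat.abs_cast, Nat.abs_cast]
      gcongr)
    (fun i j => by
      rw [mul_comm]
      have a1 := (r j).1.2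
      have a2 := (r j).2.2
      have a3 := i.2.2
      gcongr)
    (fun i j => by
      rw [mul_comm]
      have a1 := (r j).1.2
      have a2 := (r j).2.2
      have a3 := i.2.2
      gcongr)
    (fun i j s => if s = (i.1 : ℕ) then x j ^ (i.1 : ℕ) else 0)
    (fun i j => (i.2 : ℕ) * (τ * x j)) (fun i j => (i.2 : ℕ) * (((r j).2 : ℕ) * Λ))
    (fun i j => (hasum i j).summable)
    (fun i j => by
      rw [(hasum i j).tsum_eq, abs_pow, ← mul_pow]
      refine (pow_le_pow_left₀ (by positivity)
        (mul_le_mul_of_nonneg_left (hxX j) (by positivity)) _).trans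
        (pow_le_pow_right₀ (one_le_mul_of_one_le_of_one_le hE hX) i.1.2.le))
    (fun i j => by
      rw [abs_mul, Nat.abs_cast]
      have a3 := i.2.2
      exact mul_le_mul (by exact_mod_cast a3.le) (hθ j) (abs_nonneg _) (by positivity))
    (fun i j => by
      rw [abs_mul, abs_mul, Nat.abs_cast, Nat.abs_cast]
      have a2 : (((r j).2 : ℕ) : ℝ) ≤ R₂ := by exact_mod_cast (r j).2.2.le
      have a3 : ((i.2 : ℕ) : ℝ) ≤ L := by exact_mod_cast i.2.2.le
      calc 2 * (((i.2 : ℕ) : ℝ) * (((r j).2 : ℕ) * |Λ|)) * Real.exp ((K * L : ℕ))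
          ≤ 2 * ((L : ℝ) * (R₂ * Real.exp (-(2 * (K * L))))) * Real.exp ((K * L : ℕ)) := by gcongr
        _ = 2 * ((L : ℝ) * R₂) * Real.exp (-(K * L)) := by
          rw [show -((2 : ℝ) * (K * L)) = -(K * L) + -(K * L : ℕ) by push_cast; ring, Real.exp_add,
            Real.exp_neg ((K * L : ℕ) : ℝ)]
          field_simp
        _ ≤ 1 := by
          rw [Real.exp_neg, ← div_eq_mul_inv, div_le_one (Real.exp_pos _)]
          exact hLR)
    (fun i j => by
      rw [tsum_ite_eq, mul_assoc, mul_assoc, ← mul_assoc (α ^ _), hpow, hexp, ← Real.exp_nat_mul,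
        mul_add]
      simp [x])
    (fun s => Submodule.span ℝ {fun i => ∑ t ∈ range (s + 1),
      (if t = (i.1 : ℕ) then 1 else 0) * (((i.2 : ℕ) * τ) ^ (s - t) / (s - t)!)})
    (fun s _ => (finrank_span_le_card _).trans (by simp))
    (fun s _ j => by
      rw [Submodule.mem_span_singleton]
      refine ⟨x j ^ s, ?_⟩
      ext i
      rw [Pi.smul_apply, smul_eq_mul, mul_sum]
      refine sum_congr rfl fun t ht => ?_
      have hts : s = t + (s - t) := by have := mem_range.mp ht; omega
      split_ifs with h
      · rw [← h]
        conv_lhs => rw [hts, pow_add, add_tsub_cancel_left]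
        ring
      · simp)
    (by push_cast; exact hmain)
  rw [← key]
  congr 1
  ext i j
  simp only [Matrix.of_apply]
  rw [mul_assoc, mul_assoc, ← mul_assoc (α ^ _), hpow]
  push_cast
  ring

open Finset Polynomial in
theorem eq_zero_of_sum_mul_pow_eq_zero {K : ℕ} {a : Fin K → ℝ}
    (h : ∀ x : ℝ, ∑ p, a p * x ^ (p : ℕ) = 0) : a = 0 := by
  have h0 : (∑ p : Fin K, C (a p) * X ^ (p : ℕ) : ℝ[X]) = 0 := Polynomial.funext fun x => by
    simpa [eval_finsetSum] using h x
  ext p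
  have := congrArg (fun P => P.coeff (p : ℕ)) h0
  simp only [finsetSum_coeff, coeff_C_mul_X_pow, coeff_zero] at this
  rw [sum_eq_single p (fun b _ hb => if_neg fun h => hb (Fin.ext h.symm)) (by simp)] at this
  simpa using this

open Polynomial in
theorem natDegree_coeff_pow_le {R : Type*} [CommRing R] {p : R[X][X]} {a : ℕ}
    (hp : ∀ n, (p.coeff n).natDegree ≤ a) (j : ℕ) : ∀ n, ((p ^ j).coeff n).natDegree ≤ j * a := by
  induction j with
  | zero =>
    intro n
    rw [pow_zero, coeff_one]
    split_ifs <;> simp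
  | succ j ih =>
    intro n
    rw [pow_succ]
    exact (natDegree_coeff_mul_le ih hp n).trans (by nlinarith)

open Finset Polynomial in
/-- The zero estimate for exponential polynomials in three logarithms. -/
theorem exists_int_of_sum_eq_zero {K L R₁ R₂ R₃ A₁ A₂ A₃ B₁ B₂ B₃ X a b : ℕ} {α β δ : ℝ}
    (hα : 0 < α) (hα1 : α ≠ 1) (hβ : 0 < β) (hδ : 0 < δ) {w : Fin K × Fin K × Fin L → ℝ}
    (hw0 : w ≠ 0)
    (hw : ∀ r₁ r₂ r₃ : ℕ, r₁ < R₁ → r₂ < R₂ → r₃ < R₃ →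
      ∑ i, w i * (((r₁ : ℝ) - a * r₃) ^ (i.1 : ℕ) * ((r₂ : ℝ) - b * r₃) ^ (i.2.1 : ℕ) *
        (α ^ r₁ * β ^ r₂ * δ ^ r₃) ^ (i.2.2 : ℕ)) = 0)
    (hX₁ : ∀ r₁ r₃ : ℕ, r₁ < R₁ → r₃ < R₃ → |(r₁ : ℤ) - a * r₃| ≤ X)
    (h1 : A₁ + B₁ + L ≤ R₁) (h2 : A₂ + B₂ ≤ R₂) (h3 : A₃ + B₃ ≤ R₃) (hA₃ : 0 < A₃)
    (hA12 : 2 * K * L < A₁ * A₂) (hA3 : 2 * K * L < A₃ * min A₁ A₂)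
    (hB : 2 * (2 * K * L) ^ 2 < B₁ * B₂ * B₃) (ha : B₁ ≤ a) :
    ∃ c d e : ℤ, (c ≠ 0 ∨ d ≠ 0) ∧ e + d * a = c * b ∧
      d.natAbs * A₁ ≤ 2 * K * L ∧ c.natAbs * A₂ ≤ 2 * K * L ∧ e.natAbs * A₃ ≤ 2 * K * L := by
  set ξ : ℝ := ((2 * X + 1 : ℕ) : ℝ) with hξ
  let P : Fin L → ℝ[X][X] := fun q => ∑ p₁ : Fin K, ∑ p₂ : Fin K, C (C (w (p₁, p₂, q))) *
    ((C Polynomial.X - C (C ξ) * Polynomial.X) ^ (p₁ : ℕ) * Polynomial.X ^ (p₂ : ℕ))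
  have hPeval : ∀ q x₁ x₂, (P q).evalEval (x₁ + ξ * x₂) x₂ =
      ∑ p₁ : Fin K, ∑ p₂ : Fin K, w (p₁, p₂, q) * (x₁ ^ (p₁ : ℕ) * x₂ ^ (p₂ : ℕ)) := by
    intro q x₁ x₂
    simp only [P, evalEval_finsetSum, evalEval_mul, evalEval_pow, evalEval_sub,
      evalEval_C, evalEval_X, eval_X, eval_C, add_sub_cancel_right]
  have hP : P ≠ 0 := by
    intro h0
    apply hw0
    ext ⟨p₁, p₂, q⟩
    have h4 : ∀ x₁ x₂ : ℝ, ∑ p₁ : Fin K, (∑ p₂ : Fin K, w (p₁, p₂, q) * x₂ ^ (p₂ : ℕ)) *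
        x₁ ^ (p₁ : ℕ) = 0 := fun x₁ x₂ => by
      have := hPeval q x₁ x₂
      rw [h0] at this
      simp only [Pi.zero_apply, evalEval_zero] at this
      rw [this]
      refine sum_congr rfl fun p _ => ?_
      rw [sum_mul]
      exact sum_congr rfl fun p' _ => by ring
    have h5 : ∀ x₂ : ℝ, ∑ p₂ : Fin K, w (p₁, p₂, q) * x₂ ^ (p₂ : ℕ) = 0 := fun x₂ =>
      congrFun (eq_zero_of_sum_mul_pow_eq_zero fun x₁ => h4 x₁ x₂) p₁
    exact congrFun (eq_zero_of_sum_mul_pow_eq_zero h5) p₂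
  have hbase : ∀ n,
      ((C Polynomial.X - C (C ξ) * Polynomial.X : ℝ[X][X]).coeff n).natDegree ≤ 1 := by
    intro n
    rw [coeff_sub, coeff_C, coeff_C_mul, coeff_X]
    refine (natDegree_sub_le _ _).trans (max_le ?_ ?_)
    · split_ifs <;> simp
    · split_ifs <;> simp
  have hbase' : (C Polynomial.X - C (C ξ) * Polynomial.X : ℝ[X][X]).natDegree ≤ 1 := by
    refine (natDegree_sub_le _ _).trans (max_le (by simp) ?_)
    exact natDegree_C_mul_le _ _ |>.trans natDegree_X_le
  obtain ⟨Q, hQ, hQd, hQc, hQv⟩ := exists_bivariate_of_vanishing (K := 2 * K) P hP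
    (fun q => natDegree_sum_le_of_forall_le _ _ fun p₁ _ =>
      natDegree_sum_le_of_forall_le _ _ fun p₂ _ => by
        refine (natDegree_C_mul_le _ _).trans (natDegree_mul_le.trans ?_)
        have e1 := natDegree_pow_le_of_le (p₁ : ℕ) hbase'
        have e2 := natDegree_X_pow_le (R := ℝ[X]) (p₂ : ℕ)
        have := p₁.2
        have := p₂.2
        omega)
    (fun q n => by
      simp only [P, finsetSum_coeff]
      refine natDegree_sum_le_of_forall_le _ _ fun p₁ _ =>
        natDegree_sum_le_of_forall_le _ _ fun p₂ _ => ?_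
      rw [coeff_C_mul]
      refine (natDegree_C_mul_le _ _).trans ?_
      have e1 := natDegree_coeff_pow_le hbase (p₁ : ℕ)
      have e2 : ∀ m, (((Polynomial.X : ℝ[X][X]) ^ (p₂ : ℕ)).coeff m).natDegree ≤ 0 := fun m => by
        rw [coeff_X_pow]
        split_ifs <;> simp
      refine (natDegree_coeff_mul_le e1 e2 n).trans ?_
      have := p₁.2
      omega) hα hα1 1
  set D := 2 * K * L with hD
  have hDL : L * (2 * K) = D := by rw [hD]; ring
  rw [hDL] at hQd hQc
  have hvan : ∀ r₁ r₂ r₃ : ℕ, r₁ + L ≤ R₁ → r₂ < R₂ → r₃ < R₃ →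
      Q.evalEval (((r₁ : ℝ) - a * r₃) + ξ * (r₂ - b * r₃)) ((r₂ : ℝ) - b * r₃) = 0 := by
    intro r₁ r₂ r₃ hr1 hr2 hr3
    refine hQv _ _ (α ^ r₁ * β ^ r₂ * δ ^ r₃) (by positivity) fun i hi => ?_
    rw [← hw (r₁ + i) r₂ r₃ (by omega) hr2 hr3, Fintype.sum_prod_type]
    simp_rw [Fintype.sum_prod_type]
    have hswap : ∀ f : Fin K → Fin K → Fin L → ℝ,
        ∑ p₁, ∑ p₂, ∑ q, f p₁ p₂ q = ∑ q, ∑ p₁, ∑ p₂, f p₁ p₂ q := fun f => by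
      exact (sum_congr rfl fun _ _ => sum_comm).trans sum_comm
    rw [hswap]
    refine sum_congr rfl fun q _ => ?_
    rw [show (r₁ : ℝ) - a * r₃ + ξ * (r₂ - b * r₃) + i * 1 =
      (((r₁ + i : ℕ) : ℝ) - a * r₃) + ξ * (r₂ - b * r₃) by push_cast; ring, hPeval, sum_mul]
    refine sum_congr rfl fun p₁ _ => ?_
    rw [sum_mul]
    refine sum_congr rfl fun p₂ _ => ?_
    rw [pow_add]
    ring
  let pt : ℕ × ℕ × ℕ → ℝ × ℝ := fun r =>
    (((r.1 : ℝ) - a * r.2.2) + ξ * (r.2.1 - b * r.2.2), (r.2.1 : ℝ) - b * r.2.2)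
  have hpt : ∀ r r', pt r + pt r' = pt (r.1 + r'.1, r.2.1 + r'.2.1, r.2.2 + r'.2.2) := by
    intro r r'
    ext <;> simp only [pt, Prod.fst_add, Prod.snd_add] <;> push_cast <;> ring
  let A := (range A₁ ×ˢ range A₂ ×ˢ range A₃).image pt
  let B := (range B₁ ×ˢ range B₂ ×ˢ range B₃).image pt
  have hA0 : 0 < A₁ ∧ 0 < A₂ := by
    constructor <;> rw [Nat.pos_iff_ne_zero] <;> rintro rfl <;> simp at hA12
  have hfst : ∀ r ∈ range B₁ ×ˢ range B₂ ×ˢ range B₃, ∀ r' ∈ range B₁ ×ˢ range B₂ ×ˢ range B₃,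
      (pt r).1 = (pt r').1 → r = r' := by
    rintro ⟨r₁, r₂, r₃⟩ hr ⟨s₁, s₂, s₃⟩ hs h
    simp only [mem_product, mem_range] at hr hs
    simp only [pt, hξ] at h
    have h' : (r₁ : ℤ) - a * r₃ + (2 * X + 1 : ℕ) * (r₂ - b * r₃) =
        (s₁ : ℤ) - a * s₃ + (2 * X + 1 : ℕ) * (s₂ - b * s₃) := by exact_mod_cast h
    have e1 := abs_le.mp (hX₁ r₁ r₃ (by omega) (by omega))
    have e2 := abs_le.mp (hX₁ s₁ s₃ (by omega) (by omega))
    have hdvd : ((2 * X + 1 : ℕ) : ℤ) ∣ ((r₁ : ℤ) - a * r₃) - (s₁ - a * s₃) :=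
      ⟨(s₂ - b * s₃) - (r₂ - b * r₃), by linarith⟩
    have hx1 : ((r₁ : ℤ) - a * r₃) - (s₁ - a * s₃) = 0 := by
      refine Int.eq_zero_of_abs_lt_dvd hdvd ?_
      rw [abs_lt]
      push_cast
      constructor <;> linarith [e1.1, e1.2, e2.1, e2.2]
    have hr13 : (r₁ : ℤ) - s₁ = a * (r₃ - s₃) := by linarith
    have h33 : (r₃ : ℤ) - s₃ = 0 := by
      by_contra hne
      have : (a : ℤ) ≤ |(r₁ : ℤ) - s₁| := by
        rw [hr13, abs_mul, Nat.abs_cast]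
        exact le_mul_of_one_le_right (by positivity) (Int.one_le_abs hne)
      have h7 : |(r₁ : ℤ) - s₁| < B₁ := by
        rw [abs_lt]
        constructor <;> omega
      omega
    have h11 : (r₁ : ℤ) - s₁ = 0 := by rw [hr13, h33, mul_zero]
    have h22 : ((2 * X + 1 : ℕ) : ℤ) * (r₂ - s₂) = 0 := by
      have h33' : (r₃ : ℤ) = s₃ := by omega
      have h11' : (r₁ : ℤ) = s₁ := by omega
      rw [h33', h11'] at h'
      linarith
    have h22' : (r₂ : ℤ) - s₂ = 0 := by
      rcases mul_eq_zero.mp h22 with h | h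
      · omega
      · exact h
    ext <;> simp only <;> omega
  obtain ⟨p, hp, hcard⟩ := exists_functional_card_le hQ hQd hQc (A := A) (B := B)
    (by
      refine mem_image.mpr ⟨(0, 0, 0), ?_, by simp [pt]⟩
      simp only [mem_product, mem_range]
      exact ⟨hA0.1, hA0.2, hA₃⟩)
    (by
      intro x hx y hy hxy
      simp only [B, coe_image, Set.mem_image, mem_coe] at hx hy
      obtain ⟨r, hr, rfl⟩ := hx
      obtain ⟨s, hs, rfl⟩ := hy
      rw [hfst r hr s hs hxy])
    (by
      rw [card_image_of_injOn fun r hr s hs h => hfst r hr s hs (by rw [h]), card_product,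
        card_product, card_range, card_range, card_range, ← mul_assoc]
      exact hB)
    (by
      intro g hg x hx
      obtain ⟨r, hr, rfl⟩ := mem_image.mp hg
      obtain ⟨s, hs, rfl⟩ := mem_image.mp hx
      simp only [mem_product, mem_range] at hr hs
      rw [← Prod.fst_add, ← Prod.snd_add, hpt]
      exact hvan _ _ _ (by simp only; omega) (by simp only; omega) (by simp only; omega))
  have himg : (A.image fun g => p.1 * g.1 + p.2 * g.2) =
      (range A₁ ×ˢ range A₂ ×ˢ range A₃).image fun r => p.1 * ((r.1 : ℝ) + ((-a : ℤ) : ℝ) * r.2.2) +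
        (p.1 * ξ + p.2) * (r.2.1 + ((-b : ℤ) : ℝ) * r.2.2) := by
    rw [image_image]
    refine image_congr fun r _ => ?_
    simp only [Function.comp, pt]
    push_cast
    ring
  rw [himg] at hcard
  have hp' : p.1 ≠ 0 ∨ p.1 * ξ + p.2 ≠ 0 := by
    by_contra! h
    apply hp
    have := h.2
    rw [h.1, zero_mul, zero_add] at this
    exact Prod.ext h.1 this
  obtain ⟨c, d, e, hcd, he, hd1, hc1, he1⟩ := exists_int_of_card_le hp' hA12 hA3 hA₃ hcard
  exact ⟨c, d, e, hcd, by rw [he]; ring, hd1, hc1, he1⟩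

theorem log_silver_gt : 0.859 < Real.log silver := by
  have h1 : silver = 2 * (silver / 2) := by ring
  have h2 := silver_gt
  rw [h1, Real.log_mul (by norm_num) (by positivity)]
  have h3 := Real.log_two_gt_d9
  have h4 := Real.one_sub_inv_le_log_of_pos (x := silver / 2) (by positivity)
  have h5 : (silver / 2)⁻¹ ≤ 0.8334 := by
    rw [inv_le_comm₀ (by linarith) (by norm_num)]
    norm_num
    linarith
  linarith

theorem log_silver_lt : Real.log silver < 0.901 := by
  have h1 : silver = 2 * (silver / 2) := by ring
  have h2 := silver_lt
  have h0 := silver_pos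
  rw [h1, Real.log_mul (by norm_num) (by positivity)]
  have h3 := Real.log_two_lt_d9
  have h4 := Real.log_le_sub_one_of_pos (x := silver / 2) (by positivity)
  linarith

theorem log_sqrt_two_sub_one : Real.log (√2 - 1) = -Real.log silver := by
  rw [← Real.log_inv]
  congr 1
  refine eq_inv_of_mul_eq_one_left ?_
  rw [silver]
  linear_combination sqrt_two_sq

theorem IsDom.log_pos {k : ℕ} {α : ℝ} (h : IsDom k α) : 0 < Real.log α := Real.log_pos h.one_lt

theorem IsDom.log_lt {k : ℕ} {α : ℝ} (h : IsDom k α) : Real.log α < 0.6932 := by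
  have := Real.log_lt_log h.pos h.lt
  have := Real.log_two_lt_d9
  linarith

open Finset Nat in
/-- A lower bound for a linear form in three logarithms `a log α + log δ - b log (1 + √2)`, unless
the coefficients satisfy a linear relation with small coefficients. -/
theorem exp_neg_le_abs_of_three_logs {k : ℕ} {α δ M : ℝ} {num den : MvPolynomial (Fin 2) ℤ}
    (hα : IsDom k α) (hδ : IsFrac k α δ M num den) (hδ0 : 0 < δ) {h : ℝ} (hh : M ≤ Real.exp h)
    {a b K L L₁ R₁ R₂ R₃ A₁ A₂ A₃ B₁ B₂ B₃ X : ℕ} (hK : 0 < K) (hL : L = 2 * L₁) (hL₁ : 0 < L₁)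
    {Λ Y w : ℝ} (hΛ : a * Real.log α + Real.log δ - b * Real.log silver = Λ)
    (hX : 1 ≤ X) (hX₁ : ∀ r₁ r₃ : ℕ, r₁ < R₁ → r₃ < R₃ → |(r₁ : ℤ) - a * r₃| ≤ X)
    (hX₂ : ∀ r₂ r₃ : ℕ, r₂ < R₂ → r₃ < R₃ → |(r₂ : ℤ) - b * r₃| ≤ X)
    (hw : ∀ r₁ r₂ r₃ : ℕ, r₁ < R₁ → r₂ < R₂ → r₃ < R₃ →
      |((r₁ : ℝ) - a * r₃) * Real.log α - (r₂ - b * r₃) * Real.log silver| ≤ w)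
    (h1 : A₁ + B₁ + L ≤ R₁) (h2 : A₂ + B₂ ≤ R₂) (h3 : A₃ + B₃ ≤ R₃) (hA₃ : 0 < A₃)
    (hA12 : 2 * K * L < A₁ * A₂) (hA3 : 2 * K * L < A₃ * min A₁ A₂)
    (hB : 2 * (2 * K * L) ^ 2 < B₁ * B₂ * B₃) (ha : B₁ ≤ a)
    (hY : 2 * (K * K * L) * (7 * X : ℝ) ^ (2 * K) ≤ Real.exp Y)
    (hLR : 2 * (L * R₃) ≤ Real.exp (K * L₁))
    (hmain : (2 * k + 3) * Y + 3 * (L * w) + (2 * k + 2) * (L * R₂ + h * (L * R₃)) +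
      3 * (L * R₁) < ((K * L₁ : ℝ) - 1) / 2) :
    Real.exp (-(2 * (K * L₁))) < |Λ| ∨ ∃ c d e : ℤ, (c ≠ 0 ∨ d ≠ 0) ∧ e + d * a = c * b ∧
      d.natAbs * A₁ ≤ 2 * K * L ∧ c.natAbs * A₂ ≤ 2 * K * L ∧ e.natAbs * A₃ ≤ 2 * K * L := by
  by_contra! hcon
  obtain ⟨hΛ', hcon⟩ := hcon
  have hα0 := hα.pos
  have hα1 := hα.one_lt
  have hsq : 0 < √2 - 1 := by have := sqrt_two_gt; linarith
  have hL0 : 0 < L := by omega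
  set lα := Real.log α with hlα
  set lγ := Real.log silver with hlγ
  have hlα0 : 0 < lα := hα.log_pos
  have hlα1 : lα < 0.6932 := hα.log_lt
  have hlγ0 : 0.859 < lγ := log_silver_gt
  have hlγ1 : lγ < 0.901 := log_silver_lt
  obtain ⟨r, hr⟩ := exists_det_ne_zero
    (fun (r : Fin R₁ × Fin R₂ × Fin R₃) (i : Fin K × Fin K × Fin L) =>
      (((r.1 : ℕ) : ℝ) - a * (r.2.2 : ℕ)) ^ (i.1 : ℕ) *
      (((r.2.1 : ℕ) : ℝ) - b * (r.2.2 : ℕ)) ^ (i.2.1 : ℕ) *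
        (α ^ (r.1 : ℕ) * (√2 - 1) ^ (r.2.1 : ℕ) * δ ^ (r.2.2 : ℕ)) ^ (i.2.2 : ℕ))
    (fun v hv => by
      by_contra hv0
      obtain ⟨c, d, e, hcd, he, hd1, hc1, he1⟩ := exists_int_of_sum_eq_zero hα0 hα1.ne' hsq hδ0 hv0
        (fun r₁ r₂ r₃ hr1 hr2 hr3 => hv (⟨r₁, hr1⟩, ⟨r₂, hr2⟩, ⟨r₃, hr3⟩)) hX₁ h1 h2 h3 hA₃ hA12 hA3
        hB ha
      have := hcon c d e hcd he hd1 hc1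
      omega)
  apply hr
  have hne : Nonempty (Fin K × Fin K × Fin L) := ⟨(⟨0, hK⟩, ⟨0, hK⟩, ⟨0, hL0⟩)⟩
  have hcard : Fintype.card (Fin K × Fin K × Fin L) = K * K * L := by simp [mul_assoc]
  let x₁ : Fin K × Fin K × Fin L → ℝ := fun j => (((r j).1 : ℕ) : ℝ) - a * ((r j).2.2 : ℕ)
  let x₂ : Fin K × Fin K × Fin L → ℝ := fun j => (((r j).2.1 : ℕ) : ℝ) - b * ((r j).2.2 : ℕ)
  let θ : Fin K × Fin K × Fin L → ℝ := fun j => x₁ j * lα - x₂ j * lγ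
  have hx₁ : ∀ j, |x₁ j| ≤ X := fun j => by
    have := hX₁ _ _ (r j).1.2 (r j).2.2.2
    simp only [x₁]
    exact_mod_cast this
  have hx₂ : ∀ j, |x₂ j| ≤ X := fun j => by
    have := hX₂ _ _ (r j).2.1.2 (r j).2.2.2
    simp only [x₂]
    exact_mod_cast this
  have hθ : ∀ j, |θ j| ≤ w := fun j => hw _ _ _ (r j).1.2 (r j).2.1.2 (r j).2.2.2
  have hX1 : (1 : ℝ) ≤ X := by exact_mod_cast hX
  have hθX : ∀ j, |θ j| ≤ 1.61 * X := fun j => by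
    refine (abs_sub _ _).trans ?_
    rw [abs_mul, abs_mul, abs_of_pos hlα0, abs_of_pos (a := lγ) (by linarith)]
    have e1 := mul_le_mul (hx₁ j) hlα1.le hlα0.le (by linarith)
    have e2 := mul_le_mul (hx₂ j) hlγ1.le (by linarith) (by linarith)
    linarith
  have hpow : ∀ i j : Fin K × Fin K × Fin L,
      α ^ (((r j).1 : ℕ) * (i.2.2 : ℕ) : ℤ) * (√2 - 1) ^ (((r j).2.1 : ℕ) * (i.2.2 : ℕ)) *
      δ ^ (((r j).2.2 : ℕ) * (i.2.2 : ℕ)) =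
      (α ^ ((r j).1 : ℕ) * (√2 - 1) ^ ((r j).2.1 : ℕ) * δ ^ ((r j).2.2 : ℕ)) ^ (i.2.2 : ℕ) :=
    fun i j => by
      rw [zpow_mul, zpow_natCast, zpow_natCast, pow_mul, pow_mul]
      ring
  have hexp : ∀ j, α ^ ((r j).1 : ℕ) * (√2 - 1) ^ ((r j).2.1 : ℕ) * δ ^ ((r j).2.2 : ℕ) =
      Real.exp (θ j + ((r j).2.2 : ℕ) * Λ) := fun j => by
    have e1 : α = Real.exp lα := (Real.exp_log hα0).symm
    have e2 : √2 - 1 = Real.exp (-lγ) := by rw [← log_sqrt_two_sub_one, Real.exp_log hsq]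
    have e3 : δ = Real.exp (Λ - a * lα + b * lγ) := by
      rw [← hΛ]
      ring_nf
      exact (Real.exp_log hδ0).symm
    conv_lhs => rw [e1, e2, e3]
    rw [← Real.exp_nat_mul, ← Real.exp_nat_mul, ← Real.exp_nat_mul, ← Real.exp_add, ← Real.exp_add]
    congr 1
    simp only [θ, x₁, x₂]
    ring
  let c : (Fin K × Fin K × Fin L) → (Fin K × Fin K × Fin L) → ℕ → ℝ := fun i j t =>
    x₁ j ^ (i.1 : ℕ) * (1 / lγ) ^ (i.2.1 : ℕ) *
      ((-θ j) ^ t * (x₁ j * lα) ^ ((i.2.1 : ℕ) - t) * ((i.2.1 : ℕ).choose t : ℕ))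
  have hc : ∀ i j, HasSum (c i j) (x₁ j ^ (i.1 : ℕ) * x₂ j ^ (i.2.1 : ℕ)) := fun i j => by
    have : x₁ j ^ (i.1 : ℕ) * x₂ j ^ (i.2.1 : ℕ) = ∑ t ∈ range ((i.2.1 : ℕ) + 1), c i j t := by
      simp only [c]
      rw [← mul_sum, ← add_pow, mul_assoc, ← mul_pow]
      congr 2
      simp only [θ]
      field_simp
      ring
    rw [this]
    refine hasSum_sum_of_ne_finset_zero fun t ht => ?_
    simp only [c]
    rw [Nat.choose_eq_zero_of_lt (by have := mt mem_range.mpr ht; omega)]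
    simp
  have hcE : ∀ i j, HasSum (fun t => Real.exp 1 ^ t * |c i j t|) (|x₁ j| ^ (i.1 : ℕ) *
      (1 / lγ * (Real.exp 1 * |θ j| + |x₁ j * lα|)) ^ (i.2.1 : ℕ)) := fun i j => by
    have : |x₁ j| ^ (i.1 : ℕ) * (1 / lγ * (Real.exp 1 * |θ j| + |x₁ j * lα|)) ^ (i.2.1 : ℕ) =
        ∑ t ∈ range ((i.2.1 : ℕ) + 1), Real.exp 1 ^ t * |c i j t| := by
      simp only [c]
      rw [mul_pow, add_pow, mul_sum, mul_sum]
      refine sum_congr rfl fun t _ => ?_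
      simp only [abs_mul, abs_pow, abs_neg, Nat.abs_cast, abs_of_pos (a := 1 / lγ) (by positivity)]
      ring
    rw [this]
    refine hasSum_sum_of_ne_finset_zero fun t ht => ?_
    simp only [c]
    rw [Nat.choose_eq_zero_of_lt (by have := mt mem_range.mpr ht; omega)]
    simp
  have hcB : ∀ i j : Fin K × Fin K × Fin L, |x₁ j| ^ (i.1 : ℕ) *
      (1 / lγ * (Real.exp 1 * |θ j| + |x₁ j * lα|)) ^ (i.2.1 : ℕ) ≤ (7 * X : ℝ) ^ (2 * K) := by
    intro i j
    have e1 : 1 / lγ * (Real.exp 1 * |θ j| + |x₁ j * lα|) ≤ 7 * X := by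
      rw [one_div, inv_mul_le_iff₀ (by linarith), abs_mul, abs_of_pos hlα0]
      have e2 := mul_le_mul Real.exp_one_lt_d9.le (hθX j) (abs_nonneg _) (by norm_num)
      have e3 := mul_le_mul (hx₁ j) hlα1.le hlα0.le (by linarith)
      nlinarith
    have e0 : 0 ≤ 1 / lγ * (Real.exp 1 * |θ j| + |x₁ j * lα|) := by positivity
    have e2 : |x₁ j| ≤ 7 * X := (hx₁ j).trans (by linarith)
    rw [two_mul, pow_add]
    refine mul_le_mul ?_ ?_ (by positivity) (by positivity)
    · exact (pow_le_pow_left₀ (abs_nonneg _) e2 _).trans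
        (pow_le_pow_right₀ (by linarith) i.1.2.le)
    · exact (pow_le_pow_left₀ e0 e1 _).trans (pow_le_pow_right₀ (by linarith) i.2.1.2.le)
  have hw0 : 0 ≤ w := (abs_nonneg _).trans (hθ (Classical.choice hne))
  have key := det_eq_zero_of_series hα hδ (ι := Fin K × Fin K × Fin L) (K := 2 * K) (J := K * L₁)
    (by rw [hcard, hL]; ring) (A₀ := L * R₁) (G₀ := L * R₂)
    (D₀ := L * R₃) (X := (X : ℝ) ^ (2 * K)) (B := (7 * X : ℝ) ^ (2 * K)) (w := L * w)
    (Y := Y) (h := h) (one_le_pow₀ hX1)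
    (pow_le_pow_left₀ (by linarith) (by linarith) _)
    (by
      rw [hcard]
      push_cast
      exact hY) hh
    (fun i j => (((r j).1 : ℕ) - a * ((r j).2.2 : ℕ)) ^ (i.1 : ℕ) *
      (((r j).2.1 : ℕ) - b * ((r j).2.2 : ℕ)) ^ (i.2.1 : ℕ))
    (fun i j => ((r j).1 : ℕ) * (i.2.2 : ℕ))
    (fun i j => (r j).2.1 * (i.2.2 : ℕ))
    (fun i j => (r j).2.2 * (i.2.2 : ℕ))
    (fun i j => by
      push_cast
      rw [abs_mul, abs_pow, abs_pow, two_mul, pow_add]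
      refine mul_le_mul ?_ ?_ (by positivity) (by positivity)
      · exact (pow_le_pow_left₀ (abs_nonneg _) (hx₁ j) _).trans (pow_le_pow_right₀ hX1 i.1.2.le)
      · exact (pow_le_pow_left₀ (abs_nonneg _) (hx₂ j) _).trans (pow_le_pow_right₀ hX1 i.2.1.2.le))
    (fun i j => by
      rw [abs_mul, Nat.abs_cast, Nat.abs_cast, mul_comm]
      exact_mod_cast Nat.mul_le_mul i.2.2.2.le (r j).1.2.le)
    (fun i j => by
      rw [mul_comm]
      exact Nat.mul_le_mul i.2.2.2.le (r j).2.1.2.le)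
    (fun i j => by
      rw [mul_comm]
      exact Nat.mul_le_mul i.2.2.2.le (r j).2.2.2.le)
    c (fun i j => (i.2.2 : ℕ) * θ j) (fun i j => (i.2.2 : ℕ) * (((r j).2.2 : ℕ) * Λ))
    (fun i j => (hcE i j).summable)
    (fun i j => by
      rw [(hcE i j).tsum_eq]
      exact hcB i j)
    (fun i j => by
      rw [abs_mul, Nat.abs_cast]
      have a3 := i.2.2.2
      exact mul_le_mul (by exact_mod_cast a3.le) (hθ j) (abs_nonneg _) (by positivity))
    (fun i j => by
      rw [abs_mul, abs_mul, Nat.abs_cast, Nat.abs_cast]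
      have a2 : (((r j).2.2 : ℕ) : ℝ) ≤ R₃ := by exact_mod_cast (r j).2.2.2.le
      have a3 : ((i.2.2 : ℕ) : ℝ) ≤ L := by exact_mod_cast i.2.2.2.le
      calc 2 * (((i.2.2 : ℕ) : ℝ) * (((r j).2.2 : ℕ) * |Λ|)) * Real.exp ((K * L₁ : ℕ))
          ≤ 2 * ((L : ℝ) * (R₃ * Real.exp (-(2 * (K * L₁))))) * Real.exp ((K * L₁ : ℕ)) := by gcongr
        _ = 2 * ((L : ℝ) * R₃) * Real.exp (-(K * L₁)) := by
          rw [show -((2 : ℝ) * (K * L₁)) = -(K * L₁) + -(K * L₁ : ℕ) by push_cast; ring,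
            Real.exp_add, Real.exp_neg ((K * L₁ : ℕ) : ℝ)]
          field_simp
        _ ≤ 1 := by
          rw [Real.exp_neg, ← div_eq_mul_inv, div_le_one (Real.exp_pos _)]
          exact hLR)
    (fun i j => by
      rw [(hc i j).tsum_eq, mul_assoc, mul_assoc, ← mul_assoc (α ^ _), hpow, hexp,
        ← Real.exp_nat_mul, mul_add]
      simp [x₁, x₂])
    (fun s => Submodule.span ℝ (Set.range fun (τ : Fin (2 * K)) (i : Fin K × Fin K × Fin L) =>
      ∑ t ∈ range (s + 1), if (i.1 : ℕ) + (i.2.1 : ℕ) - t = τ then (1 / lγ) ^ (i.2.1 : ℕ) *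
        ((-1) ^ t * lα ^ ((i.2.1 : ℕ) - t) * ((i.2.1 : ℕ).choose t : ℕ)) *
          (((i.2.2 : ℕ) : ℝ) ^ (s - t) / (s - t)!) else 0))
    (fun s _ => (finrank_range_le_card _).trans (by simp))
    (fun s _ j => by
      rw [show (fun i => ∑ t ∈ range (s + 1), c i j t *
        (((i.2.2 : ℕ) * θ j) ^ (s - t) / (s - t)!)) =
        ∑ τ : Fin (2 * K), (θ j ^ s * x₁ j ^ (τ : ℕ)) • fun i : Fin K × Fin K × Fin L =>
          ∑ t ∈ range (s + 1), if (i.1 : ℕ) + (i.2.1 : ℕ) - t = τ then (1 / lγ) ^ (i.2.1 : ℕ) *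
          ((-1) ^ t * lα ^ ((i.2.1 : ℕ) - t) * ((i.2.1 : ℕ).choose t : ℕ)) *
          (((i.2.2 : ℕ) : ℝ) ^ (s - t) / (s - t)!) else 0 from ?_]
      · exact Submodule.sum_mem _ fun τ _ => Submodule.smul_mem _ _ (Submodule.subset_span ⟨τ, rfl⟩)
      · ext i
        simp only [Finset.sum_apply, Pi.smul_apply, smul_eq_mul, mul_sum]
        rw [sum_comm]
        refine sum_congr rfl fun t ht => ?_
        have hi1 := i.1.2
        have hi2 := i.2.1.2
        rw [sum_eq_single (⟨(i.1 : ℕ) + (i.2.1 : ℕ) - t, by omega⟩ : Fin (2 * K))]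
        · rw [if_pos rfl]
          have hts : s = t + (s - t) := by have := mem_range.mp ht; omega
          simp only [c]
          rcases le_or_gt t (i.2.1 : ℕ) with htp | htp
          · have e1 : θ j ^ s = θ j ^ t * θ j ^ (s - t) := by rw [← pow_add, ← hts]
            have e2 : (i.1 : ℕ) + (i.2.1 : ℕ) - t = i.1 + ((i.2.1 : ℕ) - t) := by omega
            rw [e1, e2, pow_add, neg_pow (θ j), mul_pow, mul_pow]
            ring
          · rw [Nat.choose_eq_zero_of_lt htp]
            simp
        · intro τ _ hτ
          rw [if_neg, mul_zero]
          intro h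
          exact hτ (Fin.ext h.symm)
        · simp)
    (by push_cast; exact hmain)
  rw [← key]
  congr 1
  ext i j
  simp only [Matrix.of_apply]
  rw [mul_assoc _ (_ ^ (_ : ℤ)), mul_assoc _ (_ * _), hpow]
  push_cast
  ring

theorem exists_silver_pow_eq (d : ℕ) : ∃ u v : ℤ, silver ^ d = u + v * √2 ∧
    (1 - √2) ^ d = (u - v * √2 : ℝ) := by
  induction d with
  | zero => exact ⟨1, 0, by simp, by simp⟩
  | succ d ih =>
    obtain ⟨u, v, h1, h2⟩ := ih
    refine ⟨u + 2 * v, u + v, ?_, ?_⟩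
    · rw [pow_succ, h1, silver]
      push_cast
      linear_combination (v : ℝ) * sqrt_two_sq
    · rw [pow_succ, h2]
      push_cast
      linear_combination (v : ℝ) * sqrt_two_sq

theorem goldenRatio_pow_ne_silver_pow {c d : ℕ} (hd : 0 < d) :
    Real.goldenRatio ^ c ≠ silver ^ d := by
  intro h
  have hs : silver * (1 - √2) = -1 := by
    rw [silver]
    linear_combination -sqrt_two_sq
  have h1 := Real.coe_fib_eq (2 * c)
  have h2 := pell_binet (2 * d)
  have e1 : (Real.goldenRatio ^ c) ^ 2 * (Real.goldenConj ^ c) ^ 2 = 1 := by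
    rw [← mul_pow, ← mul_pow, Real.goldenRatio_mul_goldenConj, ← pow_mul, mul_comm, pow_mul]
    norm_num
  have e2 : (silver ^ d) ^ 2 * ((1 - √2) ^ d) ^ 2 = 1 := by
    rw [← mul_pow, ← mul_pow, hs, ← pow_mul, mul_comm, pow_mul]
    norm_num
  rw [h] at e1
  have e3 : (Real.goldenConj ^ c) ^ 2 = ((1 - √2) ^ d) ^ 2 :=
    mul_left_cancel₀ (pow_ne_zero 2 (pow_ne_zero d silver_pos.ne')) (e1.trans e2.symm)
  have h3 : √5 * (Nat.fib (2 * c) : ℝ) = 2 * √2 * (pell (2 * d) : ℝ) := by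
    rw [h1, h2, mul_comm 2 c, mul_comm 2 d, pow_mul, pow_mul, pow_mul, pow_mul, ← e3, h]
    field_simp
  have h4 : (5 : ℝ) * (Nat.fib (2 * c) : ℝ) ^ 2 = 8 * (pell (2 * d) : ℝ) ^ 2 := by
    have h5 : √5 ^ 2 = (5 : ℝ) := Real.sq_sqrt (by norm_num)
    calc (5 : ℝ) * (Nat.fib (2 * c) : ℝ) ^ 2 = (√5 * (Nat.fib (2 * c) : ℝ)) ^ 2 := by
          rw [mul_pow, h5]
      _ = _ := by
        rw [h3]
        linear_combination 4 * (pell (2 * d) : ℝ) ^ 2 * sqrt_two_sq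
  have hp : (1 : ℤ) ≤ pell (2 * d) := by
    obtain ⟨j, rfl⟩ : ∃ j, d = j + 1 := ⟨d - 1, by omega⟩
    exact pell_pos (2 * j + 1)
  have hirr : Irrational √10 := by
    rw [show (10 : ℝ) = ((10 : ℕ) : ℝ) by norm_num, irrational_sqrt_natCast_iff]
    rintro ⟨r, hr⟩
    have : r < 4 := by nlinarith
    interval_cases r <;> omega
  refine hirr ⟨(2 * (pell (2 * d) : ℚ))⁻¹ * (5 * (Nat.fib (2 * c) : ℚ)), ?_⟩
  have hp' : (0 : ℝ) < pell (2 * d) := by exact_mod_cast hp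
  symm
  rw [Real.sqrt_eq_iff_mul_self_eq (by norm_num) (by positivity)]
  push_cast
  field_simp
  linear_combination -5 * h4

open Polynomial in
/-- The dominant root and the silver ratio are multiplicatively independent. -/
theorem IsDom.pow_ne_silver_pow {k : ℕ} {α : ℝ} (h : IsDom k α) {c d : ℕ} (hd : 0 < d) :
    α ^ c ≠ silver ^ d := by
  intro hcd
  have hα0 := h.pos
  have hα1 := h.one_lt
  have hγ1 : 1 < silver := by linarith [silver_gt]
  have hγd : 1 < silver ^ d := one_lt_pow₀ hγ1 hd.ne'
  have hc : c ≠ 0 := by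
    rintro rfl
    simp at hcd
    linarith
  obtain ⟨u, v, huv, huv'⟩ := exists_silver_pow_eq d
  have hs : silver ^ d * (1 - √2) ^ d = (-1) ^ d := by
    rw [← mul_pow, silver]
    congr 1
    linear_combination -sqrt_two_sq
  have hstep : aeval (α : ℝ) (stepPoly k) = 0 := by
    simp [stepPoly, h.pow_eq_sum]
  have hinteg : IsIntegral ℤ α := ⟨stepPoly k, stepPoly_monic k, hstep⟩
  set q : ℤ[X] := (X ^ c) ^ 2 - C (2 * u) * X ^ c + C ((-1) ^ d) with hq
  have hq0 : aeval α q = 0 := by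
    simp only [hq, map_add, map_sub, map_mul, map_pow, aeval_X, aeval_C, hcd]
    simp only [algebraMap_int_eq, eq_intCast]
    push_cast
    rw [← hs]
    have : (2 * u : ℝ) = silver ^ d + (1 - √2) ^ d := by rw [huv, huv']; ring
    rw [this]
    ring
  set P := minpoly ℤ α with hP
  have hPm : P.Monic := minpoly.monic hinteg
  have hd1 : P ∣ stepPoly k := minpoly.isIntegrallyClosed_dvd hinteg hstep
  have hd2 : P ∣ q := minpoly.isIntegrallyClosed_dvd hinteg hq0
  set Pc := P.map (Int.castRingHom ℂ) with hPc
  have hPcm : Pc.Monic := hPm.map _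
  have hroot : ∀ z ∈ Pc.roots, z = α ∨ ‖z‖ = α⁻¹ := by
    intro z hz
    have hz0 : eval₂ (Int.castRingHom ℂ) z P = 0 := by
      rw [← eval_map]
      exact (mem_roots'.mp hz).2
    have z1 : eval₂ (Int.castRingHom ℂ) z (stepPoly k) = 0 :=
      eval₂_eq_zero_of_dvd_of_eval₂_eq_zero _ _ hd1 hz0
    have z2 : eval₂ (Int.castRingHom ℂ) z q = 0 :=
      eval₂_eq_zero_of_dvd_of_eval₂_eq_zero _ _ hd2 hz0
    have z3 : z ^ k = ∑ i ∈ Finset.range k, z ^ i := by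
      rw [stepPoly, eval₂_sub, eval₂_finsetSum] at z1
      simp only [eval₂_X_pow] at z1
      exact sub_eq_zero.mp z1
    have z4 : (z ^ c - ((silver ^ d : ℝ) : ℂ)) * (z ^ c - (((1 - √2) ^ d : ℝ) : ℂ)) = 0 := by
      simp only [hq, eval₂_add, eval₂_sub, eval₂_mul, eval₂_pow, eval₂_X, eval₂_C] at z2
      rw [← z2]
      have e1 : ((silver ^ d : ℝ) : ℂ) + (((1 - √2) ^ d : ℝ) : ℂ) = 2 * u := by
        rw [huv, huv']
        push_cast
        ring
      have e2 : ((silver ^ d : ℝ) : ℂ) * (((1 - √2) ^ d : ℝ) : ℂ) = (-1) ^ d := by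
        rw [← Complex.ofReal_mul, hs]
        push_cast
        rfl
      simp only [eq_intCast]
      push_cast at e1 e2 ⊢
      linear_combination -z ^ c * e1 + e2
    by_cases hzα : z = α
    · exact Or.inl hzα
    right
    have hz1 := h.norm_root_le_one z3 hzα
    rcases mul_eq_zero.mp z4 with e | e
    · exfalso
      have e1 : ‖z‖ ^ c = silver ^ d := by
        rw [← norm_pow, sub_eq_zero.mp e, Complex.norm_real, Real.norm_eq_abs,
          abs_of_pos (by linarith)]
      have e2 := pow_le_one₀ (n := c) (norm_nonneg z) hz1
      linarith
    · have e1 : ‖z‖ ^ c = (α⁻¹) ^ c := by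
        rw [← norm_pow, sub_eq_zero.mp e, Complex.norm_real, Real.norm_eq_abs, inv_pow, hcd]
        refine eq_inv_of_mul_eq_one_right ?_
        rw [← abs_of_pos (a := silver ^ d) (by linarith), ← abs_mul, hs]
        simp
      exact (pow_left_inj₀ (norm_nonneg z) (by positivity) hc).mp e1
  have hsplit := IsAlgClosed.splits Pc
  have hcard : Pc.roots.card = P.natDegree := by
    rw [← hPm.natDegree_map (Int.castRingHom ℂ)]
    exact splits_iff_card_roots.mp hsplit
  have hαmem : (α : ℂ) ∈ Pc.roots := by
    rw [mem_roots hPcm.ne_zero, IsRoot, hPc, eval_map]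
    have : aeval ((algebraMap ℝ ℂ) α) P = 0 := by
      rw [aeval_algebraMap_apply, minpoly.aeval, map_zero]
    exact this
  have hsep : Pc.Separable := by
    have h1 : (minpoly ℚ α).Separable :=
      (minpoly.irreducible hinteg.tower_top).separable
    have h2 : Pc = (minpoly ℚ α).map (algebraMap ℚ ℂ) := by
      rw [minpoly.isIntegrallyClosed_eq_field_fractions' ℚ hinteg, map_map]
      rfl
    rw [h2]
    exact h1.map
  have hnodup : Pc.roots.Nodup := nodup_roots hsep
  have hcoeff : Pc.coeff 0 = (-1) ^ P.natDegree * Pc.roots.prod := by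
    rw [← hPm.natDegree_map (Int.castRingHom ℂ)]
    exact hsplit.coeff_zero_eq_prod_roots_of_monic hPcm
  obtain ⟨s, hs'⟩ := Multiset.exists_cons_of_mem hαmem
  have hs1 : ∀ z ∈ s, ‖z‖ = α⁻¹ := by
    intro z hz
    rcases hroot z (by rw [hs']; exact Multiset.mem_cons_of_mem hz) with e | e
    · exfalso
      rw [hs', Multiset.nodup_cons] at hnodup
      exact hnodup.1 (e ▸ hz)
    · exact e
  have hprod : ‖s.prod‖ = (α⁻¹) ^ Multiset.card s := by
    have e1 := Multiset.prod_hom s (normHom : ℂ →*₀ ℝ)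
    have e2 : s.map (normHom : ℂ →*₀ ℝ) = Multiset.replicate s.card α⁻¹ := by
      rw [← Multiset.map_const']
      exact Multiset.map_congr rfl hs1
    rw [e2, Multiset.prod_replicate] at e1
    exact e1.symm
  have hN : |(P.coeff 0 : ℝ)| = α * (α⁻¹) ^ Multiset.card s := by
    have e1 : Pc.coeff 0 = ((P.coeff 0 : ℝ) : ℂ) := by simp [hPc]
    rw [← Real.norm_eq_abs, ← Complex.norm_real, ← e1, hcoeff, hs', Multiset.prod_cons, norm_mul,
      norm_mul, hprod, Complex.norm_real, Real.norm_eq_abs, abs_of_pos hα0]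
    simp
  have hdeg : P.natDegree = s.card + 1 := by rw [← hcard, hs', Multiset.card_cons]
  have hN1 : 1 ≤ |(P.coeff 0 : ℝ)| := by
    have : P.coeff 0 ≠ 0 := by
      intro h0
      rw [h0] at hN
      have : 0 < α * (α⁻¹) ^ Multiset.card s := by positivity
      simp at hN
      rcases hN with hN | hN <;> linarith
    exact_mod_cast Int.one_le_abs this
  have hle : Multiset.card s ≤ 1 := by
    by_contra! hlt
    rw [hN] at hN1
    have e1 : (α⁻¹) ^ Multiset.card s ≤ (α⁻¹) ^ 2 :=
      pow_le_pow_of_le_one (by positivity) (inv_le_one_of_one_le₀ hα1.le) hlt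
    have e2 : α * (α⁻¹) ^ Multiset.card s ≤ α * (α⁻¹) ^ 2 := by gcongr
    have e3 : α * (α⁻¹) ^ 2 = α⁻¹ := by field_simp
    have e4 : α⁻¹ < 1 := inv_lt_one_of_one_lt₀ hα1
    linarith
  have hα2 := h.lt
  have hα3 := h.gt
  rcases Nat.lt_or_ge (Multiset.card s) 1 with hs0 | hs0
  · have e0 : Multiset.card s = 0 := by omega
    rw [e0, pow_zero, mul_one] at hN
    have e1 : (1 : ℝ) < |(P.coeff 0 : ℝ)| := by linarith
    have e2 : |(P.coeff 0 : ℝ)| < 2 := by linarith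
    have e3 : 1 < |P.coeff 0| := by exact_mod_cast e1
    have e4 : |P.coeff 0| < 2 := by exact_mod_cast e2
    omega
  · have e0 : Multiset.card s = 1 := by omega
    rw [e0, pow_one, mul_inv_cancel₀ hα0.ne'] at hN
    have hlead : P.coeff 2 = 1 := by
      have := hPm.coeff_natDegree
      rwa [hdeg, e0] at this
    have heq : (P.coeff 0 : ℝ) + P.coeff 1 * α + α ^ 2 = 0 := by
      have e1 := minpoly.aeval ℤ α
      rw [← hP, aeval_eq_sum_range, hdeg, e0] at e1
      simpa [Finset.sum_range_succ, hlead] using e1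
    set T : ℤ := -P.coeff 1 with hT
    have hTe : (P.coeff 1 : ℝ) = -T := by simp [hT]
    rw [hTe] at heq
    rcases (abs_eq (zero_le_one' ℝ)).mp hN with e | e
    · rw [e] at heq
      have t1 : (2 : ℝ) < T := by nlinarith
      have t2 : (T : ℝ) < 3 := by nlinarith
      have t3 : 2 < T := by exact_mod_cast t1
      have t4 : T < 3 := by exact_mod_cast t2
      omega
    · rw [e] at heq
      have t1 : (0 : ℝ) < T := by nlinarith
      have t2 : (T : ℝ) < 2 := by nlinarith
      have t3 : 0 < T := by exact_mod_cast t1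
      have t4 : T < 2 := by exact_mod_cast t2
      have t5 : T = 1 := by omega
      rw [t5] at heq
      have hφ : α = Real.goldenRatio := by
        have e2 := Real.goldenRatio_sq
        have e3 : (α - Real.goldenRatio) * (α + Real.goldenRatio - 1) = 0 := by
          push_cast at heq
          linear_combination heq - e2
        rcases mul_eq_zero.mp e3 with e4 | e4
        · linarith
        · linarith [Real.one_lt_goldenRatio]
      rw [hφ] at hcd
      exact goldenRatio_pow_ne_silver_pow hd hcd

theorem IsDom.mul_log_sub_ne_zero {k : ℕ} {α : ℝ} (h : IsDom k α) (c : ℤ) {d : ℕ} (hd : 0 < d) :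
    c * Real.log α - d * Real.log silver ≠ 0 := by
  intro h0
  have hlα := h.log_pos
  have hlγ := log_silver_gt
  have hd' : (0 : ℝ) < d := by exact_mod_cast hd
  have hc : (0 : ℝ) < c := by
    by_contra! hc
    nlinarith
  obtain ⟨n, rfl⟩ := Int.eq_ofNat_of_zero_le (show 0 ≤ c by exact_mod_cast hc.le)
  refine h.pow_ne_silver_pow (c := n) hd ?_
  refine Real.log_injOn_pos (Set.mem_Ioi.2 (_root_.pow_pos h.pos _))
    (Set.mem_Ioi.2 (_root_.pow_pos silver_pos _)) ?_
  rw [Real.log_pow, Real.log_pow]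
  push_cast at h0
  linarith

theorem three_logs_main_ineq {k h T H : ℝ} (hk : 2 ≤ k) (hh : 1 ≤ h) (hT : 1 ≤ T) (hH : 1 ≤ H) :
    (2 * k + 3) * ((2 * (128 * k * h * T) + 3) * H) + 3 * ((128 * k * H) * (1.7 * (k * h * T))) +
      (2 * k + 2) * ((128 * k * H) * (h * T) + h * ((128 * k * H) * T)) +
      3 * ((128 * k * H) * (k * h * T)) < ((128 * k * h * T) * (64 * k * H) - 1) / 2 := by
  have h1 : 1 ≤ h * T := one_le_mul_of_one_le_of_one_le hh hT
  have h2 : k * H ≤ k * H * (h * T) := le_mul_of_one_le_right (by positivity) h1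
  have h3 : 2 * (k * H * (h * T)) ≤ k * (k * H * (h * T)) := by gcongr
  have h4 : 2 * H ≤ k * H := by gcongr
  nlinarith

theorem two_logs_main_ineq {k h l R H c d e : ℝ} (hk : 2 ≤ k) (hh : 1 ≤ h) (hl : 1 ≤ l)
    (hR : 1 ≤ R) (hH : 1 ≤ H) (hd : d ≤ 513 * l) (hc : c ≤ 512 * k * l)
    (he : e ≤ 512 * k * h * l) :
    (2 * k + 3) * ((2 ^ 16 * k * h * l * R + 3) * H) +
      3 * ((32 * k * H) * (870 * k * h * l * R)) +
      (2 * k + 2) * ((32 * k * H) * (d * (h * R)) + h * ((32 * k * H) * (d * R))) +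
      3 * ((32 * k * H) * (c * (h * R) + e * R)) <
      ((2 ^ 16 * k * h * l * R) * (32 * k * H) - 1) / 2 := by
  have h1 : 1 ≤ h * (l * R) :=
    one_le_mul_of_one_le_of_one_le hh (one_le_mul_of_one_le_of_one_le hl hR)
  have h2 : k * H ≤ k * H * (h * (l * R)) := le_mul_of_one_le_right (by positivity) h1
  have h3 : 2 * (k * H * (h * (l * R))) ≤ k * (k * H * (h * (l * R))) := by gcongr
  have h4 : 2 * H ≤ k * H := by gcongr
  have h5 : (2 * k + 2) * ((32 * k * H) * (d * (h * R)) + h * ((32 * k * H) * (d * R))) ≤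
      (2 * k + 2) * ((32 * k * H) * (513 * l * (h * R)) + h * ((32 * k * H) * (513 * l * R))) := by
    gcongr
  have h6 : 3 * ((32 * k * H) * (c * (h * R) + e * R)) ≤
      3 * ((32 * k * H) * (512 * k * l * (h * R) + 512 * k * h * l * R)) := by
    gcongr
  nlinarith

set_option maxHeartbeats 1000000 in
/-- If `a log α + log δ - b log (1 + √2)` is tiny, then its coefficients satisfy a linear relation
with small coefficients. -/
theorem exp_neg_le_abs_or_relation {k : ℕ} {α δ M : ℝ} {num den : MvPolynomial (Fin 2) ℤ}
    (hα : IsDom k α) (hδ : IsFrac k α δ M num den) (hδ0 : 0 < δ) {h a b N H : ℕ} (hh1 : 1 ≤ h)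
    (hh : M ≤ Real.exp h) (hlog : |Real.log δ| + 1 ≤ 2 * h) {Λ : ℝ}
    (hΛ : a * Real.log α + Real.log δ - b * Real.log silver = Λ) (hΛ1 : |Λ| ≤ 1)
    (ha : 2 ^ 35 * k ^ 4 * h * H ^ 2 ≤ a) (haN : a ≤ N) (hbN : b ≤ N) (hH1 : 1 ≤ H)
    (hN1 : 1 ≤ N) (hN : (2 ^ 38 * k ^ 4 * h * H ^ 2 * N : ℝ) ≤ Real.exp H) :
    Real.exp (-(2 ^ 49 * k ^ 5 * h * H ^ 3)) < |Λ| ∨ ∃ c d e : ℤ, (c ≠ 0 ∨ d ≠ 0) ∧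
      e + d * a = c * b ∧ d.natAbs ≤ 513 * (128 * k * H) ∧
      c.natAbs ≤ 512 * k * (128 * k * H) ∧ e.natAbs ≤ 512 * k * h * (128 * k * H) := by
  have hk := hα.two_le
  obtain ⟨L, hL⟩ : ∃ L, L = 128 * k * H := ⟨_, rfl⟩
  obtain ⟨S, hS⟩ : ∃ S, S = 2 ^ 20 * k * L ^ 2 := ⟨_, rfl⟩
  rw [← hL]
  have hL1 : 1 ≤ L := by rw [hL]; exact Nat.mul_pos (by omega) (by omega)
  have hSL : 1000 * L ≤ S := by
    rw [hS]
    have : 2 ≤ k * L ^ 2 := by nlinarith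
    nlinarith
  have hhS : S ≤ h * S := Nat.le_mul_of_pos_left _ hh1
  have hW2 : 2 * (h * S) ≤ k * h * S := by rw [mul_assoc]; exact Nat.mul_le_mul_right _ hk
  obtain ⟨A, hA⟩ : ∃ A, A + L = k * h * S := ⟨k * h * S - L, by omega⟩
  have hAh : h * S ≤ A := by omega
  have hS0 : 0 < S := by omega
  obtain ⟨K, hK⟩ : ∃ K, K = 128 * k * h * (2 * S) := ⟨_, rfl⟩
  have hK0 : 0 < K := by rw [hK]; positivity
  have hXe : 8 * (k * h * (2 * S) * N) = 2 ^ 38 * k ^ 4 * h * H ^ 2 * N := by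
    rw [hS, hL]; ring
  have hXe' : (8 * ((k * h * (2 * S) * N : ℕ) : ℝ)) ≤ Real.exp H := by
    have e1 : (8 * ((k * h * (2 * S) * N : ℕ) : ℝ)) = 2 ^ 38 * k ^ 4 * h * H ^ 2 * N := by
      exact_mod_cast hXe
    rw [e1]; exact hN
  have hkr : (2 : ℝ) ≤ k := by exact_mod_cast hk
  have hhr : (1 : ℝ) ≤ h := by exact_mod_cast hh1
  have hHr : (1 : ℝ) ≤ H := by exact_mod_cast hH1
  have hSr : (1 : ℝ) ≤ S := by exact_mod_cast hS0
  have hT1 : k * h * (2 * S) ≤ k * h * (2 * S) * N := Nat.le_mul_of_pos_right _ hN1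
  have hT2 : N * (2 * S) ≤ k * h * (2 * S) * N := by
    rw [show k * h * (2 * S) * N = (k * h) * (N * (2 * S)) by ring]
    exact Nat.le_mul_of_pos_left _ (Nat.mul_pos (by omega) hh1)
  have hT3 : h * (2 * S) ≤ k * h * (2 * S) * N :=
    (by rw [mul_assoc k]; exact Nat.le_mul_of_pos_left _ (by omega) : h * (2 * S) ≤
      k * h * (2 * S)).trans
      hT1
  have hbox : ∀ R r₁ r₃ a' : ℕ, R ≤ k * h * (2 * S) * N → r₁ < R → r₃ < 2 * S → a' ≤ N →
      |(r₁ : ℤ) - a' * r₃| ≤ (k * h * (2 * S) * N : ℕ) := by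
    intro R r₁ r₃ a' hR h1 h3 ha'
    have e1 : a' * r₃ ≤ N * (2 * S) := Nat.mul_le_mul ha' h3.le
    have e2 : (a' : ℤ) * r₃ = ((a' * r₃ : ℕ) : ℤ) := by push_cast; ring
    rw [e2, abs_le]
    constructor <;> omega
  have key := exp_neg_le_abs_of_three_logs hα hδ hδ0 (h := (h : ℝ)) hh (a := a) (b := b) (K := K)
    (L := L) (L₁ := 64 * k * H) (R₁ := k * h * (2 * S)) (R₂ := h * (2 * S)) (R₃ := 2 * S)
    (A₁ := A) (A₂ := h * S) (A₃ := S) (B₁ := A) (B₂ := h * S) (B₃ := S)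
    (X := k * h * (2 * S) * N) hK0 (by rw [hL]; ring) (by positivity) hΛ
    (Y := (2 * K + 3) * H) (w := 1.7 * (k * h * (2 * S)))
    (Nat.mul_pos (by positivity) hN1)
    (fun r₁ r₃ h1 h3 => hbox _ r₁ r₃ a hT1 h1 h3 haN)
    (fun r₂ r₃ h1 h3 => hbox _ r₂ r₃ b hT3 h1 h3 hbN)
    (fun r₁ r₂ r₃ h1 h2 h3 => by
      have e0 : ((r₁ : ℝ) - a * r₃) * Real.log α - (r₂ - b * r₃) * Real.log silver =
        r₁ * Real.log α - r₂ * Real.log silver + r₃ * (Real.log δ - Λ) := by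
        rw [← hΛ]; ring
      have e1 : |Real.log δ - Λ| ≤ 2 * h := (abs_sub _ _).trans (by linarith)
      have e2 : |(r₃ : ℝ) * (Real.log δ - Λ)| ≤ (2 * S) * (2 * h) := by
        rw [abs_mul, Nat.abs_cast]
        have : (r₃ : ℝ) ≤ 2 * S := by exact_mod_cast h3.le
        exact mul_le_mul this e1 (abs_nonneg _) (by positivity)
      have a1 := hα.log_pos
      have a2 := hα.log_lt
      have a3 := log_silver_gt
      have a4 := log_silver_lt
      have e3 : (r₁ : ℝ) * Real.log α ≤ k * h * (2 * S) * 0.6932 := by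
        have : (r₁ : ℝ) ≤ k * h * (2 * S) := by exact_mod_cast h1.le
        exact mul_le_mul this a2.le a1.le (by positivity)
      have e4 : (r₂ : ℝ) * Real.log silver ≤ h * (2 * S) * 0.901 := by
        have : (r₂ : ℝ) ≤ h * (2 * S) := by exact_mod_cast h2.le
        exact mul_le_mul this a4.le (by linarith) (by positivity)
      have e5 : 0 ≤ (r₁ : ℝ) * Real.log α := by positivity
      have e6 : 0 ≤ (r₂ : ℝ) * Real.log silver := by positivity
      have e7 : 2 * (h * S : ℝ) ≤ k * (h * S) := by gcongr
      rw [e0]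
      rw [abs_le] at e2 ⊢
      constructor <;> nlinarith)
    (by rw [show k * h * (2 * S) = 2 * (k * h * S) by ring]; omega)
    (by rw [show h * (2 * S) = 2 * (h * S) by ring]; omega) (by omega) hS0
    (by
      have e1 : 2 * K * L = 512 * k * L * (h * S) := by rw [hK]; ring
      rw [e1]
      refine Nat.mul_lt_mul_of_pos_right ?_ (by positivity)
      refine lt_of_lt_of_le ?_ (hhS.trans hAh)
      rw [hS, show 2 ^ 20 * k * L ^ 2 = (2 ^ 20 * L) * (k * L) by ring,
        show 512 * k * L = 512 * (k * L) by ring]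
      exact Nat.mul_lt_mul_of_pos_right (by omega) (by positivity))
    (by
      rw [min_eq_right hAh]
      have e1 : 2 * K * L = 512 * k * L * (h * S) := by rw [hK]; ring
      rw [e1]
      refine Nat.mul_lt_mul_of_pos_right ?_ (by positivity)
      rw [hS, show 2 ^ 20 * k * L ^ 2 = (2 ^ 20 * L) * (k * L) by ring,
        show 512 * k * L = 512 * (k * L) by ring]
      exact Nat.mul_lt_mul_of_pos_right (by omega) (by positivity))
    (by
      have e1 : 2 * (2 * K * L) ^ 2 = (k * h * S) * (h * S) * (2 ^ 19 * k * L ^ 2) := by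
        rw [hK]; ring
      have e2 : S = 2 * (2 ^ 19 * k * L ^ 2) := by rw [hS]; ring
      have e3 : k * h * S < 2 * A := by omega
      rw [e1]
      calc (k * h * S) * (h * S) * (2 ^ 19 * k * L ^ 2)
          < (2 * A) * (h * S) * (2 ^ 19 * k * L ^ 2) := by gcongr
        _ = A * (h * S) * (2 * (2 ^ 19 * k * L ^ 2)) := by ring
        _ = A * (h * S) * S := by rw [← e2])
    (by
      refine le_trans ?_ ha
      have : 2 ^ 35 * k ^ 4 * h * H ^ 2 = 2 * (k * h * S) := by rw [hS, hL]; ring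
      omega)
    (by
      have e1 : Real.exp ((2 * K + 3) * H) = Real.exp H ^ (2 * K) * Real.exp H ^ 3 := by
        rw [← Real.exp_nat_mul, ← Real.exp_nat_mul, ← Real.exp_add]
        congr 1
        push_cast
        ring
      rw [e1, mul_comm]
      have hX0 : (0 : ℝ) ≤ ((k * h * (2 * S) * N : ℕ) : ℝ) := by positivity
      refine mul_le_mul (pow_le_pow_left₀ (by positivity) (by linarith) _) ?_ (by positivity)
        (by positivity)
      have e2 : (8 * ((k * h * (2 * S) * N : ℕ) : ℝ)) ^ 3 ≤ Real.exp H ^ 3 :=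
        pow_le_pow_left₀ (by positivity) hXe' 3
      refine le_trans ?_ e2
      have e3 : K * K * L ≤ (128 * (k * h * (2 * S) * N)) * (128 * (k * h * (2 * S) * N)) * L := by
        have : K ≤ 128 * (k * h * (2 * S) * N) := by
          rw [hK, show 128 * k * h * (2 * S) = 128 * (k * h * (2 * S)) by ring]; omega
        gcongr
      have e4 : 1000 * L ≤ k * h * (2 * S) * N := by
        refine le_trans (le_trans hSL ?_) hT2
        nlinarith
      have e5 : 2 * (K * K * L) ≤ (8 * (k * h * (2 * S) * N)) ^ 3 := by
        generalize k * h * (2 * S) * N = x at *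
        have : x * x * (1000 * L) ≤ x * x * x := by gcongr
        nlinarith
      exact_mod_cast e5)
    (by
      refine le_trans ?_ (Real.add_one_le_exp _)
      have e1 : 2 * (L * (2 * S)) ≤ K * (64 * k * H) := by
        rw [hK, hL, show 128 * k * h * (2 * S) * (64 * k * H) =
          (32 * k * h) * (2 * (128 * k * H * (2 * S))) by ring]
        exact Nat.le_mul_of_pos_left _ (by positivity)
      have e2 : (2 * (L * (2 * S)) : ℝ) ≤ K * (64 * k * H) := by exact_mod_cast e1
      push_cast
      linarith)
    (by
      have := three_logs_main_ineq (T := 2 * (S : ℝ)) hkr hhr (by linarith) hHr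
      rw [hL, hK]
      push_cast
      exact this)
  have hD : 2 * K * L = 512 * L * (k * h * S) := by rw [hK]; ring
  rcases key with key | ⟨c, d, e, hcd, he, h1, h2, h3⟩
  · left
    have e1 : (2 * (K * ((64 * k * H : ℕ) : ℝ)) : ℝ) = 2 ^ 49 * k ^ 5 * h * H ^ 3 := by
      rw [hK, hS, hL]
      push_cast
      ring
    rw [← e1]
    exact key
  · right
    refine ⟨c, d, e, hcd, he, ?_, ?_, ?_⟩
    · by_contra! hlt
      rw [hD] at h1
      have e1 : (513 * L + 1) * A ≤ d.natAbs * A := Nat.mul_le_mul_right _ hlt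
      have e2 : 1000 * L ≤ k * h * S := by omega
      have e3 : 1000 * L * L ≤ k * h * S * L := Nat.mul_le_mul_right _ e2
      nlinarith
    · refine Nat.le_of_mul_le_mul_right (h2.trans_eq ?_) (show 0 < h * S by positivity)
      rw [hD]; ring
    · refine Nat.le_of_mul_le_mul_right (h3.trans_eq ?_) hS0
      rw [hD]; ring

set_option maxHeartbeats 1000000 in
theorem exp_neg_le_abs_of_relation {k : ℕ} {α δ M : ℝ} {num den : MvPolynomial (Fin 2) ℤ}
    (hα : IsDom k α) (hδ : IsFrac k α δ M num den) (hδ0 : 0 < δ) {h a b N H d : ℕ} (hh1 : 1 ≤ h)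
    (hh : M ≤ Real.exp h) (hlog : |Real.log δ| + 1 ≤ 2 * h) {Λ : ℝ}
    (hΛ : a * Real.log α + Real.log δ - b * Real.log silver = Λ) (hΛ1 : |Λ| ≤ 1)
    (hb : 2 ^ 35 * k ^ 4 * h * H ^ 2 ≤ b) (hbN : b ≤ N) (hH1 : 1 ≤ H)
    (hN : (2 ^ 38 * k ^ 4 * h * H ^ 2 * N : ℝ) ≤ Real.exp H)
    {c e : ℤ} (hd0 : 0 < d) (he : e + d * a = c * b) (hd : d ≤ 513 * (128 * k * H))
    (hc : c.natAbs ≤ 512 * k * (128 * k * H)) (he' : e.natAbs ≤ 512 * k * h * (128 * k * H)) :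
    Real.exp (-(2 ^ 58 * k ^ 6 * h * H ^ 4)) < d * |Λ| := by
  have hk := hα.two_le
  obtain ⟨l, hl⟩ : ∃ l, l = 128 * k * H := ⟨_, rfl⟩
  rw [← hl] at hd hc he'
  have hl1 : 1 ≤ l := by rw [hl]; exact Nat.mul_pos (by omega) (by omega)
  obtain ⟨R, hR⟩ : ∃ R, R = 2 ^ 17 * k * l * (32 * k * H) := ⟨_, rfl⟩
  have hR0 : 0 < R := by rw [hR]; positivity
  obtain ⟨K, hK⟩ : ∃ K, K = 2 ^ 16 * k * h * l * R := ⟨_, rfl⟩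
  have hK0 : 0 < K := by rw [hK]; positivity
  have hbR : h * R ≤ b := by
    have : 2 ^ 35 * k ^ 4 * h * H ^ 2 = (64 * k) * (h * R) := by rw [hR, hl]; ring
    rw [this] at hb
    exact (Nat.le_mul_of_pos_left _ (by omega)).trans hb
  have hb0 : 0 < b := lt_of_lt_of_le (by positivity) hbR
  have hkr : (2 : ℝ) ≤ k := by exact_mod_cast hk
  have hhr : (1 : ℝ) ≤ h := by exact_mod_cast hh1
  have hHr : (1 : ℝ) ≤ H := by exact_mod_cast hH1
  have hlr : (1 : ℝ) ≤ l := by exact_mod_cast hl1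
  have hRr : (1 : ℝ) ≤ R := by exact_mod_cast hR0
  have hbr : (1 : ℝ) ≤ b := by exact_mod_cast hb0
  have hdr : (d : ℝ) ≤ 513 * l := by exact_mod_cast hd
  have her : |(e : ℝ)| ≤ 512 * k * h * l := by
    rw [← Int.cast_abs, Int.abs_eq_natAbs]; exact_mod_cast he'
  obtain ⟨τ, hτ⟩ : ∃ τ, τ = c * Real.log α - d * Real.log silver := ⟨_, rfl⟩
  have hτ0 : τ ≠ 0 := hτ ▸ hα.mul_log_sub_ne_zero c hd0
  have hbτ : b * τ = d * Λ + e * Real.log α - d * Real.log δ := by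
    have he2 : (e : ℝ) + d * a = c * b := by exact_mod_cast he
    rw [hτ, ← hΛ]
    linear_combination -Real.log α * he2
  have hlα := hα.log_pos
  have hlα1 := hα.log_lt
  have hbτ' : b * |τ| ≤ 870 * k * h * l := by
    rw [← abs_of_pos (a := (b : ℝ)) (by linarith), ← abs_mul, hbτ]
    have e1 : |(d : ℝ) * Λ + e * Real.log α - d * Real.log δ| ≤
        d * |Λ| + |(e : ℝ)| * Real.log α + d * |Real.log δ| := by
      refine (abs_sub _ _).trans (add_le_add ((abs_add_le _ _).trans (add_le_add ?_ ?_)) ?_)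
      · rw [abs_mul, Nat.abs_cast]
      · rw [abs_mul, abs_of_pos hlα]
      · rw [abs_mul, Nat.abs_cast]
    have e2 : |(e : ℝ)| * Real.log α ≤ 512 * k * h * l * 0.6932 :=
      mul_le_mul her hlα1.le hlα.le (by positivity)
    have e3 : (d : ℝ) * (|Λ| + |Real.log δ|) ≤ 513 * l * (2 * h) :=
      mul_le_mul hdr (by linarith) (by positivity) (by positivity)
    have e4 : 2 * (h * l : ℝ) ≤ k * (h * l) := by gcongr
    nlinarith
  have hXe : 2 ^ 9 * k * h * (b * R) ≤ 2 ^ 38 * k ^ 4 * h * H ^ 2 * N := by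
    rw [hR, hl, show 2 ^ 9 * k * h * (b * (2 ^ 17 * k * (128 * k * H) * (32 * k * H))) =
      2 ^ 38 * k ^ 4 * h * H ^ 2 * b by ring]
    gcongr
  have hXe' : 2 ^ 9 * k * h * (b * R : ℝ) ≤ Real.exp H := by
    refine le_trans ?_ hN
    exact_mod_cast hXe
  have hkh : (1 : ℝ) ≤ k * h := by nlinarith
  have hbR1 : (1 : ℝ) ≤ b * R := one_le_mul_of_one_le_of_one_le hbr hRr
  have key := exp_neg_le_abs_of_two_logs hα hδ hδ0 (h := (h : ℝ)) hh (c₁ := c) (c₂ := -e)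
    (s₁ := 1) (s₂ := -b) (d₁ := d) (d₂ := 0) (f₁ := 0) (f₂ := d) (τ := τ) (Λ := d * Λ)
    (by simpa using hτ0)
    (by
      have := hα.pos
      have h2 := sqrt_two_gt
      rw [pow_zero, mul_one, Real.log_mul (zpow_ne_zero _ this.ne') (pow_ne_zero _ (by linarith)),
        Real.log_zpow, Real.log_pow, log_sqrt_two_sub_one, hτ]
      push_cast
      ring)
    (by
      have := hα.pos
      rw [pow_zero, mul_one, Real.log_mul (zpow_ne_zero _ this.ne') (pow_ne_zero _ hδ0.ne'),
        Real.log_zpow, Real.log_pow]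
      push_cast
      linear_combination hbτ)
    (K := K) (L := 32 * k * H) (R₁ := h * R) (R₂ := R) hK0 (by positivity)
    (by
      rw [hK, show (32 * k * H) * (2 ^ 16 * k * h * l * R) =
        ((32 * k * H) * (2 ^ 16 * k * h * l)) * R by ring]
      refine Nat.mul_lt_mul_of_pos_right ?_ hR0
      have e1 : h * R = 2 * ((32 * k * H) * (2 ^ 16 * k * h * l)) := by rw [hR]; ring
      rw [e1]
      have e2 : (32 * k * H) * 2 ≤ (32 * k * H) * (2 ^ 16 * k * h * l) := by
        refine Nat.mul_le_mul_left _ ?_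
        rw [show 2 ^ 16 * k * h * l = 2 * (2 ^ 15 * k * h * l) by ring]
        exact Nat.le_mul_of_pos_right _ (by positivity)
      have e3 : 0 < 32 * k * H := by positivity
      omega)
    (fun r₁ r₁' r₂ r₂' h1 h1' _ _ heq => by
      have e1 : (r₁ : ℤ) - r₁' = b * (r₂ - r₂') := by linear_combination heq
      have e2 : (r₂ : ℤ) - r₂' = 0 := by
        have : |(r₁ : ℤ) - r₁'| < b := by
          rw [abs_lt]; constructor <;> omega
        rw [e1, abs_mul, Nat.abs_cast] at this
        have h3 : |(r₂ : ℤ) - r₂'| < 1 := by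
          by_contra! h3
          nlinarith
        rwa [Int.abs_lt_one_iff] at h3
      rw [e2, mul_zero] at e1
      omega)
    (X := b * R) (Y := (K + 3) * H) (w := 870 * k * h * l * R)
    hbR1
    (fun r₁ r₂ h1 h2 => by
      push_cast
      have e1 : (r₁ : ℝ) ≤ h * R := by exact_mod_cast h1.le
      have e2 : (r₂ : ℝ) ≤ R := by exact_mod_cast h2.le
      have e3 : (h * R : ℝ) ≤ b := by exact_mod_cast hbR
      have e4 : (b * r₂ : ℝ) ≤ b * R := by gcongr
      have e5 : (0 : ℝ) ≤ b * r₂ := by positivity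
      have e6 : (b : ℝ) ≤ b * R := le_mul_of_one_le_right (by linarith) hRr
      have e7 : (0 : ℝ) ≤ r₁ := by positivity
      rw [abs_le]
      constructor <;> linarith)
    (by
      rw [show |τ| * (b * R) = b * |τ| * R by ring]
      gcongr)
    (by
      have e1 : Real.exp ((K + 3) * H) = Real.exp H ^ 3 * Real.exp H ^ K := by
        rw [← Real.exp_nat_mul, ← Real.exp_nat_mul, ← Real.exp_add]
        congr 1
        push_cast
        ring
      rw [e1]
      have e2 : (b * R : ℝ) ≤ k * h * (b * R) := le_mul_of_one_le_left (by positivity) hkh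
      have e3 : Real.exp 1 * (b * R) ≤ Real.exp H := by
        have := Real.exp_one_lt_d9
        nlinarith
      refine mul_le_mul ?_ (pow_le_pow_left₀ (by positivity) e3 _) (by positivity) (by positivity)
      have e4 : (2 ^ 9 * k * h * (b * R) : ℝ) ^ 3 ≤ Real.exp H ^ 3 :=
        pow_le_pow_left₀ (by positivity) hXe' 3
      refine le_trans ?_ e4
      have e5 : 2 * (K * (32 * k * H)) ≤ (2 ^ 9 * k * h * (b * R)) ^ 3 := by
        have f1 : 2 * (K * (32 * k * H)) = (h * R) * R := by rw [hK, hR]; ring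
        have f3 : R ≤ b * R := Nat.le_mul_of_pos_left _ hb0
        have f4 : h * R ≤ b * R := hbR.trans (Nat.le_mul_of_pos_right _ hR0)
        have f5 : 0 < b * R := by positivity
        have f6 : b * R ≤ 2 ^ 9 * k * h * (b * R) := Nat.le_mul_of_pos_left _ (by positivity)
        rw [f1]
        calc (h * R) * R ≤ (b * R) * (b * R) := by gcongr
          _ ≤ (b * R) * (b * R) * (b * R) := Nat.le_mul_of_pos_right _ f5
          _ = (b * R) ^ 3 := by ring
          _ ≤ _ := by gcongr
      exact_mod_cast e5)
    (by
      refine le_trans ?_ (Real.add_one_le_exp _)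
      have e1 : 2 * ((32 * k * H) * R) ≤ K * (32 * k * H) := by
        rw [hK, show 2 ^ 16 * k * h * l * R * (32 * k * H) =
          (2 ^ 15 * k * h * l) * (2 * ((32 * k * H) * R)) by ring]
        exact Nat.le_mul_of_pos_left _ (by positivity)
      have e2 : (2 * ((32 * k * H) * R) : ℝ) ≤ K * (32 * k * H) := by exact_mod_cast e1
      push_cast
      linarith)
    (by
      have := two_logs_main_ineq (k := k) (h := h) (l := l) (R := R) (H := H) (c := c.natAbs)
        (d := d) (e := e.natAbs) hkr hhr hlr hRr hHr hdr (by exact_mod_cast hc)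
        (by exact_mod_cast he')
      rw [hK, Int.natAbs_neg]
      refine lt_of_eq_of_lt ?_ (this.trans_eq ?_) <;> (push_cast; ring))
  have e1 : (2 * (K * ((32 * k * H : ℕ) : ℝ)) : ℝ) = 2 ^ 58 * k ^ 6 * h * H ^ 4 := by
    rw [hK, hR, hl]
    push_cast
    ring
  rw [← e1]
  rwa [abs_mul, Nat.abs_cast] at key

set_option maxHeartbeats 1000000 in
/-- A lower bound for a linear form in the logarithms of `α`, `δ` and `1 + √2`. -/
theorem exp_neg_lt_abs_linear_form {k : ℕ} {α δ M : ℝ} {num den : MvPolynomial (Fin 2) ℤ}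
    (hα : IsDom k α) (hδ : IsFrac k α δ M num den) (hδ0 : 0 < δ) {h a b N H : ℕ} (hh1 : 1 ≤ h)
    (hh : M ≤ Real.exp h) (hlog : |Real.log δ| + 1 ≤ 2 * h)
    (ha : 2 ^ 35 * k ^ 4 * h * H ^ 2 ≤ a) (hb : 2 ^ 35 * k ^ 4 * h * H ^ 2 ≤ b)
    (haN : a ≤ N) (hbN : b ≤ N) (hH1 : 1 ≤ H)
    (hN : (2 ^ 38 * k ^ 4 * h * H ^ 2 * N : ℝ) ≤ Real.exp H) :
    Real.exp (-(2 ^ 59 * k ^ 6 * h * H ^ 4)) <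
      |a * Real.log α + Real.log δ - b * Real.log silver| := by
  have hk := hα.two_le
  obtain ⟨Λ, hΛ⟩ : ∃ Λ, a * Real.log α + Real.log δ - b * Real.log silver = Λ := ⟨_, rfl⟩
  rw [hΛ]
  have hkr : (2 : ℝ) ≤ k := by exact_mod_cast hk
  have hhr : (1 : ℝ) ≤ h := by exact_mod_cast hh1
  have hHr : (1 : ℝ) ≤ H := by exact_mod_cast hH1
  rcases lt_or_ge 1 |Λ| with hΛ1 | hΛ1
  · refine lt_trans ?_ hΛ1
    rw [Real.exp_lt_one_iff]
    have : (0 : ℝ) < 2 ^ 59 * k ^ 6 * h * H ^ 4 := by positivity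
    linarith
  have ha0 : 1 ≤ a := le_trans (Nat.succ_le_of_lt (by positivity)) ha
  rcases exp_neg_le_abs_or_relation hα hδ hδ0 hh1 hh hlog hΛ hΛ1 ha haN hbN hH1 (ha0.trans haN) hN
    with hlt | ⟨c, d, e, hcd, he, hd, hc, he'⟩
  · refine lt_of_le_of_lt ?_ hlt
    rw [Real.exp_le_exp, neg_le_neg_iff]
    have e1 : (k : ℝ) ^ 5 ≤ k ^ 6 := pow_le_pow_right₀ (by linarith) (by norm_num)
    have e2 : (H : ℝ) ^ 3 ≤ H ^ 4 := pow_le_pow_right₀ hHr (by norm_num)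
    gcongr <;> norm_num
  · have main : ∀ d : ℕ, ∀ c e : ℤ, 0 < d → e + d * a = c * b → d ≤ 513 * (128 * k * H) →
        c.natAbs ≤ 512 * k * (128 * k * H) → e.natAbs ≤ 512 * k * h * (128 * k * H) →
        Real.exp (-(2 ^ 59 * k ^ 6 * h * H ^ 4)) < |Λ| := by
      intro d c e hd0 he hd hc he'
      have h1 := exp_neg_le_abs_of_relation hα hδ hδ0 hh1 hh hlog hΛ hΛ1 hb hbN hH1
        hN hd0 he hd hc he'
      obtain ⟨Z, hZ⟩ : ∃ Z : ℝ, Z = k ^ 6 * h * H ^ 4 := ⟨_, rfl⟩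
      have e1 : (2 ^ 58 * k ^ 6 * h * H ^ 4 : ℝ) = 2 ^ 58 * Z := by rw [hZ]; ring
      have e2 : (2 ^ 59 * k ^ 6 * h * H ^ 4 : ℝ) = 2 ^ 58 * Z + 2 ^ 58 * Z := by rw [hZ]; ring
      have e3 : (k * H : ℝ) ≤ Z := by
        rw [hZ, show (k ^ 6 * h * H ^ 4 : ℝ) = (k * H) * (k ^ 5 * h * H ^ 3) by ring]
        refine le_mul_of_one_le_right (by positivity) ?_
        exact one_le_mul_of_one_le_of_one_le (one_le_mul_of_one_le_of_one_le
          (one_le_pow₀ (by linarith)) hhr) (one_le_pow₀ hHr)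
      have e4 : (d : ℝ) ≤ Real.exp (2 ^ 58 * Z) := by
        refine le_trans ?_ (Real.add_one_le_exp _)
        have : (d : ℝ) ≤ 513 * (128 * k * H) := by exact_mod_cast hd
        have : (0 : ℝ) < k * H := by positivity
        linarith
      rw [e1] at h1
      rw [e2, neg_add, Real.exp_add, Real.exp_neg (2 ^ 58 * Z), ← Real.exp_neg (2 ^ 58 * Z)]
      nth_rewrite 2 [Real.exp_neg]
      rw [← div_eq_mul_inv, div_lt_iff₀ (Real.exp_pos _), mul_comm |Λ|]
      exact h1.trans_le (mul_le_mul_of_nonneg_right e4 (abs_nonneg _))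
    rcases lt_trichotomy d 0 with hd0 | hd0 | hd0
    · refine main d.natAbs (-c) (-e) (by omega) ?_ hd (by rwa [Int.natAbs_neg])
        (by rwa [Int.natAbs_neg])
      rw [Int.ofNat_natAbs_of_nonpos hd0.le]
      linear_combination -he
    · exfalso
      subst hd0
      have hc0 : c ≠ 0 := by simpa using hcd
      have e1 : e.natAbs = c.natAbs * b := by
        rw [← Int.natAbs_natCast b, ← Int.natAbs_mul, ← he]
        simp
      have e2 : b ≤ e.natAbs := by
        rw [e1]
        exact Nat.le_mul_of_pos_left _ (by omega)
      have e3 := (hb.trans e2).trans he'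
      have e4 : 512 * k * h * (128 * k * H) < 2 ^ 35 * k ^ 4 * h * H ^ 2 := by
        rw [show 512 * k * h * (128 * k * H) = (k ^ 2 * h * H) * 2 ^ 16 by ring,
          show 2 ^ 35 * k ^ 4 * h * H ^ 2 = (k ^ 2 * h * H) * (2 ^ 35 * k ^ 2 * H) by ring]
        refine Nat.mul_lt_mul_of_pos_left ?_ (by positivity)
        have : 0 < k ^ 2 * H := by positivity
        rw [mul_assoc]
        omega
      omega
    · refine main d.natAbs c e (by omega) ?_ hd hc he'
      rw [Int.natAbs_of_nonneg hd0.le]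
      exact he

theorem abs_log_one_add_le {x c : ℝ} (hx : |x| ≤ c) (hc : c < 1) :
    |Real.log (1 + x)| ≤ |x| / (1 - c) := by
  have h := Real.abs_log_sub_add_sum_range_le (x := -x) (by rw [abs_neg]; linarith) 0
  simp only [Finset.range_zero, Finset.sum_empty, zero_add, sub_neg_eq_add, abs_neg, pow_one] at h
  refine h.trans ?_
  gcongr

theorem log_two_lt' : Real.log 2 < 0.6932 := by linarith [Real.log_two_lt_d9]

namespace IsDom
variable {k : ℕ} {α : ℝ}

theorem log_gt (h : IsDom k α) : 0.48 < Real.log α := by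
  rw [Real.lt_log_iff_exp_lt h.pos]
  refine lt_trans ?_ h.gt
  refine lt_of_pow_lt_pow_left₀ 25 (by norm_num) ?_
  rw [← Real.exp_nat_mul]
  have h1 : Real.exp (((25 : ℕ) : ℝ) * 0.48) = Real.exp 1 ^ 12 := by
    rw [← Real.exp_nat_mul]; norm_num
  rw [h1]
  calc Real.exp 1 ^ 12 < 2.7182818286 ^ 12 := by
        gcongr
        exact Real.exp_one_lt_d9
    _ < 1.618 ^ 25 := by norm_num

theorem inv_pow_le (h : IsDom k α) {j : ℕ} (hj : 2 ≤ j) : (α ^ j)⁻¹ ≤ 0.382 := by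
  have : (1.618 : ℝ) ^ 2 ≤ α ^ j :=
    (pow_le_pow_left₀ (by norm_num) h.gt.le 2).trans (pow_le_pow_right₀ h.one_lt.le hj)
  exact inv_le_of_inv_le₀ (by norm_num) (by norm_num at this ⊢; linarith)

theorem abs_log_genFib_sub_le (h : IsDom k α) {n : ℕ} (hn : 2 ≤ n) :
    |Real.log (genFib k (n + 1)) - (Real.log (binetCoeff k α) + n * Real.log α)| ≤
      1.7 * (α ^ n)⁻¹ := by
  have h1 := h.abs_genFib_sub_le (n := n + 1) (by omega)
  rw [Nat.add_sub_cancel] at h1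
  have hf := h.half_lt
  have hp := h.pow_pos n
  have hfp : 0 < binetCoeff k α * α ^ n := by positivity
  have hi := h.inv_pow_le hn
  set x := ((genFib k (n + 1) : ℝ) - binetCoeff k α * α ^ n) / (binetCoeff k α * α ^ n) with hx
  have hxe : (genFib k (n + 1) : ℝ) = (binetCoeff k α * α ^ n) * (1 + x) := by
    rw [hx]; field_simp; ring
  have hxle : |x| ≤ (α ^ n)⁻¹ := by
    rw [hx, abs_div, abs_of_pos hfp, div_le_iff₀ hfp]
    refine h1.trans ?_
    field_simp
    linarith
  have hxpos : 0 < 1 + x := by have := neg_le_of_abs_le hxle; linarith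
  rw [hxe, Real.log_mul hfp.ne' hxpos.ne', Real.log_mul (by linarith) hp.ne', Real.log_pow]
  rw [add_sub_cancel_left]
  refine (abs_log_one_add_le (hxle.trans hi) (by norm_num)).trans ?_
  rw [div_le_iff₀ (by norm_num)]
  have : 0 < (α ^ n)⁻¹ := by positivity
  nlinarith

theorem abs_log_pell_sub_le {l : ℕ} (hl : 1 ≤ l) :
    |Real.log (2 * √2) + Real.log (pell l) - l * Real.log silver| ≤
      1.21 * ((silver ^ l) ^ 2)⁻¹ := by
  have h1 := abs_pell_sub_le l
  have hs := silver_gt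
  have hp : 0 < silver ^ l := _root_.pow_pos silver_pos l
  have hpell : (0 : ℝ) < pell l := by
    obtain ⟨j, rfl⟩ := Nat.exists_eq_add_of_le' hl
    exact_mod_cast pell_pos j
  have hge : 2.4142 ≤ silver ^ l := hs.le.trans (le_self_pow₀ (by linarith) (by omega))
  have hi : ((silver ^ l) ^ 2)⁻¹ ≤ 0.172 :=
    inv_le_of_inv_le₀ (by norm_num) (by norm_num; nlinarith)
  set x := (2 * √2 * (pell l : ℝ) - silver ^ l) / silver ^ l with hx
  have hxe : 2 * √2 * (pell l : ℝ) = silver ^ l * (1 + x) := by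
    rw [hx]; field_simp; ring
  have hxle : |x| ≤ ((silver ^ l) ^ 2)⁻¹ := by
    rw [hx, abs_div, abs_of_pos hp, div_le_iff₀ hp]
    refine h1.trans (le_of_eq ?_)
    field_simp
  have hxpos : 0 < 1 + x := by have := neg_le_of_abs_le hxle; linarith
  rw [← Real.log_mul (by positivity) hpell.ne', hxe, Real.log_mul hp.ne' hxpos.ne', Real.log_pow,
    add_sub_cancel_left]
  refine (abs_log_one_add_le (hxle.trans hi) (by norm_num)).trans ?_
  rw [div_le_iff₀ (by norm_num)]
  have : 0 < ((silver ^ l) ^ 2)⁻¹ := by positivity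
  nlinarith

variable {n m l : ℕ}

theorem pow_le_silver_pow (h : IsDom k α) (hm : 2 ≤ m) (hnm : m ≤ n)
    (heq : genFib k (n + 1) * genFib k (m + 1) = pell l) : 1 ≤ l ∧ α ^ n ≤ silver ^ l := by
  have hk := h.two_le
  have h1 := h.abs_genFib_sub_le (n := n + 1) (by omega)
  rw [Nat.add_sub_cancel] at h1
  have h2 := two_le_genFib hk (n := m + 1) (by omega)
  have hn1 := genFib_pos hk n
  have hl : 1 ≤ l := by
    rcases Nat.eq_zero_or_pos l with rfl | hl
    · have : pell 0 = 0 := rfl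
      nlinarith
    · exact hl
  refine ⟨hl, ?_⟩
  have h3 : (2 : ℝ) * genFib k (n + 1) ≤ pell l := by
    rw [← heq]; push_cast
    have h2' : (2 : ℝ) ≤ genFib k (m + 1) := by exact_mod_cast h2
    have h1' : (1 : ℝ) ≤ genFib k (n + 1) := by exact_mod_cast hn1
    nlinarith
  have h4 := abs_pell_sub_le l
  have hge : 2.4142 ≤ silver ^ l := silver_gt.le.trans
    (le_self_pow₀ (by linarith [silver_gt]) (by omega))
  have h5 : (silver ^ l)⁻¹ ≤ 0.42 := inv_le_of_inv_le₀ (by norm_num) (by norm_num; linarith)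
  have h6 := h.half_lt
  have h7 : (1.618 : ℝ) ^ 2 ≤ α ^ n :=
    (pow_le_pow_left₀ (by norm_num) h.gt.le 2).trans (pow_le_pow_right₀ h.one_lt.le (by omega))
  have h8 := (abs_le.1 h1).1
  have h9 := (abs_le.1 h4).2
  have h10 := sqrt_two_gt
  have h11 : 1 / 2 * α ^ n ≤ binetCoeff k α * α ^ n := by gcongr
  have h12 : (0 : ℝ) ≤ pell l := by
    have : (1 : ℝ) ≤ genFib k (n + 1) := by exact_mod_cast hn1
    linarith
  have h13 : 2.8 * (pell l : ℝ) ≤ 2 * √2 * pell l := by gcongr; linarith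
  norm_num at h7
  linarith

theorem abs_form_two_le (h : IsDom k α) (hm : 2 ≤ m) (hnm : m ≤ n)
    (heq : genFib k (n + 1) * genFib k (m + 1) = pell l) :
    |n * Real.log α + (Real.log (2 * √2) + Real.log (binetCoeff k α) +
      Real.log (genFib k (m + 1))) - l * Real.log silver| ≤ 2.2 * (α ^ n)⁻¹ := by
  have hk := h.two_le
  obtain ⟨hl, hle⟩ := h.pow_le_silver_pow hm hnm heq
  have h1 := h.abs_log_genFib_sub_le (hm.trans hnm)
  have h2 := abs_log_pell_sub_le hl
  have hn1 : (0 : ℝ) < genFib k (n + 1) := by exact_mod_cast genFib_pos hk n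
  have hm1 : (0 : ℝ) < genFib k (m + 1) := by exact_mod_cast genFib_pos hk m
  rw [← heq] at h2
  push_cast at h2
  rw [Real.log_mul hn1.ne' hm1.ne'] at h2
  have hp := h.pow_pos n
  have hi := h.inv_pow_le (hm.trans hnm)
  have h3 : ((silver ^ l) ^ 2)⁻¹ ≤ 0.382 * (α ^ n)⁻¹ := by
    have : ((silver ^ l) ^ 2)⁻¹ ≤ ((α ^ n) ^ 2)⁻¹ := by gcongr
    rw [← inv_pow (α ^ n), sq (α ^ n)⁻¹] at this
    have h0 : 0 < (α ^ n)⁻¹ := by positivity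
    nlinarith
  have h0 : 0 < (α ^ n)⁻¹ := by positivity
  rw [abs_le] at h1 h2 ⊢
  constructor <;> linarith [h1.1, h1.2, h2.1, h2.2]

theorem abs_form_one_le (h : IsDom k α) (hm : 2 ≤ m) (hnm : m ≤ n)
    (heq : genFib k (n + 1) * genFib k (m + 1) = pell l) :
    |(n + m) * Real.log α + (Real.log (2 * √2) + 2 * Real.log (binetCoeff k α))
      - l * Real.log silver| ≤ 4 * (α ^ m)⁻¹ := by
  have h1 := h.abs_log_genFib_sub_le hm
  have h2 := h.abs_form_two_le hm hnm heq
  have h3 : (α ^ n)⁻¹ ≤ (α ^ m)⁻¹ :=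
    inv_anti₀ (h.pow_pos m) (pow_le_pow_right₀ h.one_lt.le hnm)
  have h0 : 0 < (α ^ m)⁻¹ := inv_pos.2 (h.pow_pos m)
  rw [abs_le] at h1 h2 ⊢
  constructor <;> linarith [h1.1, h1.2, h2.1, h2.2]

theorem log_two_sqrt_two : Real.log (2 * √2) = 3 / 2 * Real.log 2 := by
  rw [Real.log_mul (by norm_num) (by positivity), Real.log_sqrt (by norm_num)]; ring

theorem log_binetCoeff_gt (h : IsDom k α) : -Real.log 2 < Real.log (binetCoeff k α) := by
  rw [← Real.log_inv]
  exact Real.log_lt_log (by norm_num) (by have := h.half_lt; norm_num at this ⊢; exact this)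

theorem log_binetCoeff_neg (h : IsDom k α) : Real.log (binetCoeff k α) < 0 :=
  Real.log_neg (by linarith [h.half_lt]) h.binetCoeff_lt

theorem index_le (h : IsDom k α) (hm : 2 ≤ m) (hnm : m ≤ n)
    (heq : genFib k (n + 1) * genFib k (m + 1) = pell l) : l ≤ 4 * n := by
  have h1 := h.abs_form_one_le hm hnm heq
  have hi := h.inv_pow_le hm
  have h2 := log_silver_gt
  have h3 := h.log_lt
  have h4 := log_two_sqrt_two
  have h5 := log_two_lt'
  have h6 := h.log_binetCoeff_neg
  have h7 := (abs_le.1 h1).1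
  have hn : (2 : ℝ) ≤ n := by exact_mod_cast hm.trans hnm
  have hmn : (m : ℝ) ≤ n := by exact_mod_cast hnm
  have h8 : ((n : ℝ) + m) * Real.log α ≤ (2 * n) * 0.6932 := by
    have := h.log_pos
    gcongr
    linarith
  have h9 : (l : ℝ) * 0.859 ≤ l * Real.log silver := by gcongr
  have : (l : ℝ) ≤ 4 * n := by linarith
  exact_mod_cast this

theorem le_index (h : IsDom k α) (hm : 2 ≤ m) (hnm : m ≤ n)
    (heq : genFib k (n + 1) * genFib k (m + 1) = pell l) : n ≤ 2 * l + 4 := by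
  have h1 := h.abs_form_one_le hm hnm heq
  have hi := h.inv_pow_le hm
  have h2 := log_silver_lt
  have h3 := h.log_gt
  have h4 := log_two_sqrt_two
  have h5 := log_two_lt'
  have h6 := h.log_binetCoeff_gt
  have h7 := (abs_le.1 h1).2
  have hn : (2 : ℝ) ≤ m := by exact_mod_cast hm
  have h8 : ((n : ℝ) + 2) * 0.48 ≤ (n + m) * Real.log α := by gcongr
  have h9 : (l : ℝ) * Real.log silver ≤ l * 0.901 := by gcongr
  have : (n : ℝ) ≤ 2 * l + 4 := by linarith
  exact_mod_cast this

end IsDom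

open MvPolynomial in
theorem biEval_denPoly (k : ℕ) (z w : ℂ) :
    biEval z w ((C ((k : ℤ) + 1)) * X 0 - C (2 * (k : ℤ))) = (k + 1) * z - 2 * k := by
  simp [biEval]

open MvPolynomial in
theorem biEval_numPoly (c : ℤ) (j : ℕ) (z w : ℂ) :
    biEval z w (C c * X 1 * (X 0 - 1) ^ j) = c * w * (z - 1) ^ j := by
  simp [biEval]

theorem norm_eq_sqrt_two {w : ℂ} (hw : w ^ 2 = 2) : ‖w‖ = √2 := by
  have : ‖w‖ ^ 2 = 2 := by rw [← norm_pow, hw]; simp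
  rw [← this, Real.sqrt_sq (norm_nonneg _)]

theorem norm_den_le (k : ℕ) {z : ℂ} (hz : ‖z‖ ≤ 1) : ‖((k : ℂ) + 1) * z - 2 * k‖ ≤ 3 * k + 1 := by
  have h1 : ‖(k : ℂ) + 1‖ ≤ k + 1 := (norm_add_le _ _).trans (by simp)
  calc ‖((k : ℂ) + 1) * z - 2 * k‖ ≤ ‖((k : ℂ) + 1) * z‖ + ‖2 * (k : ℂ)‖ := norm_sub_le _ _
    _ ≤ (k + 1) * 1 + 2 * k := by
      rw [norm_mul, norm_mul, Complex.norm_natCast]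
      gcongr
      simp
    _ = 3 * k + 1 := by ring

theorem norm_sub_one_le {z : ℂ} (hz : ‖z‖ ≤ 1) : ‖z - 1‖ ≤ 2 := by
  calc ‖z - 1‖ ≤ ‖z‖ + ‖(1 : ℂ)‖ := norm_sub_le _ _
    _ ≤ 2 := by rw [norm_one]; linarith

open MvPolynomial in
theorem IsDom.isFrac_one {k : ℕ} {α : ℝ} (h : IsDom k α) :
    IsFrac k α (2 * √2 * binetCoeff k α ^ 2) ((3 * k + 1) ^ 2) (C 2 * X 1 * (X 0 - 1) ^ 2)
      ((C ((k : ℤ) + 1) * X 0 - C (2 * (k : ℤ))) ^ 2) := by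
  have hk : (2 : ℝ) ≤ k := by exact_mod_cast h.two_le
  have hd := h.den_pos
  have hd2 := h.den_lt
  have h1 := h.one_lt
  have h2 := h.lt
  have hs := sqrt_two_lt
  have hs0 : (0 : ℝ) ≤ √2 := Real.sqrt_nonneg 2
  have hM : (49 : ℝ) ≤ (3 * k + 1) ^ 2 := by nlinarith
  have hden : ((k : ℂ) + 1) * (α : ℂ) - 2 * k = (((k + 1) * α - 2 * k : ℝ) : ℂ) := by push_cast; rfl
  have hnum : ‖(α : ℂ) - 1‖ ≤ 2 := by
    have : (α : ℂ) - 1 = ((α - 1 : ℝ) : ℂ) := by push_cast; rfl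
    rw [this, Complex.norm_real, Real.norm_of_nonneg (by linarith)]; linarith
  have hden' : ‖(((k + 1) * α - 2 * k : ℝ) : ℂ)‖ ≤ 2 := by
    rw [Complex.norm_real, Real.norm_of_nonneg (by linarith)]; linarith
  have hnum' : ∀ z w : ℂ, ‖z - 1‖ ≤ 2 → ‖w‖ = √2 →
      ‖(2 : ℤ) * w * (z - 1) ^ 2‖ ≤ (3 * (k : ℝ) + 1) ^ 2 := by
    intro z w hz hw
    rw [norm_mul, norm_mul, norm_pow, hw]
    calc ‖((2 : ℤ) : ℂ)‖ * √2 * ‖z - 1‖ ^ 2 ≤ 2 * √2 * 2 ^ 2 := by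
          gcongr
          simp
      _ ≤ _ := by linarith
  refine ⟨by linarith, ?_, ?_, ?_, ?_, ?_, ?_, ?_⟩
  · rw [map_pow, biEval_denPoly, hden]
    exact pow_ne_zero _ (by exact_mod_cast (by linarith : (k + 1) * α - 2 * k ≠ 0))
  · rw [map_pow, biEval_denPoly, hden, biEval_numPoly, binetCoeff]
    have hd' : ((k + 1 : ℕ) : ℝ) * α - ((2 * k : ℕ) : ℝ) ≠ 0 := by push_cast; linarith
    norm_cast
    rw [div_pow, mul_assoc, div_mul_cancel₀ _ (pow_ne_zero 2 hd')]
  · rw [map_pow, biEval_denPoly, hden, norm_pow]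
    nlinarith [norm_nonneg (((k + 1) * α - 2 * k : ℝ) : ℂ)]
  · rw [biEval_numPoly]
    exact hnum' _ _ hnum (by rw [norm_neg, Complex.norm_real, Real.norm_of_nonneg hs0])
  · rw [map_pow, biEval_denPoly, hden, norm_pow]
    nlinarith [norm_nonneg (((k + 1) * α - 2 * k : ℝ) : ℂ)]
  · intro z w hz _ hw
    rw [biEval_numPoly]
    exact hnum' _ _ (norm_sub_one_le hz) (norm_eq_sqrt_two hw)
  · intro z w hz _ hw
    rw [map_pow, biEval_denPoly, norm_pow]
    exact pow_le_pow_left₀ (norm_nonneg _) (norm_den_le k hz) 2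

open MvPolynomial in
theorem IsDom.isFrac_two {k : ℕ} {α : ℝ} (h : IsDom k α) {F : ℤ} (hF : 1 ≤ F) :
    IsFrac k α (2 * √2 * binetCoeff k α * F) (6 * (3 * k + 1) * F)
      (C (2 * F) * X 1 * (X 0 - 1) ^ 1) (C ((k : ℤ) + 1) * X 0 - C (2 * (k : ℤ))) := by
  have hk : (2 : ℝ) ≤ k := by exact_mod_cast h.two_le
  have hF' : (1 : ℝ) ≤ F := by exact_mod_cast hF
  have hd := h.den_pos
  have hd2 := h.den_lt
  have h1 := h.one_lt
  have h2 := h.lt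
  have hs := sqrt_two_lt
  have hs0 : (0 : ℝ) ≤ √2 := Real.sqrt_nonneg 2
  have hM : 3 * (k : ℝ) + 1 ≤ 6 * (3 * k + 1) * F := by nlinarith
  have hden : ((k : ℂ) + 1) * (α : ℂ) - 2 * k = (((k + 1) * α - 2 * k : ℝ) : ℂ) := by push_cast; rfl
  have hnum : ‖(α : ℂ) - 1‖ ≤ 2 := by
    have : (α : ℂ) - 1 = ((α - 1 : ℝ) : ℂ) := by push_cast; rfl
    rw [this, Complex.norm_real, Real.norm_of_nonneg (by linarith)]; linarith
  have hden' : ‖(((k + 1) * α - 2 * k : ℝ) : ℂ)‖ ≤ 2 := by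
    rw [Complex.norm_real, Real.norm_of_nonneg (by linarith)]; linarith
  have hnum' : ∀ z w : ℂ, ‖z - 1‖ ≤ 2 → ‖w‖ = √2 →
      ‖((2 * F : ℤ) : ℂ) * w * (z - 1) ^ 1‖ ≤ 6 * (3 * (k : ℝ) + 1) * F := by
    intro z w hz hw
    rw [norm_mul, norm_mul, norm_pow, hw]
    have hFn : ‖((2 * F : ℤ) : ℂ)‖ = 2 * F := by
      rw [Complex.norm_intCast]; push_cast
      rw [abs_of_nonneg (by linarith)]
    calc ‖((2 * F : ℤ) : ℂ)‖ * √2 * ‖z - 1‖ ^ 1 ≤ (2 * F) * √2 * 2 ^ 1 := by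
          rw [hFn]
          gcongr
      _ ≤ _ := by nlinarith
  refine ⟨by linarith, ?_, ?_, ?_, ?_, ?_, ?_, ?_⟩
  · rw [biEval_denPoly, hden]
    exact_mod_cast (by linarith : (k + 1) * α - 2 * k ≠ 0)
  · rw [biEval_denPoly, hden, biEval_numPoly, binetCoeff]
    have hd' : ((k + 1 : ℕ) : ℝ) * α - ((2 * k : ℕ) : ℝ) ≠ 0 := by push_cast; linarith
    norm_cast
    rw [mul_div_assoc', div_mul_eq_mul_div, div_mul_cancel₀ _ hd']
    push_cast
    ring
  · rw [biEval_denPoly, hden]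
    linarith
  · rw [biEval_numPoly]
    exact hnum' _ _ hnum (by rw [norm_neg, Complex.norm_real, Real.norm_of_nonneg hs0])
  · rw [biEval_denPoly, hden]
    linarith
  · intro z w hz _ hw
    rw [biEval_numPoly]
    exact hnum' _ _ (norm_sub_one_le hz) (norm_eq_sqrt_two hw)
  · intro z w hz _ hw
    rw [biEval_denPoly]
    exact (norm_den_le k hz).trans hM

theorem two_pow_le_exp (n : ℕ) : (2 : ℝ) ^ n ≤ Real.exp n := by
  rw [← Real.exp_one_pow]
  gcongr
  linarith [Real.exp_one_gt_d9]

theorem exponent_le_of_linear_form {k : ℕ} {α δ M : ℝ} {num den : MvPolynomial (Fin 2) ℤ}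
    (hα : IsDom k α) (hδ : IsFrac k α δ M num den) (hδ0 : 0 < δ) {h a b n v j : ℕ} (hh1 : 1 ≤ h)
    (hh : M ≤ Real.exp h) (hlog : |Real.log δ| + 1 ≤ 2 * h)
    (hv : 2 ^ 42 * k ^ 4 * h * (2 * v) ^ 2 ≤ 2 ^ v) (hv1 : 1 ≤ v) (hvn : 2 ^ v ≤ n)
    (hnv : n < 2 ^ (v + 1)) (hna : n ≤ a) (han : a ≤ 4 * n) (hnb : n ≤ 2 * b + 6) (hbn : b ≤ 4 * n)
    (hΛ : |a * Real.log α + Real.log δ - b * Real.log silver| ≤ 4 * (α ^ j)⁻¹) :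
    j + 1 < 2 ^ 61 * k ^ 6 * h * (2 * v) ^ 4 := by
  have hk := hα.two_le
  have hX : 1 ≤ k ^ 4 * h * (2 * v) ^ 2 := by
    have : 0 < k ^ 4 * h * (2 * v) ^ 2 := by positivity
    omega
  have e1 : ∀ c : ℕ, c * k ^ 4 * h * (2 * v) ^ 2 = c * (k ^ 4 * h * (2 * v) ^ 2) := fun c => by ring
  have hlow := exp_neg_lt_abs_linear_form hα hδ hδ0 (a := a) (b := b) (N := 4 * n)
      (H := 2 * v) hh1 hh
    hlog ?_ ?_ han hbn (by omega) ?_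
  · have h1 := hlow.trans_le hΛ
    have hp := hα.pow_pos j
    have h2 : α ^ j < 4 * Real.exp (2 ^ 59 * k ^ 6 * h * ((2 * v : ℕ) : ℝ) ^ 4) := by
      rw [Real.exp_neg, ← div_eq_mul_inv, lt_div_iff₀ hp] at h1
      have he := Real.exp_pos (2 ^ 59 * k ^ 6 * h * ((2 * v : ℕ) : ℝ) ^ 4)
      rwa [inv_mul_lt_iff₀ he, mul_comm _ (4 : ℝ)] at h1
    have h3 : j * Real.log α < 2 * Real.log 2 + 2 ^ 59 * k ^ 6 * h * ((2 * v : ℕ) : ℝ) ^ 4 := by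
      have := Real.log_lt_log hp h2
      rw [Real.log_pow, Real.log_mul (by norm_num) (Real.exp_pos _).ne', Real.log_exp] at this
      have h4 : Real.log 4 = 2 * Real.log 2 := by
        rw [show (4 : ℝ) = 2 ^ 2 by norm_num, Real.log_pow]; norm_num
      linarith
    have h4 : (j : ℝ) * 0.48 ≤ j * Real.log α := by
      gcongr
      exact hα.log_gt.le
    have h5 := log_two_lt'
    have h6 : (1 : ℝ) ≤ k ^ 6 * h * ((2 * v : ℕ) : ℝ) ^ 4 := by
      have : 0 < k ^ 6 * h * (2 * v) ^ 4 := by positivity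
      exact_mod_cast this
    have h7 : (j : ℝ) + 1 < 2 ^ 61 * (k ^ 6 * h * ((2 * v : ℕ) : ℝ) ^ 4) := by
      have e : 2 ^ 59 * k ^ 6 * h * ((2 * v : ℕ) : ℝ) ^ 4 =
        2 ^ 59 * (k ^ 6 * h * ((2 * v : ℕ) : ℝ) ^ 4) := by ring
      rw [e] at h3
      linarith
    have h8 : j + 1 < 2 ^ 61 * (k ^ 6 * h * (2 * v) ^ 4) := by exact_mod_cast h7
    calc j + 1 < _ := h8
      _ = _ := by ring
  · rw [e1] at hv ⊢
    refine le_trans ?_ (hvn.trans hna)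
    omega
  · rw [e1] at hv ⊢
    omega
  · have h1 : (n : ℝ) ≤ 2 * 2 ^ v := by
      have : n ≤ 2 * 2 ^ v := by rw [pow_succ] at hnv; omega
      exact_mod_cast this
    have h2 : (2 : ℝ) ^ 42 * k ^ 4 * h * (2 * v) ^ 2 ≤ 2 ^ v := by exact_mod_cast hv
    calc (2 ^ 38 * k ^ 4 * h * ((2 * v : ℕ) : ℝ) ^ 2 * ((4 * n : ℕ) : ℝ) : ℝ)
        = 2 ^ 40 * k ^ 4 * h * (2 * v) ^ 2 * n := by push_cast; ring
      _ ≤ 2 ^ 40 * k ^ 4 * h * (2 * v) ^ 2 * (2 * 2 ^ v) := by gcongr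
      _ ≤ 2 ^ 42 * k ^ 4 * h * (2 * v) ^ 2 * 2 ^ v := by
        have : (0 : ℝ) ≤ k ^ 4 * h * (2 * v) ^ 2 * 2 ^ v := by positivity
        linarith
      _ ≤ 2 ^ v * 2 ^ v := by gcongr
      _ = 2 ^ (2 * v) := by rw [← pow_add, two_mul]
      _ ≤ Real.exp ((2 * v : ℕ) : ℝ) := two_pow_le_exp _

theorem pow_nine_le (j : ℕ) : (7 * (j + 31)) ^ 9 ≤ 2 ^ (79 + j) := by
  induction j with
  | zero => norm_num
  | succ j ih =>
    have h1 : 31 * (7 * (j + 1 + 31)) ≤ 32 * (7 * (j + 31)) := by omega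
    have h2 := Nat.pow_le_pow_left h1 9
    rw [mul_pow, mul_pow 32] at h2
    have h3 : (32 : ℕ) ^ 9 ≤ 2 * 31 ^ 9 := by norm_num
    have h4 : 31 ^ 9 * (7 * (j + 1 + 31)) ^ 9 ≤ 31 ^ 9 * (2 * (7 * (j + 31)) ^ 9) := by
      calc _ ≤ _ := h2
        _ ≤ 2 * 31 ^ 9 * (7 * (j + 31)) ^ 9 := Nat.mul_le_mul_right _ h3
        _ = _ := by ring
    have h5 := Nat.le_of_mul_le_mul_left h4 (by norm_num)
    calc (7 * (j + 1 + 31)) ^ 9 ≤ 2 * (7 * (j + 31)) ^ 9 := h5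
      _ ≤ 2 * 2 ^ (79 + j) := Nat.mul_le_mul_left _ ih
      _ = 2 ^ (79 + (j + 1)) := by rw [← add_assoc, pow_succ, mul_comm]

theorem size_le {u v : ℕ} (hv : 210 + 14 * u ≤ v) :
    2 ^ (131 + 12 * u) * (2 * u + 3) * v ^ 8 ≤ 2 ^ v := by
  obtain ⟨s, rfl⟩ : ∃ s, v = 210 + s := Nat.exists_eq_add_of_le (by omega)
  have h1 := pow_nine_le (s / 7)
  have h2 : 210 + s ≤ 7 * (s / 7 + 31) := by omega
  calc 2 ^ (131 + 12 * u) * (2 * u + 3) * (210 + s) ^ 8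
      ≤ 2 ^ (131 + 12 * u) * (210 + s) * (210 + s) ^ 8 :=
        Nat.mul_le_mul_right _ (Nat.mul_le_mul_left _ (by omega))
    _ = 2 ^ (131 + 12 * u) * (210 + s) ^ 9 := by ring
    _ ≤ 2 ^ (131 + 12 * u) * (7 * (s / 7 + 31)) ^ 9 := by gcongr
    _ ≤ 2 ^ (131 + 12 * u) * 2 ^ (79 + s / 7) := by gcongr
    _ = 2 ^ (131 + 12 * u + (79 + s / 7)) := (pow_add _ _ _).symm
    _ ≤ 2 ^ (210 + s) := Nat.pow_le_pow_right (by norm_num) (by omega)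

theorem IsDom.succ_index_lt {k m' n l u v : ℕ} {α : ℝ} (hα : IsDom k α) (hu1 : 1 ≤ u)
    (hku : k ≤ 2 ^ u) (hm : 2 ≤ m' + 1) (hnm : m' + 1 ≤ n)
    (heq : genFib k (n + 1) * genFib k (m' + 1 + 1) = pell l)
    (hsize : 2 ^ 42 * k ^ 4 * (u + m' + 4) * (2 * v) ^ 2 ≤ 2 ^ v) (hv : 1 ≤ v) (hvn : 2 ^ v ≤ n)
    (hnv : n < 2 ^ (v + 1)) : n + 1 < 2 ^ 61 * k ^ 6 * (u + m' + 4) * (2 * v) ^ 4 := by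
  have hk := hα.two_le
  have hf := hα.half_lt
  have hf1 := hα.binetCoeff_lt
  have hs1 := sqrt_two_gt
  have hs2 := sqrt_two_lt
  have hl2 := log_two_lt'
  have hl20 : 0 < Real.log 2 := Real.log_pos (by norm_num)
  have hkr : (k : ℝ) ≤ 2 ^ u := by exact_mod_cast hku
  have hk2 : (2 : ℝ) ≤ k := by exact_mod_cast hk
  have hur : (1 : ℝ) ≤ u := by exact_mod_cast hu1
  have hli := hα.index_le hm hnm heq
  have hil := hα.le_index hm hnm heq
  have h2 := hα.abs_form_two_le hm hnm heq
  have hlf := hα.log_binetCoeff_neg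
  have hlf' := hα.log_binetCoeff_gt
  have hl := IsDom.log_two_sqrt_two
  have hF1 := genFib_pos hk (m' + 1)
  have hF2 := genFib_le hk m'
  set F := genFib k (m' + 2) with hF
  have hF1' : (1 : ℝ) ≤ F := by exact_mod_cast hF1
  have hF2' : (F : ℝ) ≤ 2 ^ m' := by exact_mod_cast hF2
  have hf0 : 0 < binetCoeff k α := by linarith
  have hδ0 : 0 < 2 * √2 * binetCoeff k α * F := by positivity
  have hlogδ : Real.log (2 * √2 * binetCoeff k α * F) =
      Real.log (2 * √2) + Real.log (binetCoeff k α) + Real.log F := by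
    rw [Real.log_mul (by positivity) (by positivity), Real.log_mul (by positivity) (by positivity)]
  have hlogF : Real.log F ≤ m' := by
    calc Real.log F ≤ Real.log (2 ^ m') := Real.log_le_log (by linarith) hF2'
      _ = m' * Real.log 2 := Real.log_pow _ _
      _ ≤ m' * 1 := by gcongr; linarith
      _ = m' := mul_one _
  have hlogF0 : 0 ≤ Real.log F := Real.log_nonneg hF1'
  refine exponent_le_of_linear_form hα (hα.isFrac_two hF1) hδ0 (a := n) (b := l) (n := n)
    (by omega) ?_ ?_ hsize hv hvn hnv le_rfl (by omega) (by omega) hli ?_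
  · calc 6 * (3 * (k : ℝ) + 1) * F ≤ 6 * (2 ^ u * 3.5) * 2 ^ m' := by
          gcongr
          linarith
      _ = 2 ^ (u + m') * 21 := by rw [pow_add]; ring
      _ ≤ Real.exp ((u + m' : ℕ) : ℝ) * Real.exp 1 ^ 4 := by
        gcongr
        · exact two_pow_le_exp _
        · have := Real.exp_one_gt_d9
          calc (21 : ℝ) ≤ 2.7182818283 ^ 4 := by norm_num
            _ ≤ _ := by gcongr
      _ = _ := by
        rw [← Real.exp_nat_mul, ← Real.exp_add]
        push_cast
        ring_nf
  · rw [hlogδ]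
    push_cast
    have : |Real.log (2 * √2) + Real.log (binetCoeff k α) + Real.log F| ≤ 2 + m' := by
      rw [abs_le]; constructor <;> linarith
    have : (0 : ℝ) ≤ m' := by positivity
    linarith
  · rw [hlogδ]
    refine h2.trans ?_
    have : 0 < (α ^ n)⁻¹ := inv_pos.2 (hα.pow_pos n)
    linarith

theorem index_lt_two_pow {k m n l u : ℕ} (hk : 2 ≤ k) (hm : 2 ≤ m) (hnm : m ≤ n) (hku : k ≤ 2 ^ u)
    (heq : genFib k (n + 1) * genFib k (m + 1) = pell l) : n < 2 ^ (210 + 14 * u) := by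
  obtain ⟨α, hα⟩ := exists_isDom hk
  by_contra! hn
  obtain ⟨v, hvn, hnv⟩ : ∃ v, 2 ^ v ≤ n ∧ n < 2 ^ (v + 1) :=
    ⟨Nat.log 2 n, Nat.pow_log_le_self 2 (by omega), Nat.lt_pow_succ_log_self (by norm_num) n⟩
  have hv : 210 + 14 * u ≤ v := by
    have := hn.trans_lt hnv
    rw [Nat.pow_lt_pow_iff_right (by norm_num)] at this
    omega
  have hsize := size_le hv
  have hu1 : 1 ≤ u := by
    rcases Nat.eq_zero_or_pos u with rfl | h
    · simp at hku; omega
    · exact h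
  have hf := hα.half_lt
  have hf1 := hα.binetCoeff_lt
  have hs1 := sqrt_two_gt
  have hs2 := sqrt_two_lt
  have hl2 := log_two_lt'
  have hl20 : 0 < Real.log 2 := Real.log_pos (by norm_num)
  have hkr : (k : ℝ) ≤ 2 ^ u := by exact_mod_cast hku
  have hk2 : (2 : ℝ) ≤ k := by exact_mod_cast hk
  have hur : (1 : ℝ) ≤ u := by exact_mod_cast hu1
  have hli := hα.index_le hm hnm heq
  have hil := hα.le_index hm hnm heq
  have h1 := hα.abs_form_one_le hm hnm heq
  have h2 := hα.abs_form_two_le hm hnm heq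
  have hlf := hα.log_binetCoeff_neg
  have hlf' := hα.log_binetCoeff_gt
  have hl := IsDom.log_two_sqrt_two
  -- the master size inequality
  have hbig : 2 ^ 123 * k ^ 12 * (2 * u + 3) * (2 * v) ^ 8 ≤ 2 ^ v := by
    refine le_trans ?_ hsize
    calc 2 ^ 123 * k ^ 12 * (2 * u + 3) * (2 * v) ^ 8
        ≤ 2 ^ 123 * (2 ^ u) ^ 12 * (2 * u + 3) * (2 * v) ^ 8 := by gcongr
      _ = 2 ^ (131 + 12 * u) * (2 * u + 3) * v ^ 8 := by
        rw [pow_add, pow_mul' _ 12 u]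
        ring
  have hmid : ∀ h, h ≤ 2 ^ 62 * k ^ 6 * (2 * u + 3) * (2 * v) ^ 4 →
      2 ^ 42 * k ^ 4 * h * (2 * v) ^ 2 ≤ 2 ^ v := by
    intro h hh
    refine le_trans ?_ hbig
    calc 2 ^ 42 * k ^ 4 * h * (2 * v) ^ 2
        ≤ 2 ^ 42 * k ^ 4 * (2 ^ 62 * k ^ 6 * (2 * u + 3) * (2 * v) ^ 4) * (2 * v) ^ 2 := by gcongr
      _ = 2 ^ 104 * k ^ 10 * (2 * u + 3) * (2 * v) ^ 6 := by ring
      _ ≤ 2 ^ 123 * k ^ 12 * (2 * u + 3) * (2 * v) ^ 8 := by gcongr <;> omega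
  have hpos1 : 1 ≤ k ^ 6 * (2 * v) ^ 4 := by
    have : 0 < k ^ 6 * (2 * v) ^ 4 := by
      have : 0 < v := by omega
      positivity
    omega
  have hmul : (2 * u + 3) * 1 ≤ (2 * u + 3) * (k ^ 6 * (2 * v) ^ 4) := Nat.mul_le_mul_left _ hpos1
  have hmul' : ∀ c, c * k ^ 6 * (2 * u + 3) * (2 * v) ^ 4 =
    c * ((2 * u + 3) * (k ^ 6 * (2 * v) ^ 4)) := fun c => by ring
  -- first linear form
  have hm1 : m + 1 < 2 ^ 61 * k ^ 6 * (2 * u + 3) * (2 * v) ^ 4 := by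
    have hδ0 : 0 < 2 * √2 * binetCoeff k α ^ 2 := by positivity
    have hlogδ : Real.log (2 * √2 * binetCoeff k α ^ 2) =
        Real.log (2 * √2) + 2 * Real.log (binetCoeff k α) := by
      rw [Real.log_mul (by positivity) (by positivity), Real.log_pow]; norm_num
    refine exponent_le_of_linear_form hα hα.isFrac_one hδ0 (a := n + m) (b := l) (n := n)
      (by omega) ?_ ?_ (hmid _ ?_) (by omega) hvn hnv (by omega) (by omega) (by omega) hli ?_
    · have h3 : (3 * (k : ℝ) + 1) ≤ 2 ^ u * 4 := by linarith
      calc (3 * (k : ℝ) + 1) ^ 2 ≤ (2 ^ u * 4) ^ 2 := by gcongr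
        _ = 2 ^ (2 * u) * 16 := by rw [mul_pow, ← pow_mul, mul_comm u 2]; norm_num
        _ ≤ Real.exp ((2 * u : ℕ) : ℝ) * Real.exp 1 ^ 3 := by
          gcongr
          · exact two_pow_le_exp _
          · have := Real.exp_one_gt_d9
            calc (16 : ℝ) ≤ 2.7182818283 ^ 3 := by norm_num
              _ ≤ _ := by gcongr
        _ = _ := by
          rw [← Real.exp_nat_mul, ← Real.exp_add]
          push_cast
          ring_nf
    · rw [hlogδ]
      push_cast
      have : |Real.log (2 * √2) + 2 * Real.log (binetCoeff k α)| ≤ 2 := by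
        rw [abs_le]; constructor <;> linarith
      linarith
    · rw [hmul']; omega
    · rw [hlogδ]
      push_cast
      exact h1
  -- second linear form
  obtain ⟨m', rfl⟩ := Nat.exists_eq_add_of_le' (show 1 ≤ m by omega)
  have hn1 : n + 1 < 2 ^ 61 * k ^ 6 * (u + m' + 4) * (2 * v) ^ 4 :=
    hα.succ_index_lt hu1 hku hm hnm heq
      (hmid _ (by rw [hmul'] at hm1 ⊢; omega)) (by omega) hvn hnv
  have hle : u + m' + 4 ≤ 2 ^ 62 * k ^ 6 * (2 * u + 3) * (2 * v) ^ 4 := by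
    rw [hmul'] at hm1 ⊢; omega
  have : n + 1 < n := by
    calc n + 1 < 2 ^ 61 * k ^ 6 * (u + m' + 4) * (2 * v) ^ 4 := hn1
      _ ≤ 2 ^ 61 * k ^ 6 * (2 ^ 62 * k ^ 6 * (2 * u + 3) * (2 * v) ^ 4) * (2 * v) ^ 4 := by gcongr
      _ = 2 ^ 123 * k ^ 12 * (2 * u + 3) * (2 * v) ^ 8 := by ring
      _ ≤ 2 ^ v := hbig
      _ ≤ n := hvn
  omega

theorem pell_emod_twelve (l : ℕ) : pell l % 12 ≠ 4 ∧ pell l % 12 ≠ 8 := by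
  have hrec : ∀ l, pell (l + 2) = 2 * pell (l + 1) + pell l := fun _ => rfl
  have key : ∀ t : ℕ, pell (8 * t) % 12 = 0 ∧ pell (8 * t + 1) % 12 = 1 := by
    intro t
    induction t with
    | zero => simp [pell]
    | succ t ih =>
      rw [show 8 * (t + 1) = 8 * t + 8 by ring]
      simp only [hrec]
      omega
  have h := key (l / 8)
  rw [← Nat.div_add_mod l 8]
  have hr : l % 8 < 8 := Nat.mod_lt _ (by norm_num)
  generalize l % 8 = r at hr
  generalize 8 * (l / 8) = s at h
  interval_cases r <;> (try simp only [hrec, add_zero]) <;> omega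

theorem two_pow_emod_twelve {j : ℕ} (hj : 2 ≤ j) :
    (2 ^ j : ℤ) % 12 = 4 ∨ (2 ^ j : ℤ) % 12 = 8 := by
  induction j, hj using Nat.le_induction with
  | base => norm_num
  | succ j hj ih =>
    rw [pow_succ]
    omega

theorem genFib_eq_two_pow {k j : ℕ} (hk : 2 ≤ k) (hj : j + 2 ≤ k + 1) :
    genFib k (j + 2) = 2 ^ j := by
  induction j with
  | zero => simpa using genFib_two hk
  | succ j ih =>
    rw [genFib_succ hk, ih (by omega), kfib_of_lt (by omega)]
    ring

theorem lt_index {k m n l : ℕ} (hk : 2 ≤ k) (hm : 2 ≤ m) (hnm : m ≤ n)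
    (heq : genFib k (n + 1) * genFib k (m + 1) = pell l) : k < n := by
  by_contra! hn
  obtain ⟨n, rfl⟩ := Nat.exists_eq_add_of_le' (show 1 ≤ n by omega)
  obtain ⟨m, rfl⟩ := Nat.exists_eq_add_of_le' (show 1 ≤ m by omega)
  rw [genFib_eq_two_pow hk (by omega), genFib_eq_two_pow hk (by omega), ← pow_add] at heq
  have h1 := two_pow_emod_twelve (j := n + m) (by omega)
  have h2 := pell_emod_twelve l
  rw [heq] at h1
  omega

theorem abs_log_genFib_sub_le_two {k n : ℕ} (hk : 2 ≤ k) (hn : 1 ≤ n) (hn2 : n ≤ 2 ^ (k - 2)) :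
    |Real.log (genFib k (n + 1)) - (n - 1) * Real.log 2| ≤ 4 / 3 * (n / 2 ^ k) := by
  obtain ⟨n, rfl⟩ := Nat.exists_eq_add_of_le' hn
  have h1 := genFib_le hk n
  have h2 := le_genFib hk n
  have h3 := genFib_pos hk (n + 1)
  have h1' : (genFib k (n + 2) : ℝ) ≤ 2 ^ n := by exact_mod_cast h1
  have h2' : (2 ^ n * (2 ^ k - n) : ℝ) ≤ 2 ^ k * genFib k (n + 2) := by exact_mod_cast h2
  have h3' : (1 : ℝ) ≤ genFib k (n + 2) := by exact_mod_cast h3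
  have hp : (0 : ℝ) < 2 ^ k := by positivity
  have ht : ((n + 1 : ℕ) : ℝ) / 2 ^ k ≤ 1 / 4 := by
    rw [div_le_iff₀ hp]
    have e : (2 : ℝ) ^ k = 2 ^ (k - 2) * 4 := by
      rw [show (4 : ℝ) = 2 ^ 2 by norm_num, ← pow_add, Nat.sub_add_cancel hk]
    have : ((n + 1 : ℕ) : ℝ) ≤ 2 ^ (k - 2) := by exact_mod_cast hn2
    rw [e]; linarith
  have hx : (genFib k (n + 2) : ℝ) = 2 ^ n * (1 + (genFib k (n + 2) / 2 ^ n - 1)) := by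
    field_simp; ring
  have hxle : |(genFib k (n + 2) : ℝ) / 2 ^ n - 1| ≤ ((n + 1 : ℕ) : ℝ) / 2 ^ k := by
    have e1 : (genFib k (n + 2) : ℝ) / 2 ^ n ≤ 1 := by
      rw [div_le_one (by positivity)]; exact h1'
    rw [abs_of_nonpos (by linarith)]
    have e2 : 1 - (n : ℝ) / 2 ^ k ≤ (genFib k (n + 2) : ℝ) / 2 ^ n := by
      rw [le_div_iff₀ (by positivity), ← mul_le_mul_iff_of_pos_left hp]
      refine le_trans (le_of_eq ?_) h2'
      field_simp
    have e3 : (n : ℝ) / 2 ^ k ≤ ((n + 1 : ℕ) : ℝ) / 2 ^ k := by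
      gcongr; simp
    linarith
  have hpos : (0 : ℝ) < 1 + (genFib k (n + 2) / 2 ^ n - 1) := by
    have : (0 : ℝ) < genFib k (n + 2) / 2 ^ n := by positivity
    linarith
  rw [show n + 1 + 1 = n + 2 by rfl, hx, Real.log_mul (by positivity) hpos.ne', Real.log_pow]
  have e : (n : ℝ) * Real.log 2 + Real.log (1 + (genFib k (n + 2) / 2 ^ n - 1)) -
      (((n + 1 : ℕ) : ℝ) - 1) * Real.log 2 = Real.log (1 + (genFib k (n + 2) / 2 ^ n - 1)) := by
    push_cast; ring
  rw [e]
  refine (abs_log_one_add_le (hxle.trans ht) (by norm_num)).trans ?_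
  rw [div_le_iff₀ (by norm_num)]
  linarith

/-- If `2 ^ k` is large compared with `n`, the equation gives a very small linear form in
`log √2` and `log (1 + √2)`. -/
theorem abs_form_sqrt_two_le {k m n l : ℕ} (hk : 2 ≤ k) (hm : 2 ≤ m) (hnm : m ≤ n)
    (hn2 : n ≤ 2 ^ (k - 2)) (heq : genFib k (n + 1) * genFib k (m + 1) = pell l) :
    |(2 * (n + m) - 1 : ℕ) * Real.log √2 - l * Real.log silver| ≤ 4 * n / 2 ^ k := by
  obtain ⟨α, hα⟩ := exists_isDom hk
  have hkn := lt_index hk hm hnm heq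
  obtain ⟨hl, hpow⟩ := hα.pow_le_silver_pow hm hnm heq
  have h1 := abs_log_genFib_sub_le_two hk (by omega : 1 ≤ n) hn2
  have h2 := abs_log_genFib_sub_le_two hk (by omega : 1 ≤ m) (hnm.trans hn2)
  have h3 := IsDom.abs_log_pell_sub_le hl
  have hn1 : (0 : ℝ) < genFib k (n + 1) := by exact_mod_cast genFib_pos hk n
  have hm1 : (0 : ℝ) < genFib k (m + 1) := by exact_mod_cast genFib_pos hk m
  rw [← heq] at h3
  push_cast at h3
  rw [Real.log_mul hn1.ne' hm1.ne', IsDom.log_two_sqrt_two] at h3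
  have hs : Real.log √2 = Real.log 2 / 2 := Real.log_sqrt (by norm_num)
  have hc : (((2 * (n + m) - 1 : ℕ) : ℝ)) = 2 * (n + m) - 1 := by
    rw [Nat.cast_sub (by omega)]; push_cast; ring
  have hsil : ((silver ^ l) ^ 2)⁻¹ ≤ 1 / 2 * (n / 2 ^ k) := by
    have e1 : (2 : ℝ) ^ n ≤ (silver ^ l) ^ 2 := by
      calc (2 : ℝ) ^ n ≤ (α ^ 2) ^ n := by
            gcongr
            nlinarith [hα.gt]
        _ = (α ^ n) ^ 2 := by rw [← pow_mul, ← pow_mul, mul_comm]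
        _ ≤ _ := by
          have := hα.pow_pos n
          gcongr
    have e2 : (2 : ℝ) ^ (k + 1) ≤ 2 ^ n := pow_le_pow_right₀ (by norm_num) hkn
    have e3 : ((silver ^ l) ^ 2)⁻¹ ≤ ((2 : ℝ) ^ (k + 1))⁻¹ :=
      inv_anti₀ (by positivity) (e2.trans e1)
    have e4 : ((2 : ℝ) ^ (k + 1))⁻¹ = 1 / 2 * (1 / 2 ^ k) := by
      rw [pow_succ]; field_simp
    have e5 : (1 : ℝ) / 2 ^ k ≤ n / 2 ^ k := by
      gcongr
      exact_mod_cast (by omega : 1 ≤ n)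
    linarith
  have hmn : (m : ℝ) / 2 ^ k ≤ n / 2 ^ k := by gcongr
  rw [hc, hs, mul_div_assoc]
  rw [abs_le] at h1 h2 h3 ⊢
  constructor <;> linarith

theorem exists_int_eq_silver_pow_add (l : ℕ) :
    ∃ T : ℤ, (silver ^ l) ^ 2 + ((silver ^ l) ^ 2)⁻¹ = 2 * T := by
  have h1 : (1 - √2) * silver = -1 := by unfold silver; linear_combination -sqrt_two_sq
  have h2 : (1 - √2) ^ l * silver ^ l = (-1) ^ l := by rw [← mul_pow, h1]
  have h3 : ((-1 : ℝ) ^ l) ^ 2 = 1 := by rw [← pow_mul, mul_comm, pow_mul]; simp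
  have h4 : ((silver ^ l) ^ 2)⁻¹ = ((1 - √2) ^ l) ^ 2 := by
    refine inv_eq_of_mul_eq_one_right ?_
    rw [← mul_pow, mul_comm, h2, h3]
  refine ⟨4 * pell l ^ 2 + (-1) ^ l, ?_⟩
  have h5 := pell_binet l
  rw [h4]
  push_cast
  linear_combination (-(2 * √2 * (pell l : ℝ)) - (silver ^ l - (1 - √2) ^ l)) * h5 +
    4 * (pell l : ℝ) ^ 2 * sqrt_two_sq + 2 * h2

/-- A Liouville-type bound: `4 ^ B + 1 - 2 ^ B (γ ^ (2 l) + γ ^ (-2 l))` is an odd integer. -/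
theorem inv_two_pow_le_abs_sub {B : ℕ} (hB : 1 ≤ B) (l : ℕ) :
    ((2 : ℝ) ^ B)⁻¹ ≤ |2 ^ B - (silver ^ l) ^ 2| := by
  obtain ⟨T, hT⟩ := exists_int_eq_silver_pow_add l
  obtain ⟨y, hy⟩ : ∃ y, y = (silver ^ l) ^ 2 := ⟨_, rfl⟩
  rw [← hy] at hT ⊢
  have hs : 1 ≤ silver := by linarith [silver_gt]
  have hy1 : 1 ≤ y := hy ▸ one_le_pow₀ (one_le_pow₀ hs)
  have hyi : y⁻¹ ≤ 1 := inv_le_one_of_one_le₀ hy1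
  have hyi0 : 0 < y⁻¹ := by positivity
  have hx1 : (1 : ℝ) ≤ 2 ^ B := one_le_pow₀ (by norm_num)
  have h1 : ((2 : ℝ) ^ B - y) * (2 ^ B - y⁻¹) = ((4 ^ B + 1 - 2 ^ B * (2 * T) : ℤ) : ℝ) := by
    push_cast
    rw [show (4 : ℝ) = 2 ^ 2 by norm_num, ← pow_mul, mul_comm 2 B, pow_mul]
    have : y * y⁻¹ = 1 := mul_inv_cancel₀ (by linarith)
    linear_combination this - 2 ^ B * hT
  have h2 : (4 ^ B + 1 - 2 ^ B * (2 * T) : ℤ) ≠ 0 := by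
    obtain ⟨B, rfl⟩ := Nat.exists_eq_add_of_le' hB
    rw [pow_succ, show (2 : ℤ) ^ (B + 1) * (2 * T) = 2 * (2 ^ (B + 1) * T) by ring]
    omega
  have h3 : (1 : ℝ) ≤ |((2 : ℝ) ^ B - y) * (2 ^ B - y⁻¹)| := by
    rw [h1, ← Int.cast_abs]
    exact_mod_cast Int.one_le_abs h2
  rw [abs_mul, abs_of_nonneg (a := (2 : ℝ) ^ B - y⁻¹) (by linarith)] at h3
  rw [inv_le_iff_one_le_mul₀ (by positivity)]
  refine h3.trans (mul_le_mul_of_nonneg_left (by linarith) (abs_nonneg _))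

theorem inv_two_pow_le_abs_log {B : ℕ} (hB : 1 ≤ B) (l : ℕ) :
    ((2 : ℝ) ^ (2 * B + 2))⁻¹ ≤ |B * Real.log √2 - l * Real.log silver| := by
  have h1 := inv_two_pow_le_abs_sub hB l
  have hs : Real.log √2 = Real.log 2 / 2 := Real.log_sqrt (by norm_num)
  obtain ⟨t, ht⟩ : ∃ t, B * Real.log √2 - l * Real.log silver = t := ⟨_, rfl⟩
  rw [ht]
  have hpos : (0 : ℝ) < 2 ^ B := by positivity
  have h2 : (silver ^ l) ^ 2 = 2 ^ B * Real.exp (-2 * t) := by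
    rw [← Real.exp_log (show (0 : ℝ) < (silver ^ l) ^ 2 from
      pow_pos (pow_pos silver_pos _) _), ← Real.exp_log hpos, ← Real.exp_add, Real.log_pow,
      Real.log_pow, Real.log_pow, ← ht, hs]
    push_cast
    ring_nf
  rcases lt_or_ge (|t|) (1 / 2) with h | h
  · have h3 : |Real.exp (-2 * t) - 1| ≤ 2 * |(-2) * t| := by
      refine Real.abs_exp_sub_one_le ?_
      rw [abs_mul]; norm_num; linarith
    rw [h2, show (2 : ℝ) ^ B - 2 ^ B * Real.exp (-2 * t) =
      -(2 ^ B * (Real.exp (-2 * t) - 1)) by ring,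
      abs_neg, abs_mul, abs_of_pos hpos, inv_le_iff_one_le_mul₀ hpos] at h1
    rw [inv_le_iff_one_le_mul₀ (by positivity), pow_add, mul_comm 2 B, pow_mul]
    have h4 : |(-2 : ℝ) * t| = 2 * |t| := by rw [abs_mul]; norm_num
    rw [h4] at h3
    calc 1 ≤ 2 ^ B * |Real.exp (-2 * t) - 1| * 2 ^ B := h1
      _ ≤ 2 ^ B * (2 * (2 * |t|)) * 2 ^ B := by gcongr
      _ = _ := by ring
  · refine le_trans ?_ h
    rw [inv_le_comm₀ (by positivity) (by norm_num)]
    have : (2 : ℝ) ^ 1 ≤ 2 ^ (2 * B + 2) := pow_le_pow_right₀ (by norm_num) (by omega)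
    norm_num at this ⊢
    exact this

open MvPolynomial in
theorem isFrac_sqrt_two {α : ℝ} : IsFrac 2 α √2 2 (X 1) 1 := by
  have h1 : ‖(√2 : ℂ)‖ ≤ 2 := by
    rw [Complex.norm_real, Real.norm_of_nonneg (Real.sqrt_nonneg 2)]; linarith [sqrt_two_lt]
  have hX : ∀ z w : ℂ, biEval z w (X 1) = w := fun z w => by simp [biEval]
  refine ⟨by norm_num, by simp, by simp [hX], by simp, ?_, by simp, ?_, by simp⟩
  · rw [hX, norm_neg]; exact h1
  · intro z w _ _ hw
    rw [hX, norm_eq_sqrt_two hw]; linarith [sqrt_two_lt]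

set_option maxHeartbeats 1000000 in
theorem exp_neg_lt_abs_sqrt_two_form_of_coprime {B l H : ℕ} (hB : 1 ≤ B) (hl : 1 ≤ l)
    (hBl : B ≤ 4 * l) (hcop : Nat.Coprime l B) (hH : (2 ^ 16 * l * (H + 1) : ℝ) ≤ Real.exp H) :
    Real.exp (-(2 ^ 25 * (H + 1) ^ 2)) < |B * Real.log √2 - l * Real.log silver| := by
  obtain ⟨L, hL⟩ : ∃ L, L = 32 * (H + 1) := ⟨_, rfl⟩
  obtain ⟨R, hR⟩ : ∃ R, R = 98 * L := ⟨_, rfl⟩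
  have hL0 : 32 ≤ L := by omega
  have hR0 : 0 < R := by omega
  have hLr : (32 : ℝ) ≤ L := by exact_mod_cast hL0
  have hLr' : (L : ℝ) = 32 * (H + 1) := by rw [hL]; push_cast; ring
  have hRr : (R : ℝ) = 98 * L := by rw [hR]; push_cast; ring
  have hBr : (1 : ℝ) ≤ B := by exact_mod_cast hB
  have hlr : (1 : ℝ) ≤ l := by exact_mod_cast hl
  have hBlr : (B : ℝ) ≤ 4 * l := by exact_mod_cast hBl
  have hHr : (0 : ℝ) ≤ H := Nat.cast_nonneg H
  rcases lt_or_ge l R with hlR | hlR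
  · refine lt_of_lt_of_le ?_ (inv_two_pow_le_abs_log hB l)
    rw [Real.exp_neg]
    refine inv_strictAnti₀ (by positivity) ?_
    refine (two_pow_le_exp _).trans_lt (Real.exp_lt_exp.2 ?_)
    have : (B : ℝ) ≤ 4 * R := hBlr.trans (by exact_mod_cast Nat.mul_le_mul_left 4 hlR.le)
    push_cast
    nlinarith
  have hlRr : (R : ℝ) ≤ l := by exact_mod_cast hlR
  obtain ⟨α, hα⟩ := exists_isDom (le_refl 2)
  obtain ⟨Λ, hΛ⟩ : ∃ Λ, B * Real.log √2 - l * Real.log silver = Λ := ⟨_, rfl⟩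
  have hs : Real.log √2 = Real.log 2 / 2 := Real.log_sqrt (by norm_num)
  have hs1 : Real.log √2 < 0.3466 := by rw [hs]; linarith [log_two_lt']
  have hs0 : 0 < Real.log √2 := by
    rw [hs]; linarith [Real.log_pos (show (1 : ℝ) < 2 by norm_num)]
  rw [hΛ]
  have hKL : ((96 * R : ℕ) : ℝ) * L = 9408 * L ^ 2 := by push_cast; rw [hRr]; ring
  have hinj : ∀ r₁ r₁' r₂ r₂' : ℕ, r₁ < R → r₁' < R → r₂ < R → r₂' < R →
      (l : ℤ) * r₁ + -(B : ℤ) * r₂ = (l : ℤ) * r₁' + -(B : ℤ) * r₂' → r₁ = r₁' ∧ r₂ = r₂' := by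
    intro r₁ r₁' r₂ r₂' h1 h1' h2 h2' heq
    have e1 : (l : ℤ) * (r₁ - r₁') = B * (r₂ - r₂') := by linear_combination heq
    have e2 : (l : ℤ) ∣ r₂ - r₂' :=
      (Int.isCoprime_iff_gcd_eq_one.2 (by simpa using hcop)).dvd_of_dvd_mul_left (Dvd.intro _ e1)
    have e3 : (r₂ : ℤ) - r₂' = 0 := by
      refine Int.eq_zero_of_abs_lt_dvd e2 ?_
      rw [abs_lt]; constructor <;> omega
    rw [e3, mul_zero, mul_eq_zero] at e1
    omega
  have key := exp_neg_le_abs_of_two_logs hα isFrac_sqrt_two (by positivity) (h := 1)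
    (by linarith [Real.exp_one_gt_d9]) (c₁ := 0) (c₂ := 0) (s₁ := l) (s₂ := -B) (d₁ := 0) (d₂ := 1)
    (f₁ := 1) (f₂ := 0) (τ := Real.log √2 / l) (Λ := Λ / l)
    (by
      have : Real.log √2 / l * ((l : ℤ) : ℝ) = Real.log √2 := by
        push_cast; field_simp
      rw [this]; exact hs0.ne')
    (by simp only [zpow_zero, pow_zero, pow_one, one_mul]; push_cast; field_simp)
    (by
      simp only [zpow_zero, pow_zero, pow_one, one_mul, mul_one]
      rw [log_sqrt_two_sub_one, ← hΛ]; push_cast; field_simp; ring)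
    (K := 96 * R) (L := L) (R₁ := R) (R₂ := R) (by omega) (by omega)
    (by
      rw [show L * (96 * R) = (96 * L) * R by ring]
      exact Nat.mul_lt_mul_of_pos_right (by omega) hR0)
    hinj (X := (l + B) * R) (Y := (96 * R : ℕ) * (H + 1)) (w := 2 * R)
    (by nlinarith)
    (fun r₁ r₂ h1 h2 => by
      have e1 : (r₁ : ℝ) ≤ R := by exact_mod_cast h1.le
      have e2 : (r₂ : ℝ) ≤ R := by exact_mod_cast h2.le
      push_cast
      have e3 : (l : ℝ) * r₁ ≤ l * R := by gcongr
      have e4 : (B : ℝ) * r₂ ≤ B * R := by gcongr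
      have e5 : (0 : ℝ) ≤ l * r₁ := by positivity
      have e6 : (0 : ℝ) ≤ B * r₂ := by positivity
      rw [abs_le]
      constructor <;> linarith)
    (by
      rw [abs_of_pos (by positivity), ← mul_assoc]
      refine mul_le_mul_of_nonneg_right ?_ (by positivity)
      rw [div_mul_eq_mul_div, div_le_iff₀ (by linarith)]
      nlinarith)
    (by
      have e1 : Real.exp ((96 * R : ℕ) * (H + 1)) = Real.exp ((96 * R : ℕ) : ℝ) *
          Real.exp H ^ (96 * R) := by
        rw [← Real.exp_nat_mul, ← Real.exp_add]
        congr 1; push_cast; ring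
      rw [e1]
      have e2 : Real.exp 1 * ((l + B) * R) ≤ Real.exp H := by
        refine le_trans ?_ hH
        have f1 := Real.exp_one_lt_d9
        have f2 : ((l : ℝ) + B) * R ≤ (5 * l) * R := by gcongr; linarith
        have f3 : (0 : ℝ) < (l + B) * R := by positivity
        have f4 : (0 : ℝ) < l * (H + 1) := by positivity
        rw [hRr, hLr'] at *
        nlinarith
      refine mul_le_mul ?_ (pow_le_pow_left₀ (by positivity) e2 _) (by positivity) (by positivity)
      refine le_trans ?_ (Real.quadratic_le_exp_of_nonneg (by positivity))
      rw [hKL]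
      push_cast
      rw [hRr]
      nlinarith)
    (by
      refine le_trans ?_ (Real.add_one_le_exp _)
      rw [hKL, hRr]
      nlinarith)
    (by
      rw [hKL]
      push_cast
      rw [hRr]
      have : (H : ℝ) + 1 = L / 32 := by rw [hLr']; ring
      rw [this]
      nlinarith)
  rw [hKL] at key
  refine lt_of_le_of_lt ?_ (key.trans_le ?_)
  · rw [Real.exp_le_exp, neg_le_neg_iff, hLr']
    nlinarith [sq_nonneg ((H : ℝ) + 1)]
  · rw [abs_div, Nat.abs_cast]
    exact div_le_self (abs_nonneg _) hlr

theorem exp_neg_lt_abs_sqrt_two_form {B l H : ℕ} (hB : 1 ≤ B) (hl : 1 ≤ l)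
    (hBl : B ≤ 4 * l) (hH : (2 ^ 16 * l * (H + 1) : ℝ) ≤ Real.exp H) :
    Real.exp (-(2 ^ 25 * (H + 1) ^ 2)) < |B * Real.log √2 - l * Real.log silver| := by
  obtain ⟨g, l', B', hg, hcop, hl', hB'⟩ := Nat.exists_coprime' (Nat.gcd_pos_of_pos_left B hl)
  have hg1 : 1 ≤ g := hg
  have hl'1 : 1 ≤ l' := Nat.pos_of_ne_zero fun h => by simp [h] at hl'; omega
  have hB'1 : 1 ≤ B' := Nat.pos_of_ne_zero fun h => by simp [h] at hB'; omega
  have h := exp_neg_lt_abs_sqrt_two_form_of_coprime (H := H) hB'1 hl'1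
    (Nat.le_of_mul_le_mul_right (by rw [hB', hl'] at hBl; linarith) hg) hcop
    (le_trans (by
      have : (l' : ℝ) ≤ l := by
        rw [hl']; exact_mod_cast Nat.le_mul_of_pos_right _ hg
      gcongr) hH)
  refine h.trans_le ?_
  have e : (B : ℝ) * Real.log √2 - l * Real.log silver =
      g * (B' * Real.log √2 - l' * Real.log silver) := by
    rw [hl', hB']; push_cast; ring
  rw [e, abs_mul, Nat.abs_cast]
  exact le_mul_of_one_le_left (abs_nonneg _) (by exact_mod_cast hg1)

theorem quadratic_lt_two_pow {u : ℕ} (hu : 50 ≤ u) :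
    212 + 14 * u + 2 ^ 26 * (257 + 15 * u) ^ 2 < 2 ^ (u - 1) := by
  obtain ⟨t, rfl⟩ := Nat.exists_eq_add_of_le hu
  clear hu
  induction t with
  | zero => norm_num
  | succ t ih =>
    have e : 50 + (t + 1) - 1 = (50 + t - 1) + 1 := by omega
    rw [e, pow_succ 2 (50 + t - 1)]
    generalize 2 ^ (50 + t - 1) = P at ih
    nlinarith [sq_nonneg t]

theorem succ_le_two_pow_aux (u : ℕ) : 256 + 15 * u + 1 ≤ 2 ^ (28 + u) := by
  induction u with
  | zero => norm_num
  | succ u ih => rw [← add_assoc, pow_succ]; omega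

theorem order_le_two_pow {k m n l : ℕ} (hk : 2 ≤ k) (hm : 2 ≤ m) (hnm : m ≤ n)
    (heq : genFib k (n + 1) * genFib k (m + 1) = pell l) : k ≤ 2 ^ 49 := by
  by_contra! hk49
  obtain ⟨u, hu⟩ : ∃ u, u = Nat.clog 2 k := ⟨_, rfl⟩
  have hku : k ≤ 2 ^ u := hu ▸ Nat.le_pow_clog (by norm_num) k
  have hu50 : 50 ≤ u := by
    by_contra! h
    have : 2 ^ u ≤ 2 ^ 49 := Nat.pow_le_pow_right (by norm_num) (by omega)
    omega
  have huk : 2 ^ (u - 1) < k := by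
    have := Nat.pow_pred_clog_lt_self (b := 2) (by norm_num) (x := k) (by omega)
    rwa [← hu] at this
  have hq := quadratic_lt_two_pow hu50
  have hn := index_lt_two_pow hk hm hnm hku heq
  have hkn := lt_index hk hm hnm heq
  have hn2 : n ≤ 2 ^ (k - 2) := by
    refine hn.le.trans (Nat.pow_le_pow_right (by norm_num) ?_)
    omega
  have hform := abs_form_sqrt_two_le hk hm hnm hn2 heq
  obtain ⟨α, hα⟩ := exists_isDom hk
  have hl1 := (hα.pow_le_silver_pow hm hnm heq).1
  have hli := hα.index_le hm hnm heq
  obtain ⟨B, hB⟩ : ∃ B, B = 2 * (n + m) - 1 := ⟨_, rfl⟩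
  rw [← hB] at hform
  have hk2 : (0 : ℝ) < 2 ^ k := by positivity
  have hsmall : (4 * n : ℝ) / 2 ^ k ≤ 1 := by
    rw [div_le_one hk2]
    have e : (2 : ℝ) ^ k = 2 ^ (k - 2) * 4 := by
      rw [show (4 : ℝ) = 2 ^ 2 by norm_num, ← pow_add, Nat.sub_add_cancel hk]
    have : (n : ℝ) ≤ 2 ^ (k - 2) := by exact_mod_cast hn2
    rw [e]; linarith
  have hs : Real.log √2 = Real.log 2 / 2 := Real.log_sqrt (by norm_num)
  have hl2 := Real.log_two_gt_d9
  have hBl : B ≤ 4 * l := by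
    have h1 := (abs_le.1 (hform.trans hsmall)).2
    have h2 := log_silver_lt
    have hBr : (9 : ℝ) ≤ B := by exact_mod_cast (by omega : 9 ≤ B)
    have hlr : (0 : ℝ) ≤ l := Nat.cast_nonneg l
    have : (B : ℝ) ≤ 4 * l := by
      rw [hs] at h1
      nlinarith
    exact_mod_cast this
  have hH : (2 ^ 16 * l * ((256 + 15 * u : ℕ) + 1) : ℝ) ≤ Real.exp ((256 + 15 * u : ℕ) : ℝ) := by
    refine le_trans ?_ (two_pow_le_exp _)
    have h1 : 2 ^ 16 * l * (256 + 15 * u + 1) ≤ 2 ^ (256 + 15 * u) := by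
      calc 2 ^ 16 * l * (256 + 15 * u + 1) ≤ 2 ^ 16 * (4 * 2 ^ (210 + 14 * u)) * 2 ^ (28 + u) :=
            Nat.mul_le_mul (Nat.mul_le_mul_left _ (by omega)) (succ_le_two_pow_aux u)
        _ = 2 ^ (16 + 2 + (210 + 14 * u) + (28 + u)) := by simp only [pow_add]; ring
        _ = 2 ^ (256 + 15 * u) := by congr 1; omega
    exact_mod_cast h1
  have key := (exp_neg_lt_abs_sqrt_two_form (by omega) hl1 hBl hH).trans_le hform
  rw [Real.exp_neg, lt_div_iff₀ hk2, inv_mul_lt_iff₀ (Real.exp_pos _)] at key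
  have hexp : Real.exp (2 ^ 25 * (((256 + 15 * u : ℕ) : ℝ) + 1) ^ 2) ≤
      2 ^ (2 ^ 26 * (257 + 15 * u) ^ 2) := by
    have e1 : (2 : ℝ) ^ 25 * (((256 + 15 * u : ℕ) : ℝ) + 1) ^ 2 =
        ((2 ^ 25 * (257 + 15 * u) ^ 2 : ℕ) : ℝ) * 1 := by push_cast; ring
    have e2 : 2 ^ 26 * (257 + 15 * u) ^ 2 = 2 * (2 ^ 25 * (257 + 15 * u) ^ 2) := by ring
    rw [e1, Real.exp_nat_mul, e2, pow_mul (2 : ℝ) 2]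
    exact pow_le_pow_left₀ (Real.exp_pos _).le (by linarith [Real.exp_one_lt_d9]) _
  have hn4 : (4 * n : ℝ) ≤ 2 ^ (212 + 14 * u) := by
    have : 4 * n ≤ 2 ^ (212 + 14 * u) := by
      rw [show 212 + 14 * u = (210 + 14 * u) + 2 by ring, pow_add]
      omega
    exact_mod_cast this
  have hfin : (2 : ℝ) ^ k < 2 ^ (2 ^ 26 * (257 + 15 * u) ^ 2 + (212 + 14 * u)) := by
    rw [pow_add]
    refine key.trans_le (mul_le_mul hexp hn4 (by positivity) (by positivity))
  have := (pow_lt_pow_iff_right₀ (by norm_num : (1 : ℝ) < 2)).1 hfin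
  omega

/-- Function application which makes the kernel evaluate the argument first. -/
noncomputable def force {β : Type} (x : ℕ) (f : ℕ → β) : β :=
  Nat.rec (f 0) (fun n _ => f (Nat.succ n)) x

theorem force_eq {β : Type} (x : ℕ) (f : ℕ → β) : force x f = f x := by cases x <;> rfl

/-- Fixed-point summation of `t / j + t w / (j + 2) + t w ^ 2 / (j + 4) + ⋯` (`n` terms), where `w`
has denominator `2 ^ P`. -/
noncomputable def artanhLoop (P w : ℕ) (n : ℕ) : ℕ → ℕ → ℕ → ℕ :=
  Nat.rec (fun _ s _ => s)
    (fun _ ih t s j =>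
      Nat.rec s (fun t' _ =>
        force (Nat.add s (Nat.div (Nat.succ t') j)) fun s' =>
        ih (Nat.shiftRight (Nat.mul (Nat.succ t') w) P) s' (Nat.add j 2)) t) n

theorem artanhLoop_zero (P w t s j : ℕ) : artanhLoop P w 0 t s j = s := rfl

theorem artanhLoop_zero_left (P w n s j : ℕ) : artanhLoop P w n 0 s j = s := by
  cases n <;> rfl

theorem artanhLoop_succ (P w n t s j : ℕ) :
    artanhLoop P w (n + 1) t s j = artanhLoop P w n (t * w / 2 ^ P) (s + t / j) (j + 2) := by
  rcases t with - | t
  · rw [zero_mul, Nat.zero_div, Nat.zero_div, artanhLoop_zero_left, artanhLoop_zero_left, add_zero]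
  · rw [← Nat.shiftRight_eq_div_pow]
    show force (Nat.add s (Nat.div (Nat.succ t) j)) (fun s' =>
      artanhLoop P w n (Nat.shiftRight (Nat.mul (Nat.succ t) w) P) s' (Nat.add j 2)) = _
    rw [force_eq]
    rfl

theorem artanhLoop_bounds {P w : ℕ} {y : ℝ} (hy : y ≤ 1 / 4) (hw : (w : ℝ) ≤ 2 ^ P * y)
    (hw' : 2 ^ P * y ≤ w + 3) (n : ℕ) {t s j : ℕ} {x : ℝ} (hj : 1 ≤ j) (ht : (t : ℝ) ≤ x)
    (ht' : x ≤ t + 4) (hx : x ≤ 2 ^ P / 2) :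
    (artanhLoop P w n t s j : ℝ) ≤ s + ∑ i ∈ Finset.range n, x * y ^ i / (j + 2 * i) ∧
      s + ∑ i ∈ Finset.range n, x * y ^ i / (j + 2 * i) ≤ artanhLoop P w n t s j + 5 * n := by
  have hP : (0 : ℝ) < 2 ^ P := by positivity
  have hy0 : 0 ≤ y := by
    have : (0 : ℝ) ≤ 2 ^ P * y := (Nat.cast_nonneg w).trans hw
    exact nonneg_of_mul_nonneg_right this hP
  induction n generalizing t s j x with
  | zero => simp [artanhLoop_zero]
  | succ n ih =>
    have hx0 : 0 ≤ x := (Nat.cast_nonneg t).trans ht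
    have hjr : (1 : ℝ) ≤ j := by exact_mod_cast hj
    have htw : ((t * w / 2 ^ P : ℕ) : ℝ) ≤ x * y := by
      refine (Nat.cast_div_le).trans ?_
      push_cast
      rw [div_le_iff₀ hP]
      calc (t : ℝ) * w ≤ x * (2 ^ P * y) := by gcongr
        _ = _ := by ring
    have htw' : x * y ≤ ((t * w / 2 ^ P : ℕ) : ℝ) + 4 := by
      have h1 : (t * w : ℝ) < (((t * w / 2 ^ P : ℕ) : ℝ) + 1) * 2 ^ P := by
        exact_mod_cast Nat.lt_mul_of_div_lt (Nat.lt_succ_self _) (by positivity)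
      have h2 : x * (2 ^ P * y) ≤ t * w + 3 * t + 4 * (2 ^ P * y) := by
        calc x * (2 ^ P * y) ≤ (t + 4) * (2 ^ P * y) := by gcongr
          _ = t * (2 ^ P * y) + 4 * (2 ^ P * y) := by ring
          _ ≤ t * (w + 3) + 4 * (2 ^ P * y) := by gcongr
          _ = _ := by ring
      have h3 : 2 ^ P * y ≤ 2 ^ P * (1 / 4) := by gcongr
      have h4 : (t : ℝ) ≤ 2 ^ P / 2 := ht.trans hx
      by_contra! h
      have h5 : (((t * w / 2 ^ P : ℕ) : ℝ) + 4) * 2 ^ P < x * y * 2 ^ P := by gcongr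
      linarith
    have htx : x * y ≤ 2 ^ P / 2 := by nlinarith
    have hdiv : ((t / j : ℕ) : ℝ) ≤ x / j := by
      refine (Nat.cast_div_le).trans ?_
      gcongr
    have hdiv' : x / j ≤ ((t / j : ℕ) : ℝ) + 5 := by
      have h1 : (t : ℝ) < (((t / j : ℕ) : ℝ) + 1) * j := by
        exact_mod_cast Nat.lt_mul_of_div_lt (Nat.lt_succ_self _) hj
      rw [div_le_iff₀ (by linarith)]
      linarith
    have key := ih (t := t * w / 2 ^ P) (s := s + t / j) (j := j + 2) (by omega) htw htw' htx
    rw [artanhLoop_succ, Finset.sum_range_succ']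
    have hsum : ∑ i ∈ Finset.range n, x * y * y ^ i / (((j + 2 : ℕ) : ℝ) + 2 * i) =
        ∑ i ∈ Finset.range n, x * y ^ (i + 1) / (j + 2 * ((i + 1 : ℕ) : ℝ)) := by
      refine Finset.sum_congr rfl fun i _ => ?_
      push_cast
      rw [pow_succ]
      congr 1 <;> ring
    rw [hsum] at key
    push_cast at key ⊢
    simp only [pow_zero, mul_one, mul_zero, add_zero]
    constructor <;> linarith [key.1, key.2]

/-- A fixed-point approximation of `log (a / b)`. -/
noncomputable def logRatio (P a b : ℕ) : ℕ :=
  force (Nat.div (Nat.shiftLeft (Nat.sub a b) P) (Nat.add a b)) fun z =>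
    force (Nat.shiftRight (Nat.mul z z) P) fun w => Nat.mul 2 (artanhLoop P w P z 0 1)

/-- `r / 2 ^ P` approximates `x` with error at most `E / 2 ^ P`. -/
def Near (P : ℕ) (E : ℝ) (r : ℕ) (x : ℝ) : Prop := |2 ^ P * x - r| ≤ E

theorem near_logRatio {P a b : ℕ} (hP : 1 ≤ P) (hb : 0 < b) (hba : b ≤ a) (hab : a ≤ 3 * b) :
    Near P (10 * P + 2) (logRatio P a b) (Real.log (a / b)) := by
  have hPp : (0 : ℝ) < 2 ^ P := by positivity
  have hP2 : (2 : ℝ) ≤ 2 ^ P := by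
    calc (2 : ℝ) = 2 ^ 1 := by norm_num
      _ ≤ _ := pow_le_pow_right₀ (by norm_num) hP
  have hbr : (0 : ℝ) < b := by exact_mod_cast hb
  have hbar : (b : ℝ) ≤ a := by exact_mod_cast hba
  have habr : (a : ℝ) ≤ 3 * b := by exact_mod_cast hab
  obtain ⟨z, hz⟩ : ∃ z : ℝ, z = (a - b) / (a + b) := ⟨_, rfl⟩
  have hz0 : 0 ≤ z := hz ▸ div_nonneg (by linarith) (by linarith)
  have hz2 : z ≤ 1 / 2 := by rw [hz, div_le_iff₀ (by linarith)]; linarith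
  have hratio : (1 + z) / (1 - z) = a / b := by
    have h1 : (a + b : ℝ) ≠ 0 := by linarith
    have h2 : (1 - (a - b) / (a + b) : ℝ) = 2 * b / (a + b) := by field_simp; ring
    have h3 : (1 + (a - b) / (a + b) : ℝ) = 2 * a / (a + b) := by field_simp; ring
    rw [hz, h2, h3, div_div_div_cancel_right₀ h1, mul_div_mul_left _ _ two_ne_zero]
  obtain ⟨Z, hZ⟩ : ∃ Z, Z = (a - b) * 2 ^ P / (a + b) := ⟨_, rfl⟩
  obtain ⟨w, hw⟩ : ∃ w, w = Z * Z / 2 ^ P := ⟨_, rfl⟩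
  have hdef : logRatio P a b = 2 * artanhLoop P w P Z 0 1 := by
    unfold logRatio
    rw [force_eq, force_eq]
    have h1 : Nat.div (Nat.shiftLeft (Nat.sub a b) P) (Nat.add a b) = Z := by
      rw [hZ, ← Nat.shiftLeft_eq]; rfl
    have h2 : Nat.shiftRight (Nat.mul Z Z) P = w := by
      rw [hw, ← Nat.shiftRight_eq_div_pow]; rfl
    rw [h1, h2]
    rfl
  have hZ1 : (Z : ℝ) ≤ 2 ^ P * z := by
    rw [hZ]
    refine (Nat.cast_div_le).trans (le_of_eq ?_)
    rw [hz, Nat.cast_mul, Nat.cast_sub hba]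
    push_cast; ring
  have hZ2 : 2 ^ P * z ≤ Z + 1 := by
    have h1 : (((a - b) * 2 ^ P : ℕ) : ℝ) < ((Z : ℝ) + 1) * (a + b) := by
      rw [hZ]
      exact_mod_cast Nat.lt_mul_of_div_lt (Nat.lt_succ_self _) (by omega)
    rw [Nat.cast_mul, Nat.cast_sub hba] at h1
    push_cast at h1
    rw [hz, ← mul_div_assoc, div_le_iff₀ (by linarith)]
    linarith
  have hy : z ^ 2 ≤ 1 / 4 := by nlinarith
  have hw1 : (w : ℝ) ≤ 2 ^ P * z ^ 2 := by
    rw [hw]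
    refine (Nat.cast_div_le).trans ?_
    push_cast
    rw [div_le_iff₀ hPp]
    calc (Z : ℝ) * Z ≤ (2 ^ P * z) * (2 ^ P * z) := by gcongr
      _ = _ := by ring
  have hw2 : 2 ^ P * z ^ 2 ≤ w + 3 := by
    have h1 : (Z * Z : ℝ) < ((w : ℝ) + 1) * 2 ^ P := by
      rw [hw]
      exact_mod_cast Nat.lt_mul_of_div_lt (Nat.lt_succ_self _) (by positivity)
    by_contra! h
    have h2 : ((w : ℝ) + 3) * 2 ^ P < 2 ^ P * z ^ 2 * 2 ^ P := by gcongr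
    have h3 : 2 ^ P * z ^ 2 * 2 ^ P ≤ ((Z : ℝ) + 1) * (Z + 1) := by
      calc 2 ^ P * z ^ 2 * 2 ^ P = (2 ^ P * z) * (2 ^ P * z) := by ring
        _ ≤ _ := by gcongr
    have h4 : 2 ^ P * z ≤ 2 ^ P * (1 / 2) := by gcongr
    nlinarith
  have key := artanhLoop_bounds hy hw1 hw2 P (t := Z) (s := 0) (j := 1) (x := 2 ^ P * z) le_rfl
    hZ1 (by linarith) (by nlinarith)
  have hsum : ((0 : ℕ) : ℝ) + ∑ i ∈ Finset.range P,
      2 ^ P * z * (z ^ 2) ^ i / (((1 : ℕ) : ℝ) + 2 * i) =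
      2 ^ P * ∑ i ∈ Finset.range P, z ^ (2 * i + 1) / (2 * i + 1) := by
    rw [Nat.cast_zero, zero_add, Finset.mul_sum]
    refine Finset.sum_congr rfl fun i _ => ?_
    rw [pow_succ z (2 * i), pow_mul z 2 i, Nat.cast_one, add_comm (1 : ℝ)]
    ring
  rw [hsum] at key
  have hlow := Real.sum_range_le_log_div hz0 (by linarith) P
  have hupp := Real.log_div_le_sum_range_add hz0 (by linarith) P
  rw [hratio] at hlow hupp
  have htail : 2 ^ P * (z ^ (2 * P + 1) / (1 - z ^ 2)) ≤ 1 := by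
    rw [← mul_div_assoc, div_le_one (by linarith), pow_succ, pow_mul]
    have h1 : (2 ^ P * (z ^ 2) ^ P : ℝ) ≤ 1 := by
      rw [← mul_pow]
      exact pow_le_one₀ (by positivity) (by linarith)
    calc 2 ^ P * ((z ^ 2) ^ P * z) = (2 ^ P * (z ^ 2) ^ P) * z := by ring
      _ ≤ 1 * z := by gcongr
      _ ≤ _ := by linarith
  have hlow' : 2 ^ P * ∑ i ∈ Finset.range P, z ^ (2 * i + 1) / (2 * i + 1) ≤
      2 ^ P * (1 / 2 * Real.log (a / b)) := by gcongr
  have hupp' : 2 ^ P * (1 / 2 * Real.log (a / b)) ≤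
      2 ^ P * ((∑ i ∈ Finset.range P, z ^ (2 * i + 1) / (2 * i + 1)) +
        z ^ (2 * P + 1) / (1 - z ^ 2)) := by gcongr
  rw [mul_add] at hupp'
  unfold Near
  rw [hdef, abs_le]
  push_cast
  constructor <;> linarith [key.1, key.2]

theorem Near.mono {P : ℕ} {E E' x : ℝ} {r : ℕ} (h : Near P E r x) (hE : E ≤ E') : Near P E' r x :=
  le_trans h hE

/-- Newton iteration for `2 ^ P * √2`. -/
noncomputable def sqrtTwo (P : ℕ) : ℕ :=
  Nat.rec (3 * Nat.pow 2 (P - 1)) (fun _ ih => force ih fun x =>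
    Nat.div (Nat.add x (Nat.div (Nat.pow 2 (2 * P + 1)) x)) 2) 12

noncomputable def logTwo (P : ℕ) : ℕ := logRatio P 2 1

noncomputable def logSilver (P : ℕ) : ℕ :=
  force (sqrtTwo P) fun s => logTwo P + logRatio P (Nat.add (Nat.pow 2 P) s) (Nat.pow 2 (P + 1))

noncomputable def sqrtTwoCheck (P : ℕ) : Bool :=
  force (sqrtTwo P) fun s => Nat.ble (s * s) (Nat.pow 2 (2 * P + 1)) &&
    Nat.ble (Nat.pow 2 (2 * P + 1)) ((s + 1) * (s + 1))

theorem near_logTwo {P : ℕ} (hP : 1 ≤ P) : Near P (10 * P + 2) (logTwo P) (Real.log 2) := by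
  simpa [logTwo] using near_logRatio (a := 2) (b := 1) hP one_pos (by norm_num) (by norm_num)

theorem abs_log_sub_log_le {x y ε c : ℝ} (hc : 0 < c) (hx : c ≤ x) (hy : c ≤ y)
    (h : |x - y| ≤ ε) : |Real.log x - Real.log y| ≤ ε / c := by
  have key : ∀ {x y : ℝ}, c ≤ x → c ≤ y → |x - y| ≤ ε → Real.log x - Real.log y ≤ ε / c := by
    intro x y hx hy h
    have hx0 := hc.trans_le hx
    have hy0 := hc.trans_le hy
    rw [← Real.log_div hx0.ne' hy0.ne']
    refine (Real.log_le_sub_one_of_pos (by positivity)).trans ?_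
    rw [div_sub_one hy0.ne']
    have h1 := le_abs_self (x - y)
    have h2 := (abs_nonneg _).trans h
    calc (x - y) / y ≤ ε / y := by gcongr; linarith
      _ ≤ ε / c := by gcongr
  rw [abs_le]
  constructor
  · have := key hy hx (by rwa [abs_sub_comm])
    linarith
  · exact key hx hy h

theorem near_logSilver {P : ℕ} (hP : 1 ≤ P) (h : sqrtTwoCheck P = true) :
    Near P (20 * P + 5) (logSilver P) (Real.log silver) := by
  unfold sqrtTwoCheck at h
  unfold logSilver
  rw [force_eq] at h ⊢
  generalize sqrtTwo P = s at h ⊢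
  rw [Bool.and_eq_true, Nat.ble_eq, Nat.ble_eq] at h
  obtain ⟨h1, h2⟩ := h
  change _ ≤ 2 ^ (2 * P + 1) at h1
  change 2 ^ (2 * P + 1) ≤ _ at h2
  change Near P _ (logTwo P + logRatio P (2 ^ P + s) (2 ^ (P + 1))) _
  have hP0 : (0 : ℝ) < 2 ^ P := by positivity
  have e1 : (s : ℝ) ≤ 2 ^ P * √2 := by
    have : ((s * s : ℕ) : ℝ) ≤ ((2 ^ (2 * P + 1) : ℕ) : ℝ) := by exact_mod_cast h1
    push_cast at this
    refine abs_le_of_sq_le_sq' ?_ (by positivity) |>.2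
    rw [mul_pow, Real.sq_sqrt zero_le_two]
    calc (s : ℝ) ^ 2 = s * s := sq _
      _ ≤ _ := this
      _ = _ := by ring
  have e2 : 2 ^ P * √2 ≤ (s : ℝ) + 1 := by
    have : ((2 ^ (2 * P + 1) : ℕ) : ℝ) ≤ (((s + 1) * (s + 1) : ℕ) : ℝ) := by exact_mod_cast h2
    push_cast at this
    refine abs_le_of_sq_le_sq' ?_ (by positivity) |>.2
    rw [mul_pow, Real.sq_sqrt zero_le_two]
    calc ((2 : ℝ) ^ P) ^ 2 * 2 = 2 ^ (2 * P + 1) := by ring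
      _ ≤ _ := this
      _ = _ := by ring
  have hs1 : 2 ^ P ≤ s := by
    have hP2 : (2 : ℝ) ≤ 2 ^ P := by
      calc (2 : ℝ) = 2 ^ 1 := by norm_num
        _ ≤ _ := pow_le_pow_right₀ (by norm_num) hP
    have h3 : (2 : ℝ) ^ P * 1.4142 ≤ s + 1 := by
      refine le_trans ?_ e2
      have := sqrt_two_gt
      gcongr
    have h4 : ((2 ^ P : ℕ) : ℝ) < ((s + 1 : ℕ) : ℝ) := by push_cast; linarith
    exact Nat.lt_succ_iff.1 (by exact_mod_cast h4)
  have hs2 : s ≤ 2 * 2 ^ P := by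
    have h3 : (s : ℝ) ≤ 2 ^ P * 2 := by
      refine e1.trans ?_
      have := sqrt_two_lt
      gcongr
      linarith
    have h4 : (s : ℝ) ≤ ((2 * 2 ^ P : ℕ) : ℝ) := by push_cast; linarith
    exact_mod_cast h4
  have n1 := near_logTwo hP
  have n2 := near_logRatio (a := 2 ^ P + s) (b := 2 ^ (P + 1)) hP (by positivity)
    (by rw [pow_succ]; omega) (by rw [pow_succ]; omega)
  have hlog : |Real.log silver - (Real.log 2 + Real.log ((2 ^ P + s : ℕ) / (2 ^ (P + 1) : ℕ)))| ≤
      1 / 2 ^ P := by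
    have hx : (1 : ℝ) ≤ (2 ^ P + s) / 2 ^ P := by
      rw [le_div_iff₀ hP0]; linarith [Nat.cast_nonneg (α := ℝ) s]
    have : Real.log 2 + Real.log ((2 ^ P + s : ℕ) / (2 ^ (P + 1) : ℕ)) =
        Real.log ((2 ^ P + s) / 2 ^ P) := by
      rw [← Real.log_mul two_ne_zero (by positivity)]
      congr 1
      push_cast
      rw [pow_succ]
      field_simp
    rw [this]
    have h5 := abs_log_sub_log_le (x := silver) (y := (2 ^ P + s) / 2 ^ P) (ε := 1 / 2 ^ P) one_pos
      (by linarith [silver_gt]) hx (by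
        have : silver - (2 ^ P + s) / 2 ^ P = (2 ^ P * √2 - s) / 2 ^ P := by
          unfold silver; field_simp; ring
        rw [this, abs_div, abs_of_pos hP0]
        gcongr
        rw [abs_le]
        constructor <;> linarith)
    simpa using h5
  unfold Near at n1 n2 ⊢
  have h6 : |2 ^ P * (Real.log silver -
      (Real.log 2 + Real.log ((2 ^ P + s : ℕ) / (2 ^ (P + 1) : ℕ))))| ≤ 1 := by
    rw [abs_mul, abs_of_pos hP0]
    calc _ ≤ 2 ^ P * (1 / 2 ^ P : ℝ) := by gcongr
      _ = 1 := by field_simp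
  rw [abs_le] at *
  push_cast at *
  constructor <;> linarith [n1.1, n1.2, n2.1, n2.2, h6.1, h6.2]

/-- The nearest integer to `x / g`. -/
noncomputable def nearDiv (x g : ℕ) : ℕ := Nat.div (Nat.add x (Nat.div g 2)) g

noncomputable def natDist (x y : ℕ) : ℕ := Nat.add (Nat.sub x y) (Nat.sub y x)

theorem abs_sub_eq_natDist (x y : ℕ) : |(x : ℝ) - y| = natDist x y := by
  have h : natDist x y = (x - y) + (y - x) := rfl
  rw [h]
  rcases le_total x y with hxy | hxy
  · have : (x : ℝ) ≤ y := by exact_mod_cast hxy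
    rw [abs_of_nonpos (by linarith), Nat.sub_eq_zero_of_le hxy, zero_add, Nat.cast_sub hxy]
    ring
  · have : (y : ℝ) ≤ x := by exact_mod_cast hxy
    rw [abs_of_nonneg (by linarith), Nat.sub_eq_zero_of_le hxy, add_zero, Nat.cast_sub hxy]

/-- The error committed when a linear form with coefficients bounded by `2 ^ N` is multiplied
by `q`. -/
noncomputable def redError (P N b a g q : ℕ) : ℕ :=
  force (Nat.mul q a) fun x =>
    Nat.succ (Nat.add (Nat.mul (Nat.pow 2 N) (natDist x (Nat.mul (nearDiv x g) g)))
      (Nat.mul q (Nat.add (Nat.mul (Nat.add (Nat.mul 15 (Nat.pow 2 N)) 512) (10 * P + 2))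
        (Nat.pow 2 (P - b)))))

theorem redError_eq (P N b a g q : ℕ) : redError P N b a g q =
    2 ^ N * natDist (q * a) (nearDiv (q * a) g * g) +
      q * ((15 * 2 ^ N + 512) * (10 * P + 2) + 2 ^ (P - b)) + 1 := by
  unfold redError
  rw [force_eq]
  rfl

/-- The multiple `q c` of the inhomogeneous term `c` is at distance at least `V` from the multiples
of `g`. -/
noncomputable def redTest (g q V c : ℕ) : Bool :=
  force (Nat.mod (Nat.mul q c) g) fun r =>
    Bool.rec false (Nat.ble (Nat.add r V) g) (Nat.ble V r)

theorem redTest_iff (g q V c : ℕ) :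
    redTest g q V c = true ↔ V ≤ q * c % g ∧ q * c % g + V ≤ g := by
  unfold redTest
  rw [force_eq]
  change (Bool.rec false (Nat.ble (q * c % g + V) g) (Nat.ble V (q * c % g)) : Bool) = true ↔ _
  rw [← Nat.ble_eq (x := V), ← Nat.ble_eq (x := q * c % g + V)]
  cases Nat.ble V (q * c % g) <;> simp

theorem le_abs_form_of_redTest {P N b a g q V c : ℕ} {x y z : ℝ} (hbP : b ≤ P)
    (ha : Near P (3 * (10 * P + 2)) a x) (hg : Near P (3 * (10 * P + 2)) g z)
    (hc : Near P (509 * (10 * P + 2)) c y) (hV : V = redError P N b a g q)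
    (ht : redTest g q V c = true) {A l : ℕ} (hA : A ≤ 2 ^ N) (hl : l ≤ 4 * 2 ^ N + 1) :
    (2 ^ b : ℝ)⁻¹ ≤ |A * x + y - l * z| := by
  rw [redTest_iff] at ht
  obtain ⟨h1, h2⟩ := ht
  by_contra! hlt
  have hP0 : (0 : ℝ) < 2 ^ P := by positivity
  have hAr : (A : ℝ) ≤ 2 ^ N := by exact_mod_cast hA
  have hlr : (l : ℝ) ≤ 4 * 2 ^ N + 1 := by exact_mod_cast hl
  obtain ⟨u, hu⟩ : ∃ u : ℝ, u = 10 * P + 2 := ⟨_, rfl⟩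
  have hu0 : 0 ≤ u := by rw [hu]; positivity
  rw [← hu] at ha hg hc
  -- the integer linear form
  have hform : |(A * a + c - l * g : ℝ)| < (15 * 2 ^ N + 512) * u + 2 ^ (P - b) := by
    have e : (A * a + c - l * g : ℝ) = 2 ^ P * (A * x + y - l * z) -
        (A * (2 ^ P * x - a) + (2 ^ P * y - c) - l * (2 ^ P * z - g)) := by ring
    have e1 : |A * (2 ^ P * x - a)| ≤ 2 ^ N * (3 * u) := by
      rw [abs_mul, Nat.abs_cast]
      exact mul_le_mul hAr ha (abs_nonneg _) (by positivity)
    have e2 : |l * (2 ^ P * z - g)| ≤ (4 * 2 ^ N + 1) * (3 * u) := by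
      rw [abs_mul, Nat.abs_cast]
      exact mul_le_mul hlr hg (abs_nonneg _) (by positivity)
    have e3 : |2 ^ P * (A * x + y - l * z)| < 2 ^ (P - b) := by
      rw [abs_mul, abs_of_pos hP0]
      calc _ < 2 ^ P * (2 ^ b : ℝ)⁻¹ := by gcongr
        _ = 2 ^ (P - b) := by rw [pow_sub₀ _ two_ne_zero hbP]
    unfold Near at hc
    rw [e]
    rw [abs_le] at e1 e2 hc
    rw [abs_lt] at e3 ⊢
    constructor <;> linarith [e1.1, e1.2, e2.1, e2.2, e3.1, e3.2, hc.1, hc.2]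
  obtain ⟨p, hp⟩ : ∃ p, p = nearDiv (q * a) g := ⟨_, rfl⟩
  obtain ⟨e, he⟩ : ∃ e, e = natDist (q * a) (p * g) := ⟨_, rfl⟩
  have hdist : |(q * a - p * g : ℝ)| = e := by
    rw [he, ← abs_sub_eq_natDist]; push_cast; rfl
  have hVr : (V : ℝ) = 2 ^ N * e + q * ((15 * 2 ^ N + 512) * u + 2 ^ (P - b)) + 1 := by
    rw [hV, redError_eq, ← hp, ← he, hu]; push_cast; rfl
  -- multiply by `q`
  have hq : |((A * p : ℤ) - (l * q : ℤ) : ℝ) * g + q * c| < V := by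
    have e1 : ((A * p : ℤ) - (l * q : ℤ) : ℝ) * g + q * c =
        q * (A * a + c - l * g) - A * (q * a - p * g) := by push_cast; ring
    rw [e1, hVr]
    refine (abs_sub _ _).trans_lt (lt_of_le_of_lt ?_ (lt_add_one _))
    rw [abs_mul, abs_mul, Nat.abs_cast, Nat.abs_cast, hdist, add_comm]
    gcongr
  have hdm := Nat.div_add_mod (q * c) g
  set r := q * c % g with hr
  set t := q * c / g with ht
  have hq' : |((A * p - l * q + t : ℤ) : ℝ) * g + r| < V := by
    have e1 : (q * c : ℝ) = g * t + r := by exact_mod_cast hdm.symm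
    rw [e1] at hq
    convert hq using 2
    push_cast; ring
  generalize (A * p - l * q + t : ℤ) = s at hq'
  have hqi : |s * g + r| < V := by exact_mod_cast hq'
  rw [abs_lt] at hqi
  have h1' : (V : ℤ) ≤ r := by exact_mod_cast h1
  have h2' : (r + V : ℤ) ≤ g := by exact_mod_cast h2
  rcases lt_trichotomy s 0 with hs | rfl | hs
  · have : s * g ≤ -1 * g := by gcongr; omega
    omega
  · omega
  · have : 1 * g ≤ s * g := by gcongr; omega
    omega

/-- The first denominator of a convergent of `a / g` that is at least `M`. -/
noncomputable def convDen (a g M fuel : ℕ) : ℕ :=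
  Nat.rec (motive := fun _ => ℕ → ℕ → ℕ → ℕ → ℕ) (fun _ _ _ q => q)
    (fun _ ih r s q₀ q =>
      Bool.rec
        (force (Nat.div r s) fun u => force (Nat.sub r (Nat.mul u s)) fun s' =>
          force (Nat.add q₀ (Nat.mul u q)) fun q' => ih s s' q q')
        q (Nat.ble M q)) fuel g a 0 1

noncomputable def convTest (P N Q a g q : ℕ) : Bool :=
  force (nearDiv (Nat.mul q a) g) fun p =>
    Nat.ble (2 ^ N + 1) q && (Nat.ble q (2 ^ Q) && (Nat.beq (Nat.gcd p q) 1 &&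
      Nat.ble (Nat.add (Nat.mul (2 * 2 ^ N) (Nat.add (natDist (Nat.mul q a) (Nat.mul p g))
        (Nat.mul (Nat.add q p) (3 * (10 * P + 2))))) (3 * (10 * P + 2))) g))

theorem le_abs_form_of_convTest {P N Q a g q : ℕ} {x z : ℝ}
    (ha : Near P (3 * (10 * P + 2)) a x) (hg : Near P (3 * (10 * P + 2)) g z)
    (hz : 0 < z) (ht : convTest P N Q a g q = true) {B : ℕ} (l : ℤ) (hB0 : 1 ≤ B)
    (hB : B ≤ 2 ^ N) : z ≤ 2 ^ (Q + 1) * |B * x - l * z| := by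
  unfold convTest at ht
  rw [force_eq] at ht
  generalize hp : nearDiv (Nat.mul q a) g = p at ht
  simp only [Bool.and_eq_true, Nat.ble_eq, Nat.beq_eq] at ht
  obtain ⟨h1, h2, h3, h4⟩ := ht
  change 2 * 2 ^ N * (natDist (q * a) (p * g) + (q + p) * (3 * (10 * P + 2))) +
    3 * (10 * P + 2) ≤ g at h4
  obtain ⟨e, he⟩ : ∃ e, e = natDist (q * a) (p * g) := ⟨_, rfl⟩
  have hdist : |(q * a - p * g : ℝ)| = e := by
    rw [he, ← abs_sub_eq_natDist]; push_cast; rfl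
  rw [← he] at h4
  have h4' : (2 * 2 ^ N * (e + (q + p) * (3 * (10 * P + 2))) + 3 * (10 * P + 2) : ℝ) ≤ g := by
    exact_mod_cast h4
  obtain ⟨u, hu⟩ : ∃ u : ℝ, u = 3 * (10 * P + 2) := ⟨_, rfl⟩
  have hu0 : 0 ≤ u := by rw [hu]; positivity
  rw [← hu] at ha hg h4'
  have hP0 : (0 : ℝ) < 2 ^ P := by positivity
  have hBr : (B : ℝ) ≤ 2 ^ N := by exact_mod_cast hB
  have hq0 : 0 < q := by omega
  have hqr : (q : ℝ) ≤ 2 ^ Q := by exact_mod_cast h2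
  -- `ε = q x - p z`
  have hε : 2 ^ P * |q * x - p * z| ≤ e + (q + p) * u := by
    rw [← abs_of_pos (a := (2 : ℝ) ^ P) hP0, ← abs_mul]
    have e0 : 2 ^ P * (q * x - p * z) =
        (q * a - p * g) + q * (2 ^ P * x - a) - p * (2 ^ P * z - g) := by ring
    have e1 : |q * (2 ^ P * x - a)| ≤ q * u := by
      rw [abs_mul, Nat.abs_cast]; exact mul_le_mul_of_nonneg_left ha (by positivity)
    have e2 : |p * (2 ^ P * z - g)| ≤ p * u := by
      rw [abs_mul, Nat.abs_cast]; exact mul_le_mul_of_nonneg_left hg (by positivity)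
    rw [e0]
    rw [abs_le] at *
    have e3 := abs_le.1 hdist.le
    constructor <;> linarith [e1.1, e1.2, e2.1, e2.2, e3.1, e3.2]
  have hgz : (g : ℝ) ≤ 2 ^ P * z + u := by
    have := (abs_le.1 hg).1
    linarith
  have hBε : 2 * (B * |q * x - p * z|) ≤ z := by
    have h5 : 2 ^ P * (2 * (B * |q * x - p * z|)) ≤ 2 ^ P * z := by
      calc 2 ^ P * (2 * (B * |q * x - p * z|)) = 2 * B * (2 ^ P * |q * x - p * z|) := by ring
        _ ≤ 2 * 2 ^ N * (e + (q + p) * u) := by gcongr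
        _ ≤ 2 ^ P * z := by linarith
    exact le_of_mul_le_mul_left h5 hP0
  -- the integer `B p - q l` does not vanish
  have hne : (B * p - q * l : ℤ) ≠ 0 := by
    intro h0
    have hd : (q : ℤ) ∣ (B : ℤ) * p := ⟨l, by linarith⟩
    have hd' : q ∣ B * p := by exact_mod_cast hd
    have hd2 : q ∣ B := (Nat.Coprime.symm h3).dvd_of_dvd_mul_right hd'
    have := Nat.le_of_dvd hB0 hd2
    omega
  have hone : (1 : ℝ) ≤ |((B * p - q * l : ℤ) : ℝ)| := by
    rw [← Int.cast_abs]; exact_mod_cast Int.one_le_abs hne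
  have hmain : z ≤ q * |B * x - l * z| + B * |q * x - p * z| := by
    calc z = 1 * |z| := by rw [one_mul, abs_of_pos hz]
      _ ≤ |((B * p - q * l : ℤ) : ℝ)| * |z| := by gcongr
      _ = |q * (B * x - l * z) - B * (q * x - p * z)| := by
        rw [← abs_mul]; congr 1; push_cast; ring
      _ ≤ _ := (abs_sub _ _).trans (by rw [abs_mul, abs_mul, Nat.abs_cast, Nat.abs_cast])
  calc z ≤ 2 * (q * |B * x - l * z|) := by linarith
    _ ≤ 2 * (2 ^ Q * |B * x - l * z|) := by gcongr
    _ = _ := by ring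

noncomputable def convCheck (P N Q : ℕ) : Bool :=
  sqrtTwoCheck P && force (logTwo P) fun a => force (logSilver P) fun g =>
    force (convDen a g (2 ^ (N + 2)) (2 * N + 20)) fun q => convTest P N Q a g q

theorem le_abs_form_of_convCheck {P N Q : ℕ} (hP : 1 ≤ P) (h : convCheck P N Q = true) {B : ℕ}
    (l : ℕ) (hB0 : 1 ≤ B) (hB : B ≤ 2 ^ N) :
    Real.log silver ≤ 2 ^ (Q + 2) * |B * Real.log √2 - l * Real.log silver| := by
  unfold convCheck at h
  rw [Bool.and_eq_true, force_eq, force_eq, force_eq] at h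
  have hP1 : (1 : ℝ) ≤ P := by exact_mod_cast hP
  have key := le_abs_form_of_convTest ((near_logTwo hP).mono (by linarith))
    ((near_logSilver hP h.1).mono (by linarith)) (by linarith [log_silver_gt]) h.2 (2 * l) hB0 hB
  have e : (B * Real.log 2 - ((2 * l : ℤ) : ℝ) * Real.log silver) =
      2 * (B * Real.log √2 - l * Real.log silver) := by
    rw [Real.log_sqrt zero_le_two]; push_cast; ring
  rw [e, abs_mul, abs_two] at key
  calc _ ≤ _ := key
    _ = _ := by ring

theorem order_le_of_convCheck {P N Q s k n m l : ℕ} (hP : 1 ≤ P) (h : convCheck P N Q = true)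
    (hk : 2 ≤ k) (hm : 2 ≤ m) (hnm : m ≤ n) (heq : genFib k (n + 1) * genFib k (m + 1) = pell l)
    (hs : n < 2 ^ s) (hN : s + 2 ≤ N) : k ≤ Q + s + 4 := by
  by_contra! hlt
  have hn2 : n ≤ 2 ^ (k - 2) := hs.le.trans (Nat.pow_le_pow_right two_pos (by omega))
  have h1 := abs_form_sqrt_two_le hk hm hnm hn2 heq
  have hB : 2 * (n + m) - 1 ≤ 2 ^ N := by
    have : 2 ^ (s + 2) ≤ 2 ^ N := Nat.pow_le_pow_right two_pos hN
    rw [pow_add] at this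
    omega
  have h2 := le_abs_form_of_convCheck hP h l (B := 2 * (n + m) - 1) (by omega) hB
  have h3 := log_silver_gt
  have hnr : (n : ℝ) < 2 ^ s := by exact_mod_cast hs
  have hk2 : (2 : ℝ) * 2 ^ (Q + s + 4) ≤ 2 ^ k := by
    rw [← pow_succ']; exact pow_le_pow_right₀ one_le_two (by omega)
  have h4 : Real.log silver ≤ 2 ^ (Q + 2) * (4 * n / 2 ^ k) := h2.trans (by gcongr)
  have h5 : (2 : ℝ) ^ (Q + 2) * (4 * n / 2 ^ k) ≤ 1 / 2 := by
    rw [← mul_div_assoc, div_le_iff₀ (by positivity)]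
    calc (2 : ℝ) ^ (Q + 2) * (4 * n) ≤ 2 ^ (Q + 2) * (4 * 2 ^ s) := by gcongr
      _ = 2 ^ (Q + s + 4) := by ring
      _ ≤ _ := by linarith
  linarith

theorem convCheck_898 : convCheck 1900 898 904 = true := by decide +kernel

theorem convCheck_366 : convCheck 1900 366 370 = true := by decide +kernel

theorem convCheck_167 : convCheck 400 167 174 = true := by decide +kernel

theorem convCheck_11 : convCheck 100 11 15 = true := by decide +kernel

/-- Lazy conjunction. -/
noncomputable def andThen (c t : Bool) : Bool := Bool.rec false t c

theorem andThen_eq_true {c t : Bool} : andThen c t = true ↔ c = true ∧ t = true := by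
  cases c <;> simp [andThen]

/-- Fixed-point iteration for `2 ^ P * (2 - α)`. -/
noncomputable def alphaGap (P k fuel : ℕ) : ℕ :=
  Nat.rec (motive := fun _ => ℕ → ℕ) (fun D => D)
    (fun _ ih D =>
      force (Nat.div (Nat.pow 2 (P * (k + 1)))
        (Nat.pow (Nat.sub (Nat.pow 2 (P + 1)) D) k)) fun D' =>
        Bool.rec (ih D') D (Nat.beq D' D)) fuel 0

noncomputable def gapCheck (P k D : ℕ) : Bool :=
  force (Nat.pow 2 (P + 1)) fun T => force (Nat.pow 2 (P * (k + 1))) fun U =>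
  force (Nat.sub T D) fun A =>
    andThen (Nat.ble 3 D) (andThen (Nat.ble T (3 * (T - (k + 1) * D)))
      (andThen (Nat.ble (U + 1) (Nat.mul (Nat.pow (Nat.sub A 3) k) (Nat.add D 3)))
        (Nat.ble (Nat.succ (Nat.mul (Nat.pow (Nat.add A 3) k) (Nat.sub D 3))) U)))

theorem gapCheck_sound {P k D : ℕ} {α : ℝ} (hP : 5 ≤ P) (hα : IsDom k α)
    (h : gapCheck P k D = true) :
    |2 ^ P * (2 - α) - D| ≤ 3 ∧ 2 ^ (P + 1) ≤ 3 * (2 ^ (P + 1) - (k + 1) * D) := by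
  unfold gapCheck at h
  simp only [force_eq, andThen_eq_true, Nat.ble_eq] at h
  obtain ⟨h1, h2, h3, h4⟩ := h
  change 2 ^ (P + 1) ≤ 3 * (2 ^ (P + 1) - (k + 1) * D) at h2
  change 2 ^ (P * (k + 1)) < (2 ^ (P + 1) - D - 3) ^ k * (D + 3) at h3
  change (2 ^ (P + 1) - D + 3) ^ k * (D - 3) < 2 ^ (P * (k + 1)) at h4
  refine ⟨?_, h2⟩
  have hk := hα.two_le
  have hP0 : (0 : ℝ) < 2 ^ P := by positivity
  have hP5 : 2 ^ 5 ≤ 2 ^ P := Nat.pow_le_pow_right two_pos hP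
  have hkD : 3 * D ≤ (k + 1) * D := Nat.mul_le_mul_right _ (by omega)
  rw [pow_succ] at h2 h3 h4
  have hD : 9 * D ≤ 4 * 2 ^ P := by omega
  have hpow : ((2 : ℝ) ^ P) ^ k * 2 ^ P = 2 ^ (P * (k + 1)) := by
    rw [mul_add, pow_add, pow_mul, mul_one]
  have key : ∀ x : ℝ, (x / 2 ^ P) ^ k * (2 - x / 2 ^ P) =
      x ^ k * (2 * 2 ^ P - x) / 2 ^ (P * (k + 1)) := by
    intro x
    rw [← hpow, div_pow, sub_div' hP0.ne', div_mul_div_comm]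
  rw [abs_le]
  constructor
  · -- `α < (A + 3) / 2 ^ P`
    have h5 : α < ((2 ^ P * 2 - D + 3 : ℕ) : ℝ) / 2 ^ P := by
      refine hα.of_lt ?_ ?_
      · rw [lt_div_iff₀ hP0, one_mul]
        have : 2 ^ P < 2 ^ P * 2 - D + 3 := by omega
        exact_mod_cast this
      · rw [key, div_lt_one (by positivity)]
        have h6 : (((2 ^ P * 2 - D + 3) ^ k * (D - 3) : ℕ) : ℝ) <
            ((2 ^ (P * (k + 1)) : ℕ) : ℝ) := by
          exact_mod_cast h4
        have h7 : (2 * 2 ^ P - ((2 ^ P * 2 - D + 3 : ℕ) : ℝ)) = ((D - 3 : ℕ) : ℝ) := by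
          rw [Nat.cast_add, Nat.cast_sub (by omega), Nat.cast_sub h1]; push_cast; ring
        rw [h7]
        rw [Nat.cast_mul, Nat.cast_pow] at h6
        push_cast at h6 ⊢
        exact h6
    rw [lt_div_iff₀ hP0, Nat.cast_add, Nat.cast_sub (by omega)] at h5
    push_cast at h5
    linarith
  · have h5 : ((2 ^ P * 2 - D - 3 : ℕ) : ℝ) / 2 ^ P < α := by
      refine hα.lt_of ?_ ?_
      · rw [lt_div_iff₀ hP0, one_mul]
        have : 2 ^ P < 2 ^ P * 2 - D - 3 := by omega
        exact_mod_cast this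
      · rw [key, one_lt_div (by positivity)]
        have h6 : ((2 ^ (P * (k + 1)) : ℕ) : ℝ) <
            (((2 ^ P * 2 - D - 3) ^ k * (D + 3) : ℕ) : ℝ) := by
          exact_mod_cast h3
        have h7 : (2 * 2 ^ P - ((2 ^ P * 2 - D - 3 : ℕ) : ℝ)) = ((D + 3 : ℕ) : ℝ) := by
          rw [Nat.cast_sub (by omega), Nat.cast_sub (by omega)]; push_cast; ring
        rw [h7]
        rw [Nat.cast_mul, Nat.cast_pow] at h6
        push_cast at h6 ⊢
        exact h6
    rw [div_lt_iff₀ hP0, Nat.cast_sub (by omega), Nat.cast_sub (by omega)] at h5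
    push_cast at h5
    linarith

/-- Lazy case distinction. -/
noncomputable def pick (c : Bool) (x y : Bool) : Bool := Bool.rec y x c

theorem pick_eq_true {c x y : Bool} :
    pick c x y = true ↔ c = true ∧ x = true ∨ c = false ∧ y = true := by
  cases c <;> simp [pick]

/-- Convergents of `a / g` give denominators `q` which may serve for the reduction; `acc` collects
the tests belonging to them. -/
noncomputable def collect (P N b a g M fuel : ℕ) :
    ℕ → ℕ → ℕ → ℕ → (ℕ → Bool) → ((ℕ → Bool) → Bool) → Bool :=
  Nat.rec (fun _ _ _ _ acc K => K acc)
    (fun _ ih r s q₀ q acc K =>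
      pick (Nat.ble M q) (K acc)
        (force (Nat.div r s) fun u => force (Nat.sub r (Nat.mul u s)) fun s' =>
          force (Nat.add q₀ (Nat.mul u q)) fun q' =>
          pick (Nat.ble (Nat.shiftLeft s' (N + 3)) g)
            (force (redError P N b a g q') fun V =>
              ih s s' q q' (fun c => pick (redTest g q' V c) true (acc c)) K)
            (ih s s' q q' acc K))) fuel

theorem collect_succ {P N b a g M fuel : ℕ} {r s q₀ q : ℕ} {acc : ℕ → Bool}
    {K : (ℕ → Bool) → Bool} : collect P N b a g M (fuel + 1) r s q₀ q acc K =
      pick (Nat.ble M q) (K acc)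
        (force (Nat.div r s) fun u => force (Nat.sub r (Nat.mul u s)) fun s' =>
          force (Nat.add q₀ (Nat.mul u q)) fun q' =>
          pick (Nat.ble (Nat.shiftLeft s' (N + 3)) g)
            (force (redError P N b a g q') fun V =>
              collect P N b a g M fuel s s' q q' (fun c => pick (redTest g q' V c) true (acc c)) K)
            (collect P N b a g M fuel s s' q q' acc K)) := rfl

def SoundTest (P N b a g : ℕ) (acc : ℕ → Bool) : Prop :=
  ∀ c, acc c = true → ∃ q V, V = redError P N b a g q ∧ redTest g q V c = true

theorem collect_sound {P N b a g M fuel : ℕ} {r s q₀ q : ℕ} {acc : ℕ → Bool}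
    {K : (ℕ → Bool) → Bool} (hacc : SoundTest P N b a g acc)
    (h : collect P N b a g M fuel r s q₀ q acc K = true) :
    ∃ acc', SoundTest P N b a g acc' ∧ K acc' = true := by
  induction fuel generalizing r s q₀ q acc with
  | zero => exact ⟨acc, hacc, h⟩
  | succ fuel ih =>
    simp only [collect_succ, force_eq, pick_eq_true] at h
    rcases h with ⟨-, h⟩ | ⟨-, ⟨-, h⟩ | ⟨-, h⟩⟩
    · exact ⟨acc, hacc, h⟩
    · refine ih ?_ h
      intro c hc
      rw [pick_eq_true] at hc
      rcases hc with ⟨hc, -⟩ | ⟨-, hc⟩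
      · exact ⟨_, _, rfl, hc⟩
      · exact hacc c hc
    · exact ih hacc h

/-- The numerical data for the linear forms belonging to `k`; the continuation receives the
inhomogeneous term common to all forms of the second kind, and a test. -/
noncomputable def prepare (P N b M fuel L g k : ℕ) (K : ℕ → (ℕ → Bool) → Bool) : Bool :=
  force (alphaGap P k (2 * P)) fun D => andThen (gapCheck P k D)
    (force (Nat.pow 2 P) fun T => force (Nat.mul 2 T) fun T' =>
     force (logRatio P T' (Nat.sub T' D)) fun r₁ =>
     force (logRatio P T (Nat.sub T D)) fun r₂ =>
     force (logRatio P T' (T' - (k + 1) * D)) fun r₃ =>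
     force (Nat.sub L r₁) fun a =>
     force (Nat.sub (Nat.add (Nat.add g (L / 2)) r₃) r₂) fun cf =>
     force (Nat.sub (g + 2 * r₃) (L / 2 + 2 * r₂)) fun c₁ =>
     andThen (Nat.ble r₁ L) (andThen (Nat.ble (L / 2 + 2 * r₂) (g + 2 * r₃))
       (collect P N b a g M fuel g a 0 1 (fun _ => false)
         fun acc => andThen (acc c₁) (K cf acc))))

theorem near_log_alpha {P k D : ℕ} {α : ℝ} (hP : 5 ≤ P) (hα : IsDom k α)
    (h : |2 ^ P * (2 - α) - D| ≤ 3 ∧ 2 ^ (P + 1) ≤ 3 * (2 ^ (P + 1) - (k + 1) * D)) :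
    Near P (10 * P + 5) (logRatio P (2 * 2 ^ P) (2 * 2 ^ P - D)) (Real.log 2 - Real.log α) ∧
    Near P (10 * P + 8) (logRatio P (2 ^ P) (2 ^ P - D)) (-Real.log (α - 1)) ∧
    Near P (10 * P + 2 + 5 * (k + 1)) (logRatio P (2 * 2 ^ P) (2 * 2 ^ P - (k + 1) * D))
      (Real.log 2 - Real.log ((k + 1) * α - 2 * k)) := by
  obtain ⟨h1, h2⟩ := h
  have hP0 : (0 : ℝ) < 2 ^ P := by positivity
  have hk := hα.two_le
  rw [pow_succ, mul_comm _ 2] at h2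
  have hP5 : 2 ^ 5 ≤ 2 ^ P := Nat.pow_le_pow_right two_pos hP
  have hkD : 3 * D ≤ (k + 1) * D := Nat.mul_le_mul_right _ (by omega)
  have hD : 9 * D ≤ 4 * 2 ^ P := by omega
  have hDr : (9 * D : ℝ) ≤ 4 * 2 ^ P := by exact_mod_cast hD
  have hα1 := hα.gt
  have hden := hα.den_pos
  have hd : |(2 - α) - D / 2 ^ P| ≤ 3 / 2 ^ P := by
    have e : (2 - α) - D / 2 ^ P = (2 ^ P * (2 - α) - D) / 2 ^ P := by field_simp
    rw [e, abs_div, abs_of_pos hP0]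
    gcongr
  -- generic comparison
  have key : ∀ {x : ℝ} {A B : ℕ} {E ε c : ℝ}, Near P E (logRatio P A B) (Real.log (A / B)) →
      0 < A → 0 < c → c ≤ x → c ≤ (B : ℝ) / 2 ^ P → |x - B / 2 ^ P| ≤ ε / 2 ^ P →
      Near P (E + ε / c) (logRatio P A B) (Real.log (A / 2 ^ P) - Real.log x) := by
    intro x A B E ε c hn hA hc hx hB hxB
    have hB0 : (0 : ℝ) < B := by
      have := hc.trans_le hB
      by_contra! h0
      have := div_nonpos_of_nonpos_of_nonneg h0 hP0.le
      linarith
    have hA0 : (0 : ℝ) < A := by exact_mod_cast hA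
    have e1 := abs_log_sub_log_le hc hx hB hxB
    have e2 : Real.log (A / 2 ^ P) - Real.log x =
        Real.log (A / B) - (Real.log x - Real.log (B / 2 ^ P)) := by
      rw [Real.log_div hA0.ne' hP0.ne', Real.log_div hB0.ne' hP0.ne', Real.log_div hA0.ne' hB0.ne']
      ring
    have e3 : |2 ^ P * (Real.log x - Real.log (B / 2 ^ P))| ≤ ε / c := by
      rw [abs_mul, abs_of_pos hP0]
      calc _ ≤ 2 ^ P * (ε / 2 ^ P / c) := by gcongr
        _ = ε / c := by field_simp
    unfold Near at hn ⊢
    rw [e2]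
    rw [abs_le] at hn e3 ⊢
    constructor <;> linarith [hn.1, hn.2, e3.1, e3.2]
  have hT : ((2 * 2 ^ P : ℕ) : ℝ) / 2 ^ P = 2 := by push_cast; field_simp
  have hT' : ((2 ^ P : ℕ) : ℝ) / 2 ^ P = 1 := by push_cast; field_simp
  refine ⟨?_, ?_, ?_⟩
  · have n := near_logRatio (P := P) (a := 2 * 2 ^ P) (b := 2 * 2 ^ P - D) (by omega) (by omega)
      (by omega) (by omega)
    have hB : ((2 * 2 ^ P - D : ℕ) : ℝ) / 2 ^ P = 2 - D / 2 ^ P := by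
      rw [Nat.cast_sub (by omega)]; push_cast; field_simp
    have := key (x := α) (ε := 3) (c := 1) n (by positivity) one_pos (by linarith)
      (by rw [hB, le_sub_iff_add_le, ← le_sub_iff_add_le', div_le_iff₀ hP0]; linarith)
      (by rw [hB, ← abs_neg]; convert hd using 2; ring)
    rw [hT] at this
    exact this.mono (by linarith)
  · have n := near_logRatio (P := P) (a := 2 ^ P) (b := 2 ^ P - D) (by omega) (by omega)
      (by omega) (by omega)
    have hB : ((2 ^ P - D : ℕ) : ℝ) / 2 ^ P = 1 - D / 2 ^ P := by
      rw [Nat.cast_sub (by omega)]; push_cast; field_simp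
    have hB' : (D : ℝ) / 2 ^ P ≤ 4 / 9 := by rw [div_le_iff₀ hP0]; linarith
    have := key (x := α - 1) (ε := 3) (c := 5 / 9) n (by positivity) (by norm_num) (by linarith)
      (by rw [hB]; linarith)
      (by rw [hB, ← abs_neg]; convert hd using 2; ring)
    rw [hT', Real.log_one, zero_sub] at this
    exact this.mono (by linarith)
  · have n := near_logRatio (P := P) (a := 2 * 2 ^ P) (b := 2 * 2 ^ P - (k + 1) * D) (by omega)
      (by omega) (by omega) (by omega)
    have hB : ((2 * 2 ^ P - (k + 1) * D : ℕ) : ℝ) / 2 ^ P = 2 - (k + 1) * (D / 2 ^ P) := by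
      rw [Nat.cast_sub (by omega)]; push_cast; field_simp
    have hB' : (2 / 3 : ℝ) ≤ ((2 * 2 ^ P - (k + 1) * D : ℕ) : ℝ) / 2 ^ P := by
      rw [le_div_iff₀ hP0]
      have : ((2 * 2 ^ P : ℕ) : ℝ) ≤ ((3 * (2 * 2 ^ P - (k + 1) * D) : ℕ) : ℝ) := by
        exact_mod_cast h2
      rw [Nat.cast_mul 3] at this
      push_cast [-Nat.cast_sub] at this ⊢
      linarith
    have := key (x := (k + 1) * α - 2 * k) (ε := 3 * (k + 1)) (c := 2 / 3) n (by positivity)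
      (by norm_num) (by linarith) hB' (by
        have e : (k + 1) * α - 2 * k - ((2 * 2 ^ P - (k + 1) * D : ℕ) : ℝ) / 2 ^ P =
            -((k + 1) * ((2 - α) - D / 2 ^ P)) := by rw [hB]; ring
        rw [e, abs_neg, abs_mul, abs_of_pos (by positivity : (0 : ℝ) < k + 1)]
        calc _ ≤ ((k : ℝ) + 1) * (3 / 2 ^ P) := by gcongr
          _ = _ := by ring)
    rw [hT] at this
    exact this.mono (by linarith [Nat.cast_nonneg (α := ℝ) k])

/-- Numerical inhomogeneous terms accepted by `acc` give a lower bound for the linear form. -/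
def Accepts (P N b : ℕ) (α : ℝ) (acc : ℕ → Bool) : Prop :=
  ∀ (c : ℕ) (y : ℝ), acc c = true → Near P (509 * (10 * P + 2)) c (Real.log silver + y) →
    ∀ A l : ℕ, A ≤ 2 ^ N → l ≤ 4 * 2 ^ N →
      (2 ^ b : ℝ)⁻¹ ≤ |A * Real.log α + y - l * Real.log silver|

theorem IsDom.log_binetCoeff {k : ℕ} {α : ℝ} (h : IsDom k α) :
    Real.log (binetCoeff k α) = Real.log (α - 1) - Real.log ((k + 1) * α - 2 * k) := by
  rw [binetCoeff, Real.log_div (by linarith [h.gt]) (by linarith [h.den_pos])]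

theorem prepare_sound {P N b M fuel k : ℕ} {α : ℝ} {K : ℕ → (ℕ → Bool) → Bool} (hP : 5 ≤ P)
    (hkP : k ≤ P) (hbP : b ≤ P) (hs : sqrtTwoCheck P = true) (hα : IsDom k α)
    (h : prepare P N b M fuel (logTwo P) (logSilver P) k K = true) :
    (∀ A l : ℕ, A ≤ 2 ^ N → l ≤ 4 * 2 ^ N → (2 ^ b : ℝ)⁻¹ ≤ |A * Real.log α +
      (3 / 2 * Real.log 2 + 2 * Real.log (binetCoeff k α)) - l * Real.log silver|) ∧
    ∃ cf acc, K cf acc = true ∧ Accepts P N b α acc ∧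
      Near P (45 * P + 5 * k + 22) cf
        (Real.log silver + (3 / 2 * Real.log 2 + Real.log (binetCoeff k α))) := by
  have n2 := near_logTwo (P := P) (by omega)
  have ns := near_logSilver (P := P) (by omega) hs
  obtain ⟨L, hL⟩ : ∃ L, L = logTwo P := ⟨_, rfl⟩
  obtain ⟨g, hg⟩ : ∃ g, g = logSilver P := ⟨_, rfl⟩
  rw [← hL] at n2 h
  rw [← hg] at ns h
  unfold prepare at h
  simp only [force_eq, andThen_eq_true] at h
  obtain ⟨hgap, h1, h2, h⟩ := h
  obtain ⟨D, hD⟩ : ∃ D, D = alphaGap P k (2 * P) := ⟨_, rfl⟩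
  rw [← hD] at hgap h1 h2 h
  obtain ⟨na, nb, nc⟩ := near_log_alpha hP hα (gapCheck_sound hP hα hgap)
  change Nat.ble (logRatio P (2 * 2 ^ P) (2 * 2 ^ P - D)) L = true at h1
  change Nat.ble (L / 2 + 2 * logRatio P (2 ^ P) (2 ^ P - D))
    (g + 2 * logRatio P (2 * 2 ^ P) (2 * 2 ^ P - (k + 1) * D)) = true at h2
  change collect P N b (L - logRatio P (2 * 2 ^ P) (2 * 2 ^ P - D)) g M fuel g
    (L - logRatio P (2 * 2 ^ P) (2 * 2 ^ P - D)) 0 1 (fun _ => false) (fun acc => andThen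
      (acc (g + 2 * logRatio P (2 * 2 ^ P) (2 * 2 ^ P - (k + 1) * D) -
        (L / 2 + 2 * logRatio P (2 ^ P) (2 ^ P - D))))
      (K (g + L / 2 + logRatio P (2 * 2 ^ P) (2 * 2 ^ P - (k + 1) * D) -
        logRatio P (2 ^ P) (2 ^ P - D)) acc)) = true at h
  generalize logRatio P (2 * 2 ^ P) (2 * 2 ^ P - D) = r₁ at *
  generalize logRatio P (2 ^ P) (2 ^ P - D) = r₂ at *
  generalize logRatio P (2 * 2 ^ P) (2 * 2 ^ P - (k + 1) * D) = r₃ at *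
  rw [Nat.ble_eq] at h1 h2
  obtain ⟨acc, hacc, hK⟩ := collect_sound (by intro c hc; cases hc) h
  rw [andThen_eq_true] at hK
  have hPr : (5 : ℝ) ≤ P := by exact_mod_cast hP
  have hkr : (k : ℝ) ≤ P := by exact_mod_cast hkP
  have hα' : Near P (3 * (10 * P + 2)) (L - r₁ : ℕ) (Real.log α) := by
    unfold Near at *
    rw [Nat.cast_sub h1]
    rw [abs_le] at *
    constructor <;> linarith [na.1, na.2, n2.1, n2.2]
  have hg' : Near P (3 * (10 * P + 2)) g (Real.log silver) := ns.mono (by linarith)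
  have hhalf : Near P (5 * P + 2) (L / 2 : ℕ) (1 / 2 * Real.log 2) := by
    have e1 : ((L / 2 : ℕ) : ℝ) ≤ L / 2 := Nat.cast_div_le
    have e2 : (L : ℝ) ≤ 2 * ((L / 2 : ℕ) : ℝ) + 1 := by
      have : L ≤ 2 * (L / 2) + 1 := by omega
      exact_mod_cast this
    unfold Near at *
    rw [abs_le] at *
    constructor <;> linarith [n2.1, n2.2]
  have hAcc : Accepts P N b α acc := by
    intro c y hc hy A l hA hl
    obtain ⟨q, V, hV, ht⟩ := hacc c hc
    have := le_abs_form_of_redTest hbP hα' hg' hy hV ht hA (l := l + 1) (by omega)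
    convert this using 2
    push_cast; ring
  refine ⟨fun A l hA hl => hAcc _ _ hK.1 ?_ A l hA hl, _, acc, hK.2, hAcc, ?_⟩
  · rw [hα.log_binetCoeff]
    unfold Near at *
    rw [Nat.cast_sub h2]
    push_cast
    rw [abs_le] at *
    constructor <;> linarith [hhalf.1, hhalf.2, nb.1, nb.2, nc.1, nc.2, ns.1, ns.2]
  · rw [hα.log_binetCoeff]
    unfold Near at *
    rw [Nat.cast_sub (by omega)]
    push_cast
    rw [abs_le] at *
    constructor <;> linarith [hhalf.1, hhalf.2, nb.1, nb.2, nc.1, nc.2, ns.1, ns.2]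

/-- The tests for the linear forms of the second kind. The state consists of `i`, the `i`-th
`k`-Fibonacci number, the exponent of the next power of two, and the list of the previous
`k`-Fibonacci numbers as digits in base `2 ^ W`. -/
noncomputable def secondFormLoop (P W L k cf : ℕ) (acc : ℕ → Bool) (fuel : ℕ) :
    ℕ → ℕ → ℕ → Bool :=
  Nat.rec (fun _ _ _ => true)
    (fun _ ih cur e H =>
      force (Nat.pow 2 e) fun pw =>
      force (logRatio P pw cur) fun r =>
      force (Nat.add cf (Nat.mul e L)) fun x =>
      andThen (Nat.ble cur pw) (andThen (Nat.ble pw (Nat.mul 3 cur)) (andThen (Nat.ble r x)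
        (force (Nat.sub x r) fun c => andThen (acc c)
          (force (Nat.sub (Nat.mul 2 cur)
            (Nat.mod (Nat.shiftRight H (Nat.mul W k)) (Nat.pow 2 W))) fun next =>
           force (Nat.add (Nat.shiftLeft H W) next) fun H' =>
           pick (Nat.ble next pw) (ih next e H')
             (force (Nat.succ e) fun e' => ih next e' H')))))) fuel

theorem secondFormLoop_succ {P W L k cf : ℕ} {acc : ℕ → Bool} {fuel cur e H : ℕ} :
    secondFormLoop P W L k cf acc (fuel + 1) cur e H =
      force (Nat.pow 2 e) fun pw =>
      force (logRatio P pw cur) fun r =>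
      force (Nat.add cf (Nat.mul e L)) fun x =>
      andThen (Nat.ble cur pw) (andThen (Nat.ble pw (Nat.mul 3 cur)) (andThen (Nat.ble r x)
        (force (Nat.sub x r) fun c => andThen (acc c)
          (force (Nat.sub (Nat.mul 2 cur)
            (Nat.mod (Nat.shiftRight H (Nat.mul W k)) (Nat.pow 2 W))) fun next =>
           force (Nat.add (Nat.shiftLeft H W) next) fun H' =>
           pick (Nat.ble next pw) (secondFormLoop P W L k cf acc fuel next e H')
            (force (Nat.succ e) fun e' =>
              secondFormLoop P W L k cf acc fuel next e' H'))))) := rfl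

/-- The digits of `H` in base `2 ^ W` are the `k`-Fibonacci numbers up to the `i`-th one. -/
def IsHistory (k W i H : ℕ) : Prop :=
  ∀ j, ((H / (2 ^ W) ^ j % 2 ^ W : ℕ) : ℤ) = genFib k (i - j)

theorem genFib_zero {k : ℕ} (hk : 2 ≤ k) : genFib k 0 = 0 := kfib_of_lt (by omega)

theorem IsHistory.zero {k : ℕ} (hk : 2 ≤ k) (W : ℕ) : IsHistory k W 0 0 := by
  intro j
  simp [genFib_zero hk]

theorem IsHistory.succ {k W i H next : ℕ} (hk : 2 ≤ k) (h : IsHistory k W i H)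
    (hnext : genFib k (i + 1) = next) (hW : 1 ≤ W)
    (hi : i ≤ W) :
    IsHistory k W (i + 1) (H * 2 ^ W + next) := by
  have hlt : next < 2 ^ W := by
    have h1 : genFib k (i + 1) ≤ 2 ^ (i - 1) := by
      rcases i with - | i
      · rw [zero_add, genFib_one hk]; norm_num
      · exact genFib_le hk i
    rw [hnext] at h1
    have h2 : next ≤ 2 ^ (i - 1) := by exact_mod_cast h1
    rcases i with - | i
    · exact h2.trans_lt (Nat.one_lt_two_pow (by omega))
    · exact h2.trans_lt (Nat.pow_lt_pow_right one_lt_two (by omega))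
  intro j
  rcases j with - | j
  · rw [pow_zero, Nat.div_one, Nat.mul_add_mod', Nat.mod_eq_of_lt hlt, Nat.sub_zero, hnext]
  · rw [pow_succ', ← Nat.div_div_eq_div_mul, mul_comm, Nat.mul_add_div (by positivity),
      Nat.div_eq_of_lt hlt, add_zero, h j]
    congr 1
    omega

theorem genFib_succ_eq_sub {k i : ℕ} (hk : 2 ≤ k) (hi : 2 ≤ i) :
    genFib k (i + 1) = 2 * genFib k i - genFib k (i - k) := by
  obtain ⟨n, rfl⟩ := Nat.exists_eq_add_of_le' hi
  rw [genFib_succ hk]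
  congr 1
  rcases le_or_gt k (n + 2) with h | h
  · unfold genFib
    congr 1
    omega
  · rw [Nat.sub_eq_zero_of_le h.le, genFib_zero hk, kfib_of_lt (by omega)]

theorem secondFormLoop_sound {P W L k cf : ℕ} {acc : ℕ → Bool} {y : ℝ} (hP : 5 ≤ P)
    (hkP : k ≤ P) (hW : W ≤ 440) (hk : 2 ≤ k) (hcf : Near P (45 * P + 5 * k + 22) cf y)
    (hL : Near P (10 * P + 2) L (Real.log 2)) {fuel i cur e H : ℕ} (hi : 2 ≤ i) (hei : e ≤ i)
    (hiW : i + fuel ≤ W + 1) (hcur : genFib k i = cur) (hH : IsHistory k W i H)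
    (h : secondFormLoop P W L k cf acc fuel cur e H = true) :
    ∀ j < fuel, ∃ c, acc c = true ∧
      Near P (509 * (10 * P + 2)) c (y + Real.log (genFib k (i + j))) := by
  induction fuel generalizing i cur e H with
  | zero => intro j hj; omega
  | succ fuel ih =>
    simp only [secondFormLoop_succ, force_eq, andThen_eq_true] at h
    obtain ⟨h1, h2, h3, h4, h5⟩ := h
    rw [Nat.ble_eq] at h1 h2 h3
    change cur ≤ 2 ^ e at h1
    change 2 ^ e ≤ 3 * cur at h2
    have hlag := hH k
    rw [← pow_mul] at hlag
    have hcur1 : 1 ≤ cur := by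
      have := genFib_pos hk (i - 1)
      rw [Nat.sub_add_cancel (by omega), hcur] at this
      exact_mod_cast this
    intro j hj
    rcases j with - | j
    · refine ⟨_, h4, ?_⟩
      have n := near_logRatio (P := P) (by omega) hcur1 h1 h2
      change Near P _ (logRatio P (Nat.pow 2 e) cur) _ at n
      generalize logRatio P (Nat.pow 2 e) cur = r at *
      change r ≤ cf + e * L at h3
      change Near P _ (cf + e * L - r : ℕ) _
      have hc0 : (0 : ℝ) < cur := by exact_mod_cast hcur1
      have hcurr : (genFib k i : ℝ) = cur := by rw [hcur]; rfl
      rw [add_zero, hcurr]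
      rw [Nat.cast_pow, Nat.cast_two, Real.log_div (by positivity) hc0.ne', Real.log_pow] at n
      have hPr : (5 : ℝ) ≤ P := by exact_mod_cast hP
      have hkr : (k : ℝ) ≤ P := by exact_mod_cast hkP
      have her : (e : ℝ) ≤ 440 := by
        have : e ≤ 440 := by omega
        exact_mod_cast this
      have e1 : |e * (2 ^ P * Real.log 2 - L)| ≤ 440 * (10 * P + 2) := by
        rw [abs_mul, Nat.abs_cast]
        exact mul_le_mul her hL (abs_nonneg _) (by norm_num)
      unfold Near at *
      rw [Nat.cast_sub h3]
      push_cast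
      rw [abs_le] at *
      constructor <;> linarith [n.1, n.2, hcf.1, hcf.2, e1.1, e1.2]
    · obtain ⟨next, hn⟩ : ∃ next, next = Nat.sub (Nat.mul 2 cur)
          (Nat.mod (Nat.shiftRight H (Nat.mul W k)) (Nat.pow 2 W)) := ⟨_, rfl⟩
      rw [← hn] at h5
      have hlag' : Nat.mod (Nat.shiftRight H (Nat.mul W k)) (Nat.pow 2 W) =
          H / 2 ^ (W * k) % 2 ^ W := by
        rw [← Nat.shiftRight_eq_div_pow]; rfl
      rw [hlag'] at hn
      have hnext : genFib k (i + 1) = next := by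
        have e1 := genFib_succ_eq_sub hk hi
        have e2 := genFib_pos hk i
        rw [hcur, ← hlag] at e1
        change next = 2 * cur - H / 2 ^ (W * k) % 2 ^ W at hn
        omega
      have hH' := hH.succ hk hnext (by omega) (by omega)
      have hsh : Nat.add (Nat.shiftLeft H W) next = H * 2 ^ W + next := by
        rw [← Nat.shiftLeft_eq]; rfl
      rw [hsh, pick_eq_true] at h5
      have key : ∃ e' ≤ i + 1, secondFormLoop P W L k cf acc fuel next e' (H * 2 ^ W + next) =
          true := by
        rcases h5 with ⟨-, h5⟩ | ⟨-, h5⟩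
        · exact ⟨e, by omega, h5⟩
        · exact ⟨e + 1, by omega, h5⟩
      obtain ⟨e', he', h6⟩ := key
      obtain ⟨c, hc⟩ := ih (by omega) he' (by omega) hnext hH' h6 j (by omega)
      rw [show i + 1 + j = i + (j + 1) by omega] at hc
      exact ⟨c, hc⟩

/-- The reductions for `len` values of `k`, beginning with `start`, and for the linear forms of the
second kind with `m < fuel + 2`. -/
noncomputable def reductionCheck (P N b W fuel len start : ℕ) : Bool :=
  andThen (sqrtTwoCheck P)
    (force (logTwo P) fun L => force (logSilver P) fun g =>
     force (2 + 2 ^ W + 2 ^ W * 2 ^ W) fun H => force (2 ^ (N + 14)) fun M =>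
     Nat.rec (motive := fun _ => ℕ → Bool) (fun _ => true)
      (fun _ ih k => andThen
        (prepare P N b M (2 * N + 40) L g k fun cf acc =>
          secondFormLoop P W L k cf acc fuel 2 1 H)
        (force (Nat.succ k) ih)) len start)

theorem rec_andThen_eq_true {f : ℕ → Bool} {len start : ℕ}
    (h : Nat.rec (motive := fun _ => ℕ → Bool) (fun _ => true)
      (fun _ ih k => andThen (f k) (force (Nat.succ k) ih)) len start = true) {k : ℕ}
    (h1 : start ≤ k) (h2 : k < start + len) : f k = true := by
  induction len generalizing start with
  | zero => omega
  | succ len ih =>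
    simp only [andThen_eq_true, force_eq] at h
    rcases h1.eq_or_lt with rfl | h1
    · exact h.1
    · exact ih h.2 h1 (by omega)

theorem genFib_three {k : ℕ} (hk : 2 ≤ k) : genFib k 3 = 2 := by
  rw [genFib_succ (n := 0) hk, genFib_two hk, kfib_of_lt (by omega)]; norm_num

theorem isHistory_three {k W : ℕ} (hk : 2 ≤ k) (hW : 2 ≤ W) :
    IsHistory k W 3 (2 + 2 ^ W + 2 ^ W * 2 ^ W) := by
  have h1 := (IsHistory.zero hk W).succ hk (genFib_one hk) (by omega) (by omega)
  have h2 := h1.succ hk (genFib_two hk) (by omega) (by omega)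
  have h3 := h2.succ (next := 2) hk (genFib_three hk) (by omega) (by omega)
  convert h3 using 1
  ring

theorem reductionCheck_sound {P N b W fuel len start k : ℕ} {α : ℝ} (hP : 5 ≤ P) (hbP : b ≤ P)
    (hlen : start + len ≤ P + 1) (hW : W ≤ 440) (hfuel : fuel + 2 ≤ W) (hα : IsDom k α)
    (h : reductionCheck P N b W fuel len start = true) (h1 : start ≤ k) (h2 : k < start + len) :
    (∀ A l : ℕ, A ≤ 2 ^ N → l ≤ 4 * 2 ^ N → (2 ^ b : ℝ)⁻¹ ≤ |A * Real.log α +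
      (3 / 2 * Real.log 2 + 2 * Real.log (binetCoeff k α)) - l * Real.log silver|) ∧
    ∀ m, 2 ≤ m → m < fuel + 2 → ∀ A l : ℕ, A ≤ 2 ^ N → l ≤ 4 * 2 ^ N →
      (2 ^ b : ℝ)⁻¹ ≤ |A * Real.log α + (3 / 2 * Real.log 2 + Real.log (binetCoeff k α) +
        Real.log (genFib k (m + 1))) - l * Real.log silver| := by
  have hk := hα.two_le
  unfold reductionCheck at h
  simp only [force_eq, andThen_eq_true] at h
  obtain ⟨hs, h⟩ := h
  have h3 := rec_andThen_eq_true (f := fun k =>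
    prepare P N b (2 ^ (N + 14)) (2 * N + 40) (logTwo P) (logSilver P) k fun cf acc =>
      secondFormLoop P W (logTwo P) k cf acc fuel 2 1 (2 + 2 ^ W + 2 ^ W * 2 ^ W))
    (by simpa only [force_eq] using h) h1 h2
  obtain ⟨h4, cf, acc, h5, hacc, hcf⟩ := prepare_sound hP (by omega) hbP hs hα h3
  refine ⟨h4, fun m hm hmf A l hA hl => ?_⟩
  obtain ⟨c, hc, hn⟩ := secondFormLoop_sound (i := 3) hP (by omega) hW hk hcf
    (near_logTwo (by omega)) (by omega) (by omega) (by omega)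
    (genFib_three hk)
    (isHistory_three hk (by omega)) h5 (m - 2) (by omega)
  rw [show 3 + (m - 2) = m + 1 by omega, add_assoc] at hn
  exact hacc c _ hc hn A l hA hl

/-- The list of the first `t + 3` `k`-Fibonacci numbers as digits in base `2 ^ W`. -/
noncomputable def fibHistory (k W t : ℕ) : ℕ :=
  Nat.rec (2 + 2 ^ W + 2 ^ W * 2 ^ W)
    (fun _ H => force H fun H => Nat.add (Nat.mul H (Nat.pow 2 W))
      (Nat.sub (Nat.mul 2 (Nat.mod H (Nat.pow 2 W)))
        (Nat.mod (Nat.shiftRight H (Nat.mul W k)) (Nat.pow 2 W)))) t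

theorem isHistory_fibHistory {k W t : ℕ} (hk : 2 ≤ k) (ht : t + 2 ≤ W) :
    IsHistory k W (t + 3) (fibHistory k W t) := by
  induction t with
  | zero => exact isHistory_three hk ht
  | succ t ih =>
    have h := ih (by omega)
    have e : fibHistory k W (t + 1) = fibHistory k W t * 2 ^ W +
        (2 * (fibHistory k W t / (2 ^ W) ^ 0 % 2 ^ W) -
          fibHistory k W t / (2 ^ W) ^ k % 2 ^ W) := by
      have e0 : fibHistory k W (t + 1) = force (fibHistory k W t) fun H =>
          Nat.add (Nat.mul H (Nat.pow 2 W)) (Nat.sub (Nat.mul 2 (Nat.mod H (Nat.pow 2 W)))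
            (Nat.mod (Nat.shiftRight H (Nat.mul W k)) (Nat.pow 2 W))) := rfl
      rw [pow_zero, Nat.div_one, ← pow_mul, ← Nat.shiftRight_eq_div_pow, e0, force_eq]
      rfl
    rw [e]
    refine h.succ hk ?_ (by omega) (by omega)
    have h0 := h 0
    have h1 := h k
    have h2 := genFib_succ_eq_sub (i := t + 3) hk (by omega)
    have h3 := genFib_pos hk (t + 3)
    rw [Nat.sub_zero] at h0
    rw [← h0, ← h1] at h2
    omega

/-- Walk through the Pell sequence, until it reaches `X`. -/
noncomputable def pellWalk (X : ℕ) (K : ℕ → ℕ → Bool) (fuel : ℕ) : ℕ → ℕ → Bool :=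
  Nat.rec (fun _ _ => false)
    (fun _ ih a b => pick (Nat.ble X a) (K a b)
      (force (Nat.add (Nat.mul 2 b) a) fun c => ih b c)) fuel

theorem pellWalk_sound {X fuel l a b : ℕ} {K : ℕ → ℕ → Bool} (ha : pell l = a)
    (hb : pell (l + 1) = b) (hl : ∀ j < l, pell j < X) (h : pellWalk X K fuel a b = true) :
    ∃ l' a' b' : ℕ, pell l' = a' ∧ pell (l' + 1) = b' ∧ (∀ j < l', pell j < X) ∧ X ≤ a' ∧
      K a' b' = true := by
  induction fuel generalizing l a b with
  | zero => cases h
  | succ fuel ih =>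
    change pick (Nat.ble X a) (K a b)
      (force (2 * b + a) fun c => pellWalk X K fuel b c) = true at h
    rw [pick_eq_true, force_eq, Nat.ble_eq] at h
    rcases h with ⟨h1, h2⟩ | ⟨h1, h2⟩
    · exact ⟨l, a, b, ha, hb, hl, h1, h2⟩
    · refine ih hb (by rw [pell, ha, hb]; push_cast; ring) (fun j hj => ?_) h2
      rcases Nat.lt_succ_iff_lt_or_eq.1 hj with hj | rfl
      · exact hl j hj
      · rw [ha]
        have : ¬ X ≤ a := fun h => by rw [← Nat.ble_eq, h1] at h; cases h
        exact_mod_cast not_le.1 this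

noncomputable def isKnownSolution (k m n : ℕ) : Bool :=
  (Nat.beq k 2 && (Nat.beq m 6 && Nat.beq n 6)) || ((Nat.beq k 3 && (Nat.beq m 5 && Nat.beq n 5)) ||
    (Nat.beq k 5 && (Nat.beq m 2 && Nat.beq n 14)))

theorem isKnownSolution_iff {k m n : ℕ} : isKnownSolution k m n = true ↔
    k = 2 ∧ m = 6 ∧ n = 6 ∨ k = 3 ∧ m = 5 ∧ n = 5 ∨ k = 5 ∧ m = 2 ∧ n = 14 := by
  simp [isKnownSolution]

/-- Compare the products of `f` and the `k`-Fibonacci numbers in the list `H` (of length `R + 1`)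
with Pell numbers. -/
noncomputable def productLoop (R W H k m f fuel : ℕ) : ℕ → ℕ → ℕ → Bool :=
  Nat.rec (fun _ _ _ => true)
    (fun _ ih n a b =>
      force (Nat.mul (Nat.mod (Nat.shiftRight H (Nat.mul W (Nat.sub R n))) (Nat.pow 2 W)) f)
        fun X => pellWalk X (fun a' b' => force (Nat.succ n) fun n' =>
          pick (Nat.beq X a') (andThen (isKnownSolution k m n) (ih n' a' b')) (ih n' a' b'))
          200 a b) fuel

theorem pell_strictMonoOn {i j : ℕ} (hij : i < j) (hi : 1 ≤ i) : pell i < pell j := by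
  obtain ⟨i, rfl⟩ := Nat.exists_eq_add_of_le' hi
  induction j with
  | zero => omega
  | succ j ih =>
    have h1 : pell j < pell (j + 1) ∨ j = 0 := by
      rcases j with - | - | j
      · exact .inr rfl
      · left; decide
      · left
        have h2 := pell_pos (j + 1)
        have h3 := pell_pos j
        have h4 : pell (j + 1 + 1 + 1) = 2 * pell (j + 1 + 1) + pell (j + 1) := by rw [pell]
        linarith
    rcases h1 with h1 | rfl
    · rcases (Nat.lt_succ_iff_lt_or_eq.1 hij) with h | h
      · exact (ih h).trans h1
      · rw [h]; exact h1
    · omega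

theorem pell_mono {i j : ℕ} (hij : i ≤ j) : pell i ≤ pell j := by
  rcases hij.eq_or_lt with rfl | hij
  · rfl
  · rcases Nat.eq_zero_or_pos i with rfl | hi
    · obtain ⟨j, rfl⟩ := Nat.exists_eq_add_of_le' hij
      exact (pell_pos j).trans' (by decide)
    · exact (pell_strictMonoOn hij hi).le

theorem productLoop_sound {R W H k m f fuel n a b l : ℕ} (hk : 2 ≤ k) (hn : 2 ≤ n)
    (hH : IsHistory k W (R + 1) H) (hf : genFib k (m + 1) = f) (ha : pell l = a)
    (hb : pell (l + 1) = b) (hl : ∀ j < l, pell j < genFib k (n + 1) * genFib k (m + 1))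
    (hR : n + fuel ≤ R + 1) (h : productLoop R W H k m f fuel n a b = true) {n' l' : ℕ}
    (h1 : n ≤ n') (h2 : n' < n + fuel) (heq : genFib k (n' + 1) * genFib k (m + 1) = pell l') :
    isKnownSolution k m n' = true := by
  induction fuel generalizing n a b l with
  | zero => omega
  | succ fuel ih =>
    obtain ⟨X, hX⟩ : ∃ X, X = Nat.mul (Nat.mod (Nat.shiftRight H (Nat.mul W (Nat.sub R n)))
      (Nat.pow 2 W)) f := ⟨_, rfl⟩
    have hX' : genFib k (n + 1) * genFib k (m + 1) = X := by
      have e1 := hH (R - n)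
      rw [show R + 1 - (R - n) = n + 1 by omega, ← pow_mul, ← Nat.shiftRight_eq_div_pow] at e1
      rw [hf, ← e1, hX, ← Nat.cast_mul]
      rfl
    change force (Nat.mul (Nat.mod (Nat.shiftRight H (Nat.mul W (Nat.sub R n)))
      (Nat.pow 2 W)) f) (fun X => pellWalk X (fun a' b' => force (Nat.succ n) fun n' =>
          pick (Nat.beq X a') (andThen (isKnownSolution k m n)
            (productLoop R W H k m f fuel n' a' b')) (productLoop R W H k m f fuel n' a' b'))
          200 a b) = true at h
    rw [force_eq, ← hX] at h
    rw [hX'] at hl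
    obtain ⟨l₁, a₁, b₁, ha₁, hb₁, hl₁, hXa, hK⟩ := pellWalk_sound ha hb hl h
    rw [force_eq, pick_eq_true, andThen_eq_true] at hK
    rcases h1.eq_or_lt with rfl | h1
    · rcases hK with ⟨-, hK, -⟩ | ⟨hne, -⟩
      · exact hK
      · exfalso
        rw [hX'] at heq
        have hlt : X ≠ a₁ := fun h => by rw [h] at hne; simp at hne
        rcases lt_or_ge l' l₁ with h3 | h3
        · exact absurd heq (hl₁ l' h3).ne'
        · have := pell_mono h3
          rw [← heq, ha₁] at this
          have : a₁ ≤ X := by exact_mod_cast this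
          omega
    · have h3 : productLoop R W H k m f fuel (n + 1) a₁ b₁ = true := by
        rcases hK with ⟨-, -, hK⟩ | ⟨-, hK⟩ <;> exact hK
      refine ih (by omega) ha₁ hb₁ (fun j hj => ?_) (by omega) h3 h1 (by omega)
      refine (hl₁ j hj).trans_le ?_
      rw [← hX']
      have := genFib_pos hk m
      have := genFib_mono_le hk (by omega) (show n + 1 ≤ n + 1 + 1 by omega)
      gcongr

/-- All products with `m ≤ n ≤ R`, for `len` values of `k` beginning with `start`. -/
noncomputable def productCheck (R len start : ℕ) : Bool :=
  Nat.rec (motive := fun _ => ℕ → Bool) (fun _ => true)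
    (fun _ ih k => andThen
      (force (fibHistory k R (R - 2)) fun H =>
        Nat.rec (motive := fun _ => ℕ → Bool) (fun _ => true)
          (fun _ ih m => andThen
            (force (Nat.mod (Nat.shiftRight H (Nat.mul R (Nat.sub R m))) (Nat.pow 2 R)) fun f =>
              productLoop R R H k m f (R + 1 - m) m 0 1)
            (force (Nat.succ m) ih)) (R - 1) 2)
      (force (Nat.succ k) ih)) len start

theorem productCheck_sound {R len start : ℕ} (hR : 2 ≤ R) (h : productCheck R len start = true)
    {k m n l : ℕ} (hk : 2 ≤ k) (h1 : start ≤ k) (h2 : k < start + len) (hm : 2 ≤ m) (hnm : m ≤ n)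
    (hn : n ≤ R) (heq : genFib k (n + 1) * genFib k (m + 1) = pell l) :
    isKnownSolution k m n = true := by
  have h3 := rec_andThen_eq_true h h1 h2
  rw [force_eq] at h3
  have h4 := rec_andThen_eq_true h3 (k := m) (by omega) (by omega)
  rw [force_eq] at h4
  have hH := isHistory_fibHistory (k := k) (W := R) (t := R - 2) hk (by omega)
  rw [show R - 2 + 3 = R + 1 by omega] at hH
  refine productLoop_sound hk hm hH ?_ (l := 0) rfl rfl (by simp) (by omega) h4 hnm (by omega) heq
  have e1 := hH (R - m)
  rw [show R + 1 - (R - m) = m + 1 by omega, ← pow_mul, ← Nat.shiftRight_eq_div_pow] at e1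
  rw [← e1]
  rfl

section

set_option maxRecDepth 10000

theorem reductionCheck_372_a : reductionCheck 740 351 372 2 0 240 2 = true := by decide +kernel

theorem reductionCheck_372_b : reductionCheck 740 351 372 2 0 240 242 = true := by decide +kernel

theorem reductionCheck_372_c : reductionCheck 740 351 372 2 0 243 482 = true := by decide +kernel

theorem reductionCheck_187_small : reductionCheck 380 166 187 288 286 2 2 = true := by
  decide +kernel

theorem reductionCheck_187_a : reductionCheck 380 166 187 212 208 40 4 = true := by decide +kernel

theorem reductionCheck_187_b : reductionCheck 380 166 187 212 208 75 44 = true := by decide +kernel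

theorem reductionCheck_187_c : reductionCheck 380 166 187 212 208 75 119 = true := by
  decide +kernel

theorem reductionCheck_187_d : reductionCheck 380 166 187 212 208 75 194 = true := by
  decide +kernel

theorem reductionCheck_187_e : reductionCheck 380 166 187 212 208 75 269 = true := by
  decide +kernel

theorem reductionCheck_30 : reductionCheck 80 10 30 52 50 27 2 = true := by decide +kernel

theorem productCheck_48 : productCheck 48 27 2 = true := by decide +kernel

end

namespace IsDom
variable {k : ℕ} {α : ℝ}

theorem two_mul_le_of_pow_le (h : IsDom k α) {j e : ℕ} (hj : α ^ j ≤ 2 ^ e) : 2 * j ≤ 3 * e := by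
  have h1 : (4 : ℝ) ≤ α ^ 3 := by
    calc (4 : ℝ) ≤ 1.618 ^ 3 := by norm_num
      _ ≤ α ^ 3 := pow_le_pow_left₀ (by norm_num) h.gt.le 3
  have h2 : (2 : ℝ) ^ (2 * j) ≤ 2 ^ (3 * e) := by
    calc (2 : ℝ) ^ (2 * j) = 4 ^ j := by rw [pow_mul]; norm_num
      _ ≤ (α ^ 3) ^ j := by gcongr
      _ = (α ^ j) ^ 3 := by rw [← pow_mul, ← pow_mul, mul_comm]
      _ ≤ (2 ^ e) ^ 3 := pow_le_pow_left₀ (h.pow_pos j).le hj 3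
      _ = 2 ^ (3 * e) := by rw [← pow_mul, mul_comm]
  exact (pow_le_pow_iff_right₀ one_lt_two).1 h2

theorem twelve_mul_le_of_pow_le (h : IsDom k α) (hk : 4 ≤ k) {j e : ℕ} (hj : α ^ j ≤ 2 ^ e) :
    12 * j ≤ 13 * e := by
  have h0 : (1.9 : ℝ) < α := by
    refine h.lt_of (by norm_num) ?_
    calc (1 : ℝ) < 1.9 ^ 4 * (2 - 1.9) := by norm_num
      _ ≤ 1.9 ^ k * (2 - 1.9) := by
        gcongr
        norm_num
  have h1 : (2 : ℝ) ^ 12 ≤ α ^ 13 := by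
    calc (2 : ℝ) ^ 12 ≤ 1.9 ^ 13 := by norm_num
      _ ≤ α ^ 13 := pow_le_pow_left₀ (by norm_num) h0.le 13
  have h2 : (2 : ℝ) ^ (12 * j) ≤ 2 ^ (13 * e) := by
    calc (2 : ℝ) ^ (12 * j) = (2 ^ 12) ^ j := by rw [pow_mul]
      _ ≤ (α ^ 13) ^ j := by gcongr
      _ = (α ^ j) ^ 13 := by rw [← pow_mul, ← pow_mul, mul_comm]
      _ ≤ (2 ^ e) ^ 13 := pow_le_pow_left₀ (h.pow_pos j).le hj 13
      _ = 2 ^ (13 * e) := by rw [← pow_mul, mul_comm]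
  exact (pow_le_pow_iff_right₀ one_lt_two).1 h2

end IsDom

theorem pow_le_of_inv_le {x C : ℝ} {b : ℕ} (hx : 0 < x) (hC : C ≤ 4)
    (h : (2 ^ b : ℝ)⁻¹ ≤ C * x⁻¹) : x ≤ 2 ^ (b + 2) := by
  have hb : (0 : ℝ) < 2 ^ b := by positivity
  calc x = 2 ^ b * x * (2 ^ b)⁻¹ := by field_simp
    _ ≤ 2 ^ b * x * (C * x⁻¹) := by gcongr
    _ = 2 ^ b * C := by field_simp
    _ ≤ 2 ^ b * 4 := by gcongr
    _ = 2 ^ (b + 2) := by rw [pow_add]; norm_num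

theorem pow_le_of_reductionCheck {P N b W fuel len start k m n l s : ℕ} {α : ℝ} (hP : 5 ≤ P)
    (hbP : b ≤ P) (hlen : start + len ≤ P + 1) (hW : W ≤ 440) (hfuel : fuel + 2 ≤ W)
    (hα : IsDom k α) (h : reductionCheck P N b W fuel len start = true) (h1 : start ≤ k)
    (h2 : k < start + len) (hm : 2 ≤ m) (hnm : m ≤ n)
    (heq : genFib k (n + 1) * genFib k (m + 1) = pell l) (hn : n < 2 ^ s) (hs : s + 1 ≤ N) :
    α ^ m ≤ 2 ^ (b + 2) ∧ (m < fuel + 2 → α ^ n ≤ 2 ^ (b + 2)) := by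
  obtain ⟨h3, h4⟩ := reductionCheck_sound hP hbP hlen hW hfuel hα h h1 h2
  have hN : 2 * 2 ^ s ≤ 2 ^ N := by
    rw [← pow_succ']; exact Nat.pow_le_pow_right two_pos hs
  have hl := hα.index_le hm hnm heq
  constructor
  · refine pow_le_of_inv_le (hα.pow_pos m) le_rfl ((h3 (n + m) l (by omega) (by omega)).trans ?_)
    have := hα.abs_form_one_le hm hnm heq
    rw [IsDom.log_two_sqrt_two] at this
    push_cast
    exact this
  · intro hmf
    refine pow_le_of_inv_le (C := 2.2) (hα.pow_pos n) (by norm_num)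
      ((h4 m hm hmf n l (by omega) (by omega)).trans ?_)
    have := hα.abs_form_two_le hm hnm heq
    rw [IsDom.log_two_sqrt_two] at this
    exact this

section
variable {k m n l : ℕ}

theorem order_le_724 (hk : 2 ≤ k) (hm : 2 ≤ m) (hnm : m ≤ n)
    (heq : genFib k (n + 1) * genFib k (m + 1) = pell l) : k ≤ 724 ∧ n < 2 ^ 350 := by
  have h1 := order_le_two_pow hk hm hnm heq
  have h2 := index_lt_two_pow hk hm hnm h1 heq
  have h3 := order_le_of_convCheck (by norm_num) convCheck_898 hk hm hnm heq h2 (by norm_num)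
  have h4 := index_lt_two_pow (u := 11) hk hm hnm (h3.trans (by norm_num)) heq
  have h5 := order_le_of_convCheck (by norm_num) convCheck_366 hk hm hnm heq h4 (by norm_num)
  have h6 := index_lt_two_pow (u := 10) hk hm hnm (h5.trans (by norm_num)) heq
  have h7 := order_le_of_convCheck (by norm_num) convCheck_366 hk hm hnm heq h6 (by norm_num)
  exact ⟨h7, h6⟩

theorem index_le_561 (hk : 2 ≤ k) (hm : 2 ≤ m) (hnm : m ≤ n)
    (heq : genFib k (n + 1) * genFib k (m + 1) = pell l) : m ≤ 561 := by
  obtain ⟨hk', hn⟩ := order_le_724 hk hm hnm heq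
  obtain ⟨α, hα⟩ := exists_isDom hk
  have key : α ^ m ≤ 2 ^ (372 + 2) := by
    rcases lt_or_ge k 242 with h | h
    · exact (pow_le_of_reductionCheck (by norm_num) (by norm_num) (by norm_num) (by norm_num)
        (by norm_num) hα reductionCheck_372_a hk h hm hnm heq hn (by norm_num)).1
    rcases lt_or_ge k 482 with h' | h'
    · exact (pow_le_of_reductionCheck (by norm_num) (by norm_num) (by norm_num) (by norm_num)
        (by norm_num) hα reductionCheck_372_b h h' hm hnm heq hn (by norm_num)).1
    · exact (pow_le_of_reductionCheck (by norm_num) (by norm_num) (by norm_num) (by norm_num)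
        (by norm_num) hα reductionCheck_372_c h' (by omega) hm hnm heq hn (by norm_num)).1
  have := hα.two_mul_le_of_pow_le key
  omega

theorem le_two_pow_of_165_le : ∀ v < 350, 165 ≤ v →
    2 ^ 42 * 724 ^ 4 * 575 * (2 * v) ^ 2 ≤ 2 ^ v ∧
      2 ^ 61 * 724 ^ 6 * 575 * (2 * v) ^ 4 ≤ 2 ^ v := by
  decide +kernel

theorem index_lt_two_pow_165 (hk : 2 ≤ k) (hm : 2 ≤ m) (hnm : m ≤ n)
    (heq : genFib k (n + 1) * genFib k (m + 1) = pell l) : n < 2 ^ 165 := by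
  obtain ⟨hk', hn⟩ := order_le_724 hk hm hnm heq
  have hm' := index_le_561 hk hm hnm heq
  obtain ⟨α, hα⟩ := exists_isDom hk
  by_contra! h165
  have hn0 : n ≠ 0 := by omega
  obtain ⟨v, hv⟩ : ∃ v, v = Nat.log 2 n := ⟨_, rfl⟩
  have hv1 : 2 ^ v ≤ n := hv ▸ Nat.pow_log_le_self 2 hn0
  have hv2 : n < 2 ^ (v + 1) := hv ▸ Nat.lt_pow_succ_log_self one_lt_two n
  have hv3 : v < 350 := (Nat.pow_lt_pow_iff_right one_lt_two).1 (hv1.trans_lt hn)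
  have hv4 : 165 < v + 1 := (Nat.pow_lt_pow_iff_right one_lt_two).1 (h165.trans_lt hv2)
  obtain ⟨h1, h2⟩ := le_two_pow_of_165_le v hv3 (by omega)
  obtain ⟨m', rfl⟩ := Nat.exists_eq_add_of_le' (show 1 ≤ m by omega)
  have h3 := hα.succ_index_lt (m' := m') (u := 10) (v := v) (by norm_num) (hk'.trans (by norm_num))
    hm hnm heq (by
      refine le_trans ?_ h1
      gcongr
      omega) (by omega) hv1 hv2
  have h4 : 2 ^ 61 * k ^ 6 * (10 + m' + 4) * (2 * v) ^ 4 ≤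
      2 ^ 61 * 724 ^ 6 * 575 * (2 * v) ^ 4 := by
    gcongr
    omega
  omega

theorem index_le_283 (hk : 2 ≤ k) (hm : 2 ≤ m) (hnm : m ≤ n)
    (heq : genFib k (n + 1) * genFib k (m + 1) = pell l) : n ≤ 283 := by
  have hn := index_lt_two_pow_165 hk hm hnm heq
  have hk' := order_le_of_convCheck (by norm_num) convCheck_167 hk hm hnm heq hn (by norm_num)
  obtain ⟨α, hα⟩ := exists_isDom hk
  have key : α ^ n ≤ 2 ^ (187 + 2) := by
    rcases lt_or_ge k 4 with h | h
    · obtain ⟨h1, h2⟩ := pow_le_of_reductionCheck (by norm_num) (by norm_num) (by norm_num)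
        (by norm_num) (by norm_num) hα reductionCheck_187_small hk h hm hnm heq hn (by norm_num)
      have := hα.two_mul_le_of_pow_le h1
      exact h2 (by omega)
    suffices h' : ∃ len start, start + len ≤ 381 ∧ reductionCheck 380 166 187 212 208 len start =
        true ∧
        start ≤ k ∧ k < start + len by
      obtain ⟨len, start, h3, h4, h5, h6⟩ := h'
      obtain ⟨h1, h2⟩ := pow_le_of_reductionCheck (by norm_num) (by norm_num) h3
        (by norm_num) (by norm_num) hα h4 h5 h6 hm hnm heq hn (by norm_num)
      have := hα.twelve_mul_le_of_pow_le h h1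
      exact h2 (by omega)
    rcases lt_or_ge k 44 with h1 | h1
    · exact ⟨_, _, by norm_num, reductionCheck_187_a, h, h1⟩
    rcases lt_or_ge k 119 with h2 | h2
    · exact ⟨_, _, by norm_num, reductionCheck_187_b, h1, h2⟩
    rcases lt_or_ge k 194 with h3 | h3
    · exact ⟨_, _, by norm_num, reductionCheck_187_c, h2, h3⟩
    rcases lt_or_ge k 269 with h4 | h4
    · exact ⟨_, _, by norm_num, reductionCheck_187_d, h3, h4⟩
    · exact ⟨_, _, by norm_num, reductionCheck_187_e, h4, by omega⟩
  have := hα.two_mul_le_of_pow_le key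
  omega

theorem isKnownSolution_of_eq (hk : 2 ≤ k) (hm : 2 ≤ m) (hnm : m ≤ n)
    (heq : genFib k (n + 1) * genFib k (m + 1) = pell l) : isKnownSolution k m n = true := by
  have hn : n < 2 ^ 9 := (index_le_283 hk hm hnm heq).trans_lt (by norm_num)
  have hk' := order_le_of_convCheck (by norm_num) convCheck_11 hk hm hnm heq hn (by norm_num)
  obtain ⟨α, hα⟩ := exists_isDom hk
  obtain ⟨h1, h2⟩ := pow_le_of_reductionCheck (by norm_num) (by norm_num) (by norm_num)
    (by norm_num) (by norm_num) hα reductionCheck_30 hk (by omega) hm hnm heq hn (by norm_num)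
  have h3 := hα.two_mul_le_of_pow_le h1
  have h4 := hα.two_mul_le_of_pow_le (h2 (by omega))
  exact productCheck_sound (by norm_num) productCheck_48 hk hk (by omega) hm hnm (by omega) heq

end

theorem eq_of_pell_eq {i j : ℕ} (hi : 1 ≤ i) (hj : 1 ≤ j) (h : pell i = pell j) : i = j := by
  rcases lt_trichotomy i j with h1 | h1 | h1
  · exact absurd h (pell_strictMonoOn h1 hi).ne
  · exact h1
  · exact absurd h (pell_strictMonoOn h1 hj).ne'

theorem pell_seven : pell 7 = 169 := by decide

theorem pell_twelve : pell 12 = 13860 := by decide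

theorem genFib_eq_of_fibHistory {k t v : ℕ} (hk : 2 ≤ k)
    (h : Nat.beq (fibHistory k (t + 2) t % 2 ^ (t + 2)) v = true) : genFib k (t + 3) = v := by
  have h1 := isHistory_fibHistory hk (le_refl (t + 2)) 0
  rw [pow_zero, Nat.div_one, Nat.eq_of_beq_eq_true h] at h1
  exact h1.symm

theorem genFib_two_seven : genFib 2 7 = 13 :=
  genFib_eq_of_fibHistory (t := 4) le_rfl (by decide +kernel)

theorem genFib_three_six : genFib 3 6 = 13 :=
  genFib_eq_of_fibHistory (t := 3) (by norm_num) (by decide +kernel)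

theorem genFib_five_fifteen : genFib 5 15 = 6930 :=
  genFib_eq_of_fibHistory (t := 12) (by norm_num) (by decide +kernel)

/-- All positive integer solutions `(n, m, k, ℓ)` of `F⁽ᵏ⁾_n · F⁽ᵏ⁾_m = P_ℓ` with
`k ≥ 2` and `n ≥ m ≥ 3` are `(7, 7, 2, 7)`, `(6, 6, 3, 7)` and `(15, 3, 5, 12)`. -/
theorem pell_eq_product_two_kfib (n m k ℓ : ℕ) (hk : 2 ≤ k) (hm : 3 ≤ m) (hnm : m ≤ n)
    (hℓ : 0 < ℓ) :
    kfib k (n + k - 2) * kfib k (m + k - 2) = pell ℓ ↔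
      (n, m, k, ℓ) = (7, 7, 2, 7) ∨ (n, m, k, ℓ) = (6, 6, 3, 7) ∨
        (n, m, k, ℓ) = (15, 3, 5, 12) := by
  change genFib k n * genFib k m = pell ℓ ↔ _
  simp only [Prod.mk.injEq]
  constructor
  · intro heq
    obtain ⟨m, rfl⟩ := Nat.exists_eq_add_of_le' (show 1 ≤ m by omega)
    obtain ⟨n, rfl⟩ := Nat.exists_eq_add_of_le' (show 1 ≤ n by omega)
    have h := isKnownSolution_of_eq hk (by omega) (by omega) heq
    rw [isKnownSolution_iff] at h
    rcases h with ⟨rfl, rfl, rfl⟩ | ⟨rfl, rfl, rfl⟩ | ⟨rfl, rfl, rfl⟩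
    · rw [genFib_two_seven] at heq
      have := eq_of_pell_eq hℓ (j := 7) (by norm_num) (by rw [pell_seven, ← heq]; norm_num)
      omega
    · rw [genFib_three_six] at heq
      have := eq_of_pell_eq hℓ (j := 7) (by norm_num) (by rw [pell_seven, ← heq]; norm_num)
      omega
    · rw [genFib_five_fifteen, genFib_three (by norm_num)] at heq
      have := eq_of_pell_eq hℓ (j := 12) (by norm_num) (by rw [pell_twelve, ← heq]; norm_num)
      omega
  · rintro (⟨rfl, rfl, rfl, rfl⟩ | ⟨rfl, rfl, rfl, rfl⟩ | ⟨rfl, rfl, rfl, rfl⟩)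
    · rw [genFib_two_seven, pell_seven]; norm_num
    · rw [genFib_three_six, pell_seven]; norm_num
    · rw [genFib_five_fifteen, genFib_three (by norm_num), pell_twelve]; norm_num
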